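/- There is an absolute constant C > 0 such that the following holds. Let H₀, H, N, 𝐏, 𝓛 satisfy: 1 ≤ H₀ ≤ H, log H₀ ≥ (log H)^{2/3} (log log H)², 𝐏 a set of primes in [H₀, H], 𝓛 = ∑_{p∈𝐏} 1/p ≥ e, and log H ≤ √((log N)/𝓛). Let F₁, F₂ : ℤ_{≥0} → ℂ satisfy |F_i(m)| ≤ 1 for all m, with F_i supported on S_i ⊆ ℤ_{≥0} (i = 1, 2), and set s_i = min(|S_i|, √(log log N)). Then | (1/(N𝓛)) ∑_{p∈𝐏} ∑_{N/p < n ≤ 2N/p} F₁(Ω(n)) conj(F₂(Ω(n+1))) − (1/(N𝓛)) ∑_{n∈𝐍} F₁(Ω(n)−1) ∑_{p∈𝐏} conj(F₂(Ω(n+p)−1))/p | ≤ C · min( 1/√𝓛 , (√(s₁ s₂)/√(log log N)) · ( 1/√𝓛 + (log log log N)/𝓛 ) ). -/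

import Mathlib

/-- `Ω(n)`: the number of prime divisors of `n`, counted with multiplicity. -/
def bigOmega (n : ℕ) : ℕ := n.primeFactorsList.length


namespace HR

open Finset

/-- Finite inner product. -/
noncomputable def ip {ι : Type*} (X : Finset ι) (f g : ι → ℝ) : ℝ := ∑ x ∈ X, f x * g x

section ipl
variable {ι : Type*} (X : Finset ι)

lemma ip_add_left (f g h : ι → ℝ) : ip X (f + g) h = ip X f h + ip X g h := by
  simp [ip, add_mul, Finset.sum_add_distrib]

lemma ip_sub_left (f g h : ι → ℝ) : ip X (f - g) h = ip X f h - ip X g h := by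
  simp [ip, sub_mul, Finset.sum_sub_distrib]

lemma ip_comm (f g : ι → ℝ) : ip X f g = ip X g f := by
  simp [ip, mul_comm]

lemma ip_sub_right (f g h : ι → ℝ) : ip X h (f - g) = ip X h f - ip X h g := by
  rw [ip_comm, ip_sub_left, ip_comm X f, ip_comm X g]

lemma ip_sum_left {α : Type*} (P : Finset α) (f : α → ι → ℝ) (h : ι → ℝ) :
    ip X (∑ p ∈ P, f p) h = ∑ p ∈ P, ip X (f p) h := by
  simp only [ip, Finset.sum_apply, Finset.sum_mul]
  rw [Finset.sum_comm]

lemma ip_sum_right {α : Type*} (P : Finset α) (f : α → ι → ℝ) (h : ι → ℝ) :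
    ip X h (∑ p ∈ P, f p) = ∑ p ∈ P, ip X h (f p) := by
  rw [ip_comm, ip_sum_left]
  exact Finset.sum_congr rfl fun _ _ => ip_comm _ _ _

lemma ip_zero_left (h : ι → ℝ) : ip X 0 h = 0 := by simp [ip]

lemma ip_self_nonneg (f : ι → ℝ) : 0 ≤ ip X f f :=
  Finset.sum_nonneg fun x _ => mul_self_nonneg _

lemma ip_cs (f g : ι → ℝ) : (ip X f g) ^ 2 ≤ ip X f f * ip X g g := by
  have := Finset.sum_mul_sq_le_sq_mul_sq X f g
  simpa [ip, sq] using this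

lemma ip_sub_sq_le (f g : ι → ℝ) : ip X (f - g) (f - g) ≤ 2 * ip X f f + 2 * ip X g g := by
  simp only [ip, Finset.mul_sum, ← Finset.sum_add_distrib]
  refine Finset.sum_le_sum fun x _ => ?_
  simp only [Pi.sub_apply]
  nlinarith [sq_nonneg (f x + g x)]

end ipl

section riccati
variable {ι α : Type*}

/-- The non-backtracking sums. -/
noncomputable def VV (P : Finset α) (B : α → (ι → ℝ) →ₗ[ℝ] (ι → ℝ)) (h : ι → ℝ) :
    ℕ → (ι → ℝ) × (α → ι → ℝ)
  | 0 => (h, 0)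
  | (j + 1) => (∑ p ∈ P, B p ((VV P B h j).1 - (VV P B h j).2 p),
      fun p => B p ((VV P B h j).1 - (VV P B h j).2 p))

variable (X : Finset ι) (P : Finset α) (B : α → (ι → ℝ) →ₗ[ℝ] (ι → ℝ)) (h : ι → ℝ)

lemma VV_q_step (hsym : ∀ p ∈ P, ∀ f g, ip X (B p f) g = ip X f (B p g)) (i j : ℕ) :
    ip X (VV P B h (i + 1)).1 (VV P B h j).1
      - ∑ p ∈ P, ip X ((VV P B h (i + 1)).2 p) ((VV P B h j).2 p)
    = ip X (VV P B h i).1 (VV P B h (j + 1)).1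
      - ∑ p ∈ P, ip X ((VV P B h i).2 p) ((VV P B h (j + 1)).2 p) := by
  simp only [VV]
  rw [ip_sum_left, ip_sum_right, ← Finset.sum_sub_distrib, ← Finset.sum_sub_distrib]
  refine Finset.sum_congr rfl fun p hp => ?_
  rw [← ip_sub_right, ← ip_sub_left, hsym p hp]

lemma VV_q (hsym : ∀ p ∈ P, ∀ f g, ip X (B p f) g = ip X f (B p g)) (i j : ℕ) :
    ip X (VV P B h i).1 (VV P B h j).1
      - ∑ p ∈ P, ip X ((VV P B h i).2 p) ((VV P B h j).2 p)
    = ip X h (VV P B h (i + j)).1 := by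
  induction i generalizing j with
  | zero => simp [VV, ip_zero_left]
  | succ i ih =>
    rw [VV_q_step X P B h hsym, ih (j + 1)]
    congr 3
    omega

lemma VV_c_bound (hsym : ∀ p ∈ P, ∀ f g, ip X (B p f) g = ip X f (B p g))
    (hle : ∀ p ∈ P, ∀ f, ip X (B p f) (B p f) ≤ ip X f f)
    (D : ℝ) (hD1 : 1 ≤ D) (hD : ∀ f, ∑ p ∈ P, ip X (B p f) (B p f) ≤ D * ip X f f)
    (b R x : ℝ) (hb : 16 * D ≤ b) (hR : 0 ≤ R) (hx : 0 ≤ x) (j : ℕ)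
    (ha : ∀ i < j, |ip X h (VV P B h (2 * i)).1| ≤ R * b ^ i * x) :
    ∑ p ∈ P, ip X ((VV P B h j).2 p) ((VV P B h j).2 p) ≤ R / 3 * b ^ j * x := by
  have hb0 : 0 ≤ b := by linarith
  induction j with
  | zero =>
    simp only [VV, Pi.zero_apply, ip_zero_left, Finset.sum_const_zero]
    positivity
  | succ j ih =>
    have h1 := ih (fun i hi => ha i (by omega))
    have h2 := (abs_le.mp (ha j (by omega))).2
    have hq := VV_q X P B h hsym j j
    rw [← two_mul] at hq
    set c := ∑ p ∈ P, ip X ((VV P B h j).2 p) ((VV P B h j).2 p) with hc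
    set n := ip X (VV P B h j).1 (VV P B h j).1 with hn
    have h3 : ∑ p ∈ P, ip X ((VV P B h (j+1)).2 p) ((VV P B h (j+1)).2 p) ≤ 2 * (D * n) + 2 * c := by
      calc _ ≤ ∑ p ∈ P, (2 * ip X (B p (VV P B h j).1) (B p (VV P B h j).1)
              + 2 * ip X ((VV P B h j).2 p) ((VV P B h j).2 p)) := by
            refine Finset.sum_le_sum fun p hp => ?_
            simp only [VV, map_sub]
            refine (ip_sub_sq_le X _ _).trans ?_
            have := hle p hp ((VV P B h j).2 p)
            linarith
        _ = 2 * ∑ p ∈ P, ip X (B p (VV P B h j).1) (B p (VV P B h j).1) + 2 * c := by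
            rw [Finset.sum_add_distrib, ← Finset.mul_sum, ← Finset.mul_sum]
        _ ≤ _ := by
            have := hD (VV P B h j).1
            linarith
    have h4 : n ≤ R * b ^ j * x + R / 3 * b ^ j * x := by linarith
    have hc0 : 0 ≤ R * b ^ j * x := by positivity
    have h5 : D * n ≤ D * (R * b ^ j * x + R / 3 * b ^ j * x) :=
      mul_le_mul_of_nonneg_left h4 (by linarith)
    have h6 : 16 * D * (R * b ^ j * x) ≤ b * (R * b ^ j * x) := mul_le_mul_of_nonneg_right hb hc0
    have h7 : 1 * (R * b ^ j * x) ≤ D * (R * b ^ j * x) := mul_le_mul_of_nonneg_right hD1 hc0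
    rw [pow_succ]
    nlinarith

/-- Growth of the non-backtracking moments. -/
theorem riccati (hsym : ∀ p ∈ P, ∀ f g, ip X (B p f) g = ip X f (B p g))
    (hle : ∀ p ∈ P, ∀ f, ip X (B p f) (B p f) ≤ ip X f f)
    (D : ℝ) (hD1 : 1 ≤ D) (hD : ∀ f, ∑ p ∈ P, ip X (B p f) (B p f) ≤ D * ip X f f)
    (A K Z : ℝ) (hA : 1 ≤ A) (hK : 4 ≤ K) (hZ : 0 ≤ Z) (k : ℕ)
    (ha : ∀ n, 1 ≤ n → n ≤ 2 ^ k →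
      |ip X h (VV P B h n).1| ≤ A ^ (2 ^ k) * (K * √D) ^ n * Z) :
    |ip X h (VV P B h 1).1| ≤ 4 * A * Real.exp 1 * K * √D * (ip X h h + Z * Real.exp (-(2 ^ k : ℝ))) := by
  set x := ip X h h with hxdef
  have hx : 0 ≤ x := ip_self_nonneg X h
  have hsD : 1 ≤ √D := Real.one_le_sqrt.mpr hD1
  set β := K * √D with hβ
  have hβ1 : 1 ≤ β := by nlinarith
  have hβ0 : 0 < β := by linarith
  have hb : 16 * D ≤ β ^ 2 := by
    rw [hβ, mul_pow, Real.sq_sqrt (by linarith)]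
    have : (16:ℝ) ≤ K ^ 2 := by nlinarith
    nlinarith
  have he1 : 2 ≤ Real.exp 1 := by have := Real.add_one_le_exp (1:ℝ); linarith
  set a : ℕ → ℝ := fun n => ip X h (VV P B h n).1 with hadef
  have hrhs : 0 ≤ Z * Real.exp (-(2 ^ k : ℝ)) := by positivity
  have hAe : 2 ≤ A * Real.exp 1 := by nlinarith
  rcases hx.eq_or_lt with hx0 | hx0
  · have h0 : (a 1) ^ 2 ≤ 0 := by
      have := ip_cs X h (VV P B h 1).1
      rw [← hxdef, ← hx0, zero_mul] at this
      exact this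
    have h1 : a 1 = 0 := by nlinarith [sq_nonneg (a 1)]
    change |a 1| ≤ _
    rw [h1, abs_zero]
    positivity
  have goalrw : 4 * A * Real.exp 1 * K * √D * (x + Z * Real.exp (-(2 ^ k : ℝ)))
      = 4 * (A * Real.exp 1) * β * (x + Z * Real.exp (-(2 ^ k : ℝ))) := by rw [hβ]; ring
  rw [goalrw]
  by_cases hsmall : |a 1| ≤ 4 * β * x
  · refine hsmall.trans ?_
    have : β * x ≤ β * (x + Z * Real.exp (-(2 ^ k : ℝ))) :=
      mul_le_mul_of_nonneg_left (by linarith) hβ0.le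
    have h9 : 0 ≤ β * (x + Z * Real.exp (-(2 ^ k : ℝ))) := by positivity
    nlinarith
  push Not at hsmall
  set t := 3 / 4 * (|a 1| / (β * x)) with ht
  have ht3 : 3 < t := by
    rw [ht]
    have : 4 < |a 1| / (β * x) := by
      rw [lt_div_iff₀ (by positivity)]; linarith
    linarith
  -- growth
  have key : ∀ i ≤ k, ∃ n, 1 ≤ n ∧ n ≤ 2 ^ i ∧ 4 / 3 * t ^ (2 ^ i) * (β ^ n * x) ≤ |a n| := by
    intro i hi
    induction i with
    | zero =>
      refine ⟨1, le_rfl, le_rfl, ?_⟩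
      rw [ht]; simp only [pow_zero, pow_one]
      apply le_of_eq; field_simp
    | succ i ih =>
      obtain ⟨n, hn1, hn2, hn3⟩ := ih (by omega)
      obtain ⟨ns, hns, hmax⟩ := Finset.exists_max_image (Finset.range (2 * n + 1))
        (fun l => |a l| / (β ^ l * x)) ⟨0, by simp⟩
      set R := |a ns| / (β ^ ns * x) with hR
      have hRa : ∀ l ≤ 2 * n, |a l| ≤ R * β ^ l * x := by
        intro l hl
        have := hmax l (by simp; omega)
        rw [div_le_iff₀ (by positivity)] at this
        linarith
      have hR0 : 0 ≤ R := by positivity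
      have hcb := VV_c_bound X P B h hsym hle D hD1 hD (β ^ 2) R x hb hR0 hx n (by
        intro l hl
        have := hRa (2 * l) (by omega)
        rwa [pow_mul] at this)
      have hq := VV_q X P B h hsym n n
      rw [← two_mul] at hq
      have hcs := ip_cs X h (VV P B h n).1
      have hE : (4 / 3 * t ^ (2 ^ i) * (β ^ n * x)) ^ 2 ≤ (a n) ^ 2 := by
        rw [← sq_abs (a n)]
        exact pow_le_pow_left₀ (by positivity) hn3 2
      have h2n := hRa (2 * n) le_rfl
      have h2n' := (abs_le.mp h2n).2
      have hnn : ip X (VV P B h n).1 (VV P B h n).1 ≤ 4 / 3 * R * β ^ (2 * n) * x := by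
        rw [← pow_mul] at hcb
        have : a (2 * n) = ip X h (VV P B h (2 * n)).1 := rfl
        linarith
      have hfin : (4 / 3 * t ^ (2 ^ i) * (β ^ n * x)) ^ 2 ≤ x * (4 / 3 * R * β ^ (2 * n) * x) :=
        hE.trans (hcs.trans (mul_le_mul_of_nonneg_left hnn hx))
      have hR4 : 4 / 3 * t ^ (2 ^ (i + 1)) ≤ R := by
        have e1 : (4 / 3 * t ^ (2 ^ i) * (β ^ n * x)) ^ 2
            = (16 / 9 * t ^ (2 ^ (i + 1))) * (β ^ (2 * n) * x ^ 2) := by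
          rw [pow_succ 2 i, pow_mul t, mul_comm 2 n, pow_mul β]; ring
        have e2 : x * (4 / 3 * R * β ^ (2 * n) * x) = (4 / 3 * R) * (β ^ (2 * n) * x ^ 2) := by ring
        rw [e1, e2] at hfin
        have := le_of_mul_le_mul_right hfin (by positivity)
        linarith
      have hns1 : 1 ≤ ns := by
        by_contra h0
        have h0 : ns = 0 := by omega
        have : R = 1 := by
          rw [hR, h0]
          have : a 0 = x := rfl
          rw [this, abs_of_pos hx0, pow_zero, one_mul, div_self hx0.ne']
        have : (1:ℝ) ≤ t ^ (2 ^ (i + 1)) := one_le_pow₀ (by linarith)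
        linarith
      refine ⟨ns, hns1, ?_, ?_⟩
      · have : ns ≤ 2 * n := by simpa [Nat.lt_succ_iff] using hns
        rw [pow_succ]; omega
      · have : R * (β ^ ns * x) = |a ns| := by rw [hR]; field_simp
        rw [← this]
        exact mul_le_mul_of_nonneg_right hR4 (by positivity)
  obtain ⟨n, hn1, hn2, hn3⟩ := key k le_rfl
  have hup := ha n hn1 hn2
  change |a n| ≤ _ at hup
  have h1 : 4 / 3 * t ^ (2 ^ k) * x ≤ A ^ (2 ^ k) * Z := by
    have h2 := hn3.trans hup
    have : (4 / 3 * t ^ (2 ^ k) * x) * β ^ n ≤ (A ^ (2 ^ k) * Z) * β ^ n := by linarith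
    exact le_of_mul_le_mul_right this (by positivity)
  set u := t / A with hu
  have hu0 : 0 < u := by rw [hu]; positivity
  have htu : t = A * u := by rw [hu]; field_simp
  have h2 : u ^ (2 ^ k) * x ≤ Z := by
    rw [htu, mul_pow] at h1
    have hAk : 0 < A ^ (2 ^ k) := by positivity
    have h3 : A ^ (2 ^ k) * (u ^ (2 ^ k) * x) ≤ A ^ (2 ^ k) * Z := by
      have : 0 ≤ A ^ (2 ^ k) * u ^ (2 ^ k) * x := by positivity
      nlinarith
    exact le_of_mul_le_mul_left h3 hAk
  have h3 : x * u ≤ Real.exp 1 * (x + Z * Real.exp (-(2 ^ k : ℝ))) := by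
    by_cases hue : u ≤ Real.exp 1
    · have : x * u ≤ x * Real.exp 1 := mul_le_mul_of_nonneg_left hue hx
      have h9 : 0 ≤ Real.exp 1 * (Z * Real.exp (-(2 ^ k : ℝ))) := by positivity
      linarith
    · push Not at hue
      have hS : 2 ^ k = (2 ^ k - 1) + 1 := by
        have := Nat.one_le_two_pow (n := k); omega
      have h4 : Real.exp 1 ^ (2 ^ k - 1) * (x * u) ≤ Z := by
        refine le_trans ?_ h2
        have : u ^ (2 ^ k) = u ^ (2 ^ k - 1) * u := by rw [← pow_succ, ← hS]
        rw [this]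
        have := pow_le_pow_left₀ (Real.exp_pos 1).le hue.le (2 ^ k - 1)
        have h5 : 0 ≤ x * u := by positivity
        nlinarith
      have h6 : Real.exp (-(2 ^ k : ℝ)) * Real.exp 1 * Real.exp 1 ^ (2 ^ k - 1) = 1 := by
        rw [← Real.exp_nat_mul, ← Real.exp_add, ← Real.exp_add]
        have : ((2 ^ k - 1 : ℕ) : ℝ) = (2:ℝ) ^ k - 1 := by
          rw [Nat.cast_sub Nat.one_le_two_pow]; push_cast; ring
        rw [this]
        simp
      have h7 : x * u ≤ Real.exp (-(2 ^ k : ℝ)) * Real.exp 1 * Z := by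
        calc x * u = Real.exp (-(2 ^ k : ℝ)) * Real.exp 1 * (Real.exp 1 ^ (2 ^ k - 1) * (x * u)) := by
              rw [← mul_assoc, h6, one_mul]
          _ ≤ _ := mul_le_mul_of_nonneg_left h4 (by positivity)
      have h8 : 0 ≤ Real.exp 1 * x := by positivity
      linarith
  have h4 : |a 1| = 4 / 3 * A * β * (x * u) := by
    have : |a 1| = 4 / 3 * t * (β * x) := by rw [ht]; field_simp
    rw [this, htu]; ring
  rw [h4]
  have h5 : A * β * (x * u) ≤ A * β * (Real.exp 1 * (x + Z * Real.exp (-(2 ^ k : ℝ)))) :=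
    mul_le_mul_of_nonneg_left h3 (by positivity)
  have h6 : 0 ≤ A * β * (Real.exp 1 * (x + Z * Real.exp (-(2 ^ k : ℝ)))) := by positivity
  linarith

end riccati

end HR


namespace HR

open Finset

section trace
variable {ι : Type*} [DecidableEq ι] (X : Finset ι) (T : Module.End ℝ (ι → ℝ))

lemma sym_pow (hsym : ∀ f g, ip X (T f) g = ip X f (T g)) (n : ℕ) (f g : ι → ℝ) :
    ip X ((T ^ n) f) g = ip X f ((T ^ n) g) := by
  induction n generalizing f g with
  | zero => simp
  | succ n ih =>
    rw [pow_succ, Module.End.mul_apply, ih, hsym, ← Module.End.mul_apply, ← pow_succ']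
    rw [pow_succ]

lemma pow_moment (hsym : ∀ f g, ip X (T f) g = ip X f (T g)) (h : ι → ℝ) (i : ℕ) :
    |ip X h (T h)| ^ (2 ^ i) ≤ (ip X h h) ^ (2 ^ i - 1) * |ip X h ((T ^ (2 ^ i)) h)| := by
  induction i with
  | zero => simp
  | succ i ih =>
    have hx := ip_self_nonneg X h
    have h1 := ip_cs X h ((T ^ (2 ^ i)) h)
    rw [sym_pow X T hsym, ← Module.End.mul_apply, ← pow_add, ← two_mul, ← pow_succ'] at h1
    have h2 := pow_le_pow_left₀ (by positivity) ih 2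
    rw [← pow_mul, ← pow_succ, mul_pow, sq_abs] at h2
    refine h2.trans ?_
    have h3 : (ip X h h ^ (2 ^ i - 1)) ^ 2 * ip X h h = ip X h h ^ (2 ^ (i + 1) - 1) := by
      rw [← pow_mul, ← pow_succ]
      congr 1
      have := Nat.one_le_two_pow (n := i)
      rw [pow_succ]; omega
    rw [← h3, mul_assoc]
    refine mul_le_mul_of_nonneg_left (h1.trans ?_) (by positivity)
    exact mul_le_mul_of_nonneg_left (le_abs_self _) hx

lemma expand_supp (h : ι → ℝ) (hs : ∀ x, x ∉ X → h x = 0) :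
    h = ∑ y ∈ X, h y • (Pi.single y (1 : ℝ) : ι → ℝ) := by
  funext x
  simp only [Finset.sum_apply, Pi.smul_apply, smul_eq_mul, Pi.single_apply]
  by_cases hx : x ∈ X
  · rw [Finset.sum_eq_single x]
    · simp
    · intro y _ hy; simp [Ne.symm hy]
    · intro h; exact absurd hx h
  · rw [hs x hx, Finset.sum_eq_zero]
    intro y hy
    have : x ≠ y := fun e => hx (e ▸ hy)
    simp [this]

theorem trace_bound (hsym : ∀ f g, ip X (T f) g = ip X f (T g)) (h : ι → ℝ)
    (hs : ∀ x, x ∉ X → h x = 0) (b : ℝ) (hb0 : 0 ≤ b)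
    (hb : ∀ x, |h x| ≤ b) (i : ℕ)
    (Q1 Γ1 E : ℝ) (hE : 0 ≤ E) (hQ1 : 0 ≤ Q1)
    (Near : ι → Finset ι) (hnear : ∀ y ∈ X, ((Near y).card : ℝ) ≤ Q1)
    (hnz : ∀ y ∈ X, ∀ x ∈ X, ((T ^ (2 ^ i)) (Pi.single y 1)) x ≠ 0 → x ∈ Near y)
    (htr : ∑ y ∈ X, ((T ^ (2 ^ (i + 1))) (Pi.single y 1)) y ≤ X.card * Γ1)
    (hQE : Q1 * Γ1 ≤ E ^ (2 ^ (i + 1))) :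
    |ip X h (T h)| ≤ b ^ 2 * X.card * E := by
  set V := 2 ^ i with hV
  have hV1 : 1 ≤ V := Nat.one_le_two_pow
  have hx : ip X h h ≤ X.card * b ^ 2 := by
    have : ip X h h ≤ ∑ _x ∈ X, b ^ 2 := by
      refine Finset.sum_le_sum fun x _ => ?_
      rw [← sq, ← sq_abs]
      exact pow_le_pow_left₀ (abs_nonneg _) (hb x) 2
    simpa using this
  have hx0 := ip_self_nonneg X h
  set t : ι → ι → ℝ := fun y x => ((T ^ V) (Pi.single y 1)) x with ht
  have h1 : |ip X h ((T ^ V) h)| ≤ b ^ 2 * ∑ y ∈ X, ∑ x ∈ X, |t y x| := by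
    have e : ip X h ((T ^ V) h) = ∑ y ∈ X, ∑ x ∈ X, h x * h y * t y x := by
      have e1 : (T ^ V) h = ∑ y ∈ X, h y • (T ^ V) (Pi.single y 1) := by
        conv_lhs => rw [expand_supp X h hs]
        rw [map_sum]
        exact Finset.sum_congr rfl fun y _ => map_smul _ _ _
      rw [e1, ip_sum_right]
      refine Finset.sum_congr rfl fun y _ => ?_
      simp only [ip, Pi.smul_apply, smul_eq_mul]
      exact Finset.sum_congr rfl fun x _ => by simp only [ht]; ring
    rw [e]
    refine (Finset.abs_sum_le_sum_abs _ _).trans ?_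
    rw [Finset.mul_sum]
    refine Finset.sum_le_sum fun y _ => ?_
    refine (Finset.abs_sum_le_sum_abs _ _).trans ?_
    rw [Finset.mul_sum]
    refine Finset.sum_le_sum fun x _ => ?_
    rw [abs_mul, abs_mul]
    refine mul_le_mul_of_nonneg_right ?_ (abs_nonneg _)
    rw [sq]
    exact mul_le_mul (hb x) (hb y) (abs_nonneg _) hb0
  have h2 : (∑ y ∈ X, ∑ x ∈ X, |t y x|) ^ 2 ≤ (X.card * Q1) * (X.card * Γ1) := by
    have e0 : ∀ y ∈ X, (∑ x ∈ X, |t y x|) ^ 2 ≤ Q1 * ∑ x ∈ X, (t y x) ^ 2 := by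
      intro y hy
      have : ∑ x ∈ X, |t y x| = ∑ x ∈ X.filter (· ∈ Near y), 1 * |t y x| := by
        rw [Finset.sum_filter]
        refine Finset.sum_congr rfl fun x hx => ?_
        split_ifs with hn
        · simp
        · have : t y x = 0 := by
            by_contra h0; exact hn (hnz y hy x hx h0)
          simp [this]
      rw [this]
      refine (Finset.sum_mul_sq_le_sq_mul_sq _ _ _).trans ?_
      refine mul_le_mul ?_ ?_ (Finset.sum_nonneg fun x _ => sq_nonneg _) hQ1
      · simp only [one_pow, Finset.sum_const, nsmul_eq_mul, mul_one]
        refine le_trans ?_ (hnear y hy)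
        exact_mod_cast Finset.card_le_card (fun x hx => (Finset.mem_filter.mp hx).2)
      · simp only [sq_abs]
        exact Finset.sum_le_sum_of_subset_of_nonneg (Finset.filter_subset _ _)
          (fun x _ _ => sq_nonneg _)
    have e1 : ∑ y ∈ X, ∑ x ∈ X, (t y x) ^ 2 ≤ X.card * Γ1 := by
      refine le_trans (le_of_eq ?_) htr
      refine Finset.sum_congr rfl fun y hy => ?_
      have a1 : ∑ x ∈ X, (t y x) ^ 2 = ip X (t y) (t y) := by
        simp [ip, sq]
      rw [a1]
      simp only [ht]
      have a2 : ip X ((T ^ V) (Pi.single y 1)) ((T ^ V) (Pi.single y 1))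
          = ip X (Pi.single y 1) ((T ^ (2 ^ (i + 1))) (Pi.single y 1)) := by
        rw [sym_pow X T hsym, ← Module.End.mul_apply, ← pow_add, ← two_mul, hV, ← pow_succ']
      change ip X ((T ^ V) (Pi.single y 1)) ((T ^ V) (Pi.single y 1)) = _
      rw [a2, ip, Finset.sum_eq_single y]
      · simp
      · intro x _ hxy; simp [Pi.single_apply, hxy]
      · intro hn; exact absurd hy hn
    have e2 : (∑ y ∈ X, 1 * ∑ x ∈ X, |t y x|) ^ 2
        ≤ (∑ y ∈ X, (1:ℝ) ^ 2) * ∑ y ∈ X, (∑ x ∈ X, |t y x|) ^ 2 :=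
      Finset.sum_mul_sq_le_sq_mul_sq _ _ _
    simp only [one_mul, one_pow, Finset.sum_const, nsmul_eq_mul, mul_one] at e2
    refine e2.trans ?_
    rw [mul_assoc]
    refine mul_le_mul_of_nonneg_left ?_ (Nat.cast_nonneg _)
    calc _ ≤ ∑ y ∈ X, Q1 * ∑ x ∈ X, (t y x) ^ 2 := Finset.sum_le_sum e0
      _ = Q1 * ∑ y ∈ X, ∑ x ∈ X, (t y x) ^ 2 := by rw [Finset.mul_sum]
      _ ≤ _ := mul_le_mul_of_nonneg_left e1 hQ1
  have h3 : ∑ y ∈ X, ∑ x ∈ X, |t y x| ≤ X.card * E ^ V := by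
    refine le_of_sq_le_sq ?_ (by positivity) |>.trans le_rfl
    refine h2.trans ?_
    have : (X.card * Q1) * (X.card * Γ1) = (X.card : ℝ) ^ 2 * (Q1 * Γ1) := by ring
    rw [this, mul_pow, ← pow_mul, hV, ← pow_succ]
    exact mul_le_mul_of_nonneg_left hQE (by positivity)
  have h4 := pow_moment X T hsym h i
  have h5 : |ip X h (T h)| ^ V ≤ (b ^ 2 * X.card * E) ^ V := by
    refine h4.trans ?_
    calc _ ≤ (X.card * b ^ 2) ^ (V - 1) * (b ^ 2 * (X.card * E ^ V)) := by
          refine mul_le_mul (pow_le_pow_left₀ hx0 hx _) ?_ (abs_nonneg _) (by positivity)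
          exact h1.trans (mul_le_mul_of_nonneg_left h3 (by positivity))
      _ = ((X.card * b ^ 2) ^ (V - 1) * (X.card * b ^ 2)) * E ^ V := by ring
      _ = _ := by
          rw [← pow_succ, Nat.sub_add_cancel hV1, ← mul_pow]
          ring
  exact le_of_pow_le_pow_left₀ (by omega) (by positivity) h5

end trace
end HR


namespace HR

open Finset

section words
set_option linter.unusedSectionVars false
variable {ι α : Type*} [Fintype α] [DecidableEq α] (X : Finset ι)
  (B : α → Module.End ℝ (ι → ℝ))

/-- Product of operators along a word. -/
noncomputable def opw {m : ℕ} (w : Fin m → α) : Module.End ℝ (ι → ℝ) :=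
  ((List.ofFn w).map B).prod

/-- Consecutive letters differ. -/
def Chain {m : ℕ} (w : Fin m → α) : Prop := ∀ i j : Fin m, i.val + 1 = j.val → w i ≠ w j

/-- Letters in each window of length `m` are distinct. -/
def WInj (m : ℕ) {M : ℕ} (w : Fin M → α) : Prop :=
  ∀ i j : Fin M, i.val / m = j.val / m → w i = w j → i = j

omit [Fintype α] [DecidableEq α] in
lemma opw_zero (w : Fin 0 → α) : opw B w = 1 := by simp [opw]

omit [Fintype α] [DecidableEq α] in
lemma opw_cons {m : ℕ} (p : α) (w : Fin m → α) :
    opw B (Fin.cons p w : Fin (m + 1) → α) = B p * opw B w := by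
  simp [opw, List.ofFn_cons]

omit [Fintype α] [DecidableEq α] in
lemma opw_append {m k : ℕ} (w : Fin m → α) (u : Fin k → α) :
    opw B (Fin.append w u) = opw B w * opw B u := by
  simp [opw, List.ofFn_fin_append]

omit [Fintype α] [DecidableEq α] in
lemma list_adj (hsym : ∀ p, ∀ f g, ip X (B p f) g = ip X f (B p g)) (l : List α)
    (f g : ι → ℝ) : ip X ((l.map B).prod f) g = ip X f ((l.reverse.map B).prod g) := by
  induction l generalizing f g with
  | nil => simp
  | cons p l ih =>
    simp only [List.map_cons, List.prod_cons, Module.End.mul_apply, List.reverse_cons,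
      List.map_append, List.prod_append, List.map_nil, List.prod_nil, mul_one]
    rw [hsym, ih]

omit [Fintype α] [DecidableEq α] in
lemma opw_adj (hsym : ∀ p, ∀ f g, ip X (B p f) g = ip X f (B p g)) {m : ℕ} (w : Fin m → α)
    (f g : ι → ℝ) : ip X (opw B w f) g = ip X f (opw B (w ∘ Fin.rev) g) := by
  have : List.ofFn (w ∘ Fin.rev) = (List.ofFn w).reverse := by
    apply List.ext_getElem
    · simp
    · intro i h1 h2
      simp only [List.getElem_ofFn, List.getElem_reverse, Function.comp, List.length_ofFn]
      congr 1
      ext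
      simp [Fin.rev]; omega
  rw [opw, opw, this]
  exact list_adj X B hsym _ f g

open Classical in
/-- Sum over injective words. -/
noncomputable def TT (m : ℕ) : Module.End ℝ (ι → ℝ) :=
  ∑ w : Fin m → α, if Function.Injective w then opw B w else 0

lemma TT_sym (hsym : ∀ p, ∀ f g, ip X (B p f) g = ip X f (B p g)) (m : ℕ)
    (f g : ι → ℝ) : ip X (TT B m f) g = ip X f (TT B m g) := by
  classical
  simp only [TT, LinearMap.sum_apply]
  rw [ip_sum_left, ip_sum_right]
  refine Fintype.sum_equiv (Equiv.arrowCongr Fin.revPerm (Equiv.refl α)) _ _ fun w => ?_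
  have e : (Equiv.arrowCongr Fin.revPerm (Equiv.refl α)) w = w ∘ Fin.rev := by
    funext i; simp [Equiv.arrowCongr]
  rw [e]
  have hi : Function.Injective (w ∘ Fin.rev) ↔ Function.Injective w :=
    Function.Injective.of_comp_iff' w Fin.rev_bijective
  by_cases h : Function.Injective w
  · rw [if_pos h, if_pos (hi.2 h), opw_adj X B hsym]
  · rw [if_neg h, if_neg (fun k => h (hi.1 k))]; simp [ip]

omit [Fintype α] [DecidableEq α] in
lemma WInj_append {m W : ℕ} (hm : 0 < m) (w : Fin (m * W) → α) (u : Fin m → α) :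
    WInj m (Fin.append w u) ↔ WInj m w ∧ Function.Injective u := by
  constructor
  · intro h
    refine ⟨fun i j hij hw => ?_, fun i j hu => ?_⟩
    · have := h (Fin.castAdd m i) (Fin.castAdd m j) hij (by simpa using hw)
      simpa using this
    · have := h (Fin.natAdd (m * W) i) (Fin.natAdd (m * W) j) (by
        simp [Nat.mul_add_div hm]
        rw [Nat.div_eq_of_lt i.2, Nat.div_eq_of_lt j.2]) (by simpa using hu)
      simpa using this
  · rintro ⟨hw, hu⟩ i j
    refine Fin.addCases (fun i => ?_) (fun i => ?_) i <;>
      refine Fin.addCases (fun j => ?_) (fun j => ?_) j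
    · intro h1 h2
      simp only [Fin.append_left] at h2
      rw [hw i j h1 h2]
    · intro h1 _
      exfalso
      simp only [Fin.val_castAdd, Fin.val_natAdd, Nat.mul_add_div hm] at h1
      have := Nat.div_lt_of_lt_mul i.2
      rw [h1] at this
      exact absurd this (by simp)
    · intro h1 _
      exfalso
      simp only [Fin.val_castAdd, Fin.val_natAdd, Nat.mul_add_div hm] at h1
      have := Nat.div_lt_of_lt_mul j.2
      rw [← h1] at this
      exact absurd this (by simp)
    · intro _ h2
      simp only [Fin.append_right] at h2
      rw [hu h2]

open Classical in
lemma TT_pow (m : ℕ) (hm : 0 < m) (W : ℕ) :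
    (TT B m) ^ W = ∑ w : Fin (m * W) → α, if WInj m w then opw B w else 0 := by
  induction W with
  | zero =>
    rw [pow_zero]
    have hw : ∀ w : Fin (m * 0) → α, WInj m w := fun w i => i.elim0
    have : Unique (Fin (m * 0) → α) := inferInstanceAs (Unique (Fin 0 → α))
    rw [Fintype.sum_unique, if_pos (hw _)]
    exact (opw_zero B (default : Fin 0 → α)).symm
  | succ W ih =>
    rw [pow_succ, ih, TT, Finset.sum_mul_sum, ← Finset.sum_product', Finset.univ_product_univ]
    refine Fintype.sum_equiv (Fin.appendEquiv (m * W) m) _ _ fun x => ?_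
    have e : (Fin.appendEquiv (m * W) m) x = Fin.append x.1 x.2 := rfl
    rw [e]
    have := WInj_append (W := W) hm x.1 x.2
    change _ = if WInj m (Fin.append x.1 x.2) then opw B (Fin.append x.1 x.2) else 0
    rw [opw_append]
    by_cases h1 : WInj m x.1 <;> by_cases h2 : Function.Injective x.2 <;> simp [h1, h2, this]

omit [Fintype α] [DecidableEq α] in
lemma Chain_cons {m : ℕ} (p : α) (w : Fin m → α) :
    Chain (Fin.cons p w : Fin (m + 1) → α) ↔ Chain w ∧ ∀ i : Fin m, i.val = 0 → w i ≠ p := by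
  constructor
  · intro h
    refine ⟨fun i j hij => ?_, fun i hi => ?_⟩
    · have := h i.succ j.succ (by simp; omega)
      simpa using this
    · have := h 0 i.succ (by simp [hi])
      simp only [Fin.cons_zero, Fin.cons_succ] at this
      exact this.symm
  · rintro ⟨h1, h2⟩ i j
    refine Fin.cases ?_ (fun i => ?_) i <;> refine Fin.cases ?_ (fun j => ?_) j
    · simp
    · intro h
      simp only [Fin.cons_zero, Fin.cons_succ]
      exact (h2 j (by simpa using h.symm)).symm
    · simp
    · intro h
      simp only [Fin.cons_succ]
      exact h1 i j (by simpa using h)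

open Classical in
lemma sum_cons {β : Type*} [AddCommMonoid β] {m : ℕ} (F : (Fin (m + 1) → α) → β) :
    ∑ w, F w = ∑ p : α, ∑ w : Fin m → α, F (Fin.cons p w) := by
  rw [← Finset.sum_product', Finset.univ_product_univ]
  exact (Fintype.sum_equiv (Fin.consEquiv (fun _ : Fin (m + 1) => α)) _ _ fun x => rfl).symm

open Classical in
lemma VV_expand (h : ι → ℝ) (m : ℕ) :
    ((VV univ B h m).1 = ∑ w : Fin m → α, if Chain w then opw B w h else 0) ∧
    ∀ p, (VV univ B h m).1 - (VV univ B h m).2 p =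
      ∑ w : Fin m → α, if Chain (Fin.cons p w : Fin (m + 1) → α) then opw B w h else 0 := by
  induction m with
  | zero =>
    have : ∀ w : Fin 0 → α, Chain w := fun w i => i.elim0
    have h2 : ∀ p, ∀ w : Fin 0 → α, Chain (Fin.cons p w : Fin 1 → α) := by
      intro p w i j hij; omega
    simp [VV, this, h2, opw_zero]
  | succ m ih =>
    have hp : ∀ p, (VV univ B h (m + 1)).2 p = ∑ w : Fin m → α,
        if Chain (Fin.cons p w : Fin (m + 1) → α) then
          opw B (Fin.cons p w : Fin (m + 1) → α) h else 0 := by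
      intro p
      change B p ((VV univ B h m).1 - (VV univ B h m).2 p) = _
      rw [ih.2 p, map_sum]
      refine Finset.sum_congr rfl fun w _ => ?_
      split_ifs
      · rw [opw_cons, Module.End.mul_apply]
      · simp
    have h1 : (VV univ B h (m + 1)).1 = ∑ p, (VV univ B h (m + 1)).2 p := rfl
    have h3 : (VV univ B h (m + 1)).1 = ∑ w : Fin (m + 1) → α,
        if Chain w then opw B w h else 0 := by
      rw [h1, sum_cons]
      exact Finset.sum_congr rfl fun p _ => hp p
    refine ⟨h3, fun p => ?_⟩
    rw [h3, hp p, sum_cons, sum_cons,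
      ← Finset.add_sum_erase univ _ (Finset.mem_univ p), add_sub_cancel_left,
      ← Finset.add_sum_erase univ _ (Finset.mem_univ p)]
    have z : ∑ w : Fin m → α, (if Chain (Fin.cons p (Fin.cons p w : Fin (m + 1) → α) :
        Fin (m + 2) → α) then opw B (Fin.cons p w : Fin (m + 1) → α) h else 0) = 0 := by
      refine Finset.sum_eq_zero fun w _ => ?_
      rw [if_neg]
      intro hc
      exact ((Chain_cons p _).1 hc).2 0 rfl (by simp)
    rw [z, zero_add]
    refine Finset.sum_congr rfl fun q hq => Finset.sum_congr rfl fun w _ => ?_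
    have : Chain (Fin.cons p (Fin.cons q w : Fin (m + 1) → α) : Fin (m + 2) → α) ↔
        Chain (Fin.cons q w : Fin (m + 1) → α) := by
      rw [Chain_cons]
      refine and_iff_left fun i hi => ?_
      have : i = 0 := Fin.ext hi
      rw [this]; simpa using (Finset.ne_of_mem_erase hq)
    simp [this]

omit [Fintype α] [DecidableEq α] in
lemma inj_chain {m : ℕ} (w : Fin m → α) (h : Function.Injective w) : Chain w := by
  intro i j hij e
  have := h e
  subst this
  omega

open Classical in
/-- Difference between chain sum and injective sum. -/
lemma VV_sub_TT (h : ι → ℝ) (m : ℕ) :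
    ip X h (VV univ B h m).1 = ip X h (TT B m h) +
      ∑ w : Fin m → α, if Chain w ∧ ¬ Function.Injective w then ip X h (opw B w h) else 0 := by
  rw [(VV_expand B h m).1, TT, LinearMap.sum_apply, ip_sum_right, ip_sum_right,
    ← Finset.sum_add_distrib]
  refine Finset.sum_congr rfl fun w _ => ?_
  by_cases hi : Function.Injective w
  · simp [hi, inj_chain w hi]
  · by_cases hc : Chain w <;> simp [hi, hc, ip]

end words
end HR


namespace HR

open Finset

/-- Sign attached to a Bool. -/
def sg (b : Bool) : ℤ := if b then -1 else 1

lemma sg_not (b : Bool) : sg (!b) = - sg b := by cases b <;> simp [sg]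

/-- Move by `± p`. -/
def stp (p : ℕ) (x : ℤ × Bool) : ℤ × Bool := (x.1 + sg x.2 * p, !x.2)

lemma stp_stp (p : ℕ) (x : ℤ × Bool) : stp p (stp p x) = x := by
  simp [stp, sg_not]

/-- Number of primes of `P` dividing `n`. -/
def om (P : Finset ℕ) (n : ℤ) : ℕ := (P.filter fun q : ℕ => (q : ℤ) ∣ n).card

/-- Centered divisibility weight. -/
noncomputable def dv (c : ℝ) (p : ℕ) (n : ℤ) : ℝ := (if (p : ℤ) ∣ n then 1 else 0) - c / p

lemma dv_abs_le (c : ℝ) (hc0 : 0 ≤ c) (hc1 : c ≤ 1) (p : ℕ) (hp : 1 ≤ p) (n : ℤ) :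
    |dv c p n| ≤ 1 := by
  have h : (1:ℝ) ≤ p := by exact_mod_cast hp
  have h1 : c / p ≤ 1 := by rw [div_le_one (by linarith)]; linarith
  have h2 : 0 ≤ c / p := by positivity
  unfold dv
  split_ifs <;> rw [abs_le] <;> constructor <;> linarith

lemma dv_stp (c : ℝ) (p : ℕ) (x : ℤ × Bool) : dv c p (stp p x).1 = dv c p x.1 := by
  have : ((p : ℤ) ∣ (stp p x).1) ↔ ((p : ℤ) ∣ x.1) := by
    simp only [stp]
    exact Int.dvd_add_left (Dvd.intro_left _ rfl)
  simp [dv, this]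

section ops
variable (P : Finset ℕ) (θ c : ℝ) (J : Finset ℤ)

noncomputable def gw (n : ℤ) : ℝ := Real.sqrt (θ ^ om P n)

open Classical in
noncomputable def kap (p : ℕ) (x : ℤ × Bool) : ℝ :=
  if x.1 ∈ J ∧ (stp p x).1 ∈ J then gw P θ x.1 * gw P θ (stp p x).1 * dv c p x.1 else 0

lemma kap_stp (p : ℕ) (x : ℤ × Bool) : kap P θ c J p (stp p x) = kap P θ c J p x := by
  unfold kap
  rw [stp_stp, dv_stp]
  by_cases h1 : x.1 ∈ J <;> by_cases h2 : (stp p x).1 ∈ J <;> simp [h1, h2]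
  left; ring

noncomputable def Bp (p : ℕ) : Module.End ℝ (ℤ × Bool → ℝ) where
  toFun f := fun x => kap P θ c J p x * f (stp p x)
  map_add' f g := by funext x; simp [mul_add]
  map_smul' a f := by funext x; simp; ring

/-- The underlying finite set. -/
def XX : Finset (ℤ × Bool) := J ×ˢ univ

lemma mem_XX (x : ℤ × Bool) : x ∈ XX J ↔ x.1 ∈ J := by simp [XX]

lemma kap_eq_zero {p : ℕ} {x : ℤ × Bool} (h : x ∉ XX J ∨ stp p x ∉ XX J) :
    kap P θ c J p x = 0 := by
  rw [mem_XX, mem_XX] at h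
  unfold kap
  rw [if_neg]; tauto

lemma reindex (p : ℕ) (Φ : ℤ × Bool → ℝ) :
    ∑ x ∈ XX J, kap P θ c J p x * Φ x = ∑ x ∈ XX J, kap P θ c J p x * Φ (stp p x) := by
  classical
  have key : ∀ Ψ : ℤ × Bool → ℝ, ∑ x ∈ XX J, kap P θ c J p x * Ψ x
      = ∑ x ∈ (XX J).filter (fun x => stp p x ∈ XX J), kap P θ c J p x * Ψ x := by
    intro Ψ
    rw [Finset.sum_filter]
    refine Finset.sum_congr rfl fun x _ => ?_
    split_ifs with h
    · rfl
    · rw [kap_eq_zero P θ c J (Or.inr h), zero_mul]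
  rw [key, key (fun x => Φ (stp p x))]
  refine Finset.sum_nbij' (stp p) (stp p) ?_ ?_ ?_ ?_ ?_
  · intro x hx; simp only [Finset.mem_filter, stp_stp] at *; tauto
  · intro x hx; simp only [Finset.mem_filter, stp_stp] at *; tauto
  · intro x _; exact stp_stp p x
  · intro x _; exact stp_stp p x
  · intro x _; rw [stp_stp, kap_stp]

lemma Bp_sym (p : ℕ) (f g : ℤ × Bool → ℝ) :
    ip (XX J) (Bp P θ c J p f) g = ip (XX J) f (Bp P θ c J p g) := by
  have := reindex P θ c J p (fun x => f (stp p x) * g x)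
  simp only [stp_stp] at this
  simp only [ip, Bp, LinearMap.coe_mk, AddHom.coe_mk]
  calc _ = ∑ x ∈ XX J, kap P θ c J p x * (f (stp p x) * g x) :=
        Finset.sum_congr rfl fun x _ => by ring
    _ = _ := this
    _ = _ := Finset.sum_congr rfl fun x _ => by ring

lemma Bp_sq (p : ℕ) (f : ℤ × Bool → ℝ) :
    ip (XX J) (Bp P θ c J p f) (Bp P θ c J p f) =
      ∑ x ∈ XX J, (kap P θ c J p x) ^ 2 * (f x) ^ 2 := by
  have := reindex P θ c J p (fun x => kap P θ c J p x * f (stp p x) ^ 2)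
  simp only [stp_stp, kap_stp] at this
  simp only [ip, Bp, LinearMap.coe_mk, AddHom.coe_mk]
  calc _ = ∑ x ∈ XX J, kap P θ c J p x * (kap P θ c J p x * f (stp p x) ^ 2) :=
        Finset.sum_congr rfl fun x _ => by ring
    _ = _ := this
    _ = _ := Finset.sum_congr rfl fun x _ => by ring

variable (hθ0 : 0 ≤ θ) (hθ1 : θ ≤ 1) (hc0 : 0 ≤ c) (hc1 : c ≤ 1)
include hθ0 hθ1 in
lemma gw_bd (n : ℤ) : 0 ≤ gw P θ n ∧ gw P θ n ≤ 1 :=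
  ⟨Real.sqrt_nonneg _, Real.sqrt_le_one.2 (pow_le_one₀ hθ0 hθ1)⟩

include hθ0 hθ1 in
lemma kap_abs_le_dv (p : ℕ) (x : ℤ × Bool) : |kap P θ c J p x| ≤ |dv c p x.1| := by
  unfold kap
  have h1 := gw_bd P θ hθ0 hθ1 x.1
  have h2 := gw_bd P θ hθ0 hθ1 (stp p x).1
  split_ifs
  · rw [abs_mul, abs_of_nonneg (mul_nonneg h1.1 h2.1)]
    exact mul_le_of_le_one_left (abs_nonneg _) (mul_le_one₀ h1.2 h2.1 h2.2)
  · simp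

include hθ0 hθ1 hc0 hc1 in
lemma Bp_le (p : ℕ) (hp : 1 ≤ p) (f : ℤ × Bool → ℝ) :
    ip (XX J) (Bp P θ c J p f) (Bp P θ c J p f) ≤ ip (XX J) f f := by
  rw [Bp_sq]
  refine Finset.sum_le_sum fun x _ => ?_
  rw [← sq]
  refine mul_le_of_le_one_left (sq_nonneg _) ?_
  rw [sq_le_one_iff_abs_le_one]
  exact (kap_abs_le_dv P θ c J hθ0 hθ1 p x).trans (dv_abs_le c hc0 hc1 p hp _)

lemma theta_pow_mul (L : ℝ) (hL : 1 ≤ L) (k : ℕ) : (1 - 1 / L) ^ k * k ≤ L := by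
  have hL0 : 0 < L := by linarith
  have h0 : 0 ≤ 1 - 1 / L := by
    rw [sub_nonneg, div_le_one hL0]; exact hL
  have h1 : 1 - 1 / L ≤ Real.exp (-(1 / L)) := by
    have := Real.add_one_le_exp (-(1 / L)); linarith
  have h2 : (1 - 1 / L) ^ k ≤ Real.exp (-(k / L)) := by
    refine (pow_le_pow_left₀ h0 h1 k).trans (le_of_eq ?_)
    rw [← Real.exp_nat_mul]; congr 1; ring
  have h3 : (k : ℝ) / L ≤ Real.exp (k / L) := by
    have := Real.add_one_le_exp ((k : ℝ) / L); linarith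
  calc (1 - 1 / L) ^ k * k ≤ Real.exp (-(k / L)) * k :=
        mul_le_mul_of_nonneg_right h2 (Nat.cast_nonneg _)
    _ = Real.exp (-(k / L)) * (L * (k / L)) := by rw [mul_div_cancel₀ _ hL0.ne']
    _ ≤ Real.exp (-(k / L)) * (L * Real.exp (k / L)) := by gcongr
    _ = L * (Real.exp (-(k / L)) * Real.exp (k / L)) := by ring
    _ = L := by rw [← Real.exp_add]; simp

include hc0 hc1 in
lemma Bp_sum (L : ℝ) (hL : 1 ≤ L) (hθ : θ = 1 - 1 / L) (hP : ∀ p ∈ P, 1 ≤ p)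
    (hℓ : ∑ p ∈ P, (1 : ℝ) / p ≤ L) (f : ℤ × Bool → ℝ) :
    ∑ p ∈ P, ip (XX J) (Bp P θ c J p f) (Bp P θ c J p f) ≤ 2 * L * ip (XX J) f f := by
  have hL0 : 0 < L := by linarith
  have hθ0 : 0 ≤ θ := by rw [hθ, sub_nonneg, div_le_one hL0]; exact hL
  have hθ1 : θ ≤ 1 := by rw [hθ]; simp; linarith
  simp only [Bp_sq]
  rw [Finset.sum_comm, ip, Finset.mul_sum]
  refine Finset.sum_le_sum fun x _ => ?_
  rw [← Finset.sum_mul, ← sq]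
  refine mul_le_mul_of_nonneg_right ?_ (sq_nonneg _)
  have h1 : ∀ p ∈ P, kap P θ c J p x ^ 2 ≤
      θ ^ om P x.1 * (if (p : ℤ) ∣ x.1 then 1 else 0) + 1 / p := by
    intro p hp
    have hp1 : (1:ℝ) ≤ p := by exact_mod_cast hP p hp
    have g1 := gw_bd P θ hθ0 hθ1 x.1
    have g2 := gw_bd P θ hθ0 hθ1 (stp p x).1
    have g3 : gw P θ x.1 ^ 2 = θ ^ om P x.1 := Real.sq_sqrt (by positivity)
    have gs : gw P θ (stp p x).1 ^ 2 ≤ 1 := pow_le_one₀ g2.1 g2.2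
    have d0 := dv_abs_le c hc0 hc1 p (hP p hp) x.1
    have d1 : dv c p x.1 ^ 2 ≤ 1 := (sq_le_one_iff_abs_le_one _).2 d0
    unfold kap
    split_ifs with h2 h3 h3
    · rw [mul_pow, mul_pow, g3, mul_one]
      have : θ ^ om P x.1 * gw P θ (stp p x).1 ^ 2 * dv c p x.1 ^ 2 ≤ θ ^ om P x.1 * 1 * 1 := by
        gcongr
      have : 0 ≤ 1 / (p:ℝ) := by positivity
      linarith
    · rw [mul_pow, mul_pow, g3, mul_zero, zero_add]
      have t1 : θ ^ om P x.1 ≤ 1 := pow_le_one₀ hθ0 hθ1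
      have : θ ^ om P x.1 * gw P θ (stp p x).1 ^ 2 * dv c p x.1 ^ 2 ≤ 1 * 1 * dv c p x.1 ^ 2 := by
        gcongr
      have e : dv c p x.1 ^ 2 = (c / p) * (c / p) := by simp [dv, h3]; ring
      have e2 : c / p ≤ 1 / p := by gcongr
      have e3 : c / p ≤ 1 := by rw [div_le_one (by linarith)]; linarith
      have e4 : 0 ≤ c / p := by positivity
      nlinarith
    · simp; positivity
    · simp
  refine (Finset.sum_le_sum h1).trans ?_
  rw [Finset.sum_add_distrib, ← Finset.mul_sum]
  have : ∑ p ∈ P, (if (p : ℤ) ∣ x.1 then (1:ℝ) else 0) = (om P x.1 : ℝ) := by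
    rw [om, Finset.sum_boole]
  rw [this]
  have := theta_pow_mul L hL (om P x.1)
  rw [← hθ] at this
  linarith

end ops

/-- Alternating partial sums of a word. -/
def vv (u : ℕ → ℕ) (i : ℕ) : ℤ := ∑ l ∈ range i, (-1) ^ l * (u l : ℤ)

/-- Vertices of the walk. -/
def vtx (u : ℕ → ℕ) (x : ℤ × Bool) (i : ℕ) : ℤ × Bool :=
  (x.1 + sg x.2 * vv u i, xor x.2 (decide (i % 2 = 1)))

lemma vv_succ (u : ℕ → ℕ) (i : ℕ) : vv u (i + 1) = vv u i + (-1) ^ i * (u i : ℤ) := by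
  simp [vv, Finset.sum_range_succ]

lemma vv_zero (u : ℕ → ℕ) : vv u 0 = 0 := by simp [vv]

lemma vtx_succ' (u : ℕ → ℕ) (x : ℤ × Bool) (i : ℕ) :
    vtx u x (i + 1) = vtx (fun j => u (j + 1)) (stp (u 0) x) i := by
  unfold vtx stp
  ext
  · simp only [vv, Finset.sum_range_succ', sg_not]
    simp only [pow_zero, one_mul, pow_succ, mul_neg_one, neg_mul, Finset.sum_neg_distrib]
    ring
  · simp only
    rcases Nat.mod_two_eq_zero_or_one i with h | h
    · have : (i + 1) % 2 = 1 := by omega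
      simp [h, this]
    · have : (i + 1) % 2 = 0 := by omega
      simp [h, this]

/-- Extend a word to a function on all of `ℕ`. -/
def xt {P : Finset ℕ} {M : ℕ} (w : Fin M → ↥P) (i : ℕ) : ℕ :=
  if h : i < M then (w ⟨i, h⟩).1 else 1

lemma xt_cons_zero {P : Finset ℕ} {M : ℕ} (p : ↥P) (w : Fin M → ↥P) :
    xt (Fin.cons p w : Fin (M + 1) → ↥P) 0 = p.1 := by simp [xt]

lemma xt_cons_succ {P : Finset ℕ} {M : ℕ} (p : ↥P) (w : Fin M → ↥P) (i : ℕ) :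
    xt (Fin.cons p w : Fin (M + 1) → ↥P) (i + 1) = xt w i := by
  unfold xt
  by_cases h : i < M
  · have h2 : i + 1 < M + 1 := by omega
    rw [dif_pos h, dif_pos h2]
    have : (⟨i + 1, h2⟩ : Fin (M + 1)) = Fin.succ ⟨i, h⟩ := rfl
    rw [this, Fin.cons_succ]
  · rw [dif_neg h, dif_neg (by omega)]

section kernel
variable (P : Finset ℕ) (θ c : ℝ) (J : Finset ℤ)

/-- Operators indexed by the subtype. -/
noncomputable def BB (p : ↥P) : Module.End ℝ (ℤ × Bool → ℝ) := Bp P θ c J p.1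

lemma opw_apply {M : ℕ} (w : Fin M → ↥P) (f : ℤ × Bool → ℝ) (x : ℤ × Bool) :
    opw (BB P θ c J) w f x = (∏ i ∈ range M, kap P θ c J (xt w i) (vtx (xt w) x i)) *
      f (vtx (xt w) x M) := by
  induction M generalizing x with
  | zero => simp [opw_zero, vtx, vv]
  | succ M ih =>
    obtain ⟨p, w, rfl⟩ : ∃ p w', w = (Fin.cons p w' : Fin (M + 1) → ↥P) :=
      ⟨w 0, Fin.tail w, (Fin.cons_self_tail w).symm⟩
    have hs : (fun j => xt (Fin.cons p w : Fin (M + 1) → ↥P) (j + 1)) = xt w := by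
      funext j; exact xt_cons_succ p w j
    rw [opw_cons, Module.End.mul_apply]
    change kap P θ c J p.1 x * _ = _
    rw [ih, Finset.prod_range_succ']
    simp only [vtx_succ', xt_cons_zero, xt_cons_succ]
    have h0 : vtx (xt (Fin.cons p w : Fin (M + 1) → ↥P)) x 0 = x := by simp [vtx, vv]
    rw [h0]
    change _ = _ * kap P θ c J p.1 x * f (vtx (xt w) (stp p.1 x) M)
    ring

end kernel
end HR


namespace HR

open Finset

section periodic

lemma per_nat {f : ℤ → ℝ} {a : ℕ} (hf : Function.Periodic f (a : ℤ)) (n : ℕ) :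
    f ((n % a : ℕ) : ℤ) = f n := by
  have := hf.int_mul ((n / a : ℕ) : ℤ) ((n % a : ℕ) : ℤ)
  rw [← this]; congr 1
  have h2 := Nat.mod_add_div n a
  have h3 : ((n % a : ℕ) : ℤ) + (a : ℤ) * ((n / a : ℕ) : ℤ) = n := by exact_mod_cast h2
  simp only [Int.cast_id]
  linarith

lemma crt2 {f g : ℤ → ℝ} {a b : ℕ} (ha : 0 < a) (hb : 0 < b) (hab : Nat.Coprime a b)
    (hf : Function.Periodic f (a : ℤ)) (hg : Function.Periodic g (b : ℤ)) :
    ∑ n ∈ range (a * b), f n * g n = (∑ n ∈ range a, f n) * ∑ n ∈ range b, g n := by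
  rw [Finset.sum_mul_sum, ← Finset.sum_product']
  refine Finset.sum_nbij (fun n => (n % a, n % b)) ?_ ?_ ?_ ?_
  · intro n _
    simp only [Finset.mem_product, Finset.mem_range]
    exact ⟨Nat.mod_lt _ ha, Nat.mod_lt _ hb⟩
  · intro x hx y hy h
    simp only [Finset.coe_range, Set.mem_Iio, Prod.mk.injEq] at hx hy h
    have : x ≡ y [MOD a * b] := (Nat.modEq_and_modEq_iff_modEq_mul hab).1 ⟨h.1, h.2⟩
    exact Nat.ModEq.eq_of_lt_of_lt this hx hy
  · rintro ⟨x, y⟩ h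
    simp only [Finset.coe_product, Finset.coe_range, Set.mem_prod, Set.mem_Iio] at h
    obtain ⟨k, hk⟩ := Nat.chineseRemainder hab x y
    refine ⟨k % (a * b), by simpa using Nat.mod_lt _ (Nat.mul_pos ha hb), ?_⟩
    simp only [Prod.mk.injEq]
    rw [Nat.mod_mul_right_mod, Nat.mod_mul_left_mod]
    exact ⟨Eq.trans hk.1 (Nat.mod_eq_of_lt h.1), Eq.trans hk.2 (Nat.mod_eq_of_lt h.2)⟩
  · intro n _
    simp only
    rw [per_nat hf, per_nat hg]

lemma per_prod (S : Finset ℕ) (f : ℕ → ℤ → ℝ)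
    (hf : ∀ q ∈ S, Function.Periodic (f q) (q : ℤ)) :
    Function.Periodic (fun n => ∏ q ∈ S, f q n) ((∏ q ∈ S, q : ℕ) : ℤ) := by
  intro n
  refine Finset.prod_congr rfl fun q hq => ?_
  obtain ⟨k, hk⟩ := Finset.dvd_prod_of_mem (fun q => q) hq
  have := (hf q hq).int_mul (k : ℤ)
  rw [hk]
  have h2 := this n
  rw [← h2]; congr 1; push_cast; ring

lemma crt_prod (S : Finset ℕ) (hS : ∀ q ∈ S, q.Prime) (f : ℕ → ℤ → ℝ)
    (hf : ∀ q ∈ S, Function.Periodic (f q) (q : ℤ)) :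
    ∑ n ∈ range (∏ q ∈ S, q), ∏ q ∈ S, f q n = ∏ q ∈ S, ∑ n ∈ range q, f q n := by
  classical
  induction S using Finset.induction_on with
  | empty => simp
  | insert p S hp ih =>
    simp only [Finset.prod_insert hp]
    have hS' : ∀ q ∈ S, q.Prime := fun q hq => hS q (Finset.mem_insert_of_mem hq)
    have hf' : ∀ q ∈ S, Function.Periodic (f q) (q : ℤ) :=
      fun q hq => hf q (Finset.mem_insert_of_mem hq)
    have hpp := hS p (Finset.mem_insert_self _ _)
    rw [← ih hS' hf']
    refine crt2 (g := fun n => ∏ q ∈ S, f q n) hpp.pos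
      (Finset.prod_pos fun q hq => (hS' q hq).pos) ?_ (hf p (Finset.mem_insert_self _ _))
      (per_prod S f hf')
    refine Nat.Coprime.prod_right fun q hq => ?_
    exact (Nat.coprime_primes hpp (hS' q hq)).2 (fun e => hp (e ▸ hq))

lemma per_window {F : ℤ → ℝ} {Q : ℕ} (hF : Function.Periodic F (Q : ℤ)) (a : ℤ) :
    ∑ n ∈ range Q, F (a + n) = ∑ n ∈ range Q, F n := by
  have step : ∀ a : ℤ, ∑ n ∈ range Q, F (a + 1 + n) = ∑ n ∈ range Q, F (a + n) := by
    intro a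
    have h1 := Finset.sum_range_succ (fun n : ℕ => F (a + n)) Q
    have h2 := Finset.sum_range_succ' (fun n : ℕ => F (a + n)) Q
    have h3 : F (a + (Q:ℤ)) = F a := hF a
    have h4 : ∑ n ∈ range Q, F (a + 1 + n) = ∑ n ∈ range Q, F (a + ((n + 1 : ℕ) : ℤ)) := by
      refine Finset.sum_congr rfl fun n _ => ?_
      congr 1; push_cast; ring
    rw [h4]
    simp only [Nat.cast_zero, add_zero] at h2
    linarith
  induction a using Int.induction_on with
  | zero => simp
  | succ i ih => rw [step, ih]
  | pred i ih =>
    have := step (-(i:ℤ) - 1)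
    rw [sub_add_cancel] at this
    rw [← this, ih]

lemma per_interval {F : ℤ → ℝ} {Q : ℕ} (hQ : 0 < Q) (hF : Function.Periodic F (Q : ℤ))
    (h1 : ∀ n, |F n| ≤ 1) (a : ℤ) (K : ℕ) :
    |∑ n ∈ range K, F (a + n)| ≤ K * (|∑ n ∈ range Q, F n| / Q) + Q := by
  have hd : ∀ d : ℕ, ∑ n ∈ range (Q * d), F (a + n) = d * ∑ n ∈ range Q, F n := by
    intro d
    induction d with
    | zero => simp
    | succ d ih =>
      rw [Nat.mul_succ, Finset.sum_range_add, ih]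
      have := per_window hF (a + (Q * d : ℕ))
      have e : ∑ x ∈ range Q, F (a + ((Q * d + x : ℕ) : ℤ)) = ∑ n ∈ range Q, F n := by
        rw [← this]; refine Finset.sum_congr rfl fun n _ => ?_
        congr 1; push_cast; ring
      rw [e]; push_cast; ring
  have hK := Nat.div_add_mod K Q
  set d := K / Q
  set r := K % Q
  have hr : r < Q := Nat.mod_lt _ hQ
  rw [← hK, Finset.sum_range_add, hd]
  refine (abs_add_le _ _).trans (add_le_add ?_ ?_)
  · rw [abs_mul, Nat.abs_cast, mul_div_assoc']
    rw [le_div_iff₀ (by exact_mod_cast hQ)]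
    have : ((Q * d + r : ℕ) : ℝ) = Q * d + r := by push_cast; ring
    rw [this]
    have := abs_nonneg (∑ n ∈ range Q, F n)
    have h0 : (0:ℝ) ≤ r := Nat.cast_nonneg _
    nlinarith
  · refine (Finset.abs_sum_le_sum_abs _ _).trans ?_
    refine (Finset.sum_le_sum fun n _ => h1 _).trans ?_
    simp; exact hr.le

/-- Average over a period. -/
noncomputable def avg (q : ℕ) (f : ℤ → ℝ) : ℝ := (∑ n ∈ range q, f n) / q

lemma per_bound (S : Finset ℕ) (hS : ∀ q ∈ S, q.Prime) (f : ℕ → ℤ → ℝ)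
    (hf : ∀ q ∈ S, Function.Periodic (f q) (q : ℤ)) (h1 : ∀ q ∈ S, ∀ n, |f q n| ≤ 1)
    (a : ℤ) (K : ℕ) :
    |∑ n ∈ range K, ∏ q ∈ S, f q (a + n)| ≤
      K * (∏ q ∈ S, |avg q (f q)|) + ((∏ q ∈ S, q : ℕ) : ℝ) := by
  have := per_interval (F := fun n => ∏ q ∈ S, f q n) (Q := ∏ q ∈ S, q)
    (Finset.prod_pos fun q hq => (hS q hq).pos) (per_prod S f hf)
    (fun n => by
      rw [Finset.abs_prod]
      exact Finset.prod_le_one (fun q _ => abs_nonneg _) fun q hq => h1 q hq n) a K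
  refine this.trans (le_of_eq ?_)
  rw [crt_prod S hS f hf, Finset.abs_prod]
  simp only [avg, abs_div, Nat.abs_cast]
  rw [Finset.prod_div_distrib]
  push_cast
  rfl

end periodic

section bonferroni

/-- Elementary symmetric sums. -/
noncomputable def esy (k : ℕ) (T : Finset ℕ) (a : ℕ → ℝ) : ℝ :=
  ∑ U ∈ T.powersetCard k, ∏ q ∈ U, a q

lemma esy_zero (T : Finset ℕ) (a : ℕ → ℝ) : esy 0 T a = 1 := by simp [esy]

lemma esy_insert (k : ℕ) (T : Finset ℕ) (a : ℕ → ℝ) (x : ℕ) (hx : x ∉ T) :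
    esy (k + 1) (insert x T) a = esy (k + 1) T a + a x * esy k T a := by
  classical
  unfold esy
  rw [Finset.powersetCard_succ_insert hx, Finset.sum_union, Finset.sum_image, Finset.mul_sum]
  · congr 1
    refine Finset.sum_congr rfl fun U hU => ?_
    rw [Finset.prod_insert]
    exact fun h => hx ((Finset.mem_powersetCard.1 hU).1 h)
  · intro U hU V hV h
    have hU' : x ∉ U := fun h => hx ((Finset.mem_powersetCard.1 hU).1 h)
    have hV' : x ∉ V := fun h => hx ((Finset.mem_powersetCard.1 hV).1 h)
    have := congrArg (fun Z => Z.erase x) h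
    simpa [Finset.erase_insert hU', Finset.erase_insert hV'] using this
  · rw [Finset.disjoint_left]
    intro U hU hV
    obtain ⟨V, _, rfl⟩ := Finset.mem_image.1 hV
    exact hx ((Finset.mem_powersetCard.1 hU).1 (Finset.mem_insert_self _ _))

lemma esy_nonneg (k : ℕ) (T : Finset ℕ) (a : ℕ → ℝ) (ha : ∀ q ∈ T, 0 ≤ a q) :
    0 ≤ esy k T a :=
  Finset.sum_nonneg fun _ hU => Finset.prod_nonneg fun q hq =>
    ha q ((Finset.mem_powersetCard.1 hU).1 hq)

lemma bonf (T : Finset ℕ) (a : ℕ → ℝ) (ha : ∀ q ∈ T, 0 ≤ a q ∧ a q ≤ 1) (j : ℕ) :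
    0 ≤ (-1) ^ j * (∏ q ∈ T, (1 - a q) - ∑ k ∈ range j, (-1) ^ k * esy k T a) ∧
    (-1) ^ j * (∏ q ∈ T, (1 - a q) - ∑ k ∈ range j, (-1) ^ k * esy k T a) ≤ esy j T a := by
  classical
  induction T using Finset.induction_on generalizing j with
  | empty =>
    have h : ∀ k, esy (k + 1) ∅ a = 0 := by
      intro k; rw [esy, Finset.powersetCard_eq_empty.2 (by simp)]; simp
    cases j with
    | zero => simp [esy_zero]
    | succ j => rw [Finset.sum_range_succ']; simp [h, esy_zero]
  | insert x T hx ih =>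
    have ih' := ih (fun q hq => ha q (Finset.mem_insert_of_mem hq))
    have hax := ha x (Finset.mem_insert_self _ _)
    cases j with
    | zero =>
      simp only [pow_zero, one_mul, Finset.range_zero, Finset.sum_empty, sub_zero, esy_zero]
      exact ⟨Finset.prod_nonneg fun q hq => by linarith [(ha q hq).2],
        Finset.prod_le_one (fun q hq => by linarith [(ha q hq).2])
          fun q hq => by linarith [(ha q hq).1]⟩
    | succ j =>
      have e : (-1 : ℝ) ^ (j + 1) * (∏ q ∈ insert x T, (1 - a q) -
          ∑ k ∈ range (j + 1), (-1) ^ k * esy k (insert x T) a) =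
          (-1) ^ (j + 1) * (∏ q ∈ T, (1 - a q) - ∑ k ∈ range (j + 1), (-1) ^ k * esy k T a) +
          a x * ((-1) ^ j * (∏ q ∈ T, (1 - a q) - ∑ k ∈ range j, (-1) ^ k * esy k T a)) := by
        rw [Finset.prod_insert hx, Finset.sum_range_succ', Finset.sum_range_succ']
        simp only [esy_insert _ T a x hx, esy_zero, mul_add, Finset.sum_add_distrib]
        have : ∑ k ∈ range j, (-1 : ℝ) ^ (k + 1) * (a x * esy k T a) =
            - a x * ∑ k ∈ range j, (-1) ^ k * esy k T a := by
          rw [Finset.mul_sum]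
          exact Finset.sum_congr rfl fun k _ => by rw [pow_succ]; ring
        rw [this, pow_succ]; ring
      rw [e, esy_insert _ T a x hx]
      have i1 := ih' (j + 1)
      have i2 := ih' j
      constructor
      · have := mul_nonneg hax.1 i2.1; linarith [i1.1]
      · have := mul_le_mul_of_nonneg_left i2.2 hax.1; linarith [i1.2]

lemma esy_le (k : ℕ) (T : Finset ℕ) (a : ℕ → ℝ) (ha : ∀ q ∈ T, 0 ≤ a q) :
    esy k T a ≤ (∑ q ∈ T, a q) ^ k / k.factorial := by
  classical
  induction T using Finset.induction_on generalizing k with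
  | empty =>
    cases k with
    | zero => simp [esy_zero]
    | succ k => rw [esy, Finset.powersetCard_eq_empty.2 (by simp)]; simp
  | insert x T hx ih =>
    have ha' : ∀ q ∈ T, 0 ≤ a q := fun q hq => ha q (Finset.mem_insert_of_mem hq)
    have hax := ha x (Finset.mem_insert_self _ _)
    cases k with
    | zero => simp [esy_zero]
    | succ k =>
      rw [esy_insert _ T a x hx, Finset.sum_insert hx]
      have h1 := ih (k + 1) ha'
      have h2 := mul_le_mul_of_nonneg_left (ih k ha') hax
      set s := ∑ q ∈ T, a q
      have hs : 0 ≤ s := Finset.sum_nonneg ha'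
      have h3 : s ^ (k + 1) + (k + 1) * (a x * s ^ k) ≤ (a x + s) ^ (k + 1) := by
        rw [add_comm (a x) s]
        have := Finset.sum_le_sum_of_subset_of_nonneg (s := {0, 1})
          (t := range (k + 1 + 1)) (f := fun m => (a x) ^ m * s ^ (k + 1 - m) *
            ((k + 1).choose m : ℝ)) (by
              intro i hi; simp only [Finset.mem_insert, Finset.mem_singleton] at hi
              simp only [Finset.mem_range]; omega)
            (fun i _ _ => by positivity)
        rw [← add_pow, Finset.sum_pair (by norm_num)] at this
        simp at this
        rw [add_comm s]
        linarith
      have hf : (0:ℝ) < ((k + 1).factorial : ℝ) := by exact_mod_cast Nat.factorial_pos _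
      have hk : (0:ℝ) < (k.factorial : ℝ) := by exact_mod_cast Nat.factorial_pos _
      refine (add_le_add h1 h2).trans ?_
      rw [le_div_iff₀ hf, add_mul, div_mul_cancel₀ _ hf.ne']
      refine le_trans (le_of_eq ?_) h3
      rw [Nat.factorial_succ]; push_cast
      field_simp

end bonferroni
end HR


namespace HR

open Finset

section expect

/-- Number of shifts hitting a multiple of `q`. -/
def mq (t : ℕ → ℤ) (M q : ℕ) (n : ℤ) : ℕ := ((range M).filter fun i => (q : ℤ) ∣ n + t i).card

lemma dvd_per (q : ℕ) (t n : ℤ) : (q : ℤ) ∣ n + q + t ↔ (q : ℤ) ∣ n + t := by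
  rw [add_right_comm]; exact dvd_add_self_right

lemma mq_per (t : ℕ → ℤ) (M q : ℕ) (n : ℤ) : mq t M q (n + q) = mq t M q n := by
  simp only [mq, dvd_per]

lemma one_res (q : ℕ) (hq : 0 < q) (t : ℤ) :
    ∑ n ∈ range q, (if (q : ℤ) ∣ (n : ℤ) + t then (1 : ℝ) else 0) = 1 := by
  have hper : Function.Periodic (fun n : ℤ => if (q : ℤ) ∣ n then (1 : ℝ) else 0) (q : ℤ) := by
    intro n; simp
  have h := per_window hper t
  have e : ∑ n ∈ range q, (if (q : ℤ) ∣ (n : ℤ) then (1 : ℝ) else 0) = 1 := by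
    rw [Finset.sum_eq_single 0]
    · simp
    · intro b hb hb0
      rw [if_neg]
      intro hd
      have := Nat.le_of_dvd (by omega) (Int.natCast_dvd_natCast.1 hd)
      have := Finset.mem_range.1 hb
      omega
    · intro h0; exact absurd (Finset.mem_range.2 hq) h0
  refine Eq.trans ?_ (h.trans e)
  exact Finset.sum_congr rfl fun n _ => by rw [add_comm]

lemma mq_sum (t : ℕ → ℤ) (M q : ℕ) (hq : 0 < q) : ∑ n ∈ range q, (mq t M q n : ℝ) = M := by
  have : ∀ n : ℕ, (mq t M q n : ℝ) = ∑ i ∈ range M, if (q : ℤ) ∣ (n : ℤ) + t i then (1:ℝ) else 0 := by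
    intro n; rw [Finset.sum_boole]; rfl
  simp only [this]
  rw [Finset.sum_comm]
  simp [one_res q hq]

lemma one_sub_pow (L : ℝ) (hL : 1 ≤ L) (m : ℕ) :
    0 ≤ 1 - (1 - 1 / L) ^ m ∧ 1 - (1 - 1 / L) ^ m ≤ m / L ∧ 1 - (1 - 1 / L) ^ m ≤ 1 := by
  have hL0 : 0 < L := by linarith
  have h0 : 0 ≤ 1 - 1 / L := by rw [sub_nonneg, div_le_one hL0]; exact hL
  have h1 : 1 - 1 / L ≤ 1 := by simp; linarith
  have h2 := one_add_mul_le_pow (a := -(1 / L)) (by linarith) m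
  refine ⟨by linarith [pow_le_one₀ h0 h1 (n := m)], ?_, by linarith [pow_nonneg h0 m]⟩
  have e : (1 + -(1 / L)) = 1 - 1 / L := by ring
  rw [e] at h2
  have : (m : ℝ) * -(1 / L) = - (m / L) := by ring
  linarith

/-- The sieve variable. -/
noncomputable def aq (L : ℝ) (t : ℕ → ℤ) (M q : ℕ) (n : ℤ) : ℝ := 1 - (1 - 1 / L) ^ mq t M q n

lemma aq_avg (L : ℝ) (hL : 1 ≤ L) (t : ℕ → ℤ) (M q : ℕ) (hq : 0 < q) :
    |avg q (aq L t M q)| ≤ M / (L * q) := by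
  have hq' : (0:ℝ) < q := by exact_mod_cast hq
  have h0 : 0 ≤ ∑ n ∈ range q, aq L t M q n :=
    Finset.sum_nonneg fun n _ => (one_sub_pow L hL _).1
  rw [avg, abs_div, Nat.abs_cast, abs_of_nonneg h0, div_le_div_iff₀ hq' (by positivity)]
  have h1 : ∑ n ∈ range q, aq L t M q n ≤ M / L := by
    calc _ ≤ ∑ n ∈ range q, (mq t M q n : ℝ) / L :=
          Finset.sum_le_sum fun n _ => (one_sub_pow L hL _).2.1
      _ = _ := by rw [← Finset.sum_div, mq_sum t M q hq]
  rw [le_div_iff₀ (by linarith)] at h1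
  nlinarith

lemma ex_term (P Q U : Finset ℕ) (hP : ∀ q ∈ P, q.Prime) (hQ : Q ⊆ P) (hU : U ⊆ P \ Q)
    (L : ℝ) (hL : 1 ≤ L) (t : ℕ → ℤ) (M : ℕ) (X : ℕ → ℤ → ℝ)
    (hX : ∀ q ∈ Q, Function.Periodic (X q) (q : ℤ)) (hX1 : ∀ q ∈ Q, ∀ n, |X q n| ≤ 1)
    (b : ℕ → ℝ) (hb : ∀ q ∈ Q, |avg q (X q)| ≤ b q) (H : ℝ) (hH : 1 ≤ H)
    (hPH : ∀ q ∈ P, (q : ℝ) ≤ H) (a : ℤ) (K : ℕ) :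
    |∑ n ∈ range K, (∏ q ∈ Q, X q (a + n)) * ∏ q ∈ U, aq L t M q (a + n)| ≤
      K * ((∏ q ∈ Q, b q) * ∏ q ∈ U, (M / (L * q) : ℝ)) + H ^ (Q.card + U.card) := by
  classical
  have hUP : U ⊆ P := fun q hq => (Finset.mem_sdiff.1 (hU hq)).1
  have hdis : Disjoint Q U := by
    rw [Finset.disjoint_left]; intro q h1 h2
    exact (Finset.mem_sdiff.1 (hU h2)).2 h1
  set f : ℕ → ℤ → ℝ := fun q => if q ∈ Q then X q else aq L t M q with hfdef
  have hS : ∀ q ∈ Q ∪ U, q ∈ P := fun q hq => (Finset.union_subset hQ hUP) hq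
  have fQ : ∀ q ∈ Q, f q = X q := fun q hq => by simp [hfdef, hq]
  have fU : ∀ q ∈ U, f q = aq L t M q := fun q hq => by
    simp [hfdef, (Finset.mem_sdiff.1 (hU hq)).2]
  have main := per_bound (Q ∪ U) (fun q hq => hP q (hS q hq)) f (by
      intro q hq
      rcases Finset.mem_union.1 hq with h | h
      · rw [fQ q h]; exact hX q h
      · rw [fU q h]; intro n; simp only [aq, mq_per]) (by
      intro q hq n
      rcases Finset.mem_union.1 hq with h | h
      · rw [fQ q h]; exact hX1 q h n
      · rw [fU q h]
        have := one_sub_pow L hL (mq t M q n)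
        change |1 - (1 - 1 / L) ^ mq t M q n| ≤ 1
        rw [abs_of_nonneg this.1]; exact this.2.2) a K
  simp only [Finset.prod_union hdis] at main
  have e1 : ∀ n : ℤ, (∏ q ∈ Q, f q n) * ∏ q ∈ U, f q n =
      (∏ q ∈ Q, X q n) * ∏ q ∈ U, aq L t M q n := by
    intro n
    rw [Finset.prod_congr rfl fun q hq => by rw [fQ q hq],
      Finset.prod_congr (s₁ := U) rfl fun q hq => by rw [fU q hq]]
  simp only [e1] at main
  refine main.trans (add_le_add ?_ ?_)
  · refine mul_le_mul_of_nonneg_left (mul_le_mul ?_ ?_ ?_ ?_) (Nat.cast_nonneg _)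
    · exact Finset.prod_le_prod (fun q _ => abs_nonneg _) fun q hq => by rw [fQ q hq]; exact hb q hq
    · exact Finset.prod_le_prod (fun q _ => abs_nonneg _) fun q hq => by
        rw [fU q hq]; exact aq_avg L hL t M q (hP q (hUP hq)).pos
    · exact Finset.prod_nonneg fun q _ => abs_nonneg _
    · exact Finset.prod_nonneg fun q hq => (abs_nonneg _).trans (hb q hq)
  · push_cast
    rw [pow_add]
    refine mul_le_mul ?_ ?_ (Finset.prod_nonneg fun q _ => Nat.cast_nonneg _) (by positivity)
    · exact (Finset.prod_le_prod (fun q _ => Nat.cast_nonneg _) (fun q hq => hPH q (hQ hq))).trans (by rw [Finset.prod_const])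
    · exact (Finset.prod_le_prod (fun q _ => Nat.cast_nonneg _) (fun q hq => hPH q (hUP hq))).trans (by rw [Finset.prod_const])

theorem ex_bound (P Q : Finset ℕ) (hP : ∀ q ∈ P, q.Prime) (hQ : Q ⊆ P)
    (L : ℝ) (hL : 1 ≤ L) (hℓ : ∑ q ∈ P, (1 : ℝ) / q ≤ L) (t : ℕ → ℤ) (M : ℕ) (X : ℕ → ℤ → ℝ)
    (hX : ∀ q ∈ Q, Function.Periodic (X q) (q : ℤ)) (hX1 : ∀ q ∈ Q, ∀ n, |X q n| ≤ 1)
    (b d : ℕ → ℝ) (hb : ∀ q ∈ Q, |avg q (X q)| ≤ b q)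
    (hd : ∀ q ∈ Q, avg q (fun n => |X q n|) ≤ d q) (H : ℝ) (hH : 1 ≤ H)
    (hPH : ∀ q ∈ P, (q : ℝ) ≤ H) (hPc : (P.card : ℝ) ≤ H) (a : ℤ) (K R : ℕ) :
    |∑ n ∈ range K, (∏ q ∈ Q, X q (a + n)) * ∏ q ∈ P \ Q, (1 - 1 / L) ^ mq t M q (a + n)| ≤
      K * ((∏ q ∈ Q, b q) * Real.exp M) + K * ((∏ q ∈ Q, d q) * (M ^ R / R.factorial)) +
        (R + 1) * H ^ (Q.card + 2 * R) := by
  classical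
  have hL0 : 0 < L := by linarith
  set T := P \ Q with hT
  have hTP : T ⊆ P := Finset.sdiff_subset
  have hb0 : ∀ q ∈ Q, 0 ≤ b q := fun q hq => (abs_nonneg _).trans (hb q hq)
  have hd0 : ∀ q ∈ Q, 0 ≤ d q := fun q hq => le_trans (by
    unfold avg; positivity) (hd q hq)
  set A : ℤ → ℕ → ℝ := fun n q => aq L t M q n with hA
  have hA1 : ∀ n, ∀ q ∈ T, 0 ≤ A n q ∧ A n q ≤ 1 := fun n q _ =>
    ⟨(one_sub_pow L hL _).1, (one_sub_pow L hL _).2.2⟩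
  have hY : ∀ n, ∏ q ∈ T, (1 - 1 / L) ^ mq t M q n = ∏ q ∈ T, (1 - A n q) := by
    intro n; refine Finset.prod_congr rfl fun q _ => ?_
    simp only [hA, aq]; ring
  have hesy : ∀ k, esy k T (fun q => (M / (L * q) : ℝ)) ≤ M ^ k / k.factorial := by
    intro k
    have hnn : ∀ q ∈ T, (0:ℝ) ≤ M / (L * q) := fun q _ => by positivity
    refine (esy_le k T _ hnn).trans ?_
    gcongr
    · calc ∑ q ∈ T, (M / (L * q) : ℝ) ≤ ∑ q ∈ P, (M / (L * q) : ℝ) :=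
            Finset.sum_le_sum_of_subset_of_nonneg hTP fun q _ _ => by positivity
        _ = M / L * ∑ q ∈ P, (1:ℝ) / q := by
            rw [Finset.mul_sum]; exact Finset.sum_congr rfl fun q _ => by
              rw [div_mul_div_comm, mul_one]
        _ ≤ M / L * L := by gcongr
        _ = M := by field_simp
  have hcard : ∀ k, k ≤ R → (((T.powersetCard k).card : ℕ) : ℝ) ≤ H ^ R := by
    intro k hk
    rw [Finset.card_powersetCard]
    calc ((T.card.choose k : ℕ) : ℝ) ≤ (T.card : ℝ) ^ k := by exact_mod_cast Nat.choose_le_pow _ _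
      _ ≤ H ^ k := by
          gcongr
          exact le_trans (by exact_mod_cast Finset.card_le_card hTP) hPc
      _ ≤ H ^ R := pow_le_pow_right₀ hH hk
  -- estimate for one level
  have level : ∀ (X' : ℕ → ℤ → ℝ) (b' : ℕ → ℝ),
      (∀ q ∈ Q, Function.Periodic (X' q) (q : ℤ)) → (∀ q ∈ Q, ∀ n, |X' q n| ≤ 1) →
      (∀ q ∈ Q, |avg q (X' q)| ≤ b' q) → ∀ k ≤ R,
      |∑ n ∈ range K, (∏ q ∈ Q, X' q (a + n)) * esy k T (A (a + n))| ≤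
        K * ((∏ q ∈ Q, b' q) * (M ^ k / k.factorial)) + H ^ (Q.card + 2 * R) := by
    intro X' b' h1 h2 h3 k hk
    have e : ∑ n ∈ range K, (∏ q ∈ Q, X' q (a + n)) * esy k T (A (a + n)) =
        ∑ U ∈ T.powersetCard k, ∑ n ∈ range K,
          (∏ q ∈ Q, X' q (a + n)) * ∏ q ∈ U, aq L t M q (a + n) := by
      rw [Finset.sum_comm]
      exact Finset.sum_congr rfl fun n _ => by rw [esy, Finset.mul_sum]
    rw [e]
    refine (Finset.abs_sum_le_sum_abs _ _).trans ?_
    have b0 : 0 ≤ ∏ q ∈ Q, b' q := Finset.prod_nonneg fun q hq => (abs_nonneg _).trans (h3 q hq)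
    calc _ ≤ ∑ U ∈ T.powersetCard k,
          (K * ((∏ q ∈ Q, b' q) * ∏ q ∈ U, (M / (L * q) : ℝ)) + H ^ (Q.card + R)) := by
          refine Finset.sum_le_sum fun U hU => ?_
          have hU' := Finset.mem_powersetCard.1 hU
          refine (ex_term P Q U hP hQ hU'.1 L hL t M X' h1 h2 b' h3 H hH hPH a K).trans ?_
          gcongr
          · rw [hU'.2]; exact hk
      _ = K * ((∏ q ∈ Q, b' q) * esy k T (fun q => (M / (L * q) : ℝ))) +
          (T.powersetCard k).card * H ^ (Q.card + R) := by
          rw [Finset.sum_add_distrib, ← Finset.mul_sum, ← Finset.mul_sum, Finset.sum_const,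
            nsmul_eq_mul]; rfl
      _ ≤ K * ((∏ q ∈ Q, b' q) * (M ^ k / k.factorial)) + H ^ R * H ^ (Q.card + R) := by
          gcongr
          · exact hesy k
          · exact hcard k hk
      _ = _ := by rw [← pow_add]; congr 2; ring
  -- decomposition
  have dec : ∀ n : ℤ, (∏ q ∈ Q, X q n) * ∏ q ∈ T, (1 - 1 / L) ^ mq t M q n =
      ∑ k ∈ range R, (-1) ^ k * ((∏ q ∈ Q, X q n) * esy k T (A n)) +
      (∏ q ∈ Q, X q n) * (∏ q ∈ T, (1 - A n q) - ∑ k ∈ range R, (-1) ^ k * esy k T (A n)) := by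
    intro n
    rw [hY n]
    have : ∑ k ∈ range R, (-1 : ℝ) ^ k * ((∏ q ∈ Q, X q n) * esy k T (A n)) =
        (∏ q ∈ Q, X q n) * ∑ k ∈ range R, (-1) ^ k * esy k T (A n) := by
      rw [Finset.mul_sum]; exact Finset.sum_congr rfl fun k _ => by ring
    rw [this]; ring
  have rem : ∀ n : ℤ, |(∏ q ∈ Q, X q n) * (∏ q ∈ T, (1 - A n q) -
      ∑ k ∈ range R, (-1) ^ k * esy k T (A n))| ≤ (∏ q ∈ Q, |X q n|) * esy R T (A n) := by
    intro n
    rw [abs_mul, Finset.abs_prod]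
    refine mul_le_mul_of_nonneg_left ?_ (Finset.prod_nonneg fun q _ => abs_nonneg _)
    have hb := bonf T (A n) (hA1 n) R
    have h2 : |(-1 : ℝ) ^ R * (∏ q ∈ T, (1 - A n q) -
      ∑ k ∈ range R, (-1) ^ k * esy k T (A n))| ≤ esy R T (A n) := by
      rw [abs_of_nonneg hb.1]; exact hb.2
    rwa [abs_mul, abs_pow, abs_neg, abs_one, one_pow, one_mul] at h2
  simp only [dec]
  rw [Finset.sum_add_distrib]
  refine (abs_add_le _ _).trans ?_
  have p1 : |∑ n ∈ range K, ∑ k ∈ range R, (-1 : ℝ) ^ k * ((∏ q ∈ Q, X q (a + n)) *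
      esy k T (A (a + n)))| ≤ K * ((∏ q ∈ Q, b q) * Real.exp M) + R * H ^ (Q.card + 2 * R) := by
    rw [Finset.sum_comm]
    refine (Finset.abs_sum_le_sum_abs _ _).trans ?_
    calc _ ≤ ∑ k ∈ range R, (K * ((∏ q ∈ Q, b q) * (M ^ k / k.factorial)) +
          H ^ (Q.card + 2 * R)) := by
          refine Finset.sum_le_sum fun k hk => ?_
          rw [← Finset.mul_sum, abs_mul, abs_pow, abs_neg, abs_one, one_pow, one_mul]
          exact level X b hX hX1 hb k (Finset.mem_range.1 hk).le
      _ = K * ((∏ q ∈ Q, b q) * ∑ k ∈ range R, (M:ℝ) ^ k / k.factorial) +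
          R * H ^ (Q.card + 2 * R) := by
          rw [Finset.sum_add_distrib, ← Finset.mul_sum, ← Finset.mul_sum, Finset.sum_const,
            nsmul_eq_mul, Finset.card_range]
      _ ≤ _ := by
          have := Real.sum_le_exp_of_nonneg (Nat.cast_nonneg (α := ℝ) M) R
          have b0 := Finset.prod_nonneg hb0
          gcongr
  have p2 : |∑ n ∈ range K, (∏ q ∈ Q, X q (a + n)) * (∏ q ∈ T, (1 - A (a + n) q) -
      ∑ k ∈ range R, (-1) ^ k * esy k T (A (a + n)))| ≤
      K * ((∏ q ∈ Q, d q) * (M ^ R / R.factorial)) + H ^ (Q.card + 2 * R) := by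
    refine (Finset.abs_sum_le_sum_abs _ _).trans ?_
    refine (Finset.sum_le_sum fun n _ => rem _).trans ?_
    refine (le_abs_self _).trans (level (fun q n => |X q n|) d ?_ ?_ ?_ R le_rfl)
    · intro q hq n; simp only [hX q hq n]
    · intro q hq n; rw [abs_abs]; exact hX1 q hq n
    · intro q hq
      rw [abs_of_nonneg]
      · exact hd q hq
      · unfold avg; positivity
  nlinarith [p1, p2]

end expect
end HR


namespace HR

open Finset

set_option linter.unusedSectionVars false

section elim
variable {ι α : Type*} [Fintype ι] [DecidableEq ι] [Fintype α] [DecidableEq α]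

lemma sum_update (F : (ι → α) → ℝ) (c : ι) :
    ∑ u, ∑ a, F (Function.update u c a) = Fintype.card α * ∑ u, F u := by
  have h1 : ∑ x : (ι → α) × α, F (Function.update x.1 c x.2) = ∑ x : (ι → α) × α, F x.1 := by
    refine Finset.sum_nbij' (fun x => (Function.update x.1 c x.2, x.1 c))
      (fun x => (Function.update x.1 c x.2, x.1 c)) ?_ ?_ ?_ ?_ ?_ <;> intros <;> simp
  rw [Fintype.sum_prod_type, Fintype.sum_prod_type] at h1
  rw [h1, Finset.mul_sum]
  simp

lemma sum_update_le [Nonempty α] (F F' : (ι → α) → ℝ) (c : ι) (B : ℝ)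
    (h : ∀ u, ∑ a, F (Function.update u c a) ≤ B * ∑ a, F' (Function.update u c a)) :
    ∑ u, F u ≤ B * ∑ u, F' u := by
  have h1 : ∑ u, ∑ a, F (Function.update u c a) ≤ ∑ u, B * ∑ a, F' (Function.update u c a) :=
    Finset.sum_le_sum fun u _ => h u
  rw [← Finset.mul_sum, sum_update, sum_update] at h1
  have h2 : (0 : ℝ) < Fintype.card α := by exact_mod_cast Fintype.card_pos
  nlinarith

open Classical in
lemma elim_sum (p0 : α) (B : ℝ) (hB0 : 0 ≤ B) (G : ℕ) (c : ℕ → ι)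
    (D : ℕ → (ι → α) → Finset α) (f : ι → α → ℝ) (hf : ∀ i a, 0 ≤ f i a)
    (hinj : ∀ j < G, ∀ k < G, c j = c k → j = k)
    (hD : ∀ k < G, ∀ j, k ≤ j → j < G → ∀ u a, D k (Function.update u (c j) a) = D k u)
    (hB : ∀ k < G, ∀ u, ∑ a ∈ D k u, f (c k) a ≤ B) :
    ∑ u : ι → α, (if ∀ k < G, u (c k) ∈ D k u then ∏ i, f i (u i) else 0) ≤
      B ^ G * ∏ i, (if ∃ k < G, c k = i then 1 else ∑ a, f i a) := by
  have : Nonempty α := ⟨p0⟩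
  induction G generalizing f with
  | zero =>
    simp only [Nat.not_lt_zero, IsEmpty.forall_iff, implies_true, if_true, pow_zero, one_mul,
      false_and, exists_false, if_false]
    rw [Finset.prod_univ_sum]
    simp
  | succ G ih =>
    set c0 := c G with hc0
    set f' : ι → α → ℝ := Function.update f c0 (fun a => if a = p0 then 1 else 0) with hf'
    have hne : ∀ k < G, c k ≠ c0 := fun k hk h => by
      have := hinj k (by omega) G (by omega) h; omega
    have hfne : ∀ i, i ≠ c0 → f' i = f i := fun i hi => by simp [hf', hi]
    have ih' := ih f' (by
        intro i a
        by_cases h : i = c0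
        · subst h; simp only [hf', Function.update_self]; split_ifs <;> norm_num
        · rw [hfne i h]; exact hf i a)
      (fun j hj k hk => hinj j (by omega) k (by omega))
      (fun k hk j hkj hj => hD k (by omega) j hkj (by omega))
      (fun k hk u => by rw [hfne _ (hne k hk)]; exact hB k (by omega) u)
    have key : ∑ u : ι → α, (if ∀ k < G + 1, u (c k) ∈ D k u then ∏ i, f i (u i) else 0) ≤
        B * ∑ u : ι → α, (if ∀ k < G, u (c k) ∈ D k u then ∏ i, f' i (u i) else 0) := by
      refine sum_update_le _ _ c0 B fun u => ?_
      set Rr := ∏ i ∈ univ.erase c0, f i (u i) with hR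
      have hR0 : 0 ≤ Rr := Finset.prod_nonneg fun i _ => hf _ _
      have hp : ∀ a, ∏ i, f i (Function.update u c0 a i) = f c0 a * Rr := by
        intro a
        rw [← Finset.mul_prod_erase univ _ (Finset.mem_univ c0), Function.update_self]
        congr 1
        exact Finset.prod_congr rfl fun i hi => by
          rw [Function.update_of_ne (Finset.ne_of_mem_erase hi)]
      have hp' : ∀ a, ∏ i, f' i (Function.update u c0 a i) = (if a = p0 then 1 else 0) * Rr := by
        intro a
        rw [← Finset.mul_prod_erase univ _ (Finset.mem_univ c0), Function.update_self]
        congr 1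
        · simp [hf']
        · exact Finset.prod_congr rfl fun i hi => by
            rw [Function.update_of_ne (Finset.ne_of_mem_erase hi),
              hfne i (Finset.ne_of_mem_erase hi)]
      have hc1 : ∀ a, (∀ k < G, Function.update u c0 a (c k) ∈ D k (Function.update u c0 a)) ↔
          ∀ k < G, u (c k) ∈ D k u := by
        intro a
        refine forall_congr' fun k => forall_congr' fun hk => ?_
        rw [hD k (by omega) G (by omega) (by omega), Function.update_of_ne (hne k hk)]
      have hc2 : ∀ a, (∀ k < G + 1, Function.update u c0 a (c k) ∈ D k (Function.update u c0 a)) ↔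
          (∀ k < G, u (c k) ∈ D k u) ∧ a ∈ D G u := by
        intro a
        rw [← hc1 a]
        constructor
        · intro h
          refine ⟨fun k hk => h k (by omega), ?_⟩
          have := h G (by omega)
          rwa [hD G (by omega) G le_rfl (by omega), Function.update_self] at this
        · rintro ⟨h1, h2⟩ k hk
          rcases Nat.lt_succ_iff_lt_or_eq.1 hk with h | h
          · exact h1 k h
          · subst h
            rw [hD k (by omega) k le_rfl (by omega), Function.update_self]; exact h2
      simp only [hc1, hc2, hp, hp']
      by_cases hc : ∀ k < G, u (c k) ∈ D k u
      · have e1 : ∑ a, (if (∀ k < G, u (c k) ∈ D k u) ∧ a ∈ D G u then f c0 a * Rr else 0) =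
            (∑ a ∈ D G u, f c0 a) * Rr := by
          rw [Finset.sum_mul, ← Finset.sum_filter]
          refine Finset.sum_congr ?_ fun _ _ => rfl
          ext a; simp
          intro _; exact hc
        have e2 : ∑ a, (if ∀ k < G, u (c k) ∈ D k u then (if a = p0 then (1:ℝ) else 0) * Rr else 0)
            = Rr := by
          simp only [if_pos hc]; rw [← Finset.sum_mul]; simp
        rw [e1, e2]
        exact mul_le_mul_of_nonneg_right (hB G (by omega) u) hR0
      · simp [hc]
    refine key.trans ?_
    calc _ ≤ B * (B ^ G * ∏ i, (if ∃ k < G, c k = i then 1 else ∑ a, f' i a)) :=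
          mul_le_mul_of_nonneg_left ih' hB0
      _ = B ^ (G + 1) * ∏ i, (if ∃ k < G, c k = i then 1 else ∑ a, f' i a) := by ring
      _ = _ := by
          congr 1
          refine Finset.prod_congr rfl fun i _ => ?_
          by_cases hi : i = c0
          · subst hi
            rw [if_neg (by rintro ⟨k, hk, h⟩; exact hne k hk h),
              if_pos ⟨G, by omega, rfl⟩]
            simp [hf']
          · rw [hfne i hi]
            refine if_congr ⟨?_, ?_⟩ rfl rfl
            · rintro ⟨k, hk, h⟩; exact ⟨k, by omega, h⟩
            · rintro ⟨k, hk, h⟩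
              refine ⟨k, ?_, h⟩
              rcases Nat.lt_succ_iff_lt_or_eq.1 hk with h' | h'
              · exact h'
              · subst h'; exact absurd h.symm hi

end elim

section pattern
variable {α : Type*} [Fintype α] [DecidableEq α] {M : ℕ}

/-- First occurrence pattern of a word. -/
def pat (w : Fin M → α) (i : Fin M) : Fin M :=
  (univ.filter fun j => w j = w i).min' ⟨i, by simp⟩

lemma pat_spec (w : Fin M → α) (i : Fin M) : w (pat w i) = w i := by
  have := Finset.min'_mem (univ.filter fun j => w j = w i) ⟨i, by simp⟩
  exact (Finset.mem_filter.1 this).2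

lemma pat_congr (w w' : Fin M → α) (h : ∀ i j, w i = w j ↔ w' i = w' j) : pat w = pat w' := by
  funext i
  unfold pat
  congr 1
  ext j; simp [h]

lemma pat_eq (w : Fin M → α) {i j : Fin M} (h : w i = w j) : pat w i = pat w j := by
  unfold pat; simp only [h]

lemma pat_eq_iff (w : Fin M → α) {i j : Fin M} : pat w i = pat w j ↔ w i = w j :=
  ⟨fun h => by rw [← pat_spec w i, h, pat_spec w j], pat_eq w⟩

/-- Normal form of the values. -/
def nrm (p0 : α) (w : Fin M → α) (c : Fin M) : α := if c ∈ univ.image (pat w) then w c else p0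

lemma nrm_pat (p0 : α) (w : Fin M → α) : nrm p0 w ∘ pat w = w := by
  funext i; simp [nrm, pat_spec]

/-- Weights adapted to a pattern. -/
noncomputable def gp (g : α → ℝ) (p0 : α) (π : Fin M → Fin M) (c : Fin M) (a : α) : ℝ :=
  if c ∈ univ.image π then g a else if a = p0 then 1 else 0

lemma gp_nonneg (g : α → ℝ) (hg : ∀ a, 0 ≤ g a) (p0 : α) (π : Fin M → Fin M) (c a) :
    0 ≤ gp g p0 π c a := by
  unfold gp; split_ifs
  · exact hg a
  · norm_num
  · norm_num

lemma gp_sum (g : α → ℝ) (p0 : α) (π : Fin M → Fin M) (c) :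
    ∑ a, gp g p0 π c a = if c ∈ univ.image π then ∑ a, g a else 1 := by
  unfold gp; split_ifs <;> simp

lemma gp_prod (g : α → ℝ) (p0 : α) (w : Fin M → α) :
    ∏ c, gp g p0 (pat w) c (nrm p0 w c) = ∏ q ∈ univ.image w, g q := by
  have h1 : ∀ c, gp g p0 (pat w) c (nrm p0 w c) = if c ∈ univ.image (pat w) then g (w c) else 1 := by
    intro c; unfold gp nrm; by_cases h : c ∈ univ.image (pat w) <;> simp [h]
  simp only [h1]
  rw [Finset.prod_ite_mem, Finset.univ_inter]
  have h2 : univ.image w = (univ.image (pat w)).image w := by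
    ext q; simp only [Finset.mem_image, Finset.mem_univ, true_and]
    constructor
    · rintro ⟨i, rfl⟩; exact ⟨pat w i, ⟨i, rfl⟩, pat_spec w i⟩
    · rintro ⟨_, ⟨i, rfl⟩, rfl⟩; exact ⟨_, rfl⟩
  rw [h2]
  refine (Finset.prod_image ?_).symm
  intro x hx y hy hxy
  simp only [Finset.coe_image, Set.mem_image, Finset.coe_univ, Set.mem_univ, true_and] at hx hy
  obtain ⟨i, rfl⟩ := hx
  obtain ⟨j, rfl⟩ := hy
  rw [pat_spec w i, pat_spec w j] at hxy
  exact pat_eq w hxy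

open Classical in
lemma pat_sum (g : α → ℝ) (hg : ∀ a, 0 ≤ g a) (p0 : α) (R : (Fin M → α) → Prop)
    (Pi : Finset (Fin M → Fin M)) (hPi : ∀ w, R w → pat w ∈ Pi) :
    ∑ w : Fin M → α, (if R w then ∏ q ∈ univ.image w, g q else 0) ≤
      ∑ π ∈ Pi, ∑ u : Fin M → α,
        (if R (u ∘ π) ∧ pat (u ∘ π) = π then ∏ c, gp g p0 π c (u c) else 0) := by
  set F : (Fin M → Fin M) × (Fin M → α) → ℝ := fun x =>
    if R (x.2 ∘ x.1) ∧ pat (x.2 ∘ x.1) = x.1 then ∏ c, gp g p0 x.1 c (x.2 c) else 0 with hF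
  rw [← Finset.sum_filter, ← Finset.sum_product' (s := Pi) (t := univ) (f := fun π u => F (π, u))]
  have hinj : Set.InjOn (fun w : Fin M → α => (pat w, nrm p0 w)) (univ.filter R : Finset _) := by
    intro w _ w' _ h
    simp only [Prod.mk.injEq] at h
    rw [← nrm_pat p0 w, ← nrm_pat p0 w', h.1, h.2]
  have e : ∑ w ∈ univ.filter R, ∏ q ∈ univ.image w, g q =
      ∑ x ∈ (univ.filter R).image (fun w : Fin M → α => (pat w, nrm p0 w)), F x := by
    rw [Finset.sum_image hinj]
    refine Finset.sum_congr rfl fun w hw => ?_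
    have hw' := (Finset.mem_filter.1 hw).2
    simp only [hF, nrm_pat]
    rw [if_pos ⟨hw', trivial⟩, gp_prod]
  rw [e]
  refine Finset.sum_le_sum_of_subset_of_nonneg ?_ ?_
  · intro x hx
    obtain ⟨w, hw, rfl⟩ := Finset.mem_image.1 hx
    exact Finset.mem_product.2 ⟨hPi w (Finset.mem_filter.1 hw).2, Finset.mem_univ _⟩
  · intro x _ _
    simp only [hF]
    split_ifs
    · exact Finset.prod_nonneg fun c _ => gp_nonneg g hg p0 _ _ _
    · exact le_rfl

open Classical in
/-- Summation over words with few patterns. -/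
lemma tame_sum (g : α → ℝ) (hg : ∀ a, 0 ≤ g a) (p0 : α) (R : (Fin M → α) → Prop)
    (Pi : Finset (Fin M → Fin M)) (hPi : ∀ w, R w → pat w ∈ Pi) (B : ℝ) (hB : 1 ≤ B)
    (hgB : ∑ a, g a ≤ B) (k : ℕ) (hk : ∀ w, R w → (univ.image w).card ≤ k) :
    ∑ w : Fin M → α, (if R w then ∏ q ∈ univ.image w, g q else 0) ≤ Pi.card * B ^ k := by
  refine (pat_sum g hg p0 R Pi hPi).trans ?_
  rw [← nsmul_eq_mul]
  refine Finset.sum_le_card_nsmul _ _ _ fun π _ => ?_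
  by_cases hπ : (univ.image π).card ≤ k
  · calc _ ≤ ∑ u : Fin M → α, ∏ c, gp g p0 π c (u c) := by
          refine Finset.sum_le_sum fun u _ => ?_
          split_ifs
          · exact le_rfl
          · exact Finset.prod_nonneg fun c _ => gp_nonneg g hg p0 _ _ _
      _ = ∏ c, ∑ a, gp g p0 π c a := by rw [Finset.prod_univ_sum]; simp
      _ = (∑ a, g a) ^ (univ.image π).card := by
          simp only [gp_sum]
          rw [Finset.prod_ite_mem, Finset.univ_inter, Finset.prod_const]
      _ ≤ B ^ (univ.image π).card :=
          pow_le_pow_left₀ (Finset.sum_nonneg fun a _ => hg a) hgB _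
      _ ≤ B ^ k := pow_le_pow_right₀ hB hπ
  · refine le_trans (le_of_eq ?_) (by positivity : (0:ℝ) ≤ B ^ k)
    refine Finset.sum_eq_zero fun u _ => if_neg ?_
    rintro ⟨h1, h2⟩
    have h3 := hk _ h1
    apply hπ
    refine le_trans ?_ h3
    have : univ.image π = (univ.image (u ∘ π)).image (fun q => if h : ∃ i, (u ∘ π) i = q then
        π h.choose else π (⟨0, by
          by_contra hM
          apply hπ
          have : M = 0 := by omega
          subst this
          simp⟩)) := by
      ext x
      simp only [Finset.mem_image, Finset.mem_univ, true_and]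
      have hkey : ∀ i, (if h : ∃ j, (u ∘ π) j = (u ∘ π) i then π h.choose else π (⟨0, by
          have := i.2; omega⟩)) = π i := by
        intro i
        have hex : ∃ j, (u ∘ π) j = (u ∘ π) i := ⟨i, rfl⟩
        rw [dif_pos hex]
        have := hex.choose_spec
        rw [← pat_eq_iff (u ∘ π), h2] at this
        exact this
      constructor
      · rintro ⟨i, rfl⟩; exact ⟨_, ⟨i, rfl⟩, hkey i⟩
      · rintro ⟨_, ⟨i, rfl⟩, rfl⟩; exact ⟨i, (hkey i).symm⟩
    rw [this]
    exact Finset.card_image_le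

end pattern
end HR


namespace HR

open Finset

set_option linter.unusedSectionVars false

section rare

/-- Divisibility quantity. -/
def Kk (w : ℕ → ℕ) (z σ τ : ℤ) (A B C D : ℕ) : ℤ :=
  z + σ * (vv w B - vv w A) + τ * (vv w D - vv w C)

/-- The local part of the rareness condition. -/
def RareAt (_M G : ℕ) (X : ℤ) (w : ℕ → ℕ) (z σ τ : ℤ) (s A B C D : ℕ → ℕ) (k : ℕ) : Prop :=
  A k ≤ B k ∧ C k ≤ D k ∧ Kk w z σ τ (A k) (B k) (C k) (D k) ≠ 0 ∧
  |Kk w z σ τ (A k) (B k) (C k) (D k)| ≤ X ∧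
  ((w (s k) : ℕ) : ℤ) ∣ Kk w z σ τ (A k) (B k) (C k) (D k) ∧
  (∀ l, A k ≤ l ∧ l < B k ∨ C k ≤ l ∧ l < D k → ∀ j, k ≤ j → j < G → w l ≠ w (s j)) ∧
  (∀ j < G, w (s j) = w (s k) → j = k)

/-- Rare words, with a separate bound for the free parameter. -/
def RareZ (M G : ℕ) (X Z : ℤ) (w : ℕ → ℕ) : Prop :=
  ∃ z σ τ : ℤ, ∃ s A B C D : ℕ → ℕ, |z| ≤ Z ∧ |σ| ≤ 1 ∧ |τ| ≤ 1 ∧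
    ∀ k < G, s k < M ∧ A k ≤ M ∧ B k ≤ M ∧ C k ≤ M ∧ D k ≤ M ∧ RareAt M G X w z σ τ s A B C D k

/-- Rare words. -/
def RareC (M G : ℕ) (X : ℤ) (w : ℕ → ℕ) : Prop := RareZ M G X X w

/-- Data of a rare configuration. -/
abbrev DT (M G : ℕ) := ℤ × ℤ × ℤ × (Fin G → Fin (M + 1)) × (Fin G → Fin (M + 1)) ×
  (Fin G → Fin (M + 1)) × (Fin G → Fin (M + 1)) × (Fin G → Fin (M + 1))

lemma vv_sub_congr (w w' : ℕ → ℕ) (A B : ℕ) (hAB : A ≤ B)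
    (h : ∀ l, A ≤ l → l < B → w l = w' l) : vv w B - vv w A = vv w' B - vv w' A := by
  unfold vv
  rw [← Finset.sum_Ico_eq_sub _ hAB, ← Finset.sum_Ico_eq_sub _ hAB]
  refine Finset.sum_congr rfl fun l hl => ?_
  rw [Finset.mem_Ico] at hl
  rw [h l hl.1 hl.2]

lemma few_div (P : Finset ℕ) (hP : ∀ p ∈ P, p.Prime) (K : ℤ) (hK : K ≠ 0) (D : ℕ)
    (hKD : |K| ≤ 2 ^ D) : (P.filter fun p : ℕ => (p : ℤ) ∣ K).card ≤ D := by
  have h0 : 0 < K.natAbs := Int.natAbs_pos.2 hK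
  have h1 : ∏ p ∈ P.filter (fun p : ℕ => (p : ℤ) ∣ K), p ∣ K.natAbs := by
    refine Finset.prod_primes_dvd _ ?_ ?_
    · intro p hp; exact (hP p (Finset.mem_filter.1 hp).1).prime
    · intro p hp; exact Int.natCast_dvd.1 (Finset.mem_filter.1 hp).2
  have h2 : 2 ^ (P.filter fun p : ℕ => (p : ℤ) ∣ K).card ≤
      ∏ p ∈ P.filter (fun p : ℕ => (p : ℤ) ∣ K), p := by
    refine Finset.pow_card_le_prod _ _ _ fun p hp => (hP p (Finset.mem_filter.1 hp).1).two_le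
  have h3 : K.natAbs ≤ 2 ^ D := by zify; exact hKD
  have := (h2.trans (Nat.le_of_dvd h0 h1)).trans h3
  exact (Nat.pow_le_pow_iff_right (by norm_num)).1 this

variable (P : Finset ℕ) (hP : ∀ p ∈ P, p.Prime) (H0 : ℝ) (hH0 : 0 < H0)
  (hPH : ∀ p ∈ P, H0 ≤ (p : ℝ)) (Bs : ℝ) (hBs : 1 ≤ Bs) (hsum : ∑ p ∈ P, (2 : ℝ) / p ≤ Bs)

open Classical in
include hP hH0 hPH hBs hsum in
lemma rare_fix {M : ℕ} (p0 : ↥P) (G Dd : ℕ) (z σ τ : ℤ) (s A B C D : ℕ → ℕ)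
    (hr : ∀ k < G, s k < M ∧ A k ≤ M ∧ B k ≤ M ∧ C k ≤ M ∧ D k ≤ M) :
    ∑ w : Fin M → ↥P, (if ∀ k < G, RareAt M G (2 ^ Dd) (xt w) z σ τ s A B C D k then
      ∏ q ∈ univ.image w, (2 : ℝ) / (q : ℕ) else 0) ≤ M ^ M * (Bs ^ M * (2 * Dd / H0) ^ G) := by
  have hg : ∀ a : ↥P, (0:ℝ) ≤ 2 / (a : ℕ) := fun a => by positivity
  have hsum' : ∑ a : ↥P, (2:ℝ) / (a : ℕ) ≤ Bs := by
    rw [Finset.sum_coe_sort P (fun a => (2:ℝ) / (a : ℕ))]; exact hsum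
  have h1 := pat_sum (fun a : ↥P => (2:ℝ) / (a : ℕ)) hg p0
    (fun w : Fin M → ↥P => ∀ k < G, RareAt M G (2 ^ Dd) (xt w) z σ τ s A B C D k) univ (fun _ _ => mem_univ _)
  refine le_trans (le_of_eq ?_) (h1.trans ?_)
  · refine Finset.sum_congr rfl fun w _ => ?_
    split_ifs <;> rfl
  have hcard : ((M ^ M : ℕ) : ℝ) = ((univ : Finset (Fin M → Fin M)).card : ℝ) := by simp
  have : (M : ℝ) ^ M * (Bs ^ M * (2 * Dd / H0) ^ G) =
      ((univ : Finset (Fin M → Fin M)).card) • (Bs ^ M * (2 * Dd / H0) ^ G) := by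
    rw [nsmul_eq_mul, ← hcard]; push_cast; ring
  rw [this]
  refine Finset.sum_le_card_nsmul _ _ _ fun π _ => ?_
  have hnn : (0:ℝ) ≤ Bs ^ M * (2 * Dd / H0) ^ G := by positivity
  by_cases hex : ∃ u : Fin M → ↥P, (∀ k < G, RareAt M G (2 ^ Dd) (xt (u ∘ π)) z σ τ s A B C D k) ∧
      pat (u ∘ π) = π
  swap
  · refine le_trans (le_of_eq ?_) hnn
    exact Finset.sum_eq_zero fun u _ => if_neg fun h => hex ⟨u, h⟩
  obtain ⟨u0, hu0, hpat⟩ := hex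
  rcases Nat.eq_zero_or_pos G with hG | hG
  · subst hG
    rw [pow_zero, mul_one]
    calc _ ≤ ∑ u : Fin M → ↥P, ∏ c, gp (fun a : ↥P => (2:ℝ) / (a : ℕ)) p0 π c (u c) := by
          refine Finset.sum_le_sum fun u _ => ?_
          split_ifs
          · exact le_rfl
          · exact Finset.prod_nonneg fun c _ => gp_nonneg _ hg p0 _ _ _
      _ = ∏ c, ∑ a, gp (fun a : ↥P => (2:ℝ) / (a : ℕ)) p0 π c a := by
          rw [Finset.prod_univ_sum, Fintype.piFinset_univ]
      _ ≤ ∏ c : Fin M, Bs := by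
          refine Finset.prod_le_prod (fun c _ => Finset.sum_nonneg fun a _ => gp_nonneg _ hg p0 _ _ _)
            fun c _ => ?_
          rw [gp_sum]; split_ifs
          · exact hsum'
          · exact hBs
      _ = Bs ^ M := by simp
  have hM : 0 < M := lt_of_le_of_lt (Nat.zero_le _) (hr 0 hG).1
  -- pattern conditions
  have hxt : ∀ (u : Fin M → ↥P) (l : ℕ) (hl : l < M), xt (u ∘ π) l = (u (π ⟨l, hl⟩)).1 := by
    intro u l hl; simp [xt, hl]
  have hpi : ∀ i j : Fin M, xt (u0 ∘ π) i ≠ xt (u0 ∘ π) j → π i ≠ π j := by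
    intro i j hne h
    apply hne
    rw [hxt u0 i i.2, hxt u0 j j.2]
    simp only [Fin.eta]; rw [h]
  have hpi' : ∀ i j : Fin M, π i = π j ↔ xt (u0 ∘ π) i = xt (u0 ∘ π) j := by
    intro i j
    refine ⟨fun h => by by_contra hne; exact hpi i j hne h, fun h => ?_⟩
    rw [← hpat, pat_eq_iff]
    rw [hxt u0 i i.2, hxt u0 j j.2] at h
    exact Subtype.ext h
  set c : ℕ → Fin M := fun k => if h : k < G then π ⟨s k, (hr k h).1⟩ else ⟨0, hM⟩ with hc
  have hck : ∀ k (h : k < G), c k = π ⟨s k, (hr k h).1⟩ := fun k h => by simp [hc, h]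
  set KK : ℕ → (Fin M → ↥P) → ℤ := fun k u => Kk (xt (u ∘ π)) z σ τ (A k) (B k) (C k) (D k) with hKK
  set DD : ℕ → (Fin M → ↥P) → Finset ↥P := fun k u =>
    if KK k u ≠ 0 ∧ |KK k u| ≤ 2 ^ Dd then univ.filter (fun a : ↥P => ((a : ℕ) : ℤ) ∣ KK k u) else ∅
    with hDD
  have hKinv : ∀ k < G, ∀ j, k ≤ j → j < G → ∀ u a, KK k (Function.update u (c j) a) = KK k u := by
    intro k hk j hkj hj u a
    obtain ⟨hAB, hCD, -, -, -, hav, -⟩ := hu0 k hk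
    have hl : ∀ l, A k ≤ l ∧ l < B k ∨ C k ≤ l ∧ l < D k →
        xt (Function.update u (c j) a ∘ π) l = xt (u ∘ π) l := by
      intro l hl
      have hlM : l < M := by
        have := hr k hk; omega
      rw [hxt _ l hlM, hxt _ l hlM, Function.update_of_ne]
      rw [hck j hj]
      exact hpi ⟨l, hlM⟩ ⟨s j, (hr j hj).1⟩ (hav l hl j hkj hj)
    simp only [hKK, Kk]
    rw [vv_sub_congr _ (xt (u ∘ π)) (A k) (B k) hAB (fun l h1 h2 => hl l (Or.inl ⟨h1, h2⟩)),
      vv_sub_congr _ (xt (u ∘ π)) (C k) (D k) hCD (fun l h1 h2 => hl l (Or.inr ⟨h1, h2⟩))]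
  have helim := elim_sum p0 (2 * Dd / H0) (by positivity) G c DD
    (gp (fun a : ↥P => (2:ℝ) / (a : ℕ)) p0 π) (gp_nonneg _ hg p0 π)
    (by
      intro j hj k hk h
      rw [hck j hj, hck k hk, hpi'] at h
      exact (hu0 k hk).2.2.2.2.2.2 j hj h)
    (by
      intro k hk j hkj hj u a
      simp only [hDD, hKinv k hk j hkj hj u a])
    (by
      intro k hk u
      have hin : c k ∈ univ.image π := by rw [hck k hk]; exact Finset.mem_image_of_mem _ (mem_univ _)
      have : ∑ a ∈ DD k u, gp (fun a : ↥P => (2:ℝ) / (a : ℕ)) p0 π (c k) a ≤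
          (DD k u).card • (2 / H0) := by
        refine Finset.sum_le_card_nsmul _ _ _ fun a _ => ?_
        rw [gp, if_pos hin]
        exact div_le_div_of_nonneg_left (by norm_num) hH0 (hPH a.1 a.2)
      refine this.trans ?_
      rw [nsmul_eq_mul]
      have hcd : (DD k u).card ≤ Dd := by
        simp only [hDD]
        split_ifs with h
        · refine le_trans (le_of_eq ?_) (few_div P hP _ h.1 Dd h.2)
          rw [← Finset.card_map (Function.Embedding.subtype (· ∈ P))]
          congr 1
          ext x
          simp [and_comm]
        · simp
      calc ((DD k u).card : ℝ) * (2 / H0) ≤ Dd * (2 / H0) := by gcongr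
        _ = 2 * Dd / H0 := by ring)
  calc _ ≤ _ := ?_
    _ ≤ _ := helim
    _ ≤ _ := ?_
  · refine Finset.sum_le_sum fun u _ => ?_
    by_cases h : (∀ k < G, RareAt M G (2 ^ Dd) (xt (u ∘ π)) z σ τ s A B C D k) ∧ pat (u ∘ π) = π
    · rw [if_pos h, if_pos]
      intro k hk
      obtain ⟨hAB, hCD, hne, hle, hdv, hav, -⟩ := h.1 k hk
      simp only [hDD]
      rw [if_pos ⟨hne, hle⟩, Finset.mem_filter]
      refine ⟨mem_univ _, ?_⟩
      rw [hxt u (s k) (hr k hk).1, ← hck k hk] at hdv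
      exact hdv
    · rw [if_neg h]
      split_ifs
      · exact Finset.prod_nonneg fun c _ => gp_nonneg _ hg p0 _ _ _
      · exact le_rfl
  · rw [mul_comm]
    refine mul_le_mul_of_nonneg_right ?_ (by positivity)
    calc _ ≤ ∏ i : Fin M, Bs := by
          refine Finset.prod_le_prod (fun i _ => ?_) fun i _ => ?_
          · split_ifs
            · norm_num
            · exact Finset.sum_nonneg fun a _ => gp_nonneg _ hg p0 _ _ _
          · split_ifs
            · exact hBs
            · rw [gp_sum]; split_ifs
              · exact hsum'
              · exact hBs
      _ = Bs ^ M := by simp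

open Classical in
include hP hH0 hPH hBs hsum in
theorem rare_sum {M : ℕ} (p0 : ↥P) (G Dd Z : ℕ) :
    ∑ w : Fin M → ↥P, (if RareZ M G (2 ^ Dd) Z (xt w) then
      ∏ q ∈ univ.image w, (2 : ℝ) / (q : ℕ) else 0) ≤
      (2 * Z + 1) * 9 * (M + 1) ^ (5 * G) * (M ^ M * (Bs ^ M * (2 * Dd / H0) ^ G)) := by
  let T : Finset (DT M G) := Finset.Icc (-(Z:ℤ)) Z ×ˢ Finset.Icc (-1) 1 ×ˢ Finset.Icc (-1) 1 ×ˢ univ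
  let e : (Fin G → Fin (M + 1)) → ℕ → ℕ := fun f k => if h : k < G then (f ⟨k, h⟩ : ℕ) else 0
  let Rd : DT M G → (Fin M → ↥P) → Prop := fun d w =>
    (∀ k < G, e d.2.2.2.1 k < M) ∧ ∀ k < G, RareAt M G (2 ^ Dd) (xt w) d.1 d.2.1 d.2.2.1
      (e d.2.2.2.1) (e d.2.2.2.2.1) (e d.2.2.2.2.2.1) (e d.2.2.2.2.2.2.1) (e d.2.2.2.2.2.2.2) k
  have hele : ∀ f k, e f k ≤ M := by
    intro f k; simp only [e]; split_ifs
    · have := (f ⟨k, ‹_›⟩).2; omega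
    · omega
  have hcov : ∀ w : Fin M → ↥P, RareZ M G (2 ^ Dd) Z (xt w) → ∃ d ∈ T, Rd d w := by
    rintro w ⟨z, σ, τ, s, A, B, C, D, hz, hσ, hτ, h⟩
    let f : (ℕ → ℕ) → Fin G → Fin (M + 1) := fun a k => ⟨min (a k) M, by omega⟩
    have hf : ∀ (a : ℕ → ℕ) k, k < G → a k ≤ M → e (f a) k = a k := by
      intro a k hk ha; simp [e, f, hk, ha]
    refine ⟨(z, σ, τ, f s, f A, f B, f C, f D), ?_, ?_, ?_⟩
    · simp only [T, Finset.mem_product, Finset.mem_Icc, mem_univ, and_true]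
      exact ⟨abs_le.1 hz, abs_le.1 hσ, abs_le.1 hτ⟩
    · intro k hk
      obtain ⟨h1, -⟩ := h k hk
      change e (f s) k < M
      rw [hf s k hk (by omega)]; exact h1
    · intro k hk
      obtain ⟨h1, h2, h3, h4, h5, h6⟩ := h k hk
      have hs : ∀ j < G, e (f s) j = s j := fun j hj => hf s j hj (by have := (h j hj).1; omega)
      change RareAt M G (2 ^ Dd) (xt w) z σ τ (e (f s)) (e (f A)) (e (f B)) (e (f C)) (e (f D)) k
      unfold RareAt at h6 ⊢
      rw [hf A k hk h2, hf B k hk h3, hf C k hk h4, hf D k hk h5, hs k hk]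
      obtain ⟨q1, q2, q3, q4, q5, q6, q7⟩ := h6
      refine ⟨q1, q2, q3, q4, q5, ?_, ?_⟩
      · intro l hl j hkj hj; rw [hs j hj]; exact q6 l hl j hkj hj
      · intro j hj; rw [hs j hj]; exact q7 j hj
  have hnn : ∀ w : Fin M → ↥P, (0:ℝ) ≤ ∏ q ∈ univ.image w, (2 : ℝ) / (q : ℕ) :=
    fun w => Finset.prod_nonneg fun q _ => by positivity
  calc _ ≤ ∑ w : Fin M → ↥P, ∑ d ∈ T, (if Rd d w then ∏ q ∈ univ.image w, (2 : ℝ) / (q : ℕ) else 0) := by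
        refine Finset.sum_le_sum fun w _ => ?_
        have h0 : ∀ d ∈ T, (0:ℝ) ≤ (if Rd d w then ∏ q ∈ univ.image w, (2 : ℝ) / (q : ℕ) else 0) := by
          intro d _; split_ifs
          · exact hnn w
          · exact le_rfl
        split_ifs with hR
        · obtain ⟨d, hd, hRd⟩ := hcov w hR
          refine le_trans (le_of_eq ?_) (Finset.single_le_sum h0 hd)
          rw [if_pos hRd]
        · exact Finset.sum_nonneg h0
    _ = ∑ d ∈ T, ∑ w : Fin M → ↥P, (if Rd d w then ∏ q ∈ univ.image w, (2 : ℝ) / (q : ℕ) else 0) :=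
        Finset.sum_comm
    _ ≤ T.card • ((M:ℝ) ^ M * (Bs ^ M * (2 * Dd / H0) ^ G)) := by
        refine Finset.sum_le_card_nsmul _ _ _ fun d _ => ?_
        by_cases hd : ∀ k < G, e d.2.2.2.1 k < M
        · refine le_trans (le_of_eq ?_) (rare_fix P hP H0 hH0 hPH Bs hBs hsum p0 G Dd d.1 d.2.1 d.2.2.1
            (e d.2.2.2.1) (e d.2.2.2.2.1) (e d.2.2.2.2.2.1) (e d.2.2.2.2.2.2.1) (e d.2.2.2.2.2.2.2)
            (fun k hk => ⟨hd k hk, hele _ _, hele _ _, hele _ _, hele _ _⟩))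
          refine Finset.sum_congr rfl fun w _ => ?_
          simp only [Rd]
          exact if_congr ⟨fun h => h.2, fun h => ⟨hd, h⟩⟩ rfl rfl
        · refine le_trans (le_of_eq ?_) (by positivity :
            (0:ℝ) ≤ (M:ℝ) ^ M * (Bs ^ M * (2 * Dd / H0) ^ G))
          exact Finset.sum_eq_zero fun w _ => if_neg fun h => hd h.1
    _ = _ := by
        rw [nsmul_eq_mul]
        congr 1
        have : T.card = (2 * Z + 1) * (3 * (3 * ((M + 1) ^ G * ((M + 1) ^ G * ((M + 1) ^ G *
            ((M + 1) ^ G * (M + 1) ^ G)))))) := by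
          simp only [T, Finset.card_product, Int.card_Icc, Finset.card_univ, Fintype.card_prod,
            Fintype.card_fun, Fintype.card_fin]
          congr 1
          have : ((Z:ℤ) + 1 - -Z) = ((2 * Z + 1 : ℕ) : ℤ) := by push_cast; ring
          rw [this, Int.toNat_natCast]
        rw [this]; push_cast; ring

end rare
end HR


namespace HR

open Finset

set_option linter.unusedSectionVars false

section tame1

lemma incr_seq (S : Finset ℕ) (G : ℕ) (h : G ≤ S.card) :
    ∃ s : ℕ → ℕ, (∀ k < G, s k ∈ S) ∧ ∀ j k, j < k → k < G → s j < s k := by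
  refine ⟨fun k => if hk : k < S.card then S.orderEmbOfFin rfl ⟨k, hk⟩ else 0, ?_, ?_⟩
  · intro k hk
    have hk' : k < S.card := by omega
    simp only [hk', dif_pos]
    exact Finset.orderEmbOfFin_mem _ _ _
  · intro j k hjk hk
    have hk' : k < S.card := by omega
    have hj' : j < S.card := by omega
    simp only [hk', hj', dif_pos]
    exact (S.orderEmbOfFin rfl).strictMono (by simpa using hjk)

lemma decr_seq (S : Finset ℕ) (G : ℕ) (h : G ≤ S.card) :
    ∃ s : ℕ → ℕ, (∀ k < G, s k ∈ S) ∧ ∀ j k, j < k → k < G → s k < s j := by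
  obtain ⟨s, h1, h2⟩ := incr_seq S G h
  refine ⟨fun k => s (G - 1 - k), fun k hk => h1 _ (by omega), fun j k hjk hk => h2 _ _ (by omega) (by omega)⟩

lemma erd_sz (f : ℕ → ℕ) (G r : ℕ) : ∀ S : Finset ℕ, Set.InjOn f S → r * G < S.card →
    (∃ s : ℕ → ℕ, (∀ k < G, s k ∈ S) ∧ ∀ j k, j < k → k < G → s j < s k ∧ f (s k) < f (s j)) ∨
    (∃ s : ℕ → ℕ, (∀ k < r + 1, s k ∈ S) ∧ ∀ j k, j < k → k < r + 1 → s j < s k ∧ f (s j) < f (s k)) := by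
  induction r with
  | zero =>
    intro S _ hS
    obtain ⟨x, hx⟩ := Finset.card_pos.1 (by omega : 0 < S.card)
    right
    exact ⟨fun _ => x, fun _ _ => hx, fun j k hjk hk => by omega⟩
  | succ r ih =>
    intro S hf hS
    classical
    set S' := S.filter (fun i => ¬ ∃ i0 ∈ S, i0 < i ∧ f i0 < f i) with hS'
    by_cases hc : G ≤ S'.card
    · left
      obtain ⟨s, h1, h2⟩ := incr_seq S' G hc
      have hm : ∀ k < G, s k ∈ S := fun k hk => (Finset.mem_filter.1 (h1 k hk)).1
      refine ⟨s, hm, fun j k hjk hk => ⟨h2 j k hjk hk, ?_⟩⟩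
      have hlt := h2 j k hjk hk
      have h3 := (Finset.mem_filter.1 (h1 k hk)).2
      rcases lt_trichotomy (f (s j)) (f (s k)) with h | h | h
      · exact absurd ⟨s j, hm j (by omega), hlt, h⟩ h3
      · have := hf (hm j (by omega)) (hm k hk) h; omega
      · exact h
    · have hcard : (S \ S').card = S.card - S'.card :=
        Finset.card_sdiff_of_subset (Finset.filter_subset _ _)
      have hmul : (r + 1) * G = r * G + G := by ring
      rcases ih (S \ S') (hf.mono (by simp)) (by omega) with ⟨s, h1, h2⟩ | ⟨s, h1, h2⟩
      · left; exact ⟨s, fun k hk => (Finset.mem_sdiff.1 (h1 k hk)).1, h2⟩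
      · right
        have h0 := Finset.mem_sdiff.1 (h1 0 (by omega))
        have : ∃ i0 ∈ S, i0 < s 0 ∧ f i0 < f (s 0) := by
          by_contra hne
          exact h0.2 (Finset.mem_filter.2 ⟨h0.1, hne⟩)
        obtain ⟨i0, hi0, hi1, hi2⟩ := this
        refine ⟨fun k => if k = 0 then i0 else s (k - 1), ?_, ?_⟩
        · intro k hk
          by_cases hk0 : k = 0
          · simpa [hk0] using hi0
          · simp only [hk0, if_false]; exact (Finset.mem_sdiff.1 (h1 _ (by omega))).1
        · intro j k hjk hk
          have hk0 : k ≠ 0 := by omega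
          simp only [hk0, if_false]
          by_cases hj0 : j = 0
          · simp only [hj0, if_true]
            by_cases hk1 : k - 1 = 0
            · rw [hk1]; exact ⟨hi1, hi2⟩
            · have := h2 0 (k - 1) (by omega) (by omega)
              exact ⟨hi1.trans this.1, hi2.trans this.2⟩
          · simp only [hj0, if_false]
            exact h2 _ _ (by omega) (by omega)

variable (w : ℕ → ℕ) (m : ℕ)

open Classical in
/-- Backward divisibilities inside a window. -/
noncomputable def Bk (α : ℕ) : Finset ℕ :=
  (Finset.Ico α (α + m)).filter fun i => ∃ t, α ≤ t ∧ t < i ∧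
    (w i : ℤ) ∣ vv w t - vv w i ∧ vv w t ≠ vv w i

open Classical in
/-- Forward divisibilities inside a window. -/
noncomputable def Fw (α : ℕ) : Finset ℕ :=
  (Finset.Ico α (α + m)).filter fun i => ∃ t, i + 1 ≤ t ∧ t ≤ α + m ∧
    (w i : ℤ) ∣ vv w t - vv w (i + 1) ∧ vv w t ≠ vv w (i + 1)

open Classical in
/-- Unmatched steps with a divisibility into another window. -/
noncomputable def Cr (α β : ℕ) : Finset ℕ :=
  (Finset.Ico α (α + m)).filter fun i => (∀ j, β ≤ j → j < β + m → w j ≠ w i) ∧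
    ∃ t, β ≤ t ∧ t ≤ β + m ∧ (w i : ℤ) ∣ vv w t - vv w i ∧ vv w t ≠ vv w i

open Classical in
/-- Badly matched steps. -/
noncomputable def Bd (α β : ℕ) : Finset ℕ :=
  (Finset.Ico α (α + m)).filter fun i => ∃ j, β ≤ j ∧ j < β + m ∧ w j = w i ∧
    (w i : ℤ) ∣ vv w i - vv w j ∧ vv w i ≠ vv w j ∧ vv w i ≠ vv w (j + 1)

lemma mem_Bk {α i : ℕ} : i ∈ Bk w m α ↔ (α ≤ i ∧ i < α + m) ∧ ∃ t, α ≤ t ∧ t < i ∧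
    (w i : ℤ) ∣ vv w t - vv w i ∧ vv w t ≠ vv w i := by
  classical
  unfold Bk; rw [Finset.mem_filter, Finset.mem_Ico]

lemma mem_Fw {α i : ℕ} : i ∈ Fw w m α ↔ (α ≤ i ∧ i < α + m) ∧ ∃ t, i + 1 ≤ t ∧ t ≤ α + m ∧
    (w i : ℤ) ∣ vv w t - vv w (i + 1) ∧ vv w t ≠ vv w (i + 1) := by
  classical
  unfold Fw; rw [Finset.mem_filter, Finset.mem_Ico]

lemma mem_Cr {α β i : ℕ} : i ∈ Cr w m α β ↔ (α ≤ i ∧ i < α + m) ∧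
    (∀ j, β ≤ j → j < β + m → w j ≠ w i) ∧
    ∃ t, β ≤ t ∧ t ≤ β + m ∧ (w i : ℤ) ∣ vv w t - vv w i ∧ vv w t ≠ vv w i := by
  classical
  unfold Cr; rw [Finset.mem_filter, Finset.mem_Ico]

lemma mem_Bd {α β i : ℕ} : i ∈ Bd w m α β ↔ (α ≤ i ∧ i < α + m) ∧ ∃ j, β ≤ j ∧ j < β + m ∧
    w j = w i ∧ (w i : ℤ) ∣ vv w i - vv w j ∧ vv w i ≠ vv w j ∧ vv w i ≠ vv w (j + 1) := by
  classical
  unfold Bd; rw [Finset.mem_filter, Finset.mem_Ico]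

variable (M G : ℕ) (X V : ℤ) (hV : ∀ i ≤ M, |vv w i| ≤ V) (hX : 2 * V ≤ X)

include hV hX in
lemma dif_le {i j : ℕ} (hi : i ≤ M) (hj : j ≤ M) : |vv w i - vv w j| ≤ X := by
  have h1 := abs_le.1 (hV i hi)
  have h2 := abs_le.1 (hV j hj)
  rw [abs_le]; constructor <;> linarith

lemma X_nonneg (hV : ∀ i ≤ M, |vv w i| ≤ V) (hX : 2 * V ≤ X) : 0 ≤ X := by
  have := (abs_nonneg _).trans (hV 0 (Nat.zero_le _)); linarith

variable {w m}

include hV hX in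
lemma rare_Bk {α : ℕ} (hα : α + m ≤ M)
    (hinj : ∀ i j, α ≤ i → i < α + m → α ≤ j → j < α + m → w i = w j → i = j)
    (h : G ≤ (Bk w m α).card) : RareC M G X w := by
  obtain ⟨s, hs, hmono⟩ := incr_seq _ G h
  have hs' := fun k hk => (mem_Bk w m).1 (hs k hk)
  have hle : ∀ j k, j ≤ k → k < G → s j ≤ s k := fun j k hjk hk => by
    rcases hjk.lt_or_eq with h' | h'
    · exact (hmono j k h' hk).le
    · rw [h']
  choose! t ht using fun k hk => (hs' k hk).2
  refine ⟨0, 1, 0, s, t, s, fun _ => 0, fun _ => 0, by simpa using X_nonneg w M X V hV hX,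
    by norm_num, by norm_num, fun k hk => ?_⟩
  obtain ⟨t1, t2, t3, t4⟩ := ht k hk
  obtain ⟨⟨a1, a2⟩, -⟩ := hs' k hk
  have hK : Kk w 0 1 0 (t k) (s k) 0 0 = vv w (s k) - vv w (t k) := by unfold Kk; ring
  refine ⟨by omega, by beta_reduce; omega, by beta_reduce; omega, by beta_reduce; omega, by beta_reduce; omega,
    by beta_reduce; omega, by beta_reduce; omega, ?_, ?_, ?_, ?_, ?_⟩
  · rw [hK]; exact sub_ne_zero.2 (Ne.symm t4)
  · rw [hK]; exact dif_le w M X V hV hX (by omega) (by omega)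
  · rw [hK, ← neg_sub]; exact (dvd_neg).2 t3
  · intro l hl j hkj hj he
    beta_reduce at hl
    have hl' : t k ≤ l ∧ l < s k := by omega
    have := hle k j hkj hj
    have hj' := (hs' j hj).1
    have := hinj l (s j) (by omega) (by omega) hj'.1 hj'.2 he
    omega
  · intro j hj he
    have hj' := (hs' j hj).1
    have e := hinj _ _ hj'.1 hj'.2 a1 a2 he
    by_contra hne
    rcases lt_or_gt_of_ne hne with h' | h'
    · have := hmono j k h' hk; omega
    · have := hmono k j h' hj; omega

include hV hX in
lemma rare_Fw {α : ℕ} (hα : α + m ≤ M)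
    (hinj : ∀ i j, α ≤ i → i < α + m → α ≤ j → j < α + m → w i = w j → i = j)
    (h : G ≤ (Fw w m α).card) : RareC M G X w := by
  obtain ⟨s, hs, hmono⟩ := decr_seq _ G h
  have hs' := fun k hk => (mem_Fw w m).1 (hs k hk)
  have hle : ∀ j k, j ≤ k → k < G → s k ≤ s j := fun j k hjk hk => by
    rcases hjk.lt_or_eq with h' | h'
    · exact (hmono j k h' hk).le
    · rw [h']
  choose! t ht using fun k hk => (hs' k hk).2
  refine ⟨0, 1, 0, s, fun k => s k + 1, t, fun _ => 0, fun _ => 0,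
    by simpa using X_nonneg w M X V hV hX,
    by norm_num, by norm_num, fun k hk => ?_⟩
  obtain ⟨t1, t2, t3, t4⟩ := ht k hk
  obtain ⟨⟨a1, a2⟩, -⟩ := hs' k hk
  have hK : Kk w 0 1 0 (s k + 1) (t k) 0 0 = vv w (t k) - vv w (s k + 1) := by unfold Kk; ring
  refine ⟨by omega, by beta_reduce; omega, by beta_reduce; omega, by beta_reduce; omega, by beta_reduce; omega,
    by beta_reduce; omega, by beta_reduce; omega, ?_, ?_, ?_, ?_, ?_⟩
  · rw [hK]; exact sub_ne_zero.2 t4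
  · rw [hK]; exact dif_le w M X V hV hX (by omega) (by omega)
  · rw [hK]; exact t3
  · intro l hl j hkj hj he
    beta_reduce at hl
    have hl' : s k + 1 ≤ l ∧ l < t k := by omega
    have := hle k j hkj hj
    have hj' := (hs' j hj).1
    have := hinj l (s j) (by omega) (by omega) hj'.1 hj'.2 he
    omega
  · intro j hj he
    have hj' := (hs' j hj).1
    have e := hinj _ _ hj'.1 hj'.2 a1 a2 he
    by_contra hne
    rcases lt_or_gt_of_ne hne with h' | h'
    · have := hmono j k h' hk; omega
    · have := hmono k j h' hj; omega

include hV hX in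
lemma rare_Cr {α β : ℕ} (hα : α + m ≤ M) (hβ : β + m ≤ M)
    (hinj : ∀ i j, α ≤ i → i < α + m → α ≤ j → j < α + m → w i = w j → i = j)
    (h : G ≤ (Cr w m α β).card) : RareC M G X w := by
  obtain ⟨s, hs, hmono⟩ := incr_seq _ G h
  have hs' := fun k hk => (mem_Cr w m).1 (hs k hk)
  have hle : ∀ j k, j ≤ k → k < G → s j ≤ s k := fun j k hjk hk => by
    rcases hjk.lt_or_eq with h' | h'
    · exact (hmono j k h' hk).le
    · rw [h']
  choose! t ht using fun k hk => (hs' k hk).2.2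
  refine ⟨vv w β - vv w α, 1, -1, s, fun _ => β, t, fun _ => α, s,
    dif_le w M X V hV hX (by omega) (by omega),
    by norm_num, by norm_num, fun k hk => ?_⟩
  obtain ⟨t1, t2, t3, t4⟩ := ht k hk
  obtain ⟨⟨a1, a2⟩, -, -⟩ := hs' k hk
  have hK : Kk w (vv w β - vv w α) 1 (-1) β (t k) α (s k) = vv w (t k) - vv w (s k) := by
    unfold Kk; ring
  refine ⟨by omega, by beta_reduce; omega, by beta_reduce; omega, by beta_reduce; omega, by beta_reduce; omega,
    by beta_reduce; omega, by beta_reduce; omega, ?_, ?_, ?_, ?_, ?_⟩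
  · rw [hK]; exact sub_ne_zero.2 t4
  · rw [hK]; exact dif_le w M X V hV hX (by omega) (by omega)
  · rw [hK]; exact t3
  · intro l hl j hkj hj he
    have := hle k j hkj hj
    obtain ⟨hj', hj2, -⟩ := hs' j hj
    rcases hl with hl | hl
    · beta_reduce at hl
      exact hj2 l hl.1 (by omega) he
    · beta_reduce at hl
      have := hinj l (s j) (by omega) (by omega) hj'.1 hj'.2 he
      omega
  · intro j hj he
    have hj' := (hs' j hj).1
    have e := hinj _ _ hj'.1 hj'.2 a1 a2 he
    by_contra hne
    rcases lt_or_gt_of_ne hne with h' | h'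
    · have := hmono j k h' hk; omega
    · have := hmono k j h' hj; omega

include hV hX in
lemma rare_Bd {α β : ℕ} (hα : α + m ≤ M) (hβ : β + m ≤ M)
    (hinj : ∀ i j, α ≤ i → i < α + m → α ≤ j → j < α + m → w i = w j → i = j)
    (hinj' : ∀ i j, β ≤ i → i < β + m → β ≤ j → j < β + m → w i = w j → i = j)
    (h : G * G < (Bd w m α β).card) : RareC M G X w := by
  choose! f hf using fun i (hi : i ∈ Bd w m α β) => ((mem_Bd w m).1 hi).2
  have hfi : Set.InjOn f (Bd w m α β) := by
    intro i hi i' hi' he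
    have h1 := hf i hi
    have h2 := hf i' hi'
    have h3 := ((mem_Bd w m).1 hi).1
    have h4 := ((mem_Bd w m).1 hi').1
    refine hinj i i' h3.1 h3.2 h4.1 h4.2 ?_
    rw [← h1.2.2.1, ← h2.2.2.1, he]
  rcases erd_sz f G G _ hfi h with ⟨s, hs, hmono⟩ | ⟨s, hs, hmono⟩
  · have hs' := fun k hk => ((mem_Bd w m).1 (hs k hk)).1
    have hle : ∀ j k, j ≤ k → k < G → s j ≤ s k ∧ f (s k) ≤ f (s j) := fun j k hjk hk => by
      rcases hjk.lt_or_eq with h' | h'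
      · exact ⟨(hmono j k h' hk).1.le, (hmono j k h' hk).2.le⟩
      · rw [h']; exact ⟨le_rfl, le_rfl⟩
    refine ⟨vv w α - vv w (β + m), 1, 1, s, fun _ => α, s, fun k => f (s k) + 1, fun _ => β + m,
      dif_le w M X V hV hX (by omega) (by omega),
      by norm_num, by norm_num, fun k hk => ?_⟩
    obtain ⟨t1, t2, t3, t4, t5, t6⟩ := hf (s k) (hs k hk)
    obtain ⟨a1, a2⟩ := hs' k hk
    have hK : Kk w (vv w α - vv w (β + m)) 1 1 α (s k) (f (s k) + 1) (β + m) =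
        vv w (s k) - vv w (f (s k) + 1) := by
      unfold Kk; ring
    refine ⟨by omega, by beta_reduce; omega, by beta_reduce; omega, by beta_reduce; omega, by beta_reduce; omega,
    by beta_reduce; omega, by beta_reduce; omega, ?_, ?_, ?_, ?_, ?_⟩
    · rw [hK]; exact sub_ne_zero.2 t6
    · rw [hK]; exact dif_le w M X V hV hX (by omega) (by omega)
    · rw [hK, vv_succ, ← sub_sub]
      refine dvd_sub t4 (Dvd.dvd.mul_left ?_ _)
      rw [t3]
    · intro l hl j hkj hj he
      have := hle k j hkj hj
      have hj' := hs' j hj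
      rcases hl with hl | hl
      · beta_reduce at hl
        have := hinj l (s j) (by omega) (by omega) hj'.1 hj'.2 he
        omega
      · beta_reduce at hl
        obtain ⟨t1, t2, t3, -⟩ := hf (s j) (hs j hj)
        have := hinj' l (f (s j)) (by omega) (by omega) t1 t2 (he.trans t3.symm)
        omega
    · intro j hj he
      have hj' := hs' j hj
      have e := hinj _ _ hj'.1 hj'.2 a1 a2 he
      by_contra hne
      rcases lt_or_gt_of_ne hne with h' | h'
      · have := hmono j k h' hk; omega
      · have := hmono k j h' hj; omega
  · have hs' := fun k (hk : k < G) => ((mem_Bd w m).1 (hs k (by omega))).1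
    have hle : ∀ j k, j ≤ k → k < G → s j ≤ s k ∧ f (s j) ≤ f (s k) := fun j k hjk hk => by
      rcases hjk.lt_or_eq with h' | h'
      · exact ⟨(hmono j k h' (by omega)).1.le, (hmono j k h' (by omega)).2.le⟩
      · rw [h']; exact ⟨le_rfl, le_rfl⟩
    refine ⟨vv w α - vv w β, 1, -1, s, fun _ => α, s, fun _ => β, fun k => f (s k),
      dif_le w M X V hV hX (by omega) (by omega),
      by norm_num, by norm_num, fun k hk => ?_⟩
    obtain ⟨t1, t2, t3, t4, t5, t6⟩ := hf (s k) (hs k (by omega))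
    obtain ⟨a1, a2⟩ := hs' k hk
    have hK : Kk w (vv w α - vv w β) 1 (-1) α (s k) β (f (s k)) =
        vv w (s k) - vv w (f (s k)) := by
      unfold Kk; ring
    refine ⟨by omega, by beta_reduce; omega, by beta_reduce; omega, by beta_reduce; omega, by beta_reduce; omega,
    by beta_reduce; omega, by beta_reduce; omega, ?_, ?_, ?_, ?_, ?_⟩
    · rw [hK]; exact sub_ne_zero.2 t5
    · rw [hK]; exact dif_le w M X V hV hX (by omega) (by omega)
    · rw [hK]; exact t4
    · intro l hl j hkj hj he
      have := hle k j hkj hj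
      have hj' := hs' j hj
      rcases hl with hl | hl
      · beta_reduce at hl
        have := hinj l (s j) (by omega) (by omega) hj'.1 hj'.2 he
        omega
      · beta_reduce at hl
        obtain ⟨t1, t2, t3, -⟩ := hf (s j) (hs j (by omega))
        have := hinj' l (f (s j)) (by omega) (by omega) t1 t2 (he.trans t3.symm)
        omega
    · intro j hj he
      have hj' := hs' j hj
      have e := hinj _ _ hj'.1 hj'.2 a1 a2 he
      by_contra hne
      rcases lt_or_gt_of_ne hne with h' | h'
      · have := hmono j k h' (by omega); omega
      · have := hmono k j h' (by omega); omega

end tame1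
end HR


namespace HR

open Finset

set_option linter.unusedSectionVars false

section tame2

variable (w : ℕ → ℕ) (m M : ℕ)

/-- Steps whose prime is split. -/
noncomputable def Spl : Finset ℕ :=
  open Classical in
  (Finset.range M).filter fun i => ∃ i1 i2, i1 < M ∧ i2 < M ∧ w i1 = w i ∧ w i2 = w i ∧
    ¬ ((w i : ℤ) ∣ vv w i1 - vv w i2)

lemma mem_Spl {i : ℕ} : i ∈ Spl w M ↔ i < M ∧ ∃ i1 i2, i1 < M ∧ i2 < M ∧ w i1 = w i ∧ w i2 = w i ∧
    ¬ ((w i : ℤ) ∣ vv w i1 - vv w i2) := by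
  classical
  unfold Spl; rw [Finset.mem_filter, Finset.mem_range]

open Classical in
/-- Match type. -/
noncomputable def ty (i j : ℕ) : ℕ := if vv w i = vv w j then 0 else if vv w i = vv w (j + 1) then 1 else 2

open Classical in
/-- The state of step `i` with respect to the window at `β`. -/
noncomputable def st (β i : ℕ) : Option (ℕ × ℕ) :=
  if h : ∃ j, β ≤ j ∧ j < β + m ∧ w j = w i then some (h.choose, ty w i h.choose) else none

/-- Predicted next state. -/
def nx : Option (ℕ × ℕ) → Option (ℕ × ℕ)
  | none => none
  | some (j, 0) => some (j + 1, 0)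
  | some (j, 1) => some (j - 1, 1)
  | some (_, _) => none

/-- Nicely matched step. -/
def Nice (β i : ℕ) : Prop := ∃ j, β ≤ j ∧ j < β + m ∧ w j = w i ∧ (vv w i = vv w j ∨ vv w i = vv w (j + 1))

/-- The set of obstructions. -/
noncomputable def UU (α β : ℕ) : Finset ℕ :=
  (Cr w m α β ∪ Bd w m α β) ∪ (Spl w M ∩ Finset.Ico α (α + m))

variable {w m M}

lemma st_none {β i : ℕ} (h : ∀ j, β ≤ j → j < β + m → w j ≠ w i) : st w m β i = none := by
  unfold st
  rw [dif_neg]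
  rintro ⟨j, h1, h2, h3⟩
  exact h j h1 h2 h3

lemma st_some {β i j : ℕ}
    (hinj : ∀ i j, β ≤ i → i < β + m → β ≤ j → j < β + m → w i = w j → i = j)
    (h1 : β ≤ j) (h2 : j < β + m) (h3 : w j = w i) : st w m β i = some (j, ty w i j) := by
  unfold st
  have h : ∃ j, β ≤ j ∧ j < β + m ∧ w j = w i := ⟨j, h1, h2, h3⟩
  rw [dif_pos h]
  have hc := h.choose_spec
  have : h.choose = j := hinj _ _ hc.1 hc.2.1 h1 h2 (hc.2.2.trans h3.symm)
  rw [this]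

lemma st_cases (β i : ℕ)
    (hinj : ∀ i j, β ≤ i → i < β + m → β ≤ j → j < β + m → w i = w j → i = j) :
    (st w m β i = none ∧ ∀ j, β ≤ j → j < β + m → w j ≠ w i) ∨
    ∃ j, β ≤ j ∧ j < β + m ∧ w j = w i ∧ st w m β i = some (j, ty w i j) := by
  by_cases h : ∃ j, β ≤ j ∧ j < β + m ∧ w j = w i
  · obtain ⟨j, h1, h2, h3⟩ := h
    exact Or.inr ⟨j, h1, h2, h3, st_some hinj h1 h2 h3⟩
  · push Not at h
    exact Or.inl ⟨st_none h, h⟩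

lemma ty_lt (i j : ℕ) : ty w i j = 0 ∧ vv w i = vv w j ∨ ty w i j = 1 ∧ vv w i ≠ vv w j ∧ vv w i = vv w (j + 1) ∨
    ty w i j = 2 ∧ vv w i ≠ vv w j ∧ vv w i ≠ vv w (j + 1) := by
  unfold ty
  by_cases h : vv w i = vv w j
  · simp [h]
  · by_cases h' : vv w i = vv w (j + 1)
    · rw [if_neg h, if_pos h']; exact Or.inr (Or.inl ⟨rfl, h, h'⟩)
    · rw [if_neg h, if_neg h']; exact Or.inr (Or.inr ⟨rfl, h, h'⟩)

lemma vv_par (hodd : ∀ i, Odd (w i)) (i : ℕ) : vv w i % 2 = (i : ℤ) % 2 := by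
  induction i with
  | zero => simp [vv_zero]
  | succ i ih =>
    rw [vv_succ]
    obtain ⟨k, hk⟩ := hodd i
    rcases neg_one_pow_eq_or ℤ i with h | h <;> rw [h, hk] <;> push_cast <;> omega

lemma sgn_eq {i j : ℕ} (h : i % 2 = j % 2) : (-1 : ℤ) ^ i = (-1) ^ j := by
  rcases Nat.even_or_odd i with hi | hi
  · have : Even j := by rw [Nat.even_iff] at *; omega
    rw [hi.neg_one_pow, this.neg_one_pow]
  · have : Odd j := by rw [Nat.odd_iff] at *; omega
    rw [hi.neg_one_pow, this.neg_one_pow]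

lemma step0 (hodd : ∀ i, Odd (w i)) {i j : ℕ} (hw : w j = w i) (hv : vv w i = vv w j) :
    vv w (i + 1) = vv w (j + 1) := by
  have h1 := vv_par hodd i
  have h2 := vv_par hodd j
  rw [vv_succ, vv_succ, hv, hw, sgn_eq (i := i) (j := j) (by omega)]

lemma step1 (hodd : ∀ i, Odd (w i)) {i j : ℕ} (hw : w j = w i) (hv : vv w i = vv w (j + 1)) :
    vv w (i + 1) = vv w j := by
  have h1 := vv_par hodd i
  have h2 := vv_par hodd (j + 1)
  rw [vv_succ, hv, vv_succ, hw, sgn_eq (i := i) (j := j + 1) (by push_cast at h2; omega), pow_succ]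
  ring

lemma w_dvd (i : ℕ) : (w i : ℤ) ∣ vv w (i + 1) - vv w i := by
  rw [vv_succ]; exact ⟨(-1) ^ i, by ring⟩

lemma vv_ne (hodd : ∀ i, Odd (w i)) (i : ℕ) : vv w (i + 1) ≠ vv w i := by
  intro h
  have h1 := vv_par hodd i
  have h2 := vv_par hodd (i + 1)
  rw [h] at h2; push_cast at h2; omega

/-- Coincidences of vertices in a window produce backward divisibilities. -/
lemma coin_Bk (hodd : ∀ i, Odd (w i)) {β t1 t2 : ℕ} (h1 : β ≤ t1) (h12 : t1 < t2) (h2 : t2 ≤ β + m)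
    (hv : vv w t1 = vv w t2) : t2 - 1 ∈ Bk w m β := by
  obtain ⟨x, rfl⟩ : ∃ x, t2 = x + 1 := ⟨t2 - 1, by omega⟩
  rw [Nat.add_sub_cancel, mem_Bk]
  refine ⟨⟨by omega, by omega⟩, t1, h1, ?_, ?_, ?_⟩
  · rcases Nat.lt_or_ge t1 x with h | h
    · exact h
    · have : t1 = x := by omega
      subst this
      exact absurd hv.symm (vv_ne hodd t1)
  · rw [hv]; exact w_dvd x
  · rw [hv]; exact vv_ne hodd x

lemma bad_UU {α β i j : ℕ} (hα : α + m ≤ M) (hβ : β + m ≤ M) (hi1 : α ≤ i) (hi2 : i < α + m)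
    (h1 : β ≤ j) (h2 : j < β + m) (h3 : w j = w i)
    (h4 : vv w i ≠ vv w j) (h5 : vv w i ≠ vv w (j + 1)) : i ∈ UU w m M α β := by
  unfold UU
  by_cases hd : (w i : ℤ) ∣ vv w i - vv w j
  · refine Finset.mem_union_left _ (Finset.mem_union_right _ ?_)
    rw [mem_Bd]
    exact ⟨⟨hi1, hi2⟩, j, h1, h2, h3, hd, h4, h5⟩
  · refine Finset.mem_union_right _ (Finset.mem_inter.2 ⟨?_, Finset.mem_Ico.2 ⟨hi1, hi2⟩⟩)
    rw [mem_Spl]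
    exact ⟨by omega, i, j, by omega, by omega, rfl, h3, hd⟩

/-- A non-nice step ending in a vertex of the window at `β` is an obstruction. -/
lemma enter_UU (hodd : ∀ i, Odd (w i)) {α β i t : ℕ} (hα : α + m ≤ M) (hβ : β + m ≤ M) (hi1 : α ≤ i)
    (hi2 : i < α + m) (hn : ¬ Nice w m β i) (ht1 : β ≤ t) (ht2 : t ≤ β + m)
    (hv : vv w t = vv w (i + 1)) : i ∈ UU w m M α β := by
  by_cases h : ∃ j, β ≤ j ∧ j < β + m ∧ w j = w i
  · obtain ⟨j, h1, h2, h3⟩ := h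
    refine bad_UU hα hβ hi1 hi2 h1 h2 h3 (fun h => hn ⟨j, h1, h2, h3, Or.inl h⟩)
      (fun h => hn ⟨j, h1, h2, h3, Or.inr h⟩)
  · push Not at h
    refine Finset.mem_union_left _ (Finset.mem_union_left _ ?_)
    rw [mem_Cr]
    refine ⟨⟨hi1, hi2⟩, h, t, ht1, ht2, ?_, ?_⟩
    · rw [hv]; exact w_dvd i
    · rw [hv]; exact vv_ne hodd i

open Classical in
/-- Down transitions. -/
noncomputable def Dn (w : ℕ → ℕ) (m α β : ℕ) : Finset ℕ :=
  (Finset.Ico α (α + m)).filter fun i => α < i ∧ Nice w m β (i - 1) ∧ ¬ Nice w m β i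

lemma mem_Dn {α β i : ℕ} : i ∈ Dn w m α β ↔ (α ≤ i ∧ i < α + m) ∧ α < i ∧ Nice w m β (i - 1) ∧ ¬ Nice w m β i := by
  classical
  unfold Dn; rw [Finset.mem_filter, Finset.mem_Ico]

open Classical in
lemma updown (f : ℕ → Prop) (α n : ℕ) :
    ((Finset.Ico α (α + n)).filter fun i => α < i ∧ f (i - 1) ∧ ¬ f i).card +
      (if 0 < n ∧ f (α + n - 1) then 1 else 0) ≤
    1 + ((Finset.Ico α (α + n)).filter fun i => α < i ∧ ¬ f (i - 1) ∧ f i).card := by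
  induction n with
  | zero => simp
  | succ n ih =>
    rw [← add_assoc, show Finset.Ico α (α + n + 1) = insert (α + n) (Finset.Ico α (α + n)) by
      ext; simp only [Finset.mem_Ico, Finset.mem_insert]; omega, Finset.filter_insert, Finset.filter_insert]
    have hn1 : (α + n) ∉ ((Finset.Ico α (α + n)).filter fun i => α < i ∧ f (i - 1) ∧ ¬ f i) := by simp
    have hn2 : (α + n) ∉ ((Finset.Ico α (α + n)).filter fun i => α < i ∧ ¬ f (i - 1) ∧ f i) := by simp
    rcases Nat.eq_zero_or_pos n with h | h
    · subst h; simp; split_ifs <;> simp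
    · simp only [Nat.add_sub_cancel, h, true_and, show 0 < n + 1 by omega, show α < α + n by omega] at ih ⊢
      by_cases h1 : f (α + n - 1) <;> by_cases h2 : f (α + n) <;>
        simp only [h1, h2, not_true, not_false_iff, true_and, false_and, and_true, and_false, if_true, if_false,
          Finset.card_insert_of_notMem hn1, Finset.card_insert_of_notMem hn2] at ih ⊢ <;> omega

lemma Nice_vert {β i : ℕ} (h : Nice w m β i) : ∃ t, β ≤ t ∧ t ≤ β + m ∧ vv w t = vv w i := by
  obtain ⟨j, h1, h2, h3, h4 | h4⟩ := h
  · exact ⟨j, h1, h2.le, h4.symm⟩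
  · exact ⟨j + 1, by omega, by omega, h4.symm⟩

lemma card_Dn (hodd : ∀ i, Odd (w i)) {α β : ℕ} (hα : α + m ≤ M) (hβ : β + m ≤ M) :
    (Dn w m α β).card ≤ 1 + (UU w m M α β).card := by
  classical
  have h := updown (fun i => Nice w m β i) α m
  have h2 : (((Finset.Ico α (α + m)).filter fun i => α < i ∧ ¬ Nice w m β (i - 1) ∧ Nice w m β i)).card ≤
      (UU w m M α β).card := by
    refine Finset.card_le_card_of_injOn (fun i => i - 1) ?_ ?_
    · intro i hi
      simp only [Finset.coe_filter, Finset.mem_Ico, Set.mem_ofPred_eq] at hi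
      obtain ⟨t, ht1, ht2, ht3⟩ := Nice_vert hi.2.2.2
      show i - 1 ∈ UU w m M α β
      refine enter_UU hodd hα hβ (by omega) (by omega) hi.2.2.1 ht1 ht2 ?_
      rw [ht3]; congr 1; omega
    · intro i hi j hj hij
      simp only [Finset.coe_filter, Finset.mem_Ico, Set.mem_ofPred_eq] at hi hj
      beta_reduce at hij; omega
  unfold Dn
  omega

open Classical in
/-- Steps near coincidences. -/
noncomputable def Nc (w : ℕ → ℕ) (m α β : ℕ) : Finset ℕ :=
  (Finset.Ico α (α + m)).filter fun i => α < i ∧ ∃ x ∈ Bk w m β,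
    w i = w x ∨ w i = w (x + 1) ∨ w (i - 1) = w x ∨ w (i - 1) = w (x + 1)

lemma card_Nc {α β : ℕ} (hinj : ∀ i j, α ≤ i → i < α + m → α ≤ j → j < α + m → w i = w j → i = j) :
    (Nc w m α β).card ≤ 4 * (Bk w m β).card := by
  classical
  have key : ∀ (a b : ℕ), a ≤ 1 → ((Finset.Ico α (α + m)).filter fun i => α < i ∧ ∃ x ∈ Bk w m β,
      w (i - a) = w (x + b)).card ≤ (Bk w m β).card := by
    intro a b ha
    have : ∀ i ∈ ((Finset.Ico α (α + m)).filter fun i => α < i ∧ ∃ x ∈ Bk w m β, w (i - a) = w (x + b)),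
        ∃ x, x ∈ Bk w m β ∧ w (i - a) = w (x + b) := by
      intro i hi
      exact (Finset.mem_filter.1 hi).2.2
    choose! f hf using this
    refine Finset.card_le_card_of_injOn f (fun i hi => (hf i hi).1) ?_
    intro i hi j hj hij
    have h1 := (hf i hi).2
    have h2 := (hf j hj).2
    rw [← hij] at h2
    simp only [Finset.coe_filter, Finset.mem_Ico, Set.mem_ofPred_eq] at hi hj
    have := hinj _ _ (by omega) (by omega) (by omega) (by omega) (h1.trans h2.symm)
    omega
  have hsub : Nc w m α β ⊆ (((Finset.Ico α (α + m)).filter fun i => α < i ∧ ∃ x ∈ Bk w m β,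
      w (i - 0) = w (x + 0)) ∪ ((Finset.Ico α (α + m)).filter fun i => α < i ∧ ∃ x ∈ Bk w m β,
      w (i - 0) = w (x + 1))) ∪ (((Finset.Ico α (α + m)).filter fun i => α < i ∧ ∃ x ∈ Bk w m β,
      w (i - 1) = w (x + 0)) ∪ ((Finset.Ico α (α + m)).filter fun i => α < i ∧ ∃ x ∈ Bk w m β,
      w (i - 1) = w (x + 1))) := by
    intro i hi
    unfold Nc at hi
    obtain ⟨h0, h1, x, hx, h2⟩ := Finset.mem_filter.1 hi
    simp only [Finset.mem_union, Finset.mem_filter]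
    rcases h2 with h | h | h | h
    · exact Or.inl (Or.inl ⟨h0, h1, x, hx, h⟩)
    · exact Or.inl (Or.inr ⟨h0, h1, x, hx, h⟩)
    · exact Or.inr (Or.inl ⟨h0, h1, x, hx, h⟩)
    · exact Or.inr (Or.inr ⟨h0, h1, x, hx, h⟩)
  refine (Finset.card_le_card hsub).trans ?_
  refine (Finset.card_union_le _ _).trans ?_
  have h1 := Finset.card_union_le ((Finset.Ico α (α + m)).filter fun i => α < i ∧ ∃ x ∈ Bk w m β,
      w (i - 0) = w (x + 0)) ((Finset.Ico α (α + m)).filter fun i => α < i ∧ ∃ x ∈ Bk w m β,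
      w (i - 0) = w (x + 1))
  have h2 := Finset.card_union_le ((Finset.Ico α (α + m)).filter fun i => α < i ∧ ∃ x ∈ Bk w m β,
      w (i - 1) = w (x + 0)) ((Finset.Ico α (α + m)).filter fun i => α < i ∧ ∃ x ∈ Bk w m β,
      w (i - 1) = w (x + 1))
  have k1 := key 0 0 (by omega)
  have k2 := key 0 1 (by omega)
  have k3 := key 1 0 (by omega)
  have k4 := key 1 1 (by omega)
  omega

lemma mem_Nc {α β i : ℕ} : i ∈ Nc w m α β ↔ (α ≤ i ∧ i < α + m) ∧ α < i ∧ ∃ x ∈ Bk w m β,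
    w i = w x ∨ w i = w (x + 1) ∨ w (i - 1) = w x ∨ w (i - 1) = w (x + 1) := by
  classical
  unfold Nc; rw [Finset.mem_filter, Finset.mem_Ico]

/-- Two coinciding vertices next to matched steps. -/
lemma coin_Nc (hodd : ∀ i, Odd (w i)) {α β i j j' t t' : ℕ} (hi1 : α < i) (hi2 : i < α + m)
    (hj : w j = w (i - 1)) (hj' : w j' = w i)
    (ht : t = j ∨ t = j + 1) (ht' : t' = j' ∨ t' = j' + 1) (htβ : β ≤ t) (htβ' : β ≤ t')
    (htm : t ≤ β + m) (htm' : t' ≤ β + m)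
    (hne : t ≠ t') (hv : vv w t = vv w t') : i ∈ Nc w m α β := by
  rw [mem_Nc]
  refine ⟨⟨by omega, by omega⟩, hi1, ?_⟩
  rcases Nat.lt_or_gt_of_ne hne with h | h
  · refine ⟨_, coin_Bk hodd htβ h htm' hv, ?_⟩
    rcases ht' with h' | h'
    · right; left; rw [show t' - 1 + 1 = j' by omega, hj']
    · left; rw [show t' - 1 = j' by omega, hj']
  · refine ⟨_, coin_Bk hodd htβ' h htm hv.symm, ?_⟩
    rcases ht with h' | h'
    · right; right; right; rw [show t - 1 + 1 = j by omega, hj]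
    · right; right; left; rw [show t - 1 = j by omega, hj]

/-- Exceptional steps are contained in a small set. -/
lemma exc_sub (hodd : ∀ i, Odd (w i)) {α β : ℕ} (hα : α + m ≤ M) (hβ : β + m ≤ M)
    (hinjα : ∀ i j, α ≤ i → i < α + m → α ≤ j → j < α + m → w i = w j → i = j)
    (hinj : ∀ i j, β ≤ i → i < β + m → β ≤ j → j < β + m → w i = w j → i = j)
    {i : ℕ} (hi1 : α < i) (hi2 : i < α + m) (hex : st w m β i ≠ nx (st w m β (i - 1))) :
    i ∈ UU w m M α β ∨ i - 1 ∈ UU w m M α β ∨ i ∈ Dn w m α β ∨ i ∈ Nc w m α β := by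
  by_cases hn : Nice w m β i
  · by_cases hn' : Nice w m β (i - 1)
    · right; right; right
      obtain ⟨j, h1, h2, h3, h4⟩ := hn'
      obtain ⟨j', h1', h2', h3', h4'⟩ := hn
      have hi : i - 1 + 1 = i := by omega
      have e1 := st_some hinj h1 h2 h3
      have e2 := st_some hinj h1' h2' h3'
      have hjj : j ≠ j' := by
        rintro rfl
        have := hinjα (i - 1) i (by omega) (by omega) (by omega) (by omega) (h3.symm.trans h3')
        omega
      rw [e1, e2] at hex
      rcases ty_lt (w := w) (i - 1) j with ⟨ha, hb⟩ | ⟨ha, hb', hb⟩ | ⟨ha, hb', hb⟩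
      · have hs := step0 hodd h3 hb
        rw [hi] at hs
        rcases ty_lt (w := w) i j' with ⟨hc, hd⟩ | ⟨hc, hd', hd⟩ | ⟨hc, hd', hd⟩
        · rw [ha, hc] at hex
          refine coin_Nc hodd hi1 hi2 h3 h3' (t := j + 1) (t' := j') (Or.inr rfl) (Or.inl rfl) (by omega) (by omega)
            (by omega) (by omega) ?_ (hs.symm.trans hd)
          rintro rfl; exact hex rfl
        · refine coin_Nc hodd hi1 hi2 h3 h3' (t := j + 1) (t' := j' + 1) (Or.inr rfl) (Or.inr rfl) (by omega) (by omega)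
            (by omega) (by omega) (by omega) (hs.symm.trans hd)
        · rcases h4' with h | h <;> contradiction
      · have hs := step1 hodd h3 hb
        rw [hi] at hs
        rcases ty_lt (w := w) i j' with ⟨hc, hd⟩ | ⟨hc, hd', hd⟩ | ⟨hc, hd', hd⟩
        · refine coin_Nc hodd hi1 hi2 h3 h3' (t := j) (t' := j') (Or.inl rfl) (Or.inl rfl) (by omega) (by omega)
            (by omega) (by omega) hjj (hs.symm.trans hd)
        · rw [ha, hc] at hex
          refine coin_Nc hodd hi1 hi2 h3 h3' (t := j) (t' := j' + 1) (Or.inl rfl) (Or.inr rfl) (by omega) (by omega)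
            (by omega) (by omega) ?_ (hs.symm.trans hd)
          rintro rfl; exact hex rfl
        · rcases h4' with h | h <;> contradiction
      · rcases h4 with h | h <;> contradiction
    · right; left
      obtain ⟨t, ht1, ht2, ht3⟩ := Nice_vert hn
      refine enter_UU hodd hα hβ (by omega) (by omega) hn' ht1 ht2 ?_
      rw [ht3]; congr 1; omega
  · by_cases hn' : Nice w m β (i - 1)
    · right; right; left
      rw [mem_Dn]
      exact ⟨⟨by omega, by omega⟩, hi1, hn', hn⟩
    · left
      have hnx : nx (st w m β (i - 1)) = none := by
        rcases st_cases (w := w) β (i - 1) hinj with ⟨h, _⟩ | ⟨j, h1, h2, h3, h⟩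
        · rw [h]; rfl
        · rw [h]
          rcases ty_lt (w := w) (i - 1) j with ⟨ha, hb⟩ | ⟨ha, hb', hb⟩ | ⟨ha, hb', hb⟩
          · exact absurd ⟨j, h1, h2, h3, Or.inl hb⟩ hn'
          · exact absurd ⟨j, h1, h2, h3, Or.inr hb⟩ hn'
          · rw [ha]; rfl
      rw [hnx] at hex
      rcases st_cases (w := w) β i hinj with ⟨h, _⟩ | ⟨j, h1, h2, h3, h⟩
      · exact absurd h hex
      · refine bad_UU hα hβ (by omega) (by omega) h1 h2 h3 (fun h => hn ⟨j, h1, h2, h3, Or.inl h⟩)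
          (fun h => hn ⟨j, h1, h2, h3, Or.inr h⟩)

end tame2

end HR


namespace HR

open Finset

set_option linter.unusedSectionVars false

section tame3

/-- Tame words. -/
structure Tame (w : ℕ → ℕ) (m W G : ℕ) : Prop where
  odd : ∀ i, Odd (w i)
  inj : ∀ i j, i < m * W → j < m * W → i / m = j / m → w i = w j → i = j
  bk : ∀ a < W, (Bk w m (a * m)).card ≤ G
  fw : ∀ a < W, (Fw w m (a * m)).card ≤ G
  cr : ∀ a < W, ∀ b < W, (Cr w m (a * m) (b * m)).card ≤ G
  bd : ∀ a < W, ∀ b < W, (Bd w m (a * m) (b * m)).card ≤ G * G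
  sp : ∀ a < W, (Spl w (m * W) ∩ Finset.Ico (a * m) (a * m + m)).card ≤ G

variable {w : ℕ → ℕ} {m W G : ℕ}

lemma win_le {a : ℕ} (ha : a < W) : a * m + m ≤ m * W := by
  calc a * m + m = m * (a + 1) := by ring
    _ ≤ m * W := Nat.mul_le_mul_left _ ha

lemma win_div {a i : ℕ} (h1 : a * m ≤ i) (h2 : i < a * m + m) : i / m = a := by
  have hm : 0 < m := by omega
  rw [Nat.div_eq_iff hm]
  constructor
  · exact h1
  · omega

lemma win_of_div {i : ℕ} (hi : i < m * W) : i / m < W ∧ i / m * m ≤ i ∧ i < i / m * m + m := by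
  have hm : 0 < m := by
    rcases Nat.eq_zero_or_pos m with h | h
    · subst h; simp at hi
    · exact h
  refine ⟨Nat.div_lt_of_lt_mul hi, Nat.div_mul_le_self i m, ?_⟩
  have := Nat.lt_div_mul_add (a := i) hm
  exact this

lemma Tame.winj (T : Tame w m W G) {a : ℕ} (ha : a < W) : ∀ i j, a * m ≤ i → i < a * m + m → a * m ≤ j →
    j < a * m + m → w i = w j → i = j := by
  intro i j h1 h2 h3 h4 h5
  have := win_le (m := m) ha
  exact T.inj i j (by omega) (by omega) (by rw [win_div h1 h2, win_div h3 h4]) h5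

/-- The universal exceptional set. -/
noncomputable def Es (w : ℕ → ℕ) (m W a b : ℕ) : Finset ℕ :=
  (({a * m} ∪ UU w m (m * W) (a * m) (b * m)) ∪ (UU w m (m * W) (a * m) (b * m)).image (fun i => i + 1)) ∪
    (Dn w m (a * m) (b * m) ∪ Nc w m (a * m) (b * m))

lemma Tame.card_UU (T : Tame w m W G) {a b : ℕ} (ha : a < W) (hb : b < W) :
    (UU w m (m * W) (a * m) (b * m)).card ≤ 2 * G + G * G := by
  unfold UU
  refine (Finset.card_union_le _ _).trans ?_
  have h1 := Finset.card_union_le (Cr w m (a * m) (b * m)) (Bd w m (a * m) (b * m))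
  have h2 := T.cr a ha b hb
  have h3 := T.bd a ha b hb
  have h4 := T.sp a ha
  omega

lemma Tame.card_Es (T : Tame w m W G) (hG : 1 ≤ G) {a b : ℕ} (ha : a < W) (hb : b < W) :
    (Es w m W a b).card ≤ 15 * (G * G) := by
  unfold Es
  refine (Finset.card_union_le _ _).trans ?_
  have h1 := Finset.card_union_le ({a * m} ∪ UU w m (m * W) (a * m) (b * m))
    ((UU w m (m * W) (a * m) (b * m)).image (fun i => i + 1))
  have h2 := Finset.card_union_le {a * m} (UU w m (m * W) (a * m) (b * m))
  have h3 := Finset.card_union_le (Dn w m (a * m) (b * m)) (Nc w m (a * m) (b * m))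
  have h4 : ((UU w m (m * W) (a * m) (b * m)).image (fun i => i + 1)).card ≤ _ := Finset.card_image_le
  have h5 := card_Dn T.odd (win_le (m := m) ha) (win_le (m := m) hb)
  have h6 := card_Nc (β := b * m) (T.winj ha)
  have h7 := T.bk b hb
  have h8 := T.card_UU ha hb
  have h9 : G ≤ G * G := Nat.le_mul_self G
  rw [Finset.card_singleton] at h2
  omega

open Classical in
/-- Exceptional steps. -/
noncomputable def ExS (w : ℕ → ℕ) (m W b : ℕ) : Finset ℕ :=
  (Finset.range (m * W)).filter fun i => i % m = 0 ∨ st w m (b * m) i ≠ nx (st w m (b * m) (i - 1))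

lemma Tame.ExS_sub (T : Tame w m W G) {b : ℕ} (hb : b < W) :
    ExS w m W b ⊆ (Finset.range W).biUnion fun a => Es w m W a b := by
  classical
  intro i hi
  unfold ExS at hi
  obtain ⟨h1, h2⟩ := Finset.mem_filter.1 hi
  rw [Finset.mem_range] at h1
  obtain ⟨ha, hl, hr⟩ := win_of_div h1
  rw [Finset.mem_biUnion]
  refine ⟨i / m, Finset.mem_range.2 ha, ?_⟩
  unfold Es
  by_cases h0 : i = i / m * m
  · refine Finset.mem_union_left _ (Finset.mem_union_left _ (Finset.mem_union_left _ ?_))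
    exact Finset.mem_singleton.2 h0
  · have hne : i % m ≠ 0 := by
      intro h
      have := Nat.div_add_mod i m
      rw [h, mul_comm] at this
      omega
    have h3 := h2.resolve_left hne
    have hlt : i / m * m < i := by omega
    rcases exc_sub T.odd (win_le ha) (win_le hb) (T.winj ha) (T.winj hb) hlt hr h3 with h | h | h | h
    · exact Finset.mem_union_left _ (Finset.mem_union_left _ (Finset.mem_union_right _ h))
    · exact Finset.mem_union_left _ (Finset.mem_union_right _ (Finset.mem_image.2 ⟨i - 1, h, by omega⟩))
    · exact Finset.mem_union_right _ (Finset.mem_union_left _ h)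
    · exact Finset.mem_union_right _ (Finset.mem_union_right _ h)

lemma Tame.card_ExS (T : Tame w m W G) (hG : 1 ≤ G) {b : ℕ} (hb : b < W) :
    (ExS w m W b).card ≤ W * (15 * (G * G)) := by
  refine (Finset.card_le_card (T.ExS_sub hb)).trans ?_
  refine Finset.card_biUnion_le.trans ?_
  refine (Finset.sum_le_sum fun a ha => T.card_Es hG (Finset.mem_range.1 ha) hb).trans ?_
  simp

open Classical in
/-- The code of a word. -/
noncomputable def cd (w : ℕ → ℕ) (m W : ℕ) : Finset (ℕ × ℕ × Option (ℕ × ℕ)) :=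
  (Finset.range W).biUnion fun b => (ExS w m W b).image fun i => (b, i, st w m (b * m) i)

/-- The alphabet of codes. -/
def cdU (m W : ℕ) : Finset (ℕ × ℕ × Option (ℕ × ℕ)) :=
  Finset.range W ×ˢ (Finset.range (m * W) ×ˢ Finset.insertNone (Finset.range (m * W) ×ˢ Finset.range 3))

lemma card_cdU (m W : ℕ) : (cdU m W).card = W * (m * W * (m * W * 3 + 1)) := by
  simp [cdU]

lemma Tame.cd_sub (T : Tame w m W G) : cd w m W ⊆ cdU m W := by
  classical
  intro x hx
  unfold cd at hx
  obtain ⟨b, hb, hx⟩ := Finset.mem_biUnion.1 hx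
  obtain ⟨i, hi, rfl⟩ := Finset.mem_image.1 hx
  unfold ExS at hi
  have hi1 := (Finset.mem_filter.1 hi).1
  unfold cdU
  refine Finset.mem_product.2 ⟨hb, Finset.mem_product.2 ⟨hi1, ?_⟩⟩
  have hb' := Finset.mem_range.1 hb
  show st w m (b * m) i ∈ _
  rcases st_cases (w := w) (b * m) i (T.winj hb') with ⟨h, _⟩ | ⟨j, h1, h2, h3, h⟩
  · rw [h]; simp
  · rw [h, Finset.some_mem_insertNone, Finset.mem_product, Finset.mem_range, Finset.mem_range]
    have := win_le (m := m) hb'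
    refine ⟨?_, ?_⟩
    · show j < m * W
      omega
    · show ty w i j < 3
      rcases ty_lt (w := w) i j with h | h | h <;> omega

lemma Tame.card_cd (T : Tame w m W G) (hG : 1 ≤ G) : (cd w m W).card ≤ W * (W * (15 * (G * G))) := by
  classical
  unfold cd
  refine Finset.card_biUnion_le.trans ?_
  refine (Finset.sum_le_sum fun b hb => Finset.card_image_le.trans
    (T.card_ExS hG (Finset.mem_range.1 hb))).trans ?_
  simp

lemma cd_mem {b i : ℕ} {s : Option (ℕ × ℕ)} (h : (b, i, s) ∈ cd w m W) : i ∈ ExS w m W b ∧ s = st w m (b * m) i := by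
  classical
  unfold cd at h
  obtain ⟨b', hb', hx⟩ := Finset.mem_biUnion.1 h
  obtain ⟨i', hi, he⟩ := Finset.mem_image.1 hx
  simp only [Prod.mk.injEq] at he
  obtain ⟨rfl, rfl, rfl⟩ := he
  exact ⟨hi, rfl⟩

lemma mem_cd {b i : ℕ} (hb : b < W) (h : i ∈ ExS w m W b) : (b, i, st w m (b * m) i) ∈ cd w m W := by
  classical
  unfold cd
  exact Finset.mem_biUnion.2 ⟨b, Finset.mem_range.2 hb, Finset.mem_image_of_mem _ h⟩

lemma st_det {w w' : ℕ → ℕ} (hc : cd w m W = cd w' m W) {b : ℕ} (hb : b < W) :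
    ∀ i, i < m * W → st w m (b * m) i = st w' m (b * m) i := by
  classical
  intro i
  induction i with
  | zero =>
    intro hi
    have h : 0 ∈ ExS w m W b := Finset.mem_filter.2 ⟨Finset.mem_range.2 hi, Or.inl (Nat.zero_mod m)⟩
    have := mem_cd hb h
    rw [hc] at this
    exact (cd_mem this).2
  | succ i ih =>
    intro hi
    by_cases h : i + 1 ∈ ExS w m W b
    · have := mem_cd hb h
      rw [hc] at this
      exact (cd_mem this).2
    · by_cases h' : i + 1 ∈ ExS w' m W b
      · have := mem_cd hb h'
        rw [← hc] at this
        exact (cd_mem this).2.symm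
      · unfold ExS at h h'
        rw [Finset.mem_filter, not_and_or, not_or] at h h'
        have e1 := h.resolve_left (by simpa using hi)
        have e2 := h'.resolve_left (by simpa using hi)
        have e1 := not_not.1 e1.2
        have e2 := not_not.1 e2.2
        rw [e1, e2, Nat.add_sub_cancel, ih (by omega)]

lemma eq_det {w w' : ℕ → ℕ} (T : Tame w m W G) (T' : Tame w' m W G) (hc : cd w m W = cd w' m W) {i j : ℕ}
    (hi : i < m * W) (hj : j < m * W) (h : w i = w j) : w' i = w' j := by
  obtain ⟨ha, hl, hr⟩ := win_of_div hj
  have h1 := st_some (T.winj ha) hl hr h.symm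
  rw [st_det hc ha i hi] at h1
  rcases st_cases (w := w') (j / m * m) i (T'.winj ha) with ⟨h2, _⟩ | ⟨j', h3, h4, h5, h6⟩
  · rw [h2] at h1; exact absurd h1 (by simp)
  · rw [h6] at h1
    simp only [Option.some.injEq, Prod.mk.injEq] at h1
    rw [← h1.1, h5]

lemma small_sets {γ : Type*} [DecidableEq γ] (U : Finset γ) (E : ℕ) :
    (U.powerset.filter fun s => s.card ≤ E).card ≤ (U.card + 1) ^ E := by
  have h1 : (U.powerset.filter fun s => s.card ≤ E) = (Finset.range (E + 1)).biUnion fun j => U.powersetCard j := by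
    ext s
    simp only [Finset.mem_filter, Finset.mem_powerset, Finset.mem_biUnion, Finset.mem_range, Finset.mem_powersetCard]
    constructor
    · rintro ⟨a, b⟩; exact ⟨s.card, by omega, a, rfl⟩
    · rintro ⟨j, hj, a, rfl⟩; exact ⟨a, by omega⟩
  rw [h1]
  refine Finset.card_biUnion_le.trans ?_
  rw [add_pow]
  refine Finset.sum_le_sum fun j hj => ?_
  rw [Finset.card_powersetCard, one_pow, mul_one]
  have h2 : U.card.choose j ≤ U.card ^ j := Nat.choose_le_pow _ _
  have h3 : 1 ≤ E.choose j := Nat.choose_pos (by rw [Finset.mem_range] at hj; omega)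
  calc _ ≤ U.card ^ j * 1 := by simpa using h2
    _ ≤ _ := Nat.mul_le_mul_left _ h3

/-- The number of patterns of tame words. -/
lemma tame_pats (P : Finset ℕ) (hG : 1 ≤ G) :
    ∃ Pi : Finset (Fin (m * W) → Fin (m * W)), (∀ w : Fin (m * W) → ↥P, Tame (xt w) m W G → pat w ∈ Pi) ∧
      Pi.card ≤ (W * (m * W * (m * W * 3 + 1)) + 1) ^ (W * (W * (15 * (G * G)))) := by
  classical
  refine ⟨(univ.filter fun w : Fin (m * W) → ↥P => Tame (xt w) m W G).image pat, ?_, ?_⟩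
  · intro w hw
    exact Finset.mem_image_of_mem _ (by simpa using hw)
  · rw [← card_cdU]
    refine le_trans ?_ (small_sets _ _)
    have : ∀ π ∈ ((univ.filter fun w : Fin (m * W) → ↥P => Tame (xt w) m W G).image pat),
        ∃ w : Fin (m * W) → ↥P, Tame (xt w) m W G ∧ pat w = π := by
      intro π hπ
      obtain ⟨w, hw, he⟩ := Finset.mem_image.1 hπ
      exact ⟨w, (Finset.mem_filter.1 hw).2, he⟩
    rcases isEmpty_or_nonempty (Fin (m * W) → ↥P) with hem | hne
    · rw [Finset.univ_eq_empty]; simp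
    choose! f hf using this
    refine Finset.card_le_card_of_injOn (fun π => cd (xt (f π)) m W) ?_ ?_
    · intro π hπ
      have := (hf π hπ).1
      exact Finset.mem_coe.2 (Finset.mem_filter.2 ⟨Finset.mem_powerset.2 this.cd_sub, this.card_cd hG⟩)
    · intro π hπ π' hπ' he
      have h1 := hf π hπ
      have h2 := hf π' hπ'
      rw [← h1.2, ← h2.2]
      have hx : ∀ (w : Fin (m * W) → ↥P) (i : Fin (m * W)), xt w i = (w i : ℕ) := by
        intro w i; simp [xt]
      refine pat_congr _ _ fun i j => ?_
      rw [Subtype.ext_iff, Subtype.ext_iff, ← hx, ← hx, ← hx, ← hx]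
      exact ⟨eq_det h1.1 h2.1 he i.2 j.2, eq_det h2.1 h1.1 he.symm i.2 j.2⟩

open Classical in
/-- Lone uncancelled steps. -/
noncomputable def LU (w : ℕ → ℕ) (M : ℕ) : Finset ℕ :=
  (Finset.range M).filter fun i => (∀ j < M, w j = w i → j = i) ∧
    ∃ t < M, t ≠ i ∧ t ≠ (i + 1) % M ∧ (w i : ℤ) ∣ vv w t - vv w i

lemma Tame.LU_sub (T : Tame w m W G) : LU w (m * W) ⊆ ((Finset.range W).biUnion fun b => (Finset.range W).biUnion
    fun a => Es w m W a b) ∪ (Finset.range W).biUnion fun a => ((Bk w m (a * m) ∪ (Bk w m (a * m)).image (fun i => i + 1)) ∪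
      (Fw w m (a * m) ∪ (Fw w m (a * m)).image (fun i => i - 1))) := by
  classical
  intro i hi
  unfold LU at hi
  obtain ⟨hi1, hl, t, ht, hti, hti1, hd⟩ := Finset.mem_filter.1 hi
  rw [Finset.mem_range] at hi1
  obtain ⟨ha, hαl, hαr⟩ := win_of_div hi1
  obtain ⟨hb, hβl, hβr⟩ := win_of_div ht
  set a := i / m with hadef
  set b := t / m with hbdef
  have hWa := win_le (m := m) ha
  have hWb := win_le (m := m) hb
  have hti2 : t ≠ i + 1 := by
    rintro rfl
    rw [Nat.mod_eq_of_lt ht] at hti1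
    exact hti1 rfl
  by_cases hab : a = b
  · refine Finset.mem_union_right _ (Finset.mem_biUnion.2 ⟨a, Finset.mem_range.2 ha, ?_⟩)
    rw [← hab] at hβl hβr
    rcases Nat.lt_or_gt_of_ne hti with h | h
    · refine Finset.mem_union_left _ ?_
      by_cases hv : vv w t = vv w i
      · refine Finset.mem_union_right _ (Finset.mem_image.2 ⟨i - 1, coin_Bk T.odd hβl h hαr.le hv, by omega⟩)
      · refine Finset.mem_union_left _ ?_
        rw [mem_Bk]
        exact ⟨⟨hαl, hαr⟩, t, hβl, h, hd, hv⟩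
    · refine Finset.mem_union_right _ ?_
      by_cases hv : vv w t = vv w (i + 1)
      · refine Finset.mem_union_right _ (Finset.mem_image.2 ⟨i + 1, ?_, by omega⟩)
        rw [mem_Fw]
        refine ⟨⟨by omega, by omega⟩, t, by omega, by omega, ?_, ?_⟩
        · rw [hv, ← dvd_neg, neg_sub]; exact w_dvd (i + 1)
        · rw [hv]; exact (vv_ne T.odd (i + 1)).symm
      · refine Finset.mem_union_left _ ?_
        rw [mem_Fw]
        refine ⟨⟨hαl, hαr⟩, t, by omega, by omega, ?_, hv⟩
        have := dvd_sub hd (w_dvd (w := w) i)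
        rwa [sub_sub_sub_cancel_right] at this
  · refine Finset.mem_union_left _ (Finset.mem_biUnion.2 ⟨b, Finset.mem_range.2 hb,
      Finset.mem_biUnion.2 ⟨a, Finset.mem_range.2 ha, ?_⟩⟩)
    have hlone : ∀ j, b * m ≤ j → j < b * m + m → w j ≠ w i := by
      intro j h1 h2 h3
      have := hl j (by omega) h3
      subst this
      exact hab (hadef.trans (win_div h1 h2))
    unfold Es
    by_cases hv : vv w t = vv w i
    · by_cases h0 : i = a * m
      · exact Finset.mem_union_left _ (Finset.mem_union_left _ (Finset.mem_union_left _ (Finset.mem_singleton.2 h0)))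
      · by_cases hn : Nice w m (b * m) (i - 1)
        · refine Finset.mem_union_right _ (Finset.mem_union_left _ ?_)
          rw [mem_Dn]
          refine ⟨⟨hαl, hαr⟩, by omega, hn, ?_⟩
          rintro ⟨j, h1, h2, h3, _⟩
          exact hlone j h1 h2 h3
        · refine Finset.mem_union_left _ (Finset.mem_union_right _ (Finset.mem_image.2 ⟨i - 1, ?_, by omega⟩))
          refine enter_UU T.odd hWa hWb (by omega) (by omega) hn hβl hβr.le ?_
          rw [hv]; congr 1; omega
    · refine Finset.mem_union_left _ (Finset.mem_union_left _ (Finset.mem_union_right _ ?_))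
      unfold UU
      refine Finset.mem_union_left _ (Finset.mem_union_left _ ?_)
      rw [mem_Cr]
      exact ⟨⟨hαl, hαr⟩, hlone, t, hβl, hβr.le, hd, hv⟩

lemma Tame.card_LU (T : Tame w m W G) (hG : 1 ≤ G) :
    (LU w (m * W)).card ≤ W * (W * (15 * (G * G))) + W * (4 * G) := by
  classical
  refine (Finset.card_le_card T.LU_sub).trans ?_
  refine (Finset.card_union_le _ _).trans ?_
  refine add_le_add ?_ ?_
  · refine Finset.card_biUnion_le.trans ?_
    refine (Finset.sum_le_card_nsmul _ _ (W * (15 * (G * G))) ?_).trans (by simp)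
    intro b hb
    refine Finset.card_biUnion_le.trans ?_
    refine (Finset.sum_le_sum fun a ha => T.card_Es hG (Finset.mem_range.1 ha) (Finset.mem_range.1 hb)).trans ?_
    simp
  · refine Finset.card_biUnion_le.trans ?_
    refine (Finset.sum_le_card_nsmul _ _ (4 * G) ?_).trans (by simp)
    intro a ha
    rw [Finset.mem_range] at ha
    have h1 := T.bk a ha
    have h2 := T.fw a ha
    have h3 : ((Bk w m (a * m)).image (fun i => i + 1)).card ≤ _ := Finset.card_image_le
    have h4 : ((Fw w m (a * m)).image (fun i => i - 1)).card ≤ _ := Finset.card_image_le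
    have h5 := Finset.card_union_le (Bk w m (a * m)) ((Bk w m (a * m)).image (fun i => i + 1))
    have h6 := Finset.card_union_le (Fw w m (a * m)) ((Fw w m (a * m)).image (fun i => i - 1))
    refine (Finset.card_union_le _ _).trans ?_
    omega

end tame3

end HR


namespace HR

open Finset

set_option linter.unusedSectionVars false

section loc

/-- Local factor at `q`. -/
noncomputable def Xd (c : ℝ) (u : ℕ → ℕ) (t : ℕ → ℤ) (M q : ℕ) (n : ℤ) : ℝ :=
  ∏ i ∈ (range M).filter (fun i => u i = q), dv c q (n + t i)

variable {c : ℝ} (hc0 : 0 ≤ c) (hc1 : c ≤ 1) {u : ℕ → ℕ} {t : ℕ → ℤ} {M q : ℕ}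

lemma dv_per (c : ℝ) (q : ℕ) (t n : ℤ) : dv c q (n + q + t) = dv c q (n + t) := by
  simp only [dv, dvd_per]

lemma Xd_per (c : ℝ) (u : ℕ → ℕ) (t : ℕ → ℤ) (M q : ℕ) : Function.Periodic (Xd c u t M q) (q : ℤ) := by
  intro n
  simp only [Xd, dv_per]

include hc0 hc1 in
lemma dv_le (hq : 1 ≤ q) (n : ℤ) : |dv c q n| ≤ (if (q : ℤ) ∣ n then 1 else 0) + 1 / q := by
  have hq' : (1:ℝ) ≤ q := by exact_mod_cast hq
  have h2 : 0 ≤ c / q := by positivity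
  have h3 : c / q ≤ 1 / q := by gcongr
  unfold dv
  split_ifs <;> rw [abs_le] <;> constructor <;> linarith

include hc0 hc1 in
lemma Xd_le_one (hq : 1 ≤ q) (n : ℤ) : |Xd c u t M q n| ≤ 1 := by
  unfold Xd
  rw [Finset.abs_prod]
  exact Finset.prod_le_one (fun _ _ => abs_nonneg _) fun i _ => dv_abs_le c hc0 hc1 q hq _

include hc0 hc1 in
lemma Xd_le_sub (hq : 1 ≤ q) (n : ℤ) (A : Finset ℕ) (hA : A ⊆ (range M).filter (fun i => u i = q)) :
    |Xd c u t M q n| ≤ ∏ i ∈ A, |dv c q (n + t i)| := by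
  unfold Xd
  rw [Finset.abs_prod]
  rw [← Finset.prod_sdiff hA]
  exact mul_le_of_le_one_left (Finset.prod_nonneg fun _ _ => abs_nonneg _)
    (Finset.prod_le_one (fun _ _ => abs_nonneg _) fun i _ => dv_abs_le c hc0 hc1 q hq _)

lemma sum_ind (hq : 0 < q) (a : ℤ) :
    ∑ n ∈ range q, (if (q : ℤ) ∣ (n : ℤ) + a then (1 : ℝ) else 0) = 1 := one_res q hq a

include hc0 hc1 in
lemma Xd_avg (hq : 0 < q) (hi : ∃ i < M, u i = q) :
    avg q (fun n => |Xd c u t M q n|) ≤ 2 / q := by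
  obtain ⟨i, hiM, hiq⟩ := hi
  have hq' : (0:ℝ) < q := by exact_mod_cast hq
  unfold avg
  gcongr
  calc ∑ n ∈ range q, |Xd c u t M q n| ≤ ∑ n ∈ range q, ((if (q : ℤ) ∣ (n : ℤ) + t i then (1 : ℝ) else 0) + 1 / q) := by
        refine Finset.sum_le_sum fun n _ => ?_
        refine (Xd_le_sub hc0 hc1 hq _ {i} (by
          intro j hj; rw [Finset.mem_singleton] at hj; subst hj; simp [hiM, hiq])).trans ?_
        rw [Finset.prod_singleton]
        exact dv_le hc0 hc1 hq _
    _ = 2 := by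
        rw [Finset.sum_add_distrib, one_res q hq]
        simp
        rw [mul_inv_cancel₀ hq'.ne']; norm_num
    _ ≤ 2 := le_rfl

include hc0 hc1 in
lemma Xd_split (hq : 0 < q) {i1 i2 : ℕ} (h1 : i1 < M) (h2 : i2 < M) (e1 : u i1 = q) (e2 : u i2 = q)
    (hs : ¬ (q : ℤ) ∣ t i1 - t i2) :
    avg q (fun n => |Xd c u t M q n|) ≤ 3 / q ^ 2 := by
  have hq' : (0:ℝ) < q := by exact_mod_cast hq
  have hne : i1 ≠ i2 := by rintro rfl; simp at hs
  unfold avg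
  rw [show (3:ℝ) / q ^ 2 = (3 / q) / q by field_simp]
  gcongr
  calc ∑ n ∈ range q, |Xd c u t M q n| ≤ ∑ n ∈ range q, (1 / q * (if (q : ℤ) ∣ (n : ℤ) + t i1 then (1 : ℝ) else 0)
        + 1 / q * (if (q : ℤ) ∣ (n : ℤ) + t i2 then (1 : ℝ) else 0) + 1 / q * (1 / q)) := by
        refine Finset.sum_le_sum fun n _ => ?_
        refine (Xd_le_sub hc0 hc1 hq _ {i1, i2} (by
          intro j hj; rw [Finset.mem_insert, Finset.mem_singleton] at hj
          rcases hj with rfl | rfl <;> simp [*])).trans ?_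
        rw [Finset.prod_pair hne]
        refine (mul_le_mul (dv_le hc0 hc1 hq _) (dv_le hc0 hc1 hq _) (abs_nonneg _) (by positivity)).trans ?_
        by_cases ha : (q : ℤ) ∣ (n : ℤ) + t i1
        · have hb : ¬ (q : ℤ) ∣ (n : ℤ) + t i2 := by
            intro hb; apply hs
            have := dvd_sub ha hb
            rwa [add_sub_add_left_eq_sub] at this
          simp only [ha, hb, if_true, if_false]
          apply le_of_eq; ring
        · simp only [ha, if_false]
          apply le_of_eq; ring
    _ = 3 / q := by
        rw [Finset.sum_add_distrib, Finset.sum_add_distrib, ← Finset.mul_sum, ← Finset.mul_sum, one_res q hq, one_res q hq]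
        rw [Finset.sum_const, Finset.card_range, nsmul_eq_mul]
        field_simp
        ring

/-- A cancelled lone prime has a tiny average. -/
lemma lone_avg {L : ℝ} (hL : 1 ≤ L) (hq : 0 < q) (a : ℤ)
    (h2 : ∀ n : ℤ, (q : ℤ) ∣ n + a → mq t M q n = 2) :
    |avg q (fun n => dv ((1 - 1 / L) ^ 2) q (n + a) * (1 - 1 / L) ^ mq t M q n)| ≤ M / q ^ 2 := by
  have hq' : (0:ℝ) < q := by exact_mod_cast hq
  have hL0 : 0 < L := by linarith
  set θ := 1 - 1 / L with hθ
  have h0 : 0 ≤ θ := by rw [hθ, sub_nonneg, div_le_one hL0]; exact hL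
  have h1 : θ ≤ 1 := by rw [hθ]; simp; linarith
  have e1 : ∑ n ∈ range q, dv (θ ^ 2) q (n + a) * θ ^ mq t M q n =
      θ ^ 2 / q * ∑ n ∈ range q, (1 - θ ^ mq t M q n) := by
    have : ∀ n : ℕ, dv (θ ^ 2) q (n + a) * θ ^ mq t M q n =
        θ ^ 2 * (if (q : ℤ) ∣ (n : ℤ) + a then (1 : ℝ) else 0) - θ ^ 2 / q + θ ^ 2 / q * (1 - θ ^ mq t M q n) := by
      intro n
      unfold dv
      by_cases h : (q : ℤ) ∣ (n : ℤ) + a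
      · rw [if_pos h, h2 _ h]; ring
      · rw [if_neg h]; ring
    simp only [this]
    rw [Finset.sum_add_distrib, Finset.sum_sub_distrib, ← Finset.mul_sum, one_res q hq, ← Finset.mul_sum]
    simp
    field_simp
    ring
  have e2 : 0 ≤ ∑ n ∈ range q, (1 - θ ^ mq t M q n) := Finset.sum_nonneg fun n _ => (one_sub_pow L hL _).1
  have e3 : ∑ n ∈ range q, (1 - θ ^ mq t M q n) ≤ M := by
    rw [← mq_sum t M q hq]
    refine Finset.sum_le_sum fun n _ => (one_sub_pow L hL _).2.1.trans ?_
    exact div_le_self (Nat.cast_nonneg _) hL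
  unfold avg
  rw [e1, abs_of_nonneg (by positivity), div_mul_eq_mul_div, div_div, ← pow_two]
  gcongr
  calc θ ^ 2 * _ ≤ 1 * M := mul_le_mul (pow_le_one₀ h0 h1) e3 e2 (by norm_num)
    _ = M := one_mul _

lemma prod_Xd (c : ℝ) (u : ℕ → ℕ) (t : ℕ → ℤ) (M : ℕ) (n : ℤ) :
    ∏ i ∈ range M, dv c (u i) (n + t i) = ∏ q ∈ (range M).image u, Xd c u t M q n := by
  unfold Xd
  rw [← Finset.prod_fiberwise_of_maps_to (s := range M) (t := (range M).image u) (g := u)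
    (fun i hi => Finset.mem_image_of_mem _ hi)]
  refine Finset.prod_congr rfl fun q _ => Finset.prod_congr rfl fun i hi => ?_
  rw [(Finset.mem_filter.1 hi).2]

lemma prod_om (P : Finset ℕ) (θ : ℝ) (t : ℕ → ℤ) (M : ℕ) (n : ℤ) :
    ∏ i ∈ range M, θ ^ om P (n + t i) = ∏ q ∈ P, θ ^ mq t M q n := by
  rw [Finset.prod_pow_eq_pow_sum, Finset.prod_pow_eq_pow_sum]
  congr 1
  unfold om mq
  exact Finset.sum_card_bipartiteAbove_eq_sum_card_bipartiteBelow (fun i (q : ℕ) => (q : ℤ) ∣ n + t i)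

end loc

end HR


namespace HR

open Finset

set_option linter.unusedSectionVars false

section ker

lemma sum_Ico_int (f : ℤ → ℝ) (a b : ℤ) : ∑ n ∈ Finset.Ico a b, f n = ∑ k ∈ range (b - a).toNat, f (a + k) := by
  have : Finset.Ico a b = (range (b - a).toNat).map (Nat.castEmbedding.trans (addLeftEmbedding a)) := rfl
  rw [this, Finset.sum_map]
  rfl

lemma interval_filter (a b : ℤ) (t : ℕ → ℤ) (M : ℕ) : ∃ a' b' : ℤ, a ≤ a' ∧ b' ≤ b ∧
    ∀ n, (n ∈ Finset.Ico a b ∧ ∀ i < M, n + t i ∈ Finset.Ico a b) ↔ n ∈ Finset.Ico a' b' := by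
  induction M with
  | zero => exact ⟨a, b, le_rfl, le_rfl, by simp⟩
  | succ M ih =>
    obtain ⟨a', b', h1, h2, h3⟩ := ih
    refine ⟨max a' (a - t M), min b' (b - t M), h1.trans (le_max_left _ _), (min_le_left _ _).trans h2, fun n => ?_⟩
    have : (∀ i < M + 1, n + t i ∈ Finset.Ico a b) ↔ (∀ i < M, n + t i ∈ Finset.Ico a b) ∧ n + t M ∈ Finset.Ico a b := by
      constructor
      · intro h; exact ⟨fun i hi => h i (by omega), h M (by omega)⟩
      · rintro ⟨h, h'⟩ i hi
        rcases Nat.lt_succ_iff_lt_or_eq.1 hi with h4 | h4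
        · exact h i h4
        · rw [h4]; exact h'
    rw [this, ← and_assoc, h3]
    simp only [Finset.mem_Ico, max_le_iff, lt_min_iff]
    constructor
    · rintro ⟨⟨_, _⟩, _, _⟩; refine ⟨⟨?_, ?_⟩, ?_, ?_⟩ <;> linarith
    · rintro ⟨⟨_, _⟩, _, _⟩; refine ⟨⟨?_, ?_⟩, ?_, ?_⟩ <;> linarith

lemma vtx_step (u : ℕ → ℕ) (x : ℤ × Bool) (i : ℕ) : stp (u i) (vtx u x i) = vtx u x (i + 1) := by
  unfold vtx stp
  rw [vv_succ]
  rcases Nat.even_or_odd i with hi | hi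
  · have h1 : i % 2 = 0 := Nat.even_iff.1 hi
    have h2 : (i + 1) % 2 = 1 := by omega
    rw [hi.neg_one_pow]
    simp [h1, h2]; ring
  · have h1 : i % 2 = 1 := Nat.odd_iff.1 hi
    have h2 : (i + 1) % 2 = 0 := by omega
    rw [hi.neg_one_pow]
    simp [h1, h2, sg_not]; ring

variable (P : Finset ℕ) (θ c : ℝ) (J : Finset ℤ)

lemma sum_XX (f : ℤ × Bool → ℝ) : ∑ x ∈ XX J, f x = ∑ s : Bool, ∑ n ∈ J, f (n, s) := by
  unfold XX
  rw [Finset.sum_product_right]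

open Classical in
lemma prod_kap (hθ : 0 ≤ θ) (u : ℕ → ℕ) (x : ℤ × Bool) (M : ℕ) (hM0 : 0 < M) (hv : vv u M = 0) :
    ∏ i ∈ range M, kap P θ c J (u i) (vtx u x i) =
      if ∀ i < M, (vtx u x i).1 ∈ J then
        ∏ i ∈ range M, θ ^ om P (x.1 + sg x.2 * vv u i) * dv c (u i) (x.1 + sg x.2 * vv u i) else 0 := by
  have hM : (vtx u x M).1 = (vtx u x 0).1 := by simp [vtx, hv, vv_zero]
  split_ifs with h
  · have h' : ∀ i ≤ M, (vtx u x i).1 ∈ J := by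
      intro i hi
      rcases hi.lt_or_eq with h1 | h1
      · exact h i h1
      · rw [h1, hM]
        exact h 0 hM0
    have : ∏ i ∈ range M, kap P θ c J (u i) (vtx u x i) =
        (∏ i ∈ range M, gw P θ (vtx u x i).1) * (∏ i ∈ range M, gw P θ (vtx u x (i + 1)).1) *
          ∏ i ∈ range M, dv c (u i) (vtx u x i).1 := by
      rw [← Finset.prod_mul_distrib, ← Finset.prod_mul_distrib]
      refine Finset.prod_congr rfl fun i hi => ?_
      rw [Finset.mem_range] at hi
      unfold kap
      rw [vtx_step, if_pos ⟨h' i hi.le, h' (i + 1) hi⟩]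
    rw [this]
    have e : ∏ i ∈ range M, gw P θ (vtx u x (i + 1)).1 = ∏ i ∈ range M, gw P θ (vtx u x i).1 := by
      rcases Nat.eq_zero_or_pos M with h0 | h0
      · subst h0; simp
      obtain ⟨k, rfl⟩ : ∃ k, M = k + 1 := ⟨M - 1, by omega⟩
      rw [Finset.prod_range_succ, Finset.prod_range_succ' (fun i => gw P θ (vtx u x i).1), hM]
    rw [e, ← Finset.prod_mul_distrib, ← Finset.prod_mul_distrib]
    refine Finset.prod_congr rfl fun i hi => ?_
    unfold gw
    rw [Real.mul_self_sqrt (pow_nonneg hθ _)]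
    rfl
  · push Not at h
    obtain ⟨i, hi, hn⟩ := h
    refine Finset.prod_eq_zero (Finset.mem_range.2 hi) ?_
    unfold kap
    rw [if_neg]
    tauto

lemma sg_eq (s : Bool) : sg s = 1 ∨ sg s = -1 := by cases s <;> simp [sg]

lemma prod_im {M : ℕ} (w : Fin M → ↥P) (g : ℕ → ℝ) :
    ∏ q ∈ (range M).image (xt w), g q = ∏ q ∈ univ.image w, g (q : ℕ) := by
  symm
  have hx : ∀ i : Fin M, xt w i = (w i : ℕ) := by intro i; simp [xt]
  refine Finset.prod_nbij (fun q : ↥P => (q : ℕ)) ?_ ?_ ?_ ?_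
  · intro q hq
    obtain ⟨i, _, rfl⟩ := Finset.mem_image.1 hq
    exact Finset.mem_image.2 ⟨i, Finset.mem_range.2 i.2, hx i⟩
  · intro a _ b _ h; exact Subtype.ext h
  · intro q hq
    obtain ⟨i, hi, rfl⟩ := Finset.mem_image.1 (Finset.mem_coe.1 hq)
    rw [Finset.mem_range] at hi
    exact ⟨w ⟨i, hi⟩, by simp, (hx ⟨i, hi⟩).symm⟩
  · intro q _; rfl

lemma im_sub {M : ℕ} (w : Fin M → ↥P) : (range M).image (xt w) ⊆ P := by
  intro q hq
  obtain ⟨i, hi, rfl⟩ := Finset.mem_image.1 hq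
  rw [Finset.mem_range] at hi
  simp [xt, hi]

/-- Absolute bound for the kernel of a word. -/
lemma abs_bound (hP : ∀ q ∈ P, q.Prime) (hθ0 : 0 ≤ θ) (hθ1 : θ ≤ 1) (hc0 : 0 ≤ c) (hc1 : c ≤ 1)
    {M : ℕ} (w : Fin M → ↥P) (d : ℕ → ℝ)
    (hd : ∀ q ∈ (range M).image (xt w), ∀ s : Bool,
      avg q (fun n => |Xd c (xt w) (fun i => sg s * vv (xt w) i) M q n|) ≤ d q)
    (H : ℝ) (hH : 1 ≤ H) (hPH : ∀ q ∈ P, (q : ℝ) ≤ H) (a : ℤ) (K : ℕ) :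
    ∑ x ∈ XX (Finset.Ico a (a + K)), |∏ i ∈ range M, kap P θ c (Finset.Ico a (a + K)) (xt w i) (vtx (xt w) x i)| ≤
      2 * (K * ∏ q ∈ (range M).image (xt w), d q + H ^ M) := by
  rw [sum_XX, two_mul, Fintype.sum_bool]
  have key : ∀ s : Bool, ∑ n ∈ Finset.Ico a (a + K),
      |∏ i ∈ range M, kap P θ c (Finset.Ico a (a + K)) (xt w i) (vtx (xt w) (n, s) i)| ≤
      K * ∏ q ∈ (range M).image (xt w), d q + H ^ M := by
    intro s
    set t : ℕ → ℤ := fun i => sg s * vv (xt w) i with ht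
    have h1 : ∀ n : ℤ, |∏ i ∈ range M, kap P θ c (Finset.Ico a (a + K)) (xt w i) (vtx (xt w) (n, s) i)| ≤
        ∏ q ∈ (range M).image (xt w), |Xd c (xt w) t M q n| := by
      intro n
      rw [← Finset.abs_prod, ← prod_Xd, Finset.abs_prod, Finset.abs_prod]
      refine Finset.prod_le_prod (fun _ _ => abs_nonneg _) fun i _ => ?_
      exact kap_abs_le_dv P θ c _ hθ0 hθ1 (xt w i) (vtx (xt w) (n, s) i)
    refine (Finset.sum_le_sum fun n _ => h1 n).trans ?_
    rw [sum_Ico_int, show (a + (K:ℤ) - a).toNat = K by simp]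
    have hQ := im_sub P w
    have h2 := per_bound ((range M).image (xt w)) (fun q hq => hP q (hQ hq))
      (fun q n => |Xd c (xt w) t M q n|) (fun q _ n => by beta_reduce; rw [Xd_per c (xt w) t M q n])
      (fun q hq n => by rw [abs_abs]; exact Xd_le_one hc0 hc1 (hP q (hQ hq)).one_le n) a K
    refine (le_abs_self _).trans (h2.trans ?_)
    gcongr with q hq
    · rw [abs_of_nonneg]
      · exact hd q hq s
      · unfold avg; exact div_nonneg (Finset.sum_nonneg fun _ _ => abs_nonneg _) (Nat.cast_nonneg _)
    · push_cast
      refine (Finset.prod_le_prod (fun _ _ => Nat.cast_nonneg _) fun q hq => hPH q (hQ hq)).trans ?_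
      rw [Finset.prod_const]
      exact pow_le_pow_right₀ hH (Finset.card_image_le.trans (by simp))
  exact add_le_add (key true) (key false)

/-- Signed bound for the kernel of a closed word. -/
lemma closed_bound (hP : ∀ q ∈ P, q.Prime) (L : ℝ) (hL : 1 ≤ L) (hθ : θ = 1 - 1 / L) (hc : c = θ ^ 2)
    (hℓ : ∑ q ∈ P, (1 : ℝ) / q ≤ L)
    {M : ℕ} (hM : 0 < M) (w : Fin M → ↥P) (hv : vv (xt w) M = 0) (b : ℕ → ℝ)
    (hb : ∀ q ∈ (range M).image (xt w), ∀ s : Bool,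
      |avg q (fun n => Xd c (xt w) (fun i => sg s * vv (xt w) i) M q n *
        θ ^ mq (fun i => sg s * vv (xt w) i) M q n)| ≤ b q)
    (H : ℝ) (hH : 1 ≤ H) (hPH : ∀ q ∈ P, (q : ℝ) ≤ H) (hPc : (P.card : ℝ) ≤ H) (a : ℤ) (K R : ℕ) :
    |∑ x ∈ XX (Finset.Ico a (a + K)), ∏ i ∈ range M, kap P θ c (Finset.Ico a (a + K)) (xt w i) (vtx (xt w) x i)| ≤
      2 * (K * ((∏ q ∈ (range M).image (xt w), b q) * Real.exp M) +
        K * ((∏ q ∈ (range M).image (xt w), (2:ℝ) / q) * (M ^ R / R.factorial)) +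
        (R + 1) * H ^ (M + 2 * R)) := by
  have hL0 : 0 < L := by linarith
  have hθ0 : 0 ≤ θ := by rw [hθ, sub_nonneg, div_le_one hL0]; exact hL
  have hθ1 : θ ≤ 1 := by rw [hθ]; simp; linarith
  have hc0 : 0 ≤ c := by rw [hc]; positivity
  have hc1 : c ≤ 1 := by rw [hc]; exact pow_le_one₀ hθ0 hθ1
  have hQ := im_sub P w
  rw [sum_XX, two_mul, Fintype.sum_bool]
  have key : ∀ s : Bool, |∑ n ∈ Finset.Ico a (a + K),
      ∏ i ∈ range M, kap P θ c (Finset.Ico a (a + K)) (xt w i) (vtx (xt w) (n, s) i)| ≤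
      K * ((∏ q ∈ (range M).image (xt w), b q) * Real.exp M) +
        K * ((∏ q ∈ (range M).image (xt w), (2:ℝ) / q) * (M ^ R / R.factorial)) +
        (R + 1) * H ^ (M + 2 * R) := by
    intro s
    set t : ℕ → ℤ := fun i => sg s * vv (xt w) i with ht
    obtain ⟨a', b', h1, h2, h3⟩ := interval_filter a (a + K) t M
    have e1 : ∑ n ∈ Finset.Ico a (a + K),
        ∏ i ∈ range M, kap P θ c (Finset.Ico a (a + K)) (xt w i) (vtx (xt w) (n, s) i) =
        ∑ n ∈ Finset.Ico a' b', ∏ i ∈ range M, θ ^ om P (n + t i) * dv c (xt w i) (n + t i) := by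
      classical
      have : Finset.Ico a' b' = (Finset.Ico a (a + K)).filter (fun n => ∀ i < M, n + t i ∈ Finset.Ico a (a + K)) := by
        ext n; rw [Finset.mem_filter, ← h3]
      rw [this, Finset.sum_filter]
      refine Finset.sum_congr rfl fun n _ => ?_
      rw [prod_kap P θ c _ hθ0 (xt w) (n, s) M hM hv]
      rfl
    have e2 : ∀ n : ℤ, ∏ i ∈ range M, θ ^ om P (n + t i) * dv c (xt w i) (n + t i) =
        (∏ q ∈ (range M).image (xt w), (Xd c (xt w) t M q n * θ ^ mq t M q n)) *
          ∏ q ∈ P \ (range M).image (xt w), (1 - 1 / L) ^ mq t M q n := by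
      intro n
      rw [Finset.prod_mul_distrib, prod_om, prod_Xd, Finset.prod_mul_distrib, ← Finset.prod_sdiff hQ, ← hθ]
      ring
    rw [e1, sum_Ico_int]
    simp only [e2]
    have hth : ∀ k : ℕ, 0 ≤ θ ^ k ∧ θ ^ k ≤ 1 := fun k => ⟨pow_nonneg hθ0 k, pow_le_one₀ hθ0 hθ1⟩
    have h4 := ex_bound P ((range M).image (xt w)) hP hQ L hL hℓ t M
      (fun q n => Xd c (xt w) t M q n * θ ^ mq t M q n)
      (fun q _ n => by beta_reduce; rw [Xd_per c (xt w) t M q n, mq_per])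
      (fun q hq n => by
        rw [abs_mul, abs_of_nonneg (hth _).1]
        exact mul_le_one₀ (Xd_le_one hc0 hc1 (hP q (hQ hq)).one_le n) (hth _).1 (hth _).2)
      b (fun q => 2 / q) (fun q hq => hb q hq s)
      (fun q hq => by
        obtain ⟨i, hi, hiq⟩ := Finset.mem_image.1 hq
        refine le_trans ?_ (Xd_avg (t := t) hc0 hc1 (hP q (hQ hq)).pos ⟨i, Finset.mem_range.1 hi, hiq⟩)
        unfold avg
        gcongr with n hn
        beta_reduce
        rw [abs_mul, abs_of_nonneg (hth _).1]
        exact mul_le_of_le_one_right (abs_nonneg _) (hth _).2) H hH hPH hPc a' (b' - a').toNat R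
    refine h4.trans ?_
    have hK : (((b' - a').toNat : ℕ) : ℝ) ≤ K := by
      have : (b' - a').toNat ≤ K := by omega
      exact_mod_cast this
    have hb0 : 0 ≤ ∏ q ∈ (range M).image (xt w), b q := Finset.prod_nonneg fun q hq => (abs_nonneg _).trans (hb q hq s)
    have hcard : ((range M).image (xt w)).card ≤ M := Finset.card_image_le.trans (by simp)
    gcongr
  exact (abs_add_le _ _).trans (add_le_add (key true) (key false))

end ker

end HR


namespace HR

open Finset

set_option linter.unusedSectionVars false

section cls

lemma prod_gain {ι : Type*} [DecidableEq ι] (Q A : Finset ι) (hA : A ⊆ Q) (f g : ι → ℝ)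
    (hf : ∀ q ∈ Q, 0 ≤ f q) (hg : ∀ q ∈ Q, 0 ≤ g q) (ε : ℝ) (h0 : 0 ≤ ε) (h1 : ε ≤ 1)
    (hfA : ∀ q ∈ A, f q ≤ g q * ε) (hfo : ∀ q ∈ Q, f q ≤ g q) (G : ℕ) (hG : G ≤ A.card) :
    ∏ q ∈ Q, f q ≤ (∏ q ∈ Q, g q) * ε ^ G := by
  have h2 : ∏ q ∈ Q, f q ≤ ∏ q ∈ Q, (g q * if q ∈ A then ε else 1) := by
    refine Finset.prod_le_prod hf fun q hq => ?_
    split_ifs with h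
    · exact hfA q h
    · simpa using hfo q hq
  refine h2.trans ?_
  rw [Finset.prod_mul_distrib]
  refine mul_le_mul_of_nonneg_left ?_ (Finset.prod_nonneg hg)
  rw [Finset.prod_ite_mem, Finset.inter_eq_right.2 hA, Finset.prod_const]
  exact pow_le_pow_of_le_one h0 h1 hG

/-- Split primes. -/
noncomputable def SpP (u : ℕ → ℕ) (M : ℕ) : Finset ℕ := (Spl u M).image u

lemma mem_SpP {u : ℕ → ℕ} {M q : ℕ} : q ∈ SpP u M ↔ ∃ i < M, u i = q ∧ ∃ i1 i2, i1 < M ∧ i2 < M ∧ u i1 = q ∧ u i2 = q ∧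
    ¬ ((q : ℤ) ∣ vv u i1 - vv u i2) := by
  unfold SpP
  rw [Finset.mem_image]
  constructor
  · rintro ⟨i, hi, rfl⟩
    rw [mem_Spl] at hi
    exact ⟨i, hi.1, rfl, hi.2⟩
  · rintro ⟨i, hi, rfl, h⟩
    exact ⟨i, (mem_Spl _ _).2 ⟨hi, h⟩, rfl⟩

variable (P : Finset ℕ) (θ c : ℝ)

lemma word_abs (hP : ∀ q ∈ P, q.Prime) (hθ0 : 0 ≤ θ) (hθ1 : θ ≤ 1) (hc0 : 0 ≤ c) (hc1 : c ≤ 1)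
    {M : ℕ} (w : Fin M → ↥P) (H0 : ℝ) (hH0 : 2 ≤ H0) (hPH0 : ∀ q ∈ P, H0 ≤ (q : ℝ))
    (H : ℝ) (hH : 1 ≤ H) (hPH : ∀ q ∈ P, (q : ℝ) ≤ H) (a : ℤ) (K G : ℕ)
    (hG : G ≤ (SpP (xt w) M).card) :
    ∑ x ∈ XX (Finset.Ico a (a + K)), |∏ i ∈ range M, kap P θ c (Finset.Ico a (a + K)) (xt w i) (vtx (xt w) x i)| ≤
      2 * (K * ((∏ q ∈ univ.image w, (2 : ℝ) / (q : ℕ)) * (2 / H0) ^ G) + H ^ M) := by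
  classical
  refine (abs_bound P θ c hP hθ0 hθ1 hc0 hc1 w (fun q => if q ∈ SpP (xt w) M then 3 / (q : ℝ) ^ 2 else 2 / q)
    ?_ H hH hPH a K).trans ?_
  · intro q hq s
    have hqP := im_sub P w hq
    have hq0 : 0 < q := (hP q hqP).pos
    beta_reduce
    split_ifs with h
    · obtain ⟨i, hi, h1, i1, i2, h2, h3, h4, h5, h6⟩ := mem_SpP.1 h
      refine Xd_split hc0 hc1 hq0 h2 h3 h4 h5 ?_
      rcases sg_eq s with h | h <;> rw [h]
      · simpa using h6
      · rw [show (-1 : ℤ) * vv (xt w) i1 - -1 * vv (xt w) i2 = -(vv (xt w) i1 - vv (xt w) i2) by ring, dvd_neg]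
        exact h6
    · obtain ⟨i, hi, h1⟩ := Finset.mem_image.1 hq
      exact Xd_avg hc0 hc1 hq0 ⟨i, Finset.mem_range.1 hi, h1⟩
  · have h3 := prod_gain ((range M).image (xt w)) (SpP (xt w) M) ?_
      (fun q => if q ∈ SpP (xt w) M then 3 / (q : ℝ) ^ 2 else 2 / q) (fun q => (2:ℝ) / q) ?_ ?_ (2 / H0) (by positivity)
      (by rw [div_le_one (by linarith)]; linarith) ?_ ?_ G hG
    · rw [prod_im P w (fun q => (2:ℝ) / q)] at h3
      have := mul_le_mul_of_nonneg_left h3 (Nat.cast_nonneg (α := ℝ) K)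
      linarith
    · intro q hq
      obtain ⟨i, hi, h1, -⟩ := mem_SpP.1 hq
      exact Finset.mem_image.2 ⟨i, Finset.mem_range.2 hi, h1⟩
    · intro q hq
      beta_reduce; split_ifs <;> positivity
    · intro q hq; positivity
    · intro q hq
      rw [if_pos hq]
      obtain ⟨i, hi, h1, -⟩ := mem_SpP.1 hq
      have hqP := im_sub P w (Finset.mem_image.2 ⟨i, Finset.mem_range.2 hi, h1⟩)
      have h5 := hPH0 q hqP
      have h6 : (0:ℝ) < q := by linarith
      rw [div_mul_div_comm, div_le_div_iff₀ (by positivity) (by positivity)]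
      have : (q:ℝ) * H0 ≤ q * q := by gcongr
      nlinarith
    · intro q hq
      have h5 := hPH0 q (im_sub P w hq)
      have h6 : (0:ℝ) < q := by linarith
      beta_reduce; split_ifs
      · rw [div_le_div_iff₀ (by positivity) (by positivity)]
        nlinarith
      · exact le_rfl

/-- Words which are negligible. -/
def Bad {P : Finset ℕ} {M : ℕ} (G Dd Z : ℕ) (w : Fin M → ↥P) : Prop :=
  RareZ M G (2 ^ Dd) Z (xt w) ∨ G ≤ (SpP (xt w) M).card

/-- Bound for the bad words. -/
noncomputable def Rb (M G Dd Z : ℕ) (Bs H0 : ℝ) : ℝ :=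
  (2 * Z + 1) * 9 * (M + 1) ^ (5 * G) * (M ^ M * (Bs ^ M * (2 * Dd / H0) ^ G)) +
    M ^ M * (Bs ^ M * (2 / H0) ^ G)

open Classical in
lemma bad_sum (hP : ∀ q ∈ P, q.Prime) (hθ0 : 0 ≤ θ) (hθ1 : θ ≤ 1) (hc0 : 0 ≤ c) (hc1 : c ≤ 1)
    {M : ℕ} (p0 : ↥P) (H0 : ℝ) (hH0 : 2 ≤ H0) (hPH0 : ∀ q ∈ P, H0 ≤ (q : ℝ))
    (Bs : ℝ) (hBs : 1 ≤ Bs) (hsum : ∑ p ∈ P, (2 : ℝ) / p ≤ Bs)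
    (H : ℝ) (hH : 1 ≤ H) (hPH : ∀ q ∈ P, (q : ℝ) ≤ H) (hPc : (P.card : ℝ) ≤ H) (a : ℤ) (K G Dd Z : ℕ) :
    ∑ w : Fin M → ↥P, (if Bad G Dd Z w then
      ∑ x ∈ XX (Finset.Ico a (a + K)), |∏ i ∈ range M, kap P θ c (Finset.Ico a (a + K)) (xt w i) (vtx (xt w) x i)| else 0) ≤
      2 * K * Rb M G Dd Z Bs H0 + 2 * H ^ (2 * M) := by
  set g : (Fin M → ↥P) → ℝ := fun w => ∏ q ∈ univ.image w, (2 : ℝ) / (q : ℕ) with hg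
  have hg0 : ∀ w, 0 ≤ g w := fun w => Finset.prod_nonneg fun q _ => by positivity
  have h1 : ∀ w : Fin M → ↥P, (if Bad G Dd Z w then
      ∑ x ∈ XX (Finset.Ico a (a + K)), |∏ i ∈ range M, kap P θ c (Finset.Ico a (a + K)) (xt w i) (vtx (xt w) x i)| else 0) ≤
      2 * K * (if RareZ M G (2 ^ Dd) Z (xt w) then g w else 0) + 2 * K * (g w * (2 / H0) ^ G) + 2 * H ^ M := by
    intro w
    have hH' : 0 ≤ H ^ M := by positivity
    have hg' := hg0 w
    split_ifs with hb hr hr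
    · have := word_abs P θ c hP hθ0 hθ1 hc0 hc1 w H0 hH0 hPH0 H hH hPH a K 0 (Nat.zero_le _)
      have h3 : 0 ≤ 2 * K * (g w * (2 / H0) ^ G) := by positivity
      simp only [pow_zero, mul_one] at this
      linarith
    · have := word_abs P θ c hP hθ0 hθ1 hc0 hc1 w H0 hH0 hPH0 H hH hPH a K G (hb.resolve_left hr)
      simp only [mul_zero, zero_add]
      linarith
    · positivity
    · positivity
  refine (Finset.sum_le_sum fun w _ => h1 w).trans ?_
  rw [Finset.sum_add_distrib, Finset.sum_add_distrib, ← Finset.mul_sum, ← Finset.mul_sum, ← Finset.sum_mul]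
  have h2 := rare_sum P (fun q hq => (hP q hq)) H0 (by linarith) hPH0 Bs hBs hsum (M := M) p0 G Dd Z
  have h3 := tame_sum (M := M) (fun q : ↥P => (2:ℝ) / (q : ℕ)) (fun q => by positivity) p0 (fun _ => True) univ
    (fun w _ => mem_univ _) Bs hBs (by rw [Finset.sum_coe_sort P (fun q => (2:ℝ) / q)]; exact hsum) M
    (fun w _ => Finset.card_image_le.trans (by simp))
  simp only [if_true, Finset.card_univ, Fintype.card_fun, Fintype.card_fin] at h3
  have h4 : ∑ w : Fin M → ↥P, 2 * H ^ M ≤ 2 * H ^ (2 * M) := by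
    rw [Finset.sum_const, Finset.card_univ, Fintype.card_fun, Fintype.card_fin, Fintype.card_coe, nsmul_eq_mul]
    push_cast
    rw [two_mul M, pow_add]
    have : (P.card : ℝ) ^ M ≤ H ^ M := by gcongr
    have := mul_le_mul_of_nonneg_right this (show 0 ≤ 2 * H ^ M by positivity)
    linarith
  have h5 : (∑ w, g w) * (2 / H0) ^ G ≤ M ^ M * (Bs ^ M * (2 / H0) ^ G) := by
    push_cast at h3
    have := mul_le_mul_of_nonneg_right h3 (show 0 ≤ (2 / H0) ^ G by positivity)
    linarith
  have h6 : ∑ w : Fin M → ↥P, (if RareZ M G (2 ^ Dd) Z (xt w) then g w else 0) ≤ _ := h2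
  unfold Rb
  have := mul_le_mul_of_nonneg_left (add_le_add h6 h5) (show 0 ≤ 2 * (K:ℝ) by positivity)
  linarith

end cls

end HR


namespace HR

open Finset

set_option linter.unusedSectionVars false

section cls2

variable {P : Finset ℕ} {M : ℕ}

lemma xt_lt (w : Fin M → ↥P) {i : ℕ} (h : i < M) : xt w i = (w ⟨i, h⟩).1 := by simp [xt, h]

lemma xt_odd (hodd : ∀ q ∈ P, Odd q) (w : Fin M → ↥P) (i : ℕ) : Odd (xt w i) := by
  unfold xt; split_ifs with h
  · exact hodd _ (w ⟨i, h⟩).2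
  · exact odd_one

lemma xt_eq (w : Fin M → ↥P) {i j : ℕ} (hi : i < M) (hj : j < M) :
    xt w i = xt w j ↔ w ⟨i, hi⟩ = w ⟨j, hj⟩ := by
  rw [xt_lt w hi, xt_lt w hj]
  exact Subtype.coe_injective.eq_iff

lemma vv_bound (w : Fin M → ↥P) (Hn : ℕ) (hPH : ∀ q ∈ P, q ≤ Hn) (i : ℕ) (hi : i ≤ M) :
    |vv (xt w) i| ≤ (M * Hn : ℕ) := by
  have : ∀ i ≤ M, |vv (xt w) i| ≤ (i * Hn : ℕ) := by
    intro i
    induction i with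
    | zero => intro _; simp [vv_zero]
    | succ i ih =>
      intro h
      rw [vv_succ]
      have h1 := ih (by omega)
      have h2 : (xt w i : ℤ) ≤ Hn := by
        rw [xt_lt w (by omega)]; exact_mod_cast hPH _ (w ⟨i, by omega⟩).2
      refine (abs_add_le _ _).trans ?_
      rw [abs_mul, abs_pow, abs_neg, abs_one, one_pow, one_mul, abs_of_nonneg (by positivity : (0:ℤ) ≤ xt w i)]
      push_cast at h1 ⊢
      linarith
  refine (this i hi).trans ?_
  exact_mod_cast Nat.mul_le_mul_right _ hi

lemma tame_of_not_bad {m W G Dd : ℕ} (hodd : ∀ q ∈ P, Odd q) (w : Fin (m * W) → ↥P) (hw : WInj m w) (Hn : ℕ)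
    (hPH : ∀ q ∈ P, q ≤ Hn) (hX : 2 * (m * W * Hn) ≤ 2 ^ Dd) (hb : ¬ Bad G Dd (2 ^ Dd) w) : Tame (xt w) m W G := by
  classical
  unfold Bad at hb
  push Not at hb
  have hb : ¬ RareC (m * W) G (2 ^ Dd) (xt w) ∧ (SpP (xt w) (m * W)).card < G := by
    refine ⟨?_, hb.2⟩
    have := hb.1
    push_cast at this
    exact this
  have hV := vv_bound w Hn hPH
  have hX' : 2 * ((m * W * Hn : ℕ) : ℤ) ≤ 2 ^ Dd := by exact_mod_cast hX
  have hinj : ∀ i j, i < m * W → j < m * W → i / m = j / m → xt w i = xt w j → i = j := by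
    intro i j hi hj h1 h2
    have := hw ⟨i, hi⟩ ⟨j, hj⟩ h1 ((xt_eq w hi hj).1 h2)
    simpa using this
  have hwin : ∀ a < W, ∀ i j, a * m ≤ i → i < a * m + m → a * m ≤ j →
      j < a * m + m → xt w i = xt w j → i = j := by
    intro a ha i j h1 h2 h3 h4 h5
    have := win_le (m := m) ha
    exact hinj i j (by omega) (by omega) (by rw [win_div h1 h2, win_div h3 h4]) h5
  refine ⟨xt_odd hodd w, hinj, ?_, ?_, ?_, ?_, ?_⟩
  · intro a ha
    by_contra h
    push Not at h
    exact hb.1 (rare_Bk _ G _ _ hV hX' (win_le ha) (hwin a ha) h.le)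
  · intro a ha
    by_contra h
    push Not at h
    exact hb.1 (rare_Fw _ G _ _ hV hX' (win_le ha) (hwin a ha) h.le)
  · intro a ha b hb'
    by_contra h
    push Not at h
    exact hb.1 (rare_Cr _ G _ _ hV hX' (win_le ha) (win_le hb') (hwin a ha) h.le)
  · intro a ha b hb'
    by_contra h
    push Not at h
    exact hb.1 (rare_Bd _ G _ _ hV hX' (win_le ha) (win_le hb') (hwin a ha) (hwin b hb') h)
  · intro a ha
    refine le_trans ?_ hb.2.le
    refine Finset.card_le_card_of_injOn (xt w) ?_ ?_
    · intro i hi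
      have := Finset.mem_inter.1 (Finset.mem_coe.1 hi)
      exact Finset.mem_coe.2 (Finset.mem_image_of_mem _ this.1)
    · intro i hi j hj h
      have h1 := Finset.mem_Ico.1 (Finset.mem_inter.1 (Finset.mem_coe.1 hi)).2
      have h2 := Finset.mem_Ico.1 (Finset.mem_inter.1 (Finset.mem_coe.1 hj)).2
      exact hwin a ha i j h1.1 h1.2 h2.1 h2.2 h

lemma chain_bad {Dd : ℕ} (hodd : ∀ q ∈ P, Odd q) (w : Fin M → ↥P) (hc : Chain w)
    (hni : ¬ Function.Injective w) (Hn : ℕ)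
    (hPH : ∀ q ∈ P, q ≤ Hn) (hX : 2 * (M * Hn) ≤ 2 ^ Dd) : Bad 1 Dd 0 w := by
  classical
  set u := xt w with hu
  have hou := xt_odd hodd w
  have hV := vv_bound w Hn hPH
  have hX' : 2 * ((M * Hn : ℕ) : ℤ) ≤ 2 ^ Dd := by exact_mod_cast hX
  have hex : ∃ d, 0 < d ∧ ∃ i, i + d < M ∧ u i = u (i + d) := by
    unfold Function.Injective at hni
    push Not at hni
    obtain ⟨a, b, h1, h2⟩ := hni
    rcases lt_or_gt_of_ne h2 with h | h
    · refine ⟨b.1 - a.1, Nat.sub_pos_of_lt h, a.1, ?_, ?_⟩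
      · have := b.2; have : a.1 < b.1 := h; omega
      · have : a.1 < b.1 := h
        rw [show a.1 + (b.1 - a.1) = b.1 by omega, hu, xt_eq w a.2 b.2]; exact h1
    · refine ⟨a.1 - b.1, Nat.sub_pos_of_lt h, b.1, ?_, ?_⟩
      · have := a.2; have : b.1 < a.1 := h; omega
      · have : b.1 < a.1 := h
        rw [show b.1 + (a.1 - b.1) = a.1 by omega, hu, xt_eq w b.2 a.2]; exact h1.symm
  have hspec := Nat.find_spec hex
  have hmin : ∀ i j, i < j → j < M → j < i + Nat.find hex → u i ≠ u j := by
    intro i j h1 h2 h3 h4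
    refine Nat.find_min hex (m := j - i) (by omega) ⟨by omega, i, by omega, ?_⟩
    rw [show i + (j - i) = j by omega]; exact h4
  set d := Nat.find hex
  obtain ⟨hd0, i, hi, he⟩ := hspec
  have hd1 : d ≠ 1 := by
    intro h
    rw [h] at hi he
    exact hc ⟨i, by omega⟩ ⟨i + 1, hi⟩ rfl ((xt_eq w (by omega) hi).1 he)
  obtain ⟨j, hj⟩ : ∃ j, j = i + d := ⟨_, rfl⟩
  rw [← hj] at hi he
  by_cases hs : (u i : ℤ) ∣ vv u j - vv u i
  · left
    by_cases hK : vv u j - vv u (i + 1) = 0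
    · refine ⟨0, 1, 0, fun _ => i + 1, fun _ => i + 2, fun _ => j, fun _ => 0, fun _ => 0, by simp, by simp, by simp, ?_⟩
      intro k hk
      have hv : vv u j - vv u (i + 2) = -(vv u (i + 1 + 1) - vv u (i + 1)) := by
        rw [show i + 2 = i + 1 + 1 by rfl]; linarith
      have hKk : Kk u 0 1 0 (i + 2) j 0 0 = vv u j - vv u (i + 2) := by unfold Kk; ring
      refine ⟨by beta_reduce; omega, by beta_reduce; omega, by beta_reduce; omega, by beta_reduce; omega, by beta_reduce; omega, by beta_reduce; omega, le_rfl, ?_, ?_, ?_, ?_, ?_⟩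
      · beta_reduce; rw [hKk, hv, neg_ne_zero, sub_ne_zero]
        exact vv_ne hou (i + 1)
      · beta_reduce; rw [hKk]
        exact dif_le _ _ _ _ hV hX' (by omega) (by omega)
      · beta_reduce; rw [hKk, hv, dvd_neg]
        exact w_dvd (i + 1)
      · intro l hl j' _ _
        beta_reduce at hl ⊢
        exact (hmin (i + 1) l (by omega) (by omega) (by omega)).symm
      · intro j' _ _; omega
    · refine ⟨0, 1, 0, fun _ => j, fun _ => i + 1, fun _ => j, fun _ => 0, fun _ => 0, by simp, by simp, by simp, ?_⟩
      intro k hk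
      have hKk : Kk u 0 1 0 (i + 1) j 0 0 = vv u j - vv u (i + 1) := by unfold Kk; ring
      refine ⟨by beta_reduce; omega, by beta_reduce; omega, by beta_reduce; omega, by beta_reduce; omega, by beta_reduce; omega, by beta_reduce; omega, le_rfl, ?_, ?_, ?_, ?_, ?_⟩
      · beta_reduce; rw [hKk]; exact hK
      · beta_reduce; rw [hKk]
        exact dif_le _ _ _ _ hV hX' (by omega) (by omega)
      · beta_reduce; rw [hKk, ← hu, ← he]
        rw [show vv u j - vv u (i + 1) = (vv u j - vv u i) - (vv u (i + 1) - vv u i) by ring]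
        exact dvd_sub hs (w_dvd (w := u) i)
      · intro l hl j' _ _
        beta_reduce at hl ⊢
        exact (hmin l j (by omega) (by omega) (by omega))
      · intro j' _ _; omega
  · right
    rw [Nat.succ_le_iff, Finset.card_pos]
    exact ⟨u i, mem_SpP.2 ⟨i, by omega, rfl, j, i, hi, by omega, he.symm, rfl, hs⟩⟩

end cls2

end HR


namespace HR

open Finset

set_option linter.unusedSectionVars false

section clo

open Classical in
/-- Indices whose letter occurs only once. -/
noncomputable def Lone (u : ℕ → ℕ) (M : ℕ) : Finset ℕ :=
  (range M).filter fun i => ∀ j < M, u j = u i → j = i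

lemma mem_Lone {u : ℕ → ℕ} {M i : ℕ} : i ∈ Lone u M ↔ i < M ∧ ∀ j < M, u j = u i → j = i := by
  classical
  unfold Lone; rw [mem_filter, mem_range]

lemma two_card_im (u : ℕ → ℕ) (M : ℕ) : 2 * ((range M).image u).card ≤ M + (Lone u M).card := by
  classical
  have h1 : M = ∑ q ∈ (range M).image u, ((range M).filter fun i => u i = q).card := by
    have := Finset.card_eq_sum_card_image u (range M)
    rwa [card_range] at this
  have h2 : (Lone u M).card = ∑ q ∈ (range M).image u, ((Lone u M).filter fun i => u i = q).card := by
    refine Finset.card_eq_sum_card_fiberwise ?_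
    intro i hi
    exact Finset.mem_coe.2 (Finset.mem_image_of_mem _ (mem_range.2 (mem_Lone.1 (Finset.mem_coe.1 hi)).1))
  suffices h : 2 * ((range M).image u).card ≤ ∑ q ∈ (range M).image u, ((range M).filter fun i => u i = q).card +
      ∑ q ∈ (range M).image u, ((Lone u M).filter fun i => u i = q).card by
    rwa [← h1, ← h2] at h
  rw [← Finset.sum_add_distrib, mul_comm, ← smul_eq_mul, ← Finset.sum_const]
  refine Finset.sum_le_sum fun q hq => ?_
  obtain ⟨i, hi, rfl⟩ := Finset.mem_image.1 hq
  rw [mem_range] at hi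
  by_cases hl : i ∈ Lone u M
  · have e1 : 0 < ((range M).filter fun j => u j = u i).card :=
      Finset.card_pos.2 ⟨i, mem_filter.2 ⟨mem_range.2 hi, rfl⟩⟩
    have e2 : 0 < ((Lone u M).filter fun j => u j = u i).card :=
      Finset.card_pos.2 ⟨i, mem_filter.2 ⟨hl, rfl⟩⟩
    omega
  · rw [mem_Lone] at hl
    push Not at hl
    obtain ⟨j, hj, h3, h4⟩ := hl hi
    have e1 : 1 < ((range M).filter fun j => u j = u i).card :=
      Finset.one_lt_card.2 ⟨i, mem_filter.2 ⟨mem_range.2 hi, rfl⟩, j, mem_filter.2 ⟨mem_range.2 hj, h3⟩, h4.symm⟩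
    omega

lemma card_im {P : Finset ℕ} {M : ℕ} (w : Fin M → ↥P) :
    (univ.image w).card = ((range M).image (xt w)).card := by
  have := prod_im P w (fun _ => (2:ℝ))
  rw [prod_const, prod_const] at this
  exact (pow_right_injective₀ (by norm_num) (by norm_num) this).symm

/-- Cancelled lone primes. -/
noncomputable def CLP (u : ℕ → ℕ) (M : ℕ) : Finset ℕ := (Lone u M \ LU u M).image u

lemma card_CLP (u : ℕ → ℕ) (M : ℕ) : (Lone u M).card ≤ (CLP u M).card + (LU u M).card := by
  unfold CLP
  rw [Finset.card_image_of_injOn]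
  · have := Finset.card_le_card_sdiff_add_card (s := Lone u M) (t := LU u M)
    exact this
  · intro i hi j hj h
    have h1 := mem_Lone.1 (mem_sdiff.1 (mem_coe.1 hi)).1
    have h2 := mem_Lone.1 (mem_sdiff.1 (mem_coe.1 hj)).1
    exact h2.2 i h1.1 h

lemma mq_two (u : ℕ → ℕ) (M : ℕ) (hM : 2 ≤ M) (hv : vv u M = 0) (i : ℕ) (hi : i ∈ Lone u M) (hl : i ∉ LU u M)
    (s : Bool) (n : ℤ) (hn : (u i : ℤ) ∣ n + sg s * vv u i) :
    mq (fun i => sg s * vv u i) M (u i) n = 2 := by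
  classical
  obtain ⟨hiM, hlone⟩ := mem_Lone.1 hi
  have hdv : ∀ j, (u i : ℤ) ∣ n + sg s * vv u j ↔ (u i : ℤ) ∣ vv u j - vv u i := by
    intro j
    rw [show n + sg s * vv u j = (n + sg s * vv u i) + sg s * (vv u j - vv u i) by ring, dvd_add_right hn]
    rcases sg_eq s with h | h <;> rw [h]
    · rw [one_mul]
    · rw [neg_one_mul, dvd_neg]
  have hne : i ≠ (i + 1) % M := by
    rcases Nat.lt_or_ge (i + 1) M with h | h
    · rw [Nat.mod_eq_of_lt h]; omega
    · have : i + 1 = M := by omega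
      rw [this, Nat.mod_self]; omega
  have hset : ((range M).filter fun j => (u i : ℤ) ∣ n + sg s * vv u j) = {i, (i + 1) % M} := by
    ext j
    rw [mem_filter, mem_range, hdv, mem_insert, mem_singleton]
    constructor
    · rintro ⟨h1, h2⟩
      by_contra h
      push Not at h
      refine hl ?_
      unfold LU
      rw [mem_filter, mem_range]
      exact ⟨hiM, hlone, j, h1, h.1, h.2, h2⟩
    · rintro (rfl | rfl)
      · exact ⟨hiM, by simp⟩
      · refine ⟨Nat.mod_lt _ (by omega), ?_⟩
        rcases Nat.lt_or_ge (i + 1) M with h | h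
        · rw [Nat.mod_eq_of_lt h]; exact w_dvd i
        · have : i + 1 = M := by omega
          have h3 := w_dvd (w := u) i
          rw [this, hv] at h3
          rw [this, Nat.mod_self, vv_zero]; exact h3
  unfold mq
  rw [hset, Finset.card_pair hne]

variable (P : Finset ℕ) (θ c : ℝ)

lemma closed_word (hP : ∀ q ∈ P, q.Prime) (L : ℝ) (hL : 1 ≤ L) (hθ : θ = 1 - 1 / L) (hc : c = θ ^ 2)
    (hℓ : ∑ q ∈ P, (1 : ℝ) / q ≤ L)
    {M : ℕ} (hM : 2 ≤ M) (w : Fin M → ↥P) (hv : vv (xt w) M = 0)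
    (H0 : ℝ) (hH0 : M ≤ H0) (hPH0 : ∀ q ∈ P, H0 ≤ (q : ℝ))
    (H : ℝ) (hH : 1 ≤ H) (hPH : ∀ q ∈ P, (q : ℝ) ≤ H) (hPc : (P.card : ℝ) ≤ H) (a : ℤ) (K R G : ℕ)
    (hG : G ≤ (CLP (xt w) M).card) :
    |∑ x ∈ XX (Finset.Ico a (a + K)), ∏ i ∈ range M, kap P θ c (Finset.Ico a (a + K)) (xt w i) (vtx (xt w) x i)| ≤
      2 * (K * ((∏ q ∈ univ.image w, (2 : ℝ) / (q : ℕ)) * ((M / H0) ^ G * Real.exp M)) +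
        K * ((∏ q ∈ univ.image w, (2:ℝ) / (q : ℕ)) * (M ^ R / R.factorial)) +
        (R + 1) * H ^ (M + 2 * R)) := by
  classical
  have hM' : (2:ℝ) ≤ M := by exact_mod_cast hM
  have hθ0 : 0 ≤ θ := by
    rw [hθ, sub_nonneg, div_le_one (by linarith)]; exact hL
  have hθ1 : θ ≤ 1 := by
    rw [hθ]; have : 0 ≤ 1 / L := by positivity
    linarith
  have hc0 : 0 ≤ c := by rw [hc]; positivity
  have hc1 : c ≤ 1 := by rw [hc]; exact pow_le_one₀ hθ0 hθ1
  refine (closed_bound P θ c hP L hL hθ hc hℓ (by omega) w hv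
    (fun q => if q ∈ CLP (xt w) M then M / (q : ℝ) ^ 2 else 2 / q)
    ?_ H hH hPH hPc a K R).trans ?_
  · intro q hq s
    have hqP := im_sub P w hq
    have hq0 : 0 < q := (hP q hqP).pos
    beta_reduce
    split_ifs with h
    · obtain ⟨i, hi, rfl⟩ := Finset.mem_image.1 h
      rw [mem_sdiff] at hi
      obtain ⟨hiM, hlone⟩ := mem_Lone.1 hi.1
      have hX : ∀ n, Xd c (xt w) (fun i => sg s * vv (xt w) i) M (xt w i) n = dv c (xt w i) (n + sg s * vv (xt w) i) := by
        intro n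
        unfold Xd
        have : ((range M).filter fun j => xt w j = xt w i) = {i} := by
          ext j
          rw [mem_filter, mem_range, mem_singleton]
          exact ⟨fun h => hlone j h.1 h.2, fun h => by subst h; exact ⟨hiM, rfl⟩⟩
        rw [this, prod_singleton]
      simp only [hX]
      rw [hc, hθ]
      exact lone_avg hL hq0 _ (fun n hn => mq_two _ M hM hv i hi.1 hi.2 s n hn)
    · obtain ⟨i, hi, h1⟩ := Finset.mem_image.1 hq
      refine le_trans ?_ (Xd_avg hc0 hc1 (t := fun i => sg s * vv (xt w) i) hq0 ⟨i, Finset.mem_range.1 hi, h1⟩)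
      unfold avg
      rw [abs_div, abs_of_pos (show (0:ℝ) < q by exact_mod_cast hq0)]
      gcongr
      refine (abs_sum_le_sum_abs _ _).trans (Finset.sum_le_sum fun n _ => ?_)
      rw [abs_mul, abs_of_nonneg (pow_nonneg hθ0 _)]
      exact mul_le_of_le_one_right (abs_nonneg _) (pow_le_one₀ hθ0 hθ1)
  · have h3 := prod_gain ((range M).image (xt w)) (CLP (xt w) M) ?_
      (fun q => if q ∈ CLP (xt w) M then M / (q : ℝ) ^ 2 else 2 / q) (fun q => (2:ℝ) / q) ?_ ?_ (M / H0)
      (div_nonneg (by positivity) (by linarith))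
      (by rw [div_le_one (by linarith)]; linarith) ?_ ?_ G hG
    · rw [prod_im P w (fun q => (2:ℝ) / q)] at h3 ⊢
      have := mul_le_mul_of_nonneg_left h3 (show 0 ≤ K * Real.exp M by positivity)
      linarith
    · intro q hq
      obtain ⟨i, hi, rfl⟩ := Finset.mem_image.1 hq
      exact Finset.mem_image_of_mem _ (Finset.mem_range.2 (mem_Lone.1 (mem_sdiff.1 hi).1).1)
    · intro q hq
      beta_reduce; split_ifs <;> positivity
    · intro q hq; positivity
    · intro q hq
      rw [if_pos hq]
      obtain ⟨i, hi, rfl⟩ := Finset.mem_image.1 hq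
      have hqP := im_sub P w (Finset.mem_image_of_mem _ (Finset.mem_range.2 (mem_Lone.1 (mem_sdiff.1 hi).1).1))
      have h5 := hPH0 _ hqP
      have h6 : (0:ℝ) < xt w i := by linarith
      have h7 : 0 < H0 := by linarith
      rw [div_mul_div_comm, div_le_div_iff₀ (by positivity) (by positivity)]
      have : (xt w i:ℝ) * H0 ≤ xt w i * xt w i := by gcongr
      have := mul_le_mul_of_nonneg_left this (show (0:ℝ) ≤ M by positivity)
      have h8 : (0:ℝ) ≤ M * (xt w i * xt w i) := by positivity
      nlinarith
    · intro q hq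
      have h5 := hPH0 q (im_sub P w hq)
      have h6 : (0:ℝ) < q := by linarith
      beta_reduce; split_ifs
      · rw [div_le_div_iff₀ (by positivity) (by positivity)]
        nlinarith
      · exact le_rfl

end clo

end HR


namespace HR

open Finset

set_option linter.unusedSectionVars false

section trc

/-- Number of possible patterns. -/
def PiC (m W G : ℕ) : ℕ := (W * (m * W * (m * W * 3 + 1)) + 1) ^ (W * (W * (15 * (G * G))))

/-- Number of distinct letters of a good word (twice). -/
def kC (m W G : ℕ) : ℕ := (m * W + G + (W * (W * (15 * (G * G))) + W * (4 * G))) / 2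

variable (P : Finset ℕ) (θ c : ℝ)

open Classical in
lemma trace_eq (J : Finset ℤ) (m W : ℕ) (hm : 0 < m) (hW : Even W) :
    ∑ y ∈ XX J, ((TT (BB P θ c J) m) ^ W) (Pi.single y 1) y =
      ∑ w : Fin (m * W) → ↥P, if WInj m w ∧ vv (xt w) (m * W) = 0 then
        ∑ x ∈ XX J, ∏ i ∈ range (m * W), kap P θ c J (xt w i) (vtx (xt w) x i) else 0 := by
  have hev : (m * W) % 2 = 0 := by
    obtain ⟨r, hr⟩ := hW
    rw [hr, show m * (r + r) = 2 * (m * r) by ring, Nat.mul_mod_right]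
  rw [TT_pow _ _ hm]
  simp only [LinearMap.sum_apply, Finset.sum_apply]
  rw [Finset.sum_comm]
  refine Finset.sum_congr rfl fun w _ => ?_
  by_cases h1 : WInj m w
  · simp only [if_pos h1, opw_apply]
    by_cases h2 : vv (xt w) (m * W) = 0
    · rw [if_pos ⟨h1, h2⟩]
      refine Finset.sum_congr rfl fun x _ => ?_
      have : vtx (xt w) x (m * W) = x := by
        unfold vtx; rw [h2, hev]; simp
      rw [this, Pi.single_eq_same, mul_one]
    · rw [if_neg (fun h => h2 h.2)]
      refine Finset.sum_eq_zero fun x _ => ?_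
      rw [Pi.single_eq_of_ne, mul_zero]
      intro h
      have h3 := congrArg Prod.fst h
      unfold vtx at h3
      simp only [add_eq_left, mul_eq_zero] at h3
      rcases h3 with h3 | h3
      · rcases sg_eq x.2 with h4 | h4 <;> rw [h4] at h3 <;> omega
      · exact h2 h3
  · rw [if_neg (show ¬ (WInj m w ∧ vv (xt w) (m * W) = 0) from fun h => h1 h.1)]
    refine Finset.sum_eq_zero fun x _ => ?_
    simp [h1]

/-- The trace density. -/
noncomputable def Gam (m W G Dd R : ℕ) (Bs H0 : ℝ) : ℝ :=
  2 * (Rb (m * W) G Dd (2 ^ Dd) Bs H0 + PiC m W G * (Bs ^ (m * W) * ((((m * W : ℕ) : ℝ) / H0) ^ G * Real.exp ((m * W : ℕ) : ℝ) +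
    ((m * W : ℕ) : ℝ) ^ R / R.factorial) + Bs ^ (kC m W G) * Real.exp ((m * W : ℕ) : ℝ)))

set_option maxHeartbeats 1000000 in
open Classical in
theorem trace_le (hP : ∀ q ∈ P, q.Prime) (hodd : ∀ q ∈ P, Odd q) (L : ℝ) (hL : 1 ≤ L) (hθ : θ = 1 - 1 / L)
    (hc : c = θ ^ 2) (hℓ : ∑ q ∈ P, (1 : ℝ) / q ≤ L) (p0 : ↥P)
    (m W G Dd R : ℕ) (hm : 0 < m) (hW : Even W) (hW0 : 0 < W) (hG : 1 ≤ G)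
    (H0 : ℝ) (hH0 : ((m * W : ℕ) : ℝ) ≤ H0) (hPH0 : ∀ q ∈ P, H0 ≤ (q : ℝ))
    (Hn : ℕ) (hPHn : ∀ q ∈ P, q ≤ Hn) (hX : 2 * (m * W * Hn) ≤ 2 ^ Dd)
    (H : ℝ) (hH : 1 ≤ H) (hPH : ∀ q ∈ P, (q : ℝ) ≤ H) (hPc : (P.card : ℝ) ≤ H)
    (Bs : ℝ) (hBs : 1 ≤ Bs) (hsum : ∑ p ∈ P, (2 : ℝ) / p ≤ Bs) (a : ℤ) (K : ℕ) :
    ∑ y ∈ XX (Finset.Ico a (a + K)), ((TT (BB P θ c (Finset.Ico a (a + K))) m) ^ W) (Pi.single y 1) y ≤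
      K * Gam m W G Dd R Bs H0 + 2 * (R + 2) * H ^ (2 * (m * W) + 2 * R) := by
  have hθ0 : 0 ≤ θ := by
    rw [hθ, sub_nonneg, div_le_one (by linarith)]; exact hL
  have hθ1 : θ ≤ 1 := by
    rw [hθ]; have : 0 ≤ 1 / L := by positivity
    linarith
  have hc0 : 0 ≤ c := by rw [hc]; positivity
  have hc1 : c ≤ 1 := by rw [hc]; exact pow_le_one₀ hθ0 hθ1
  rw [trace_eq P θ c _ m W hm hW]
  set M := m * W with hMdef
  obtain ⟨Pi, hPi, hPiC⟩ : ∃ Pi : Finset (Fin M → Fin M), (∀ w : Fin M → ↥P, Tame (xt w) m W G → pat w ∈ Pi) ∧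
      Pi.card ≤ PiC m W G := tame_pats (m := m) (W := W) P hG
  have hM2 : 2 ≤ M := by
    obtain ⟨r, hr⟩ := hW
    have : 2 ≤ W := by omega
    calc 2 ≤ W := this
      _ ≤ m * W := Nat.le_mul_of_pos_left _ hm
  have hM2' : (2:ℝ) ≤ M := by exact_mod_cast hM2
  set J := Finset.Ico a (a + (K:ℤ)) with hJ
  set g : (Fin M → ↥P) → ℝ := fun w => ∏ q ∈ univ.image w, (2 : ℝ) / (q : ℕ) with hg
  have hg0 : ∀ w, 0 ≤ g w := fun w => Finset.prod_nonneg fun q _ => by positivity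
  set S : (Fin M → ↥P) → ℝ := fun w => ∑ x ∈ XX J, ∏ i ∈ range M, kap P θ c J (xt w i) (vtx (xt w) x i) with hS
  set S' : (Fin M → ↥P) → ℝ := fun w => ∑ x ∈ XX J, |∏ i ∈ range M, kap P θ c J (xt w i) (vtx (xt w) x i)| with hS'
  set ε : ℝ := M / H0 with hε
  have hε0 : 0 ≤ ε := div_nonneg (by positivity) (by linarith)
  set k := kC m W G with hk
  let R1 : (Fin M → ↥P) → Prop := fun w => Tame (xt w) m W G
  obtain ⟨R2, hR2d⟩ : ∃ R2 : (Fin M → ↥P) → Prop, ∀ w, R2 w ↔ (Tame (xt w) m W G ∧ (univ.image w).card ≤ k) :=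
    ⟨_, fun w => Iff.rfl⟩
  set er : ℝ := (R + 1) * H ^ (M + 2 * R) with her
  have her0 : 0 ≤ er := by positivity
  set t1 : ℝ := ε ^ G * Real.exp M + M ^ R / R.factorial with ht1
  have ht10 : 0 ≤ t1 := by positivity
  have hw : ∀ w : Fin M → ↥P, (if WInj m w ∧ vv (xt w) M = 0 then S w else 0) ≤
      (if Bad G Dd (2 ^ Dd) w then S' w else 0) + 2 * K * t1 * (if R1 w then g w else 0) +
        2 * K * Real.exp M * (if R2 w then g w else 0) + 2 * er := by
    intro w
    have hS'0 : 0 ≤ S' w := Finset.sum_nonneg fun _ _ => abs_nonneg _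
    have hgw := hg0 w
    have n1 : 0 ≤ (if Bad G Dd (2 ^ Dd) w then S' w else 0) := by split_ifs <;> simp [hS'0]
    have n2 : 0 ≤ (if R1 w then g w else 0) := by split_ifs <;> simp [hgw]
    have n3 : 0 ≤ (if R2 w then g w else 0) := by split_ifs <;> simp [hgw]
    have n4 : 0 ≤ 2 * K * t1 * (if R1 w then g w else 0) := by positivity
    have n5 : 0 ≤ 2 * K * Real.exp M * (if R2 w then g w else 0) := by positivity
    by_cases h1 : WInj m w ∧ vv (xt w) M = 0
    · rw [if_pos h1]
      by_cases hb : Bad G Dd (2 ^ Dd) w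
      · have : S w ≤ S' w := Finset.sum_le_sum fun x _ => le_abs_self _
        rw [if_pos hb] at n1 ⊢
        linarith
      · have hT : Tame (xt w) m W G := tame_of_not_bad hodd w h1.1 Hn hPHn hX hb
        have hR1 : R1 w := hT
        rw [if_pos hR1] at n4 ⊢
        by_cases hcl : G ≤ (CLP (xt w) M).card
        · have := closed_word P θ c hP L hL hθ hc hℓ hM2 w h1.2 H0 hH0 hPH0 H hH hPH hPc a K R G hcl
          have h3 := (le_abs_self _).trans this
          have h4 : S w ≤ _ := h3
          have h5 : 2 * K * t1 * g w = 2 * (K * (g w * (ε ^ G * Real.exp M)) + K * (g w * (M ^ R / R.factorial))) := by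
            rw [ht1]; ring
          linarith
        · have hR2 : R2 w := by
            refine (hR2d w).2 ⟨hT, ?_⟩
            rw [card_im, hk]
            unfold kC
            rw [Nat.le_div_iff_mul_le (by norm_num)]
            have e1 := two_card_im (xt w) M
            have e2 := card_CLP (xt w) M
            have e3 : (LU (xt w) M).card ≤ _ := hT.card_LU hG
            omega
          rw [if_pos hR2]
          have := closed_word P θ c hP L hL hθ hc hℓ hM2 w h1.2 H0 hH0 hPH0 H hH hPH hPc a K R 0 (Nat.zero_le _)
          have h3 := (le_abs_self _).trans this
          have h4 : S w ≤ _ := h3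
          rw [pow_zero, one_mul] at h4
          have h5 : 2 * K * (M ^ R / R.factorial) * g w ≤ 2 * K * t1 * g w := by
            have : 0 ≤ ε ^ G * Real.exp M := by positivity
            have : M ^ R / R.factorial ≤ t1 := by rw [ht1]; linarith
            gcongr
          linarith
    · rw [if_neg h1]
      positivity
  refine (Finset.sum_le_sum fun w _ => hw w).trans ?_
  rw [Finset.sum_add_distrib, Finset.sum_add_distrib, Finset.sum_add_distrib, ← Finset.mul_sum, ← Finset.mul_sum]
  have hH0' : 2 ≤ H0 := by linarith
  have b1 := bad_sum P θ c hP hθ0 hθ1 hc0 hc1 (M := M) p0 H0 hH0' hPH0 Bs hBs hsum H hH hPH hPc a K G Dd (2 ^ Dd)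
  have hsum' : ∑ q : ↥P, (2:ℝ) / ((q : ℕ) : ℝ) ≤ Bs := by
    rw [Finset.sum_coe_sort P (fun q => (2:ℝ) / q)]; exact hsum
  have b2 := tame_sum (M := M) (fun q : ↥P => (2:ℝ) / (q : ℕ)) (fun q => by positivity) p0 R1 Pi
    hPi Bs hBs hsum' M (fun w _ => Finset.card_image_le.trans (by simp))
  have b3 := tame_sum (M := M) (fun q : ↥P => (2:ℝ) / (q : ℕ)) (fun q => by positivity) p0 R2 Pi
    (fun w h => hPi w ((hR2d w).1 h).1) Bs hBs hsum' k (fun w h => ((hR2d w).1 h).2)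
  have b4 : ∑ w : Fin M → ↥P, 2 * er ≤ 2 * (R + 1) * H ^ (2 * M + 2 * R) := by
    rw [Finset.sum_const, Finset.card_univ, Fintype.card_fun, Fintype.card_fin, Fintype.card_coe, nsmul_eq_mul]
    push_cast
    have : (P.card : ℝ) ^ M ≤ H ^ M := by gcongr
    have := mul_le_mul_of_nonneg_right this (show 0 ≤ 2 * er by positivity)
    refine this.trans (le_of_eq ?_)
    rw [her, show 2 * M + 2 * R = M + (M + 2 * R) by ring, pow_add H M]; ring
  have hPi' : (Pi.card : ℝ) ≤ PiC m W G := by exact_mod_cast hPiC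
  have b2' : ∑ w, (if R1 w then g w else 0) ≤ PiC m W G * Bs ^ M := by
    refine b2.trans ?_
    gcongr
  have b3' : ∑ w, (if R2 w then g w else 0) ≤ PiC m W G * Bs ^ k := by
    refine b3.trans ?_
    gcongr
  have c2 := mul_le_mul_of_nonneg_left b2' (show 0 ≤ 2 * K * t1 by positivity)
  have c3 := mul_le_mul_of_nonneg_left b3' (show 0 ≤ 2 * K * Real.exp M by positivity)
  have c4 : 2 * H ^ (2 * M) ≤ 2 * H ^ (2 * M + 2 * R) := by
    have := pow_le_pow_right₀ hH (show 2 * M ≤ 2 * M + 2 * R by omega)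
    linarith
  have hGam : Gam m W G Dd R Bs H0 = 2 * (Rb M G Dd (2 ^ Dd) Bs H0 + PiC m W G * (Bs ^ M * t1 + Bs ^ k * Real.exp M)) := rfl
  rw [hGam]
  have b1' : ∑ w, (if Bad G Dd (2 ^ Dd) w then S' w else 0) ≤ 2 * K * Rb M G Dd (2 ^ Dd) Bs H0 + 2 * H ^ (2 * M) := b1
  linarith [b1', c2, c3, b4, c4]

end trc

end HR


namespace HR

open Finset

set_option linter.unusedSectionVars false

section anb

variable (P : Finset ℕ) (θ c : ℝ)

lemma card_XX (a : ℤ) (K : ℕ) : ((XX (Finset.Ico a (a + K))).card : ℝ) = 2 * K := by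
  unfold XX
  rw [Finset.card_product]
  simp
  ring

lemma near_zero (J : Finset ℤ) (n V Hn : ℕ) (hn : 0 < n) (hPHn : ∀ q ∈ P, q ≤ Hn) (x y : ℤ × Bool)
    (hne : ((TT (BB P θ c J) n) ^ V) (Pi.single y 1) x ≠ 0) :
    x ∈ (Finset.Icc (y.1 - (n * V * Hn : ℕ)) (y.1 + (n * V * Hn : ℕ))) ×ˢ (univ : Finset Bool) := by
  classical
  by_contra hx
  refine hne ?_
  rw [TT_pow _ _ hn]
  simp only [LinearMap.sum_apply, Finset.sum_apply]
  refine Finset.sum_eq_zero fun w _ => ?_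
  by_cases h1 : WInj n w
  · rw [if_pos h1, opw_apply, Pi.single_eq_of_ne, mul_zero]
    rintro rfl
    refine hx ?_
    rw [mem_product, mem_Icc]
    refine ⟨?_, mem_univ _⟩
    have h2 := abs_le.1 (vv_bound w Hn hPHn (n * V) le_rfl)
    unfold vtx
    rcases sg_eq x.2 with h4 | h4 <;> rw [h4] <;> constructor <;> dsimp only <;> linarith [h2.1, h2.2]
  · rw [if_neg h1]; rfl

lemma opw_ip_le (J : Finset ℤ) {M : ℕ} (w : Fin M → ↥P) (h : ℤ × Bool → ℝ) (b : ℝ) (hb0 : 0 ≤ b)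
    (hb : ∀ x, |h x| ≤ b) :
    |ip (XX J) h (opw (BB P θ c J) w h)| ≤
      b ^ 2 * ∑ x ∈ XX J, |∏ i ∈ range M, kap P θ c J (xt w i) (vtx (xt w) x i)| := by
  unfold ip
  rw [Finset.mul_sum]
  refine (Finset.abs_sum_le_sum_abs _ _).trans (Finset.sum_le_sum fun x _ => ?_)
  rw [opw_apply, abs_mul, abs_mul]
  have h1 := hb x
  have h2 := hb (vtx (xt w) x M)
  calc _ ≤ b * (|∏ i ∈ range M, kap P θ c J (xt w i) (vtx (xt w) x i)| * b) := by gcongr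
    _ = _ := by ring

open Classical in
theorem an_bound (hP : ∀ q ∈ P, q.Prime) (hodd : ∀ q ∈ P, Odd q) (L : ℝ) (hL : 1 ≤ L) (hθ : θ = 1 - 1 / L)
    (hc : c = θ ^ 2) (hℓ : ∑ q ∈ P, (1 : ℝ) / q ≤ L) (p0 : ↥P)
    (n i G Dd R : ℕ) (hn : 0 < n) (hG : 1 ≤ G)
    (H0 : ℝ) (hH0 : ((n * 2 ^ (i + 1) : ℕ) : ℝ) ≤ H0) (hPH0 : ∀ q ∈ P, H0 ≤ (q : ℝ))
    (Hn : ℕ) (hPHn : ∀ q ∈ P, q ≤ Hn) (hX : 2 * (n * 2 ^ (i + 1) * Hn) ≤ 2 ^ Dd)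
    (H : ℝ) (hH : 1 ≤ H) (hPH : ∀ q ∈ P, (q : ℝ) ≤ H) (hPc : (P.card : ℝ) ≤ H)
    (Bs : ℝ) (hBs : 1 ≤ Bs) (hsum : ∑ p ∈ P, (2 : ℝ) / p ≤ Bs) (a : ℤ) (K : ℕ) (hK : 0 < K)
    (h : ℤ × Bool → ℝ) (hs : ∀ x, x ∉ XX (Finset.Ico a (a + K)) → h x = 0) (b : ℝ) (hb0 : 0 ≤ b) (hb : ∀ x, |h x| ≤ b)
    (E : ℝ) (hE : 0 ≤ E)
    (hQE : (2 * (2 * ((n * 2 ^ i * Hn : ℕ) : ℝ) + 1)) * (Gam n (2 ^ (i + 1)) G Dd R Bs H0 / 2 +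
      (R + 2) * H ^ (2 * (n * 2 ^ (i + 1)) + 2 * R) / K) ≤ E ^ (2 ^ (i + 1))) :
    |ip (XX (Finset.Ico a (a + K))) h (VV univ (BB P θ c (Finset.Ico a (a + K))) h n).1| ≤
      b ^ 2 * (2 * K) * E + b ^ 2 * (2 * K * Rb n 1 Dd 0 Bs H0 + 2 * H ^ (2 * n)) := by
  have hθ0 : 0 ≤ θ := by
    rw [hθ, sub_nonneg, div_le_one (by linarith)]; exact hL
  have hθ1 : θ ≤ 1 := by
    rw [hθ]; have : 0 ≤ 1 / L := by positivity
    linarith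
  have hc0 : 0 ≤ c := by rw [hc]; positivity
  have hc1 : c ≤ 1 := by rw [hc]; exact pow_le_one₀ hθ0 hθ1
  have hW2 : 2 ≤ 2 ^ (i + 1) := by rw [pow_succ]; have := Nat.one_le_two_pow (n := i); omega
  have hH02 : 2 ≤ H0 := by
    refine le_trans ?_ hH0
    have : 2 ≤ n * 2 ^ (i + 1) := by nlinarith
    exact_mod_cast this
  set J := Finset.Ico a (a + (K:ℤ)) with hJ
  rw [VV_sub_TT]
  refine (abs_add_le _ _).trans (add_le_add ?_ ?_)
  · have htr := trace_le P θ c hP hodd L hL hθ hc hℓ p0 n (2 ^ (i + 1)) G Dd R hn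
      ⟨2 ^ i, by rw [pow_succ]; ring⟩ (by positivity) hG H0 hH0 hPH0 Hn hPHn hX H hH hPH hPc Bs hBs hsum a K
    have := trace_bound (XX J) (TT (BB P θ c J) n) (fun f g => TT_sym _ _ (fun p f g => Bp_sym P θ c J p.1 f g) n f g) h hs b hb0 hb i
      (2 * (2 * ((n * 2 ^ i * Hn : ℕ) : ℝ) + 1)) (Gam n (2 ^ (i + 1)) G Dd R Bs H0 / 2 +
      (R + 2) * H ^ (2 * (n * 2 ^ (i + 1)) + 2 * R) / K) E hE (by positivity)
      (fun y => (Finset.Icc (y.1 - (n * 2 ^ i * Hn : ℕ)) (y.1 + (n * 2 ^ i * Hn : ℕ))) ×ˢ (univ : Finset Bool))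
      ?_ ?_ ?_ hQE
    · rw [card_XX] at this
      exact this
    · intro y _
      rw [Finset.card_product, Int.card_Icc]
      have : y.1 + ((n * 2 ^ i * Hn : ℕ) : ℤ) + 1 - (y.1 - ((n * 2 ^ i * Hn : ℕ) : ℤ)) = ((2 * (n * 2 ^ i * Hn) + 1 : ℕ) : ℤ) := by
        push_cast; ring
      rw [this, Int.toNat_natCast]
      simp only [Finset.card_univ, Fintype.card_bool]
      push_cast
      linarith
    · intro y _ x _ hne
      exact near_zero P θ c J n (2 ^ i) Hn hn hPHn x y hne
    · refine htr.trans (le_of_eq ?_)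
      rw [card_XX]
      have : (K:ℝ) ≠ 0 := by positivity
      field_simp
  · refine (Finset.abs_sum_le_sum_abs _ _).trans ?_
    have := bad_sum P θ c hP hθ0 hθ1 hc0 hc1 (M := n) p0 H0 hH02 hPH0 Bs hBs hsum H hH hPH hPc a K 1 Dd 0
    refine le_trans ?_ (mul_le_mul_of_nonneg_left this (sq_nonneg b))
    rw [Finset.mul_sum]
    refine Finset.sum_le_sum fun w _ => ?_
    by_cases h1 : Chain w ∧ ¬ Function.Injective w
    · rw [if_pos h1, if_pos (chain_bad hodd w h1.1 h1.2 Hn hPHn ?_)]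
      · exact opw_ip_le P θ c J w h b hb0 hb
      · refine le_trans ?_ hX
        have : n * Hn ≤ n * 2 ^ (i + 1) * Hn := by
          refine Nat.mul_le_mul_right _ (Nat.le_mul_of_pos_right _ (by positivity))
        omega
    · rw [if_neg h1, abs_zero]
      refine mul_nonneg (sq_nonneg b) ?_
      split_ifs
      · exact Finset.sum_nonneg fun _ _ => abs_nonneg _
      · exact le_rfl

end anb

end HR


namespace HR

open Finset

set_option linter.unusedSectionVars false

section par

lemma pow_le_exp {x t ν : ℝ} (hx0 : 0 ≤ x) (hx : x ≤ Real.exp t) (ht : 0 ≤ t) (n : ℕ) (hn : (n : ℝ) ≤ ν) :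
    x ^ n ≤ Real.exp (ν * t) := by
  calc x ^ n ≤ (Real.exp t) ^ n := by gcongr
    _ = Real.exp (n * t) := by rw [← Real.exp_nat_mul]
    _ ≤ Real.exp (ν * t) := by gcongr

/-- Parameters: `lg = log y`, `q = y^0.22`, `v = y^0.8`. -/
structure Par (y lg q v L : ℝ) : Prop where
  hy : 100 ≤ y
  hlg : Real.exp lg = y
  hlg1 : 1 ≤ lg
  hq : 2 ≤ q
  hqy : q ≤ y
  ha : 240 * q ^ 4 * lg ≤ y
  hb : 40 * y * lg ≤ q * v
  hc : 60 * (y / q) * lg ≤ v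
  hL : 2 * L ≤ y
  hL0 : 2000000 ≤ L

variable {y lg q v L : ℝ} (p : Par y lg q v L)

include p

lemma Par.y_sq {x : ℝ} (hx : x ≤ 100 * y) : x ≤ Real.exp (2 * lg) := by
  have := p.hy
  have h : Real.exp (2 * lg) = y * y := by rw [two_mul, Real.exp_add, p.hlg]
  rw [h]; nlinarith

lemma Par.piC {m W G : ℕ} (hW : (W : ℝ) ≤ q) (hG : (G : ℝ) ≤ 2 * q) (hM : ((m * W : ℕ) : ℝ) ≤ 2 * y) :
    (PiC m W G : ℝ) ≤ Real.exp y := by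
  unfold PiC
  push_cast at hM ⊢
  have hy := p.hy
  have hq := p.hq
  have hlg := p.hlg1
  have hW0 : (0:ℝ) ≤ W := by positivity
  have hM0 : (0:ℝ) ≤ m * W := by positivity
  have hexp : ((W * (W * (15 * (G * G))) : ℕ) : ℝ) ≤ 60 * q ^ 4 := by
    push_cast
    calc (W:ℝ) * (W * (15 * (G * G))) ≤ q * (q * (15 * ((2 * q) * (2 * q)))) := by gcongr
      _ = 60 * q ^ 4 := by ring
  have hbase : (W:ℝ) * (m * W * (m * W * 3 + 1)) + 1 ≤ Real.exp (4 * lg) := by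
    have h4 : Real.exp (4 * lg) = y ^ 4 := by
      rw [← p.hlg, ← Real.exp_nat_mul]; norm_num
    rw [h4]
    have hqy := p.hqy
    calc (W:ℝ) * (m * W * (m * W * 3 + 1)) + 1 ≤ y * ((2 * y) * ((2 * y) * 3 + 1)) + 1 := by
          have : (W:ℝ) ≤ y := hW.trans hqy
          gcongr
      _ ≤ y ^ 4 := by nlinarith [pow_pos (show 0 < y by linarith) 2, pow_pos (show 0 < y by linarith) 3]
  refine (pow_le_exp (by positivity) hbase (by linarith) _ hexp).trans ?_
  rw [Real.exp_le_exp]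
  have := p.ha
  linarith

lemma Par.kCb {m W G : ℕ} (hW : (W : ℝ) ≤ q) (hG : (G : ℝ) ≤ 2 * q) :
    (2 * L) ^ (kC m W G) ≤ Real.sqrt (2 * L) ^ (m * W) * Real.exp y := by
  have hy := p.hy
  have hq := p.hq
  have hlg := p.hlg1
  have hL := p.hL0
  have hs1 : 1 ≤ Real.sqrt (2 * L) := by rw [Real.one_le_sqrt]; linarith
  have h1 : (2 * L) ^ (kC m W G) = Real.sqrt (2 * L) ^ (2 * kC m W G) := by
    rw [pow_mul, Real.sq_sqrt (by linarith)]
  set U := G + (W * (W * (15 * (G * G))) + W * (4 * G)) with hU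
  have h2 : 2 * kC m W G ≤ m * W + U := by
    unfold kC; omega
  have hUb : (U : ℝ) ≤ 70 * q ^ 4 := by
    rw [hU]; push_cast
    have hW0 : (0:ℝ) ≤ W := by positivity
    have hq4 : q ≤ q ^ 4 := by
      calc q = q ^ 1 := (pow_one q).symm
        _ ≤ q ^ 4 := pow_le_pow_right₀ (by linarith) (by norm_num)
    have hq24 : q ^ 2 ≤ q ^ 4 := pow_le_pow_right₀ (by linarith) (by norm_num)
    calc (G:ℝ) + (W * (W * (15 * (G * G))) + W * (4 * G)) ≤ 2 * q + (q * (q * (15 * ((2 * q) * (2 * q)))) + q * (4 * (2 * q))) := by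
          gcongr
      _ = 2 * q + 60 * q ^ 4 + 8 * q ^ 2 := by ring
      _ ≤ _ := by linarith
  have hsy : Real.sqrt (2 * L) ≤ Real.exp lg := by
    rw [p.hlg, Real.sqrt_le_left (by linarith)]
    have := p.hL
    nlinarith
  calc (2 * L) ^ (kC m W G) ≤ Real.sqrt (2 * L) ^ (m * W + U) := by
        rw [h1]; exact pow_le_pow_right₀ hs1 h2
    _ = Real.sqrt (2 * L) ^ (m * W) * Real.sqrt (2 * L) ^ U := pow_add _ _ _
    _ ≤ _ := by
        have h3 := pow_le_exp (by linarith) hsy (by linarith) U hUb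
        have h4 : Real.exp (70 * q ^ 4 * lg) ≤ Real.exp y := by
          rw [Real.exp_le_exp]; have := p.ha
          have : 0 ≤ q ^ 4 * lg := by positivity
          linarith
        gcongr
        exact h3.trans h4

lemma Par.HG {G : ℕ} (hG : q ≤ (G : ℝ)) (hv : 0 ≤ v) : (1 / Real.exp v) ^ G ≤ Real.exp (-(40 * y * lg)) := by
  rw [one_div, ← Real.exp_neg, ← Real.exp_nat_mul, Real.exp_le_exp]
  have := p.hb
  nlinarith

lemma Par.pw {x : ℝ} (hx0 : 0 ≤ x) (hx : x ≤ 100 * y) (n : ℕ) {ν : ℝ} (hn : (n : ℝ) ≤ ν) :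
    x ^ n ≤ Real.exp (2 * ν * lg) := by
  have := pow_le_exp hx0 (p.y_sq hx) (by linarith [p.hlg1]) n hn
  convert this using 2; ring

lemma Par.eps {M G : ℕ} (hv : 0 ≤ v) (hG : q ≤ (G : ℝ)) (hG2 : (G : ℝ) ≤ 2 * q) (hM : (M : ℝ) ≤ 2 * y) :
    (2 * L) ^ M * ((M / Real.exp v) ^ G * Real.exp M) ≤ 1 := by
  have hy := p.hy
  have hlg := p.hlg1
  have hL0 := p.hL0
  have hqy := p.hqy
  have h1 := p.HG hG hv
  have h2 := p.pw (by linarith) (by linarith [p.hL] : 2 * L ≤ 100 * y) M hM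
  have h3 := p.pw (by positivity) (by linarith : (M:ℝ) ≤ 100 * y) G (by linarith : (G:ℝ) ≤ 2 * y)
  have h4 : Real.exp M ≤ Real.exp (2 * y) := by gcongr
  rw [show (M / Real.exp v : ℝ) = M * (1 / Real.exp v) by ring, mul_pow (M : ℝ) (1 / Real.exp v)]
  calc (2 * L) ^ M * ((M:ℝ) ^ G * (1 / Real.exp v) ^ G * Real.exp M)
      ≤ Real.exp (2 * (2 * y) * lg) * (Real.exp (2 * (2 * y) * lg) * Real.exp (-(40 * y * lg)) * Real.exp (2 * y)) := by
        gcongr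
    _ = Real.exp (2 * y - 32 * (y * lg)) := by
        rw [← Real.exp_add, ← Real.exp_add, ← Real.exp_add]; congr 1; ring
    _ ≤ Real.exp 0 := by
        rw [Real.exp_le_exp]; nlinarith
    _ = 1 := Real.exp_zero

lemma two_exp_le {x : ℝ} (hx : x ≤ -2) : Real.exp x ≤ 1 / 4 := by
  have h1 : Real.exp x ≤ Real.exp (-2) := by gcongr
  have h2 : Real.exp (-2) = 1 / (Real.exp 1) ^ 2 := by
    rw [← Real.exp_nat_mul, Real.exp_neg, one_div]; norm_num
  have h3 := Real.exp_one_gt_d9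
  have h4 : 1 / (Real.exp 1) ^ 2 ≤ 1 / 4 := by
    apply div_le_div_of_nonneg_left <;> nlinarith
  linarith

lemma Par.rb {M G Dd : ℕ} (hv : 0 ≤ v) (hG : q ≤ (G : ℝ)) (hG2 : (G : ℝ) ≤ 2 * q) (hM : (M : ℝ) ≤ 2 * y)
    (hDd : (Dd : ℝ) ≤ 4 * y) : Rb M G Dd (2 ^ Dd) (2 * L) (Real.exp v) ≤ 1 := by
  have hy := p.hy
  have hlg := p.hlg1
  have hL0 := p.hL0
  have hqy := p.hqy
  have h1 := p.HG hG hv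
  have h2 := p.pw (by linarith) (by linarith [p.hL] : 2 * L ≤ 100 * y) M hM
  have h3 := p.pw (by positivity) (by linarith : (2 * Dd:ℝ) ≤ 100 * y) G (by linarith : (G:ℝ) ≤ 2 * y)
  have h3' := p.pw (by norm_num) (by linarith : (2:ℝ) ≤ 100 * y) G (by linarith : (G:ℝ) ≤ 2 * y)
  have h4 := p.pw (by positivity) (by linarith : (M:ℝ) ≤ 100 * y) M hM
  have h5 := p.pw (by positivity) (by linarith : (M + 1:ℝ) ≤ 100 * y) (5 * G) (by push_cast; linarith [p.ha, show 10 * q ≤ q ^ 4 * 2 by nlinarith [pow_le_pow_left₀ (by norm_num) p.hq 3, p.hq], show q ^ 4 * 1 ≤ q ^ 4 * lg by gcongr] : ((5 * G : ℕ):ℝ) ≤ y / 2)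
  have h6 : (2 * ((2 ^ Dd : ℕ) : ℝ) + 1) * 9 ≤ Real.exp (8 * y) := by
    have e1 : (2:ℝ) ^ Dd ≤ Real.exp (4 * y * 1) := pow_le_exp (by norm_num) (by linarith [Real.exp_one_gt_d9]) (by norm_num) _ hDd
    have e2 : (27:ℝ) ≤ Real.exp (4 * y) := by linarith [Real.add_one_le_exp (4 * y)]
    have e3 : (1:ℝ) ≤ 2 ^ Dd := one_le_pow₀ (by norm_num)
    rw [mul_one] at e1
    push_cast
    calc (2 * (2:ℝ) ^ Dd + 1) * 9 ≤ 27 * 2 ^ Dd := by linarith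
      _ ≤ Real.exp (4 * y) * Real.exp (4 * y) := by gcongr
      _ = _ := by rw [← Real.exp_add]; congr 1; ring
  unfold Rb
  have t1 : (2 * ((2 ^ Dd : ℕ) : ℝ) + 1) * 9 * (M + 1) ^ (5 * G) * (M ^ M * ((2 * L) ^ M * (2 * Dd / Real.exp v) ^ G)) ≤ 1 / 4 := by
    rw [show (2 * Dd / Real.exp v : ℝ) = (2 * Dd) * (1 / Real.exp v) by ring, mul_pow (2 * Dd : ℝ) (1 / Real.exp v)]
    calc _ ≤ Real.exp (8 * y) * Real.exp (2 * (y / 2) * lg) * (Real.exp (2 * (2 * y) * lg) * (Real.exp (2 * (2 * y) * lg) *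
            (Real.exp (2 * (2 * y) * lg) * Real.exp (-(40 * y * lg))))) := by gcongr
      _ = Real.exp (8 * y - 27 * (y * lg)) := by
          rw [← Real.exp_add, ← Real.exp_add, ← Real.exp_add, ← Real.exp_add, ← Real.exp_add]; congr 1; ring
      _ ≤ 1 / 4 := two_exp_le p (by nlinarith)
  have t2 : (M:ℝ) ^ M * ((2 * L) ^ M * (2 / Real.exp v) ^ G) ≤ 1 / 4 := by
    rw [show (2 / Real.exp v : ℝ) = 2 * (1 / Real.exp v) by ring, mul_pow (2 : ℝ) (1 / Real.exp v)]
    calc _ ≤ (Real.exp (2 * (2 * y) * lg) * (Real.exp (2 * (2 * y) * lg) *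
            (Real.exp (2 * (2 * y) * lg) * Real.exp (-(40 * y * lg))))) := by gcongr
      _ = Real.exp (- 28 * (y * lg)) := by
          rw [← Real.exp_add, ← Real.exp_add, ← Real.exp_add]; congr 1; ring
      _ ≤ 1 / 4 := two_exp_le p (by nlinarith)
  linarith

lemma Par.rb1 {n Dd : ℕ} (hn : (n : ℝ) ≤ 4 * (y / q)) (hDd : (Dd : ℝ) ≤ 4 * y) :
    Rb n 1 Dd 0 (2 * L) (Real.exp v) ≤ 1 / 2 := by
  have hy := p.hy
  have hlg := p.hlg1
  have hL0 := p.hL0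
  have hqy := p.hqy
  have hq := p.hq
  have hyq : 1 ≤ y / q := by rw [le_div_iff₀ (by linarith)]; linarith
  have hyq2 : y / q ≤ y / 2 := by gcongr
  have hc := p.hc
  have h2 : (2 * L) ^ n ≤ Real.exp (4 * (y / q) * lg) := pow_le_exp (by linarith) (by rw [p.hlg]; exact p.hL) (by linarith) n hn
  have hny : (n:ℝ) ≤ 2 * y := by linarith
  have h4 : (n:ℝ) ^ n ≤ Real.exp (2 * (4 * (y / q)) * lg) := p.pw (by positivity) (by linarith) n hn
  have h5 : (n + 1 : ℝ) ^ (5 * 1) ≤ Real.exp (2 * 5 * lg) :=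
    p.pw (by positivity) (by linarith : (n + 1:ℝ) ≤ 100 * y) (5 * 1) (by norm_num)
  have h6 : (2 * Dd : ℝ) ≤ Real.exp (2 * lg) := p.y_sq (by linarith)
  have h7 : (9 : ℝ) ≤ Real.exp (2 * lg) := p.y_sq (by linarith)
  have h8 : (2 : ℝ) ≤ Real.exp (2 * lg) := p.y_sq (by linarith)
  have h9 : Real.exp (-v) ≤ Real.exp (-(60 * (y / q) * lg)) := by
    rw [Real.exp_le_exp]; linarith
  have hyl : 1 ≤ (y / q) * lg := by nlinarith
  have hll : lg ≤ (y / q) * lg := by nlinarith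
  unfold Rb
  have t1 : (2 * ((0 : ℕ) : ℝ) + 1) * 9 * (n + 1) ^ (5 * 1) * (n ^ n * ((2 * L) ^ n * (2 * Dd / Real.exp v) ^ 1)) ≤ 1 / 4 := by
    rw [show (2 * Dd / Real.exp v : ℝ) = (2 * Dd) * Real.exp (-v) by rw [Real.exp_neg]; ring]
    calc _ = 9 * (n + 1 : ℝ) ^ (5 * 1) * ((n : ℝ) ^ n * ((2 * L) ^ n * ((2 * Dd) * Real.exp (-v)))) := by
          simp
      _ ≤ Real.exp (2 * lg) * Real.exp (2 * 5 * lg) * (Real.exp (2 * (4 * (y / q)) * lg) * (Real.exp (4 * (y / q) * lg) *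
            (Real.exp (2 * lg) * Real.exp (-(60 * (y / q) * lg))))) := by gcongr
      _ = Real.exp (14 * lg - 48 * ((y / q) * lg)) := by
          rw [← Real.exp_add, ← Real.exp_add, ← Real.exp_add, ← Real.exp_add, ← Real.exp_add]; congr 1; ring
      _ ≤ 1 / 4 := two_exp_le p (by linarith)
  have t2 : (n:ℝ) ^ n * ((2 * L) ^ n * (2 / Real.exp v) ^ 1) ≤ 1 / 4 := by
    rw [show (2 / Real.exp v : ℝ) = 2 * Real.exp (-v) by rw [Real.exp_neg]; ring, pow_one]
    calc _ ≤ (Real.exp (2 * (4 * (y / q)) * lg) * (Real.exp (4 * (y / q) * lg) *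
            (Real.exp (2 * lg) * Real.exp (-(60 * (y / q) * lg))))) := by gcongr
      _ = Real.exp (2 * lg - 48 * ((y / q) * lg)) := by
          rw [← Real.exp_add, ← Real.exp_add, ← Real.exp_add]; congr 1; ring
      _ ≤ 1 / 4 := two_exp_le p (by linarith)
  linarith

end par

end HR


namespace HR

open Finset

set_option linter.unusedSectionVars false

section par2

variable {y lg q v L : ℝ} (p : Par y lg q v L)

include p

lemma Par.fac {M R : ℕ} (hM : (M : ℝ) ≤ 2 * y) (hR : L * y / 200 ≤ R) :
    (2 * L) ^ M * ((M : ℝ) ^ R / (R.factorial : ℝ)) ≤ 1 := by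
  have hy := p.hy
  have hL0 := p.hL0
  set x := Real.sqrt L with hx
  have hxx : x * x = L := Real.mul_self_sqrt (by linarith)
  have hx0 : 0 ≤ x := Real.sqrt_nonneg L
  have hx1 : 1400 ≤ x := Real.le_sqrt_of_sq_le (by norm_num; linarith)
  have hMR : x * M ≤ R / Real.exp 1 := by
    rw [le_div_iff₀ (Real.exp_pos 1)]
    have he : Real.exp 1 ≤ 3 := by linarith [Real.exp_one_lt_d9]
    calc x * M * Real.exp 1 ≤ x * (2 * y) * 3 := by gcongr
      _ ≤ L * y / 200 := by
          rw [← hxx]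
          have : 0 ≤ x * y := by positivity
          nlinarith
      _ ≤ R := hR
  have hfac : (R / Real.exp 1 : ℝ) ^ R ≤ (R.factorial : ℝ) := by
    have := Real.pow_div_factorial_le_exp (R : ℝ) (by positivity) R
    have hf : (0 : ℝ) < (R.factorial : ℝ) := by positivity
    rw [div_le_iff₀ hf] at this
    rw [div_pow, div_le_iff₀ (by positivity), ← Real.exp_nat_mul, mul_one]
    linarith
  have h1 : (x * M) ^ R ≤ (R.factorial : ℝ) := (pow_le_pow_left₀ (by positivity) hMR R).trans hfac
  have h4 : 4 * M ≤ R := by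
    have : (4 * M : ℝ) ≤ R := by nlinarith
    exact_mod_cast this
  have h2 : (2 * L) ^ M ≤ x ^ R := by
    calc (2 * L) ^ M ≤ (x ^ 4) ^ M := by
          gcongr
          rw [show x ^ 4 = (x * x) * (x * x) by ring, hxx]; nlinarith
      _ = x ^ (4 * M) := by rw [pow_mul]
      _ ≤ x ^ R := pow_le_pow_right₀ (by linarith) h4
  have hf : (0 : ℝ) < (R.factorial : ℝ) := by positivity
  rw [← mul_div_assoc, div_le_one hf]
  calc (2 * L) ^ M * (M : ℝ) ^ R ≤ x ^ R * (M : ℝ) ^ R := by gcongr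
    _ = (x * M) ^ R := by rw [mul_pow]
    _ ≤ _ := h1

lemma Par.err {M R : ℕ} {K : ℝ} (hM : (M : ℝ) ≤ 2 * y) (hR : (R : ℝ) ≤ L * y / 100) (hK : Real.exp (L * y ^ 2 / 2) ≤ K) :
    (R + 2) * Real.exp y ^ (2 * M + 2 * R) / K ≤ 1 := by
  have hy := p.hy
  have hL0 := p.hL0
  have hK0 : 0 < K := lt_of_lt_of_le (Real.exp_pos _) hK
  rw [div_le_one hK0]
  refine le_trans ?_ hK
  calc (R + 2) * Real.exp y ^ (2 * M + 2 * R) ≤ Real.exp (L * y / 100 + 1) * Real.exp ((4 * y + L * y / 50) * y) := by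
        gcongr
        · linarith [Real.add_one_le_exp (L * y / 100 + 1)]
        · refine pow_le_exp (Real.exp_pos y).le le_rfl (by linarith) _ ?_
          push_cast; linarith
    _ = Real.exp (L * y / 100 + 1 + (4 * y + L * y / 50) * y) := by rw [← Real.exp_add]
    _ ≤ _ := by
        rw [Real.exp_le_exp]
        have h1 : L * y * 100 ≤ L * y * y := by gcongr
        have h2 : 2000000 * (y * y) ≤ L * (y * y) := by gcongr
        nlinarith

lemma Par.err2 {n : ℕ} {K : ℝ} (hn : (n : ℝ) ≤ 2 * y) (hK : Real.exp (L * y ^ 2 / 2) ≤ K) :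
    2 * Real.exp y ^ (2 * n) ≤ K := by
  have hy := p.hy
  have hL0 := p.hL0
  refine le_trans ?_ hK
  calc 2 * Real.exp y ^ (2 * n) ≤ Real.exp 1 * Real.exp ((4 * y) * y) := by
        gcongr
        · linarith [Real.exp_one_gt_d9]
        · refine pow_le_exp (Real.exp_pos y).le le_rfl (by linarith) _ ?_
          push_cast; linarith
    _ = Real.exp (1 + 4 * y * y) := by rw [← Real.exp_add]
    _ ≤ _ := by
        rw [Real.exp_le_exp]
        have h2 : 2000000 * (y * y) ≤ L * (y * y) := by gcongr
        nlinarith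

lemma Par.gam {m W G Dd R : ℕ} (hv : 0 ≤ v) (hW : (W : ℝ) ≤ q) (hG : q ≤ (G : ℝ)) (hG2 : (G : ℝ) ≤ 2 * q)
    (hM : ((m * W : ℕ) : ℝ) ≤ 2 * y) (hDd : (Dd : ℝ) ≤ 4 * y) (hR : L * y / 200 ≤ R) :
    Gam m W G Dd R (2 * L) (Real.exp v) / 2 ≤ 4 * Real.exp (4 * y) * Real.sqrt (2 * L) ^ (m * W) := by
  have hy := p.hy
  have hL0 := p.hL0
  have h1 := p.rb hv hG hG2 hM hDd
  have h2 := p.piC hW hG2 hM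
  have h3 := p.eps hv hG hG2 hM
  have h4 := p.fac hM hR
  have h5 := p.kCb (m := m) hW hG2
  have hs : 1 ≤ Real.sqrt (2 * L) ^ (m * W) := one_le_pow₀ (by rw [Real.one_le_sqrt]; linarith)
  set s := Real.sqrt (2 * L) ^ (m * W)
  have h6 : Real.exp ((m * W : ℕ) : ℝ) ≤ Real.exp (2 * y) := by gcongr
  have he : 1 ≤ Real.exp y := Real.one_le_exp (by linarith)
  have e2 : Real.exp (2 * y) = Real.exp y ^ 2 := by rw [← Real.exp_nat_mul]; norm_num
  have e4 : Real.exp (4 * y) = Real.exp y ^ 4 := by rw [← Real.exp_nat_mul]; norm_num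
  rw [e2] at h6
  rw [e4]
  set z := Real.exp y
  unfold Gam
  rw [mul_div_cancel_left₀ _ (by norm_num : (2:ℝ) ≠ 0)]
  have hz4 : z ≤ z ^ 4 * s := by
    calc z = z ^ 1 * 1 := by ring
      _ ≤ z ^ 4 * s := by gcongr; norm_num
  have hz0 : 1 ≤ z ^ 4 * s := he.trans hz4
  have h7 : (PiC m W G : ℝ) * ((2 * L) ^ (m * W) * ((((m * W : ℕ) : ℝ) / Real.exp v) ^ G * Real.exp ((m * W : ℕ) : ℝ) +
      ((m * W : ℕ) : ℝ) ^ R / R.factorial) + (2 * L) ^ kC m W G * Real.exp ((m * W : ℕ) : ℝ)) ≤ z * (2 + s * z * z ^ 2) := by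
    gcongr
    rw [mul_add]; linarith
  have h8 : z * (2 + s * z * z ^ 2) = 2 * z + z ^ 4 * s := by ring
  linarith

end par2

section core

variable {y lg q v L : ℝ}

set_option maxHeartbeats 1000000 in
/-- Main operator bound with abstract parameters. -/
theorem core_par (p : Par y lg q v L) (P : Finset ℕ) (θ c : ℝ) (hP : ∀ r ∈ P, r.Prime) (hodd : ∀ r ∈ P, Odd r)
    (hθ : θ = 1 - 1 / L) (hc : c = θ ^ 2) (hℓ : ∑ r ∈ P, (1 : ℝ) / r ≤ L) (hPv : ∀ r ∈ P, Real.exp v ≤ (r : ℝ))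
    (hPy : ∀ r ∈ P, (r : ℝ) ≤ Real.exp y)
    (a : ℤ) (K : ℕ) (hK : Real.exp (L * y ^ 2 / 2) ≤ K)
    (h : ℤ × Bool → ℝ) (hs : ∀ x, x ∉ XX (Finset.Ico a (a + K)) → h x = 0) (b : ℝ) (hb0 : 0 ≤ b) (hb : ∀ x, |h x| ≤ b) :
    |ip (XX (Finset.Ico a (a + K))) h (∑ r ∈ P, Bp P θ c (Finset.Ico a (a + K)) r h)| ≤
      16 * Real.exp 9 * Real.sqrt (2 * L) * (ip (XX (Finset.Ico a (a + K))) h h + 4 * K * b ^ 2 * Real.exp (-(y / q))) := by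
  have hy := p.hy
  have hL0 := p.hL0
  have hq := p.hq
  have hlg := p.hlg1
  have hqy := p.hqy
  set X := XX (Finset.Ico a (a + (K : ℤ))) with hX
  rcases P.eq_empty_or_nonempty with hPe | ⟨r0, hr0⟩
  · rw [hPe]
    have h0 : ip X h (∑ r ∈ (∅ : Finset ℕ), Bp ∅ θ c (Finset.Ico a (a + K)) r h) = 0 := by
      simp [ip]
    rw [h0, abs_zero]
    have := ip_self_nonneg X h
    positivity
  have hyq : 1 ≤ y / q := by rw [le_div_iff₀ (by linarith)]; linarith
  have hv : 2 * y / y * 1 ≤ v := by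
    rw [mul_div_assoc, div_self (by linarith)]
    nlinarith [p.hc]
  have hvl : 2 * lg ≤ v := by nlinarith [p.hc]
  have hv0 : 0 ≤ v := by linarith
  obtain ⟨κ, hκ1, hκ2⟩ := exists_nat_pow_near (show (1:ℝ) ≤ q by linarith) (show (1:ℝ) < 2 by norm_num)
  have hκ0 : κ ≠ 0 := by
    rintro rfl
    norm_num at hκ2; linarith
  obtain ⟨i, rfl⟩ := Nat.exists_eq_succ_of_ne_zero hκ0
  rw [Nat.succ_eq_add_one] at *
  have hWpos : (0:ℝ) < 2 ^ (i + 1) := by positivity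
  have hyW : 1 ≤ y / 2 ^ (i + 1) := by rw [le_div_iff₀ hWpos]; linarith
  obtain ⟨k, hk1, hk2⟩ := exists_nat_pow_near hyW (show (1:ℝ) < 2 by norm_num)
  rw [le_div_iff₀ hWpos] at hk1
  rw [div_lt_iff₀ hWpos] at hk2
  set S : ℕ := 2 ^ (k + 1) with hS
  set W : ℕ := 2 ^ (i + 1) with hW
  have hWr : (W : ℝ) = 2 ^ (i + 1) := by rw [hW]; push_cast; rfl
  have hSr : (S : ℝ) = 2 ^ (k + 1) := by rw [hS]; push_cast; rfl
  have hSW1 : y ≤ S * W := by rw [hSr, hWr]; linarith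
  have hSW2 : (S:ℝ) * W ≤ 2 * y := by rw [hSr, hWr, pow_succ]; linarith
  have hWq : (W:ℝ) ≤ q := by rw [hWr]; exact hκ1
  have hW2 : q ≤ 2 * W := by rw [hWr]; rw [pow_succ] at hκ2; linarith
  have hG1 : q ≤ ((2 * W : ℕ) : ℝ) := by push_cast; exact hW2
  have hG2 : ((2 * W : ℕ) : ℝ) ≤ 2 * q := by push_cast; linarith
  have hW1 : (1:ℝ) ≤ W := by rw [hWr]; exact one_le_pow₀ (by norm_num)
  have hSq : (S:ℝ) ≤ 4 * (y / q) := by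
    rw [← mul_div_assoc, le_div_iff₀ (by linarith)]
    calc (S:ℝ) * q ≤ S * (2 * W) := by gcongr
      _ ≤ 4 * y := by linarith
  have hSyq : y / q ≤ S := by
    rw [div_le_iff₀ (by linarith)]
    calc y ≤ S * W := hSW1
      _ ≤ S * q := by gcongr
  set Dd := ⌈3 * y⌉₊ with hDd
  have hDd1 : 3 * y ≤ Dd := Nat.le_ceil _
  have hDd2 : (Dd : ℝ) ≤ 4 * y := by
    have := (Nat.ceil_lt_add_one (show 0 ≤ 3 * y by linarith)).le
    linarith
  set R := ⌊L * y / 100⌋₊ with hR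
  have hLy : 200000000 ≤ L * y := by
    calc (200000000:ℝ) = 2000000 * 100 := by norm_num
      _ ≤ L * y := by gcongr
  have hR1 : (R : ℝ) ≤ L * y / 100 := Nat.floor_le (by linarith)
  have hR2 : L * y / 200 ≤ R := by
    have := (Nat.lt_floor_add_one (L * y / 100)).le
    rw [← hR] at this
    linarith
  set Hn := ⌊Real.exp y⌋₊ with hHn
  have hHn1 : (Hn : ℝ) ≤ Real.exp y := Nat.floor_le (Real.exp_pos y).le
  have hKpos : (0:ℝ) < K := lt_of_lt_of_le (Real.exp_pos _) hK
  have hK0 : 0 < K := by exact_mod_cast hKpos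
  have hθ0 : 0 ≤ θ := by
    rw [hθ, sub_nonneg, div_le_one (by linarith)]; linarith
  have hθ1 : θ ≤ 1 := by
    rw [hθ]; have : 0 ≤ 1 / L := by positivity
    linarith
  have hc0 : 0 ≤ c := by rw [hc]; positivity
  have hc1 : c ≤ 1 := by rw [hc]; exact pow_le_one₀ hθ0 hθ1
  have hsq1 : 1 ≤ Real.sqrt (2 * L) := by rw [Real.one_le_sqrt]; linarith
  have hP1 : ∀ r ∈ P, 1 ≤ r := fun r hr => (hP r hr).one_lt.le
  have hric := riccati X (univ : Finset ↥P) (BB P θ c (Finset.Ico a (a + K))) h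
    (fun r _ f g => Bp_sym P θ c _ r.1 f g)
    (fun r _ f => Bp_le P θ c _ hθ0 hθ1 hc0 hc1 r.1 (hP1 r.1 r.2) f)
    (2 * L) (by linarith)
    (fun f => by
      have := Bp_sum P θ c (Finset.Ico a (a + K)) hc0 hc1 L (by linarith) hθ hP1 hℓ f
      refine le_trans (le_of_eq ?_) this
      exact Finset.sum_coe_sort P (fun r => ip X (Bp P θ c (Finset.Ico a (a + K)) r f) (Bp P θ c (Finset.Ico a (a + K)) r f)))
    (Real.exp 8) 4 (4 * K * b ^ 2) (Real.one_le_exp (by norm_num)) le_rfl (by positivity) (k + 1) ?_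
  · have hV : (VV (univ : Finset ↥P) (BB P θ c (Finset.Ico a (a + K))) h 1).1 = ∑ r ∈ P, Bp P θ c (Finset.Ico a (a + K)) r h := by
      have : (VV (univ : Finset ↥P) (BB P θ c (Finset.Ico a (a + K))) h 1).1
          = ∑ r : ↥P, BB P θ c (Finset.Ico a (a + K)) r (h - 0) := rfl
      rw [this, sub_zero]
      exact Finset.sum_coe_sort P (fun r => Bp P θ c (Finset.Ico a (a + K)) r h)
    rw [hV] at hric
    refine hric.trans ?_
    have hexp : Real.exp (-(2 ^ (k + 1) : ℝ)) ≤ Real.exp (-(y / q)) := by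
      rw [Real.exp_le_exp, ← hSr]; linarith
    have h9 : 4 * Real.exp 8 * Real.exp 1 * 4 * Real.sqrt (2 * L) = 16 * Real.exp 9 * Real.sqrt (2 * L) := by
      rw [show (9:ℝ) = 8 + 1 by norm_num, Real.exp_add]; ring
    rw [h9]
    gcongr
  intro n hn1 hnS
  have hnS' : (n : ℝ) ≤ S := by exact_mod_cast hnS
  have hM : ((n * W : ℕ) : ℝ) ≤ 2 * y := by
    push_cast
    calc (n:ℝ) * W ≤ S * W := by gcongr
      _ ≤ _ := hSW2
  have hn2y : (n : ℝ) ≤ 2 * y := by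
    refine le_trans ?_ hM
    push_cast
    exact le_mul_of_one_le_right (by positivity) hW1
  have hpc : (P.card : ℝ) ≤ Real.exp y := by
    refine le_trans ?_ hHn1
    have : P ⊆ Finset.Icc 1 Hn := fun r hr => Finset.mem_Icc.2 ⟨hP1 r hr, Nat.le_floor (hPy r hr)⟩
    have := Finset.card_le_card this
    simp at this
    exact_mod_cast this
  have hey1 : 1 ≤ Real.exp y := Real.one_le_exp (by linarith)
  have hye : 2 * y ≤ Real.exp y := by
    have h1 := Real.quadratic_le_exp_of_nonneg (show 0 ≤ y by linarith)
    have h2 : 100 * y ≤ y ^ 2 := by rw [sq]; gcongr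
    linarith
  have hyv : 2 * y ≤ Real.exp v := by
    calc 2 * y ≤ Real.exp (2 * lg) := p.y_sq (by linarith)
      _ ≤ Real.exp v := by gcongr
  set E : ℝ := Real.exp 8 ^ S * (4 * Real.sqrt (2 * L)) ^ n with hE
  have hE1 : 1 ≤ E := one_le_mul_of_one_le_of_one_le (one_le_pow₀ (Real.one_le_exp (by norm_num))) (one_le_pow₀ (by linarith))
  have hMn : 2 * (n * W * Hn) ≤ 2 ^ Dd := by
    have : (2 * (n * W * Hn) : ℝ) ≤ 2 ^ Dd := by
      calc (2 * (n * W * Hn) : ℝ) ≤ 2 * ((2 * y) * Real.exp y) := by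
            push_cast at hM; gcongr
        _ ≤ 2 * (Real.exp y * Real.exp y) := by gcongr
        _ = 2 * Real.exp (2 * y) := by rw [two_mul y, Real.exp_add]
        _ ≤ 2 ^ Dd := by
            rw [← Real.rpow_natCast 2 Dd, Real.rpow_def_of_pos (by norm_num)]
            have h2 : (2:ℝ) = Real.exp (Real.log 2) := (Real.exp_log (by norm_num)).symm
            calc 2 * Real.exp (2 * y) = Real.exp (Real.log 2 + 2 * y) := by rw [Real.exp_add, ← h2]
              _ ≤ _ := by
                rw [Real.exp_le_exp]
                have l1 := Real.log_two_gt_d9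
                have l2 := Real.log_two_lt_d9
                have l3 : 0.69 * (3 * y) ≤ Real.log 2 * Dd := by gcongr; linarith
                linarith
    exact_mod_cast this
  have hQ : (2 * (2 * ((n * 2 ^ i * Hn : ℕ) : ℝ) + 1)) * (Gam n W (2 * W) Dd R (2 * L) (Real.exp v) / 2 +
      (R + 2) * Real.exp y ^ (2 * (n * W) + 2 * R) / K) ≤ E ^ W := by
    have g1 := p.gam (Dd := Dd) hv0 hWq hG1 hG2 hM hDd2 hR2
    have g2 := p.err hM hR1 hK
    set s := Real.sqrt (2 * L) with hsdef
    have hs1 : 1 ≤ s ^ (n * W) := one_le_pow₀ hsq1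
    have g3 : (n * 2 ^ i * Hn : ℝ) ≤ y * Real.exp y := by
      have : (n * 2 ^ i : ℝ) ≤ y := by
        push_cast at hM; rw [hWr, pow_succ] at hM; linarith
      gcongr
    have e4 : Real.exp (4 * y) = Real.exp y ^ 4 := by rw [← Real.exp_nat_mul]; norm_num
    have e8 : Real.exp (8 * y) = Real.exp y ^ 8 := by rw [← Real.exp_nat_mul]; norm_num
    rw [e4] at g1
    have hz100 : 100 ≤ Real.exp y := by linarith
    set z := Real.exp y with hz
    have hEW : z ^ 8 * s ^ (n * W) ≤ E ^ W := by
      rw [hE, mul_pow, ← pow_mul, ← pow_mul, ← e8]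
      gcongr
      · rw [← Real.exp_nat_mul, Real.exp_le_exp]; push_cast; linarith
      · linarith
    refine le_trans ?_ hEW
    have g4 : (2 * (2 * ((n * 2 ^ i * Hn : ℕ) : ℝ) + 1)) ≤ 4 * z ^ 2 := by
      have u1 : y * z ≤ z / 2 * z := by gcongr; linarith
      have u2 : (1:ℝ) ≤ z ^ 2 := one_le_pow₀ hey1
      push_cast
      have u3 : z / 2 * z = z ^ 2 / 2 := by ring
      linarith
    have g5 : Gam n W (2 * W) Dd R (2 * L) (Real.exp v) / 2 + (R + 2) * z ^ (2 * (n * W) + 2 * R) / K ≤ 5 * z ^ 4 * s ^ (n * W) := by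
      have : 1 ≤ z ^ 4 * s ^ (n * W) := one_le_mul_of_one_le_of_one_le (one_le_pow₀ hey1) hs1
      linarith
    calc _ ≤ (4 * z ^ 2) * (5 * z ^ 4 * s ^ (n * W)) := by
          refine (mul_le_mul_of_nonneg_left g5 (by positivity)).trans ?_
          gcongr
      _ = 20 * (z ^ 6 * s ^ (n * W)) := by ring
      _ ≤ z ^ 2 * (z ^ 6 * s ^ (n * W)) := by
          gcongr
          calc (20:ℝ) ≤ z := by linarith
            _ = z ^ 1 := (pow_one z).symm
            _ ≤ z ^ 2 := pow_le_pow_right₀ hey1 (by norm_num)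
      _ = _ := by ring
  have hab := an_bound P θ c hP hodd L (by linarith) hθ hc hℓ ⟨r0, hr0⟩ n i (2 * W) Dd R hn1
    (by have : 1 ≤ W := by exact_mod_cast hW1
        omega) (Real.exp v) (hM.trans hyv) hPv Hn (fun r hr => Nat.le_floor (hPy r hr)) hMn (Real.exp y) hey1 hPy hpc
    (2 * L) (by linarith) (by
      calc ∑ r ∈ P, (2:ℝ) / r = 2 * ∑ r ∈ P, (1:ℝ) / r := by
            rw [Finset.mul_sum]; exact Finset.sum_congr rfl fun r _ => by ring
        _ ≤ 2 * L := by gcongr) a K hK0 h hs b hb0 hb E (by linarith) hQ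
  refine hab.trans ?_
  have r1 := p.rb1 (n := n) (Dd := Dd) (hnS'.trans hSq) hDd2
  have r2 := p.err2 hn2y hK
  have hb2 : 0 ≤ b ^ 2 := by positivity
  have e1 : 2 * (K:ℝ) * Rb n 1 Dd 0 (2 * L) (Real.exp v) + 2 * Real.exp y ^ (2 * n) ≤ 2 * K := by
    have : 2 * (K:ℝ) * Rb n 1 Dd 0 (2 * L) (Real.exp v) ≤ 2 * K * (1 / 2) := by gcongr
    linarith
  have e2 : 2 * (K:ℝ) * E + 2 * K ≤ 4 * K * E := by
    have : 2 * (K:ℝ) * 1 ≤ 2 * K * E := by gcongr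
    linarith
  calc _ = b ^ 2 * (2 * K * E + (2 * (K:ℝ) * Rb n 1 Dd 0 (2 * L) (Real.exp v) + 2 * Real.exp y ^ (2 * n))) := by ring
    _ ≤ b ^ 2 * (4 * K * E) := by gcongr; linarith
    _ = _ := by ring

end core

end HR


namespace HR

open Finset

section mertens

/-- Primes up to `n`. -/
def prs (n : ℕ) : Finset ℕ := (Ioc 0 n).filter Nat.Prime

lemma mem_prs {n p : ℕ} : p ∈ prs n ↔ p ≤ n ∧ p.Prime := by
  simp only [prs, mem_filter, mem_Ioc]
  constructor
  · rintro ⟨⟨_, h⟩, h2⟩; exact ⟨h, h2⟩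
  · rintro ⟨h, h2⟩; exact ⟨⟨h2.pos, h⟩, h2⟩

lemma log_ge_primes {m : ℕ} (hm : 0 < m) : ∑ p ∈ m.primeFactors, Real.log p ≤ Real.log m := by
  rw [← Real.log_prod (fun p hp => by
    have := (Nat.prime_of_mem_primeFactors hp).pos
    positivity)]
  apply Real.log_le_log
  · exact Finset.prod_pos fun p hp => by
      have := (Nat.prime_of_mem_primeFactors hp).pos
      positivity
  · have := Nat.le_of_dvd hm (Nat.prod_primeFactors_dvd m)
    have h2 : ((∏ p ∈ m.primeFactors, p : ℕ) : ℝ) ≤ m := Nat.cast_le.2 this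
    rw [Nat.cast_prod] at h2
    exact h2

lemma sum_log_div (n : ℕ) (hn : 1 ≤ n) : ∑ p ∈ prs n, Real.log p / p ≤ Real.log n + Real.log 4 := by
  have hn0 : (0:ℝ) < n := by exact_mod_cast hn
  have h1 : ∑ m ∈ Ioc 0 n, ∑ p ∈ m.primeFactors, Real.log p ≤ n * Real.log n := by
    calc _ ≤ ∑ m ∈ Ioc 0 n, Real.log n := by
          refine Finset.sum_le_sum fun m hm => ?_
          rw [mem_Ioc] at hm
          refine (log_ge_primes hm.1).trans (Real.log_le_log (by exact_mod_cast hm.1) (by exact_mod_cast hm.2))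
      _ = _ := by simp
  have h2 : ∑ m ∈ Ioc 0 n, ∑ p ∈ m.primeFactors, Real.log p = ∑ p ∈ prs n, (n / p : ℕ) * Real.log p := by
    have e : ∀ m ∈ Ioc 0 n, ∑ p ∈ m.primeFactors, Real.log p = ∑ p ∈ prs n, if p ∣ m then Real.log p else 0 := by
      intro m hm
      rw [mem_Ioc] at hm
      rw [← Finset.sum_filter]
      refine Finset.sum_congr ?_ fun _ _ => rfl
      ext p
      rw [mem_filter, mem_prs, Nat.mem_primeFactors]
      constructor
      · rintro ⟨a, b, c⟩; exact ⟨⟨(Nat.le_of_dvd hm.1 b).trans hm.2, a⟩, b⟩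
      · rintro ⟨⟨a, b⟩, c⟩; exact ⟨b, c, by omega⟩
    rw [Finset.sum_congr rfl e, Finset.sum_comm]
    refine Finset.sum_congr rfl fun p _ => ?_
    rw [← Finset.sum_filter, Finset.sum_const, Nat.Ioc_filter_dvd_card_eq_div, nsmul_eq_mul]
  have h3 : ∑ p ∈ prs n, ((n:ℝ) * (Real.log p / p) - Real.log p) ≤ ∑ p ∈ prs n, (n / p : ℕ) * Real.log p := by
    refine Finset.sum_le_sum fun p hp => ?_
    have hp1 : (1:ℝ) ≤ p := by exact_mod_cast (mem_prs.1 hp).2.one_lt.le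
    have hl : 0 ≤ Real.log p := Real.log_nonneg hp1
    have : (n:ℝ) / p - 1 ≤ (n / p : ℕ) := by
      have := Nat.lt_floor_add_one ((n:ℝ) / p)
      rw [Nat.floor_div_natCast, Nat.floor_natCast] at this
      linarith
    calc (n:ℝ) * (Real.log p / p) - Real.log p = ((n:ℝ) / p - 1) * Real.log p := by ring
      _ ≤ _ := by gcongr
  rw [Finset.sum_sub_distrib, ← Finset.mul_sum] at h3
  have h4 : ∑ p ∈ prs n, Real.log p ≤ Real.log 4 * n := by
    have := Chebyshev.theta_le_log4_mul_x (x := (n:ℝ)) (by positivity)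
    rw [Chebyshev.theta, Nat.floor_natCast] at this
    exact this
  have h5 : (n:ℝ) * ∑ p ∈ prs n, Real.log p / p ≤ n * (Real.log n + Real.log 4) := by
    rw [mul_add]; linarith
  exact le_of_mul_le_mul_left h5 hn0

lemma prs_succ (n : ℕ) (f : ℕ → ℝ) :
    ∑ p ∈ prs (n + 1), f p = ∑ p ∈ prs n, f p + if (n + 1).Prime then f (n + 1) else 0 := by
  unfold prs
  rw [Finset.sum_filter, Finset.sum_filter, Finset.sum_Ioc_succ_top (by omega)]

lemma mertens_aux (n : ℕ) (hn : 2 ≤ n) :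
    ∑ p ∈ prs n, (1:ℝ) / p ≤ (∑ p ∈ prs n, Real.log p / p) / Real.log n + Real.log (Real.log n) - Real.log (Real.log 2)
      + Real.log 4 * (1 / Real.log 2 - 1 / Real.log n) := by
  induction n, hn using Nat.le_induction with
  | base =>
    have h2 : prs 2 = {2} := by
      ext p; rw [mem_prs, mem_singleton]
      constructor
      · rintro ⟨a, b⟩; have := b.two_le; omega
      · rintro rfl; exact ⟨le_rfl, Nat.prime_two⟩
    rw [h2]
    have := Real.log_pos (show (1:ℝ) < 2 by norm_num)
    simp only [Finset.sum_singleton, Nat.cast_ofNat]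
    apply le_of_eq
    field_simp
    ring
  | succ n hn ih =>
    rw [prs_succ, prs_succ]
    have hA := sum_log_div n (by omega)
    set A := ∑ p ∈ prs n, Real.log p / p
    have hn1 : (1:ℝ) < n := by exact_mod_cast (by omega : 1 < n)
    have hl : 0 < Real.log n := Real.log_pos hn1
    have hl' : 0 < Real.log ((n + 1 : ℕ):ℝ) := Real.log_pos (by push_cast; linarith)
    have hll : Real.log n ≤ Real.log ((n + 1 : ℕ):ℝ) := Real.log_le_log (by linarith) (by push_cast; linarith)
    have e1 : (if (n + 1).Prime then (1:ℝ) / ((n + 1 : ℕ):ℝ) else 0) =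
        (if (n + 1).Prime then Real.log ((n + 1 : ℕ):ℝ) / ((n + 1 : ℕ):ℝ) else 0) / Real.log ((n + 1 : ℕ):ℝ) := by
      split_ifs
      · field_simp
      · simp
    rw [e1, add_div]
    set l := Real.log n
    set m := Real.log ((n + 1 : ℕ):ℝ)
    have hd : 0 ≤ 1 / l - 1 / m := sub_nonneg.2 (one_div_le_one_div_of_le hl hll)
    have k1 : A / l - A / m ≤ (l + Real.log 4) * (1 / l - 1 / m) := by
      calc A / l - A / m = A * (1 / l - 1 / m) := by ring
        _ ≤ _ := by gcongr
    have k2 : l * (1 / l - 1 / m) ≤ Real.log m - Real.log l := by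
      have := Real.one_sub_inv_le_log_of_pos (show 0 < m / l by positivity)
      rw [Real.log_div hl'.ne' hl.ne'] at this
      refine le_trans (le_of_eq ?_) this
      field_simp
    rw [add_mul] at k1
    linarith

/-- Mertens' upper bound. -/
theorem mertens (n : ℕ) (hn : 2 ≤ n) : ∑ p ∈ prs n, (1:ℝ) / p ≤ Real.log (Real.log n) + 4 := by
  have h := mertens_aux n hn
  have hA := sum_log_div n (by omega)
  have hn1 : (2:ℝ) ≤ n := by exact_mod_cast hn
  have hl2 := Real.log_two_gt_d9
  have hl2' := Real.log_two_lt_d9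
  have hl : 0 < Real.log n := Real.log_pos (by linarith)
  have h4 : Real.log 4 = 2 * Real.log 2 := by
    rw [show (4:ℝ) = 2 ^ 2 by norm_num, Real.log_pow]; norm_num
  have h1 : (∑ p ∈ prs n, Real.log p / p) / Real.log n ≤ 1 + Real.log 4 / Real.log n := by
    rw [div_le_iff₀ hl, add_mul, div_mul_cancel₀ _ hl.ne']; linarith
  have h2 : -1 ≤ Real.log (Real.log 2) := by
    rw [Real.le_log_iff_exp_le (by linarith), Real.exp_neg, inv_le_comm₀ (Real.exp_pos _) (by linarith)]
    have : (Real.log 2)⁻¹ ≤ 0.5⁻¹ := by gcongr; linarith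
    have := Real.exp_one_gt_d9
    norm_num at *
    linarith
  have h3 : Real.log 4 * (1 / Real.log 2 - 1 / Real.log n) = 2 - Real.log 4 / Real.log n := by
    rw [h4]; field_simp
  linarith

end mertens

end HR


namespace HR

open Finset

section poisson

lemma poi_mono (s : ℝ) (hs : 0 ≤ s) (i j : ℕ) (hij : i ≤ j) (hj : (j : ℝ) ≤ s) :
    s ^ i / (i.factorial : ℝ) ≤ s ^ j / (j.factorial : ℝ) := by
  induction j, hij using Nat.le_induction with
  | base => exact le_rfl
  | succ j hij ih =>
    push_cast at hj
    refine (ih (by linarith)).trans ?_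
    rw [Nat.factorial_succ, pow_succ]
    push_cast
    have hf : (0:ℝ) < j.factorial := by positivity
    rw [div_le_div_iff₀ hf (by positivity)]
    have : 0 ≤ s ^ j * (j.factorial : ℝ) := by positivity
    nlinarith

lemma poi_big (s : ℝ) (hs : 0 < s) (i : ℕ) (hi : s / 2 ≤ i) (hi0 : 0 < i) :
    s ^ i / (i.factorial : ℝ) ≤ 2 * Real.exp s / Real.sqrt s := by
  have hir : (0:ℝ) < i := by exact_mod_cast hi0
  have h1 := Stirling.le_factorial_stirling i
  have hss : 0 < Real.sqrt s := Real.sqrt_pos.2 hs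
  have hf : (0:ℝ) < i.factorial := by positivity
  have h2 : Real.sqrt s ≤ Real.sqrt (2 * Real.pi * i) := by
    apply Real.sqrt_le_sqrt
    have := Real.pi_gt_three
    nlinarith
  have h3 : s ^ i ≤ Real.exp s * (i / Real.exp 1) ^ i := by
    have e1 : s / i ≤ Real.exp (s / i - 1) := by
      have := Real.add_one_le_exp (s / i - 1); linarith
    have e2 : (s / i) ^ i ≤ Real.exp (s / i - 1) ^ i := by gcongr
    rw [← Real.exp_nat_mul, mul_sub, mul_div_cancel₀ _ hir.ne', mul_one, Real.exp_sub, div_pow,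
      div_le_div_iff₀ (by positivity) (Real.exp_pos _)] at e2
    rw [div_pow, ← Real.exp_nat_mul, mul_one, ← mul_div_assoc, le_div_iff₀ (Real.exp_pos _)]
    exact e2
  rw [div_le_div_iff₀ hf hss]
  have h4 : Real.sqrt s * (i / Real.exp 1) ^ i ≤ i.factorial := by
    refine le_trans ?_ h1
    gcongr
  calc s ^ i * Real.sqrt s ≤ Real.exp s * (i / Real.exp 1) ^ i * Real.sqrt s := by gcongr
    _ = Real.exp s * (Real.sqrt s * (i / Real.exp 1) ^ i) := by ring
    _ ≤ Real.exp s * i.factorial := by gcongr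
    _ ≤ 2 * Real.exp s * i.factorial := by
        have : 0 ≤ Real.exp s * i.factorial := by positivity
        linarith

lemma poi (s : ℝ) (hs : 1 ≤ s) (i : ℕ) : s ^ i / (i.factorial : ℝ) ≤ 2 * Real.exp s / Real.sqrt s := by
  have hfl : s / 2 ≤ (⌊s⌋₊ : ℝ) := by
    have := Nat.lt_floor_add_one s
    have h1 : 1 ≤ ⌊s⌋₊ := Nat.le_floor (by simpa using hs)
    have h2 : (1:ℝ) ≤ ⌊s⌋₊ := by exact_mod_cast h1
    linarith
  have h1 : 1 ≤ ⌊s⌋₊ := Nat.le_floor (by simpa using hs)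
  by_cases h : i ≤ ⌊s⌋₊
  · exact (poi_mono s (by linarith) i _ h (Nat.floor_le (by linarith))).trans (poi_big s (by linarith) _ hfl h1)
  · push Not at h
    have h2 : (⌊s⌋₊ : ℝ) ≤ i := by exact_mod_cast h.le
    exact poi_big s (by linarith) i (by linarith) (by omega)

end poisson

section sqf

/-- Squarefree integers up to `z` with `j` prime factors. -/
noncomputable def Qs (z : ℝ) (j : ℕ) : Finset ℕ :=
  (Ioc 0 ⌊z⌋₊).filter fun a => Squarefree a ∧ a.primeFactors.card = j

lemma mem_Qs {z : ℝ} {j a : ℕ} : a ∈ Qs z j ↔ (0 < a ∧ a ≤ ⌊z⌋₊) ∧ Squarefree a ∧ a.primeFactors.card = j := by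
  rw [Qs, mem_filter, mem_Ioc]

lemma Qs_recip (z : ℝ) (X : ℕ) (hX : ⌊z⌋₊ ≤ X) (j : ℕ) :
    ∑ a ∈ Qs z j, (1:ℝ) / a ≤ (∑ p ∈ prs X, (1:ℝ) / p) ^ j / (j.factorial : ℝ) := by
  refine le_trans ?_ (esy_le j (prs X) (fun p => 1 / (p:ℝ)) (fun q _ => by positivity))
  unfold esy
  have e : ∀ a ∈ Qs z j, (1:ℝ) / a = ∏ q ∈ a.primeFactors, 1 / (q:ℝ) := by
    intro a ha
    have h := (mem_Qs.1 ha).2.1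
    rw [Finset.prod_div_distrib, Finset.prod_const_one]
    congr 1
    have := Nat.prod_primeFactors_of_squarefree h
    rw [← Nat.cast_prod, this]
  rw [Finset.sum_congr rfl e]
  rw [← Finset.sum_image (s := Qs z j) (g := fun a : ℕ => a.primeFactors) (f := fun U : Finset ℕ => ∏ q ∈ U, 1 / (q:ℝ))]
  · refine Finset.sum_le_sum_of_subset_of_nonneg ?_ fun U _ _ => Finset.prod_nonneg fun q _ => by positivity
    intro U hU
    obtain ⟨a, ha, rfl⟩ := mem_image.1 hU
    obtain ⟨⟨h1, h2⟩, h3, h4⟩ := mem_Qs.1 ha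
    rw [mem_powersetCard]
    refine ⟨fun p hp => ?_, h4⟩
    rw [mem_prs]
    exact ⟨((Nat.le_of_mem_primeFactors hp).trans h2).trans hX, Nat.prime_of_mem_primeFactors hp⟩
  · intro a ha b hb hab
    have h1 := Nat.prod_primeFactors_of_squarefree (mem_Qs.1 ha).2.1
    have h2 := Nat.prod_primeFactors_of_squarefree (mem_Qs.1 hb).2.1
    simp only at hab
    rw [← h1, ← h2, hab]

lemma Qs_log (z : ℝ) (hz : 0 ≤ z) (j : ℕ) :
    ∑ a ∈ Qs z (j + 1), Real.log a ≤ Real.log 4 * z * ∑ a ∈ Qs z j, (1:ℝ) / a := by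
  have e : ∀ a ∈ Qs z (j + 1), Real.log a = ∑ p ∈ a.primeFactors, Real.log p := by
    intro a ha
    rw [← Real.log_prod (fun p hp => by
      have := (Nat.prime_of_mem_primeFactors hp).pos
      positivity), ← Nat.cast_prod, Nat.prod_primeFactors_of_squarefree (mem_Qs.1 ha).2.1]
  rw [Finset.sum_congr rfl e, Finset.sum_sigma']
  have h2 : ∀ a ∈ Qs z j, ∑ p ∈ (Ioc 0 ⌊z / a⌋₊).filter Nat.Prime, Real.log p ≤ Real.log 4 * z * (1 / a) := by
    intro a _
    have := Chebyshev.theta_le_log4_mul_x (x := z / (a:ℝ)) (by positivity)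
    rw [Chebyshev.theta] at this
    refine this.trans (le_of_eq (by ring))
  rw [Finset.mul_sum]
  refine le_trans ?_ (Finset.sum_le_sum h2)
  rw [Finset.sum_sigma']
  set S := (Qs z (j + 1)).sigma fun a => a.primeFactors
  set T := (Qs z j).sigma fun a => (Ioc 0 ⌊z / (a:ℝ)⌋₊).filter Nat.Prime
  rw [← Finset.sum_image (s := S) (g := fun x => (⟨x.1 / x.2, x.2⟩ : (_ : ℕ) × ℕ)) (f := fun x => Real.log x.2)]
  · refine Finset.sum_le_sum_of_subset_of_nonneg ?_ ?_
    · intro x hx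
      obtain ⟨⟨a, p⟩, ha, rfl⟩ := mem_image.1 hx
      rw [mem_sigma] at ha
      obtain ⟨ha, hp⟩ := ha
      simp only at ha hp ⊢
      obtain ⟨⟨h1, h2⟩, h3, h4⟩ := mem_Qs.1 ha
      obtain ⟨b, rfl⟩ := Nat.dvd_of_mem_primeFactors hp
      have hpp := Nat.prime_of_mem_primeFactors hp
      have hb0 : 0 < b := Nat.pos_of_mul_pos_left h1
      rw [Nat.mul_div_cancel_left _ hpp.pos]
      have hcop : Nat.Coprime p b := Nat.coprime_of_squarefree_mul h3
      rw [mem_sigma]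
      refine ⟨mem_Qs.2 ⟨⟨hb0, ?_⟩, ?_, ?_⟩, ?_⟩
      · exact le_trans (Nat.le_mul_of_pos_left b hpp.pos) h2
      · exact h3.squarefree_of_dvd (Dvd.intro_left p rfl)
      · rw [hcop.primeFactors_mul, card_union_of_disjoint hcop.disjoint_primeFactors, hpp.primeFactors, card_singleton] at h4
        simp only; omega
      · rw [mem_filter, mem_Ioc]
        refine ⟨⟨hpp.pos, ?_⟩, hpp⟩
        apply Nat.le_floor
        have hb : (0:ℝ) < b := by exact_mod_cast hb0
        rw [le_div_iff₀ hb]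
        have := (Nat.le_floor_iff hz).1 h2
        push_cast at this
        exact this
    · intro x hx _
      rw [mem_sigma, mem_filter] at hx
      exact Real.log_nonneg (by exact_mod_cast hx.2.2.one_lt.le)
  · rintro ⟨a, p⟩ ha ⟨b, q⟩ hb hab
    simp only [Sigma.mk.injEq, heq_eq_eq] at hab
    obtain ⟨h1, h2⟩ := hab
    subst h2
    rw [mem_coe, mem_sigma] at ha hb
    have h3 := Nat.div_mul_cancel (Nat.dvd_of_mem_primeFactors ha.2)
    have h4 := Nat.div_mul_cancel (Nat.dvd_of_mem_primeFactors hb.2)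
    simp only at h3 h4
    rw [h1, h4] at h3
    rw [h3]

lemma Qs_card (z : ℝ) (hz : 1 < z) (j : ℕ) (E : ℝ) (hE : ∀ i, ∑ a ∈ Qs z i, (1:ℝ) / a ≤ E) :
    ((Qs z j).card : ℝ) ≤ Real.sqrt z + 2 / Real.log z * (Real.log 4 * z * E) := by
  have hz0 : 0 < z := by linarith
  have hlz : 0 < Real.log z := Real.log_pos hz
  have hE0 : 0 ≤ E := (Finset.sum_nonneg fun a _ => by positivity).trans (hE 0)
  have hl4 : 0 < Real.log 4 := Real.log_pos (by norm_num)
  have hlog : ∑ a ∈ Qs z j, Real.log a ≤ Real.log 4 * z * E := by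
    cases j with
    | zero =>
      have : ∑ a ∈ Qs z 0, Real.log a = 0 := by
        refine Finset.sum_eq_zero fun a ha => ?_
        obtain ⟨⟨h1, h2⟩, h3, h4⟩ := mem_Qs.1 ha
        have := Nat.prod_primeFactors_of_squarefree h3
        rw [card_eq_zero] at h4
        rw [h4] at this
        simp at this
        rw [← this]; simp
      rw [this]; positivity
    | succ j =>
      refine (Qs_log z hz0.le j).trans ?_
      gcongr
      exact hE j
  have hsub : Qs z j ⊆ Ioc 0 ⌊Real.sqrt z⌋₊ ∪ (Qs z j).filter (fun a => Real.sqrt z < a) := by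
    intro a ha
    rw [mem_union, mem_filter, mem_Ioc]
    obtain ⟨⟨h1, h2⟩, -⟩ := mem_Qs.1 ha
    by_cases h : Real.sqrt z < a
    · exact Or.inr ⟨ha, h⟩
    · exact Or.inl ⟨h1, Nat.le_floor (not_lt.1 h)⟩
  have hc := (card_le_card hsub).trans (card_union_le _ _)
  rw [Nat.card_Ioc, Nat.sub_zero] at hc
  have h1 : ((⌊Real.sqrt z⌋₊ : ℕ):ℝ) ≤ Real.sqrt z := Nat.floor_le (Real.sqrt_nonneg z)
  have h2 : (((Qs z j).filter (fun a : ℕ => Real.sqrt z < a)).card : ℝ) * (Real.log z / 2) ≤ Real.log 4 * z * E := by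
    refine le_trans ?_ hlog
    rw [← nsmul_eq_mul, ← Finset.sum_const]
    calc ∑ _a ∈ (Qs z j).filter (fun a : ℕ => Real.sqrt z < a), Real.log z / 2
        ≤ ∑ a ∈ (Qs z j).filter (fun a : ℕ => Real.sqrt z < a), Real.log a := by
          refine Finset.sum_le_sum fun a ha => ?_
          rw [← Real.log_sqrt hz0.le]
          exact Real.log_le_log (Real.sqrt_pos.2 hz0) (mem_filter.1 ha).2.le
      _ ≤ _ := Finset.sum_le_sum_of_subset_of_nonneg (filter_subset _ _) fun a ha _ =>
          Real.log_nonneg (by exact_mod_cast (mem_Qs.1 ha).1.1)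
  have h3 : (((Qs z j).filter (fun a : ℕ => Real.sqrt z < a)).card : ℝ) ≤ 2 / Real.log z * (Real.log 4 * z * E) := by
    rw [div_mul_eq_mul_div, le_div_iff₀ hlz]; linarith
  have hc' : ((Qs z j).card : ℝ) ≤ (⌊Real.sqrt z⌋₊ : ℕ) + (((Qs z j).filter (fun a : ℕ => Real.sqrt z < a)).card : ℝ) := by
    exact_mod_cast hc
  linarith

end sqf

end HR


namespace HR

open Finset

section hardyramanujan

/-- integers up to `x` with exactly `k` prime factors -/
noncomputable def Om (x k : ℕ) : Finset ℕ := (Ioc 0 x).filter fun n => n.primeFactorsList.length = k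

lemma om_sub (x k : ℕ) :
    ((Om x k).card : ℝ) ≤ ∑ b ∈ Ioc 0 x, ((Qs ((x:ℝ) / (b:ℝ)^2) (k - 2 * b.primeFactorsList.length)).card : ℝ) := by
  have hsub : Om x k ⊆ (Ioc 0 x).biUnion fun b =>
      (Qs ((x:ℝ) / (b:ℝ)^2) (k - 2 * b.primeFactorsList.length)).image fun a => b ^ 2 * a := by
    intro n hn
    simp only [Om, mem_filter, mem_Ioc] at hn
    obtain ⟨⟨hn0, hnx⟩, hk⟩ := hn
    obtain ⟨a, b, ha, hb, hab, hsq⟩ := Nat.sq_mul_squarefree_of_pos hn0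
    rw [mem_biUnion]
    have hbn : b ≤ n := by
      rw [← hab]; nlinarith [Nat.mul_le_mul hb hb, Nat.mul_le_mul_left b ha, Nat.mul_le_mul_left (b*a) hb]
    refine ⟨b, mem_Ioc.2 ⟨hb, hbn.trans hnx⟩, mem_image.2 ⟨a, ?_, hab⟩⟩
    rw [mem_Qs]
    refine ⟨⟨ha, ?_⟩, hsq, ?_⟩
    · rw [Nat.le_floor_iff (by positivity), le_div_iff₀ (by positivity)]
      have : b ^ 2 * a ≤ x := by omega
      have h2 : ((b ^ 2 * a : ℕ) : ℝ) ≤ x := by exact_mod_cast this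
      push_cast at h2; linarith
    · have h1 : ArithmeticFunction.cardFactors n = k := hk
      rw [← hab, ArithmeticFunction.cardFactors_mul (by positivity) (by positivity),
        ArithmeticFunction.cardFactors_pow] at h1
      have h2 := (ArithmeticFunction.cardDistinctFactors_eq_cardFactors_iff_squarefree ha.ne').2 hsq
      have h3 : a.primeFactors.card = ArithmeticFunction.cardDistinctFactors a := rfl
      have h4 : b.primeFactorsList.length = ArithmeticFunction.cardFactors b := rfl
      rw [h3, h4, h2]; omega
  have h1 := (card_le_card hsub).trans card_biUnion_le
  have h2 : (Om x k).card ≤ ∑ b ∈ Ioc 0 x, (Qs ((x:ℝ) / (b:ℝ)^2) (k - 2 * b.primeFactorsList.length)).card :=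
    h1.trans (sum_le_sum fun b _ => card_image_le)
  exact_mod_cast h2

lemma Qs_triv (z : ℝ) (hz : 0 ≤ z) (j : ℕ) : ((Qs z j).card : ℝ) ≤ z := by
  have : (Qs z j).card ≤ ⌊z⌋₊ := by
    have : Qs z j ⊆ Ioc 0 ⌊z⌋₊ := fun a ha => mem_Ioc.2 (mem_Qs.1 ha).1
    simpa using card_le_card this
  exact (Nat.cast_le.2 this).trans (Nat.floor_le hz)

lemma log_le_half (x : ℝ) (hx : 0 < x) : Real.log x ≤ x / 2 := by
  have h := Real.add_one_le_exp (Real.log x - 1)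
  have h2 : Real.exp (Real.log x - 1) = x * Real.exp (-1) := by
    rw [sub_eq_add_neg, Real.exp_add, Real.exp_log hx]
  have h3 : Real.exp (-1) ≤ 1 / 2 := by
    rw [Real.exp_neg, inv_eq_one_div]
    have := Real.add_one_le_exp 1
    apply one_div_le_one_div_of_le <;> linarith
  have : x * Real.exp (-1) ≤ x * (1/2) := by gcongr
  linarith

lemma Qs_main (x : ℕ) (hx : 1 ≤ Real.log (Real.log x)) (b j : ℕ) (hb : 0 < b) (hb4 : b ^ 4 ≤ x) :
    ((Qs ((x:ℝ) / (b:ℝ)^2) j).card : ℝ) ≤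
      (1 + 16 * Real.exp 4) * x / Real.sqrt (Real.log (Real.log x)) * ((b:ℝ)^2)⁻¹ := by
  set l := Real.log (Real.log x) with hl
  set z := (x:ℝ) / (b:ℝ)^2 with hz
  have hlx : 1 < Real.log x := by
    by_contra h
    push Not at h
    have h0 : 0 ≤ Real.log (x:ℝ) := Real.log_natCast_nonneg x
    have := Real.log_nonpos h0 h
    linarith
  have hbr : (0:ℝ) < b := by exact_mod_cast hb
  have hx0 : (0:ℝ) < x := by
    rcases Nat.eq_zero_or_pos x with h | h
    · subst h; simp at hlx; linarith
    · exact_mod_cast h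
  have hx2 : 2 ≤ x := by
    by_contra h
    have : x ≤ 1 := by omega
    have : Real.log (x:ℝ) ≤ 0 := Real.log_nonpos (by positivity) (by exact_mod_cast this)
    linarith
  have hb4' : (b:ℝ)^4 ≤ x := by exact_mod_cast hb4
  have hb2 : (b:ℝ)^2 ≤ Real.sqrt x := Real.le_sqrt_of_sq_le (by nlinarith)
  have hsx : 0 < Real.sqrt x := Real.sqrt_pos.2 hx0
  have hzs : Real.sqrt x ≤ z := by
    rw [hz, le_div_iff₀ (by positivity)]
    calc Real.sqrt x * (b:ℝ)^2 ≤ Real.sqrt x * Real.sqrt x := by gcongr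
      _ = x := Real.mul_self_sqrt hx0.le
  have hlz : Real.log x / 2 ≤ Real.log z := by
    rw [← Real.log_sqrt hx0.le]; exact Real.log_le_log hsx hzs
  have hz0 : 0 < z := hsx.trans_le hzs
  have hz1 : 1 < z := by
    by_contra h
    push Not at h
    have := Real.log_nonpos hz0.le h
    linarith
  have hle : ⌊z⌋₊ ≤ x := by
    apply Nat.floor_le_of_le
    rw [hz]; apply div_le_self hx0.le
    have : (1:ℝ) ≤ b := by exact_mod_cast hb
    nlinarith
  have hlpos : 0 < Real.sqrt l := Real.sqrt_pos.2 (by linarith)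
  set E := 2 * Real.exp 4 * Real.log x / Real.sqrt l with hE
  have hEb : ∀ i, ∑ a ∈ Qs z i, (1:ℝ) / a ≤ E := by
    intro i
    refine (Qs_recip z x hle i).trans ?_
    have hm := mertens x hx2
    have h0 : 0 ≤ ∑ p ∈ prs x, (1:ℝ) / p := sum_nonneg fun _ _ => by positivity
    calc (∑ p ∈ prs x, (1:ℝ) / p)^i / (i.factorial:ℝ) ≤ (l + 4)^i / (i.factorial:ℝ) := by gcongr
      _ ≤ 2 * Real.exp (l + 4) / Real.sqrt (l + 4) := poi _ (by linarith) i
      _ ≤ 2 * Real.exp (l + 4) / Real.sqrt l := by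
          gcongr; linarith
      _ = E := by
          rw [hE, Real.exp_add, hl, Real.exp_log (by linarith)]; ring
  have hQ := Qs_card z hz1 j E hEb
  have hsz : Real.sqrt z ≤ z / Real.sqrt l := by
    rw [le_div_iff₀ hlpos]
    have h1 : l ≤ z := by
      have := log_le_half (Real.log x) (by linarith)
      have h2 := log_le_half z hz0
      linarith
    calc Real.sqrt z * Real.sqrt l ≤ Real.sqrt z * Real.sqrt z := by gcongr
      _ = z := Real.mul_self_sqrt hz0.le
  have hl4 : Real.log 4 ≤ 2 := by
    have := log_le_half 4 (by norm_num); linarith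
  have h2 : 2 / Real.log z * (Real.log 4 * z * E) ≤ 16 * Real.exp 4 * z / Real.sqrt l := by
    have h3 : 2 / Real.log z ≤ 4 / Real.log x := by
      rw [div_le_div_iff₀ (by linarith) (by linarith)]; linarith
    have hE0 : 0 ≤ E := by rw [hE]; positivity
    calc 2 / Real.log z * (Real.log 4 * z * E) ≤ 4 / Real.log x * (2 * z * E) := by
          gcongr
      _ = 16 * Real.exp 4 * z / Real.sqrt l := by
          rw [hE]; field_simp; ring
  calc ((Qs z j).card : ℝ) ≤ z / Real.sqrt l + 16 * Real.exp 4 * z / Real.sqrt l := by linarith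
    _ = _ := by rw [hz]; field_simp

theorem hr : ∃ C : ℝ, 0 < C ∧ ∀ x : ℕ, 1 ≤ Real.log (Real.log x) → ∀ k : ℕ,
    ((Om x k).card : ℝ) ≤ C * x / Real.sqrt (Real.log (Real.log x)) := by
  refine ⟨2 * (1 + 16 * Real.exp 4) + 2, by positivity, fun x hx k => ?_⟩
  set l := Real.log (Real.log x) with hl
  set C1 := (1 + 16 * Real.exp 4) with hC1
  have hC1p : 0 < C1 := by positivity
  have hlpos : 0 < Real.sqrt l := Real.sqrt_pos.2 (by linarith)
  have hlx : 1 < Real.log x := by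
    by_contra h
    push Not at h
    have h0 : 0 ≤ Real.log (x:ℝ) := Real.log_natCast_nonneg x
    have := Real.log_nonpos h0 h
    linarith
  have hx0 : (0:ℝ) < x := by
    rcases Nat.eq_zero_or_pos x with h | h
    · subst h; simp at hlx; linarith
    · exact_mod_cast h
  refine (om_sub x k).trans ?_
  set m := Nat.sqrt (Nat.sqrt x) with hm
  have hbound : ∀ b ∈ Ioc 0 x, ((Qs ((x:ℝ) / (b:ℝ)^2) (k - 2 * b.primeFactorsList.length)).card : ℝ) ≤
      C1 * x / Real.sqrt l * ((b:ℝ)^2)⁻¹ + x * (if m < b then ((b:ℝ)^2)⁻¹ else 0) := by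
    intro b hb
    rw [mem_Ioc] at hb
    split_ifs with h
    · have := Qs_triv ((x:ℝ) / (b:ℝ)^2) (by positivity) (k - 2 * b.primeFactorsList.length)
      have h2 : 0 ≤ C1 * x / Real.sqrt l * ((b:ℝ)^2)⁻¹ := by positivity
      have h3 : (x:ℝ) / (b:ℝ)^2 = x * ((b:ℝ)^2)⁻¹ := div_eq_mul_inv _ _
      linarith
    · have h4 : b ^ 4 ≤ x := by
        have h5 : b ^ 2 ≤ Nat.sqrt x := by
          rw [sq]; exact Nat.le_sqrt.1 (by omega)
        have h6 : b ^ 2 * b ^ 2 ≤ x := (Nat.mul_le_mul h5 h5).trans (Nat.sqrt_le x)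
        calc b ^ 4 = b ^ 2 * b ^ 2 := by ring
          _ ≤ x := h6
      have := Qs_main x hx b (k - 2 * b.primeFactorsList.length) hb.1 h4
      simpa using this
  refine (sum_le_sum hbound).trans ?_
  rw [sum_add_distrib, ← mul_sum, ← mul_sum]
  have hs1 : ∑ b ∈ Ioc 0 x, ((b:ℝ)^2)⁻¹ ≤ 2 := by
    have := sum_Ioo_inv_sq_le (α := ℝ) 0 (x+1)
    have h2 : Ioo 0 (x+1) = Ioc 0 x := by ext; simp [Nat.lt_succ_iff]
    rw [h2] at this
    refine this.trans (by norm_num)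
  have hs2 : ∑ b ∈ Ioc 0 x, (if m < b then ((b:ℝ)^2)⁻¹ else 0) ≤ 2 / (m + 1) := by
    rw [← sum_filter]
    have := sum_Ioo_inv_sq_le (α := ℝ) m (x+1)
    have h2 : Ioo m (x+1) = (Ioc 0 x).filter fun b => m < b := by
      ext; simp only [mem_Ioo, mem_filter, mem_Ioc]; omega
    rw [h2] at this
    exact this
  have hm1 : Real.sqrt l ≤ m + 1 := by
    have h1 : x < (m+1)^4 := by
      have h2 : x < (Nat.sqrt x + 1) * (Nat.sqrt x + 1) := Nat.lt_succ_sqrt x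
      have h3 : Nat.sqrt x < (m + 1) * (m + 1) := Nat.lt_succ_sqrt _
      have h4 : Nat.sqrt x + 1 ≤ (m+1)*(m+1) := h3
      calc x < (Nat.sqrt x + 1) * (Nat.sqrt x + 1) := h2
        _ ≤ ((m+1)*(m+1)) * ((m+1)*(m+1)) := Nat.mul_le_mul h4 h4
        _ = (m+1)^4 := by ring
    have h1' : (x:ℝ) < ((m:ℝ)+1)^4 := by exact_mod_cast h1
    rw [Real.sqrt_le_left (by positivity)]
    have h5 : l ≤ Real.sqrt x := by
      apply Real.le_sqrt_of_sq_le
      have ha := log_le_half (Real.log x) (by linarith)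
      have hb : Real.log x = 2 * Real.log (Real.sqrt x) := by rw [Real.log_sqrt hx0.le]; ring
      have hc := log_le_half (Real.sqrt x) (Real.sqrt_pos.2 hx0)
      have hd : l ≤ Real.sqrt x := by
        have : l ≤ Real.log x / 2 := ha
        linarith [Real.sqrt_nonneg (x:ℝ)]
      calc l ^ 2 ≤ Real.sqrt x ^ 2 := by gcongr
        _ = (x:ℝ) := Real.sq_sqrt hx0.le
    refine h5.trans ?_
    rw [Real.sqrt_le_left (by positivity)]
    calc (x:ℝ) ≤ ((m:ℝ)+1)^4 := h1'.le
      _ = _ := by ring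
  calc C1 * x / Real.sqrt l * ∑ b ∈ Ioc 0 x, ((b:ℝ)^2)⁻¹ + x * ∑ b ∈ Ioc 0 x, (if m < b then ((b:ℝ)^2)⁻¹ else 0)
      ≤ C1 * x / Real.sqrt l * 2 + x * (2 / (m + 1)) := by gcongr
    _ ≤ C1 * x / Real.sqrt l * 2 + x * (2 / Real.sqrt l) := by gcongr
    _ = _ := by field_simp

end hardyramanujan

end HR


namespace HR

open Finset

section mainpart

lemma sum_XX2 (J : Finset ℤ) (Φ : ℤ × Bool → ℝ) :
    ∑ x ∈ XX J, Φ x = ∑ n ∈ J, Φ (n, false) + ∑ n ∈ J, Φ (n, true) := by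
  unfold XX
  rw [sum_product, ← sum_add_distrib]
  refine sum_congr rfl fun n _ => ?_
  rw [Fintype.sum_bool, add_comm]

lemma form_eq (P : Finset ℕ) (θ c : ℝ) (J : Finset ℤ) (r : ℕ) (h : ℤ × Bool → ℝ) :
    ip (XX J) h (Bp P θ c J r h) =
      2 * ∑ n ∈ J, kap P θ c J r (n, false) * (h (n, false) * h (stp r (n, false))) := by
  have h1 : ip (XX J) h (Bp P θ c J r h) = ∑ x ∈ XX J, kap P θ c J r x * (h x * h (stp r x)) := by
    unfold ip Bp
    simp only [LinearMap.coe_mk, AddHom.coe_mk]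
    exact sum_congr rfl fun x _ => by ring
  have h2 := reindex P θ c J r (fun x => if x.2 then h x * h (stp r x) else 0)
  rw [sum_XX2, sum_XX2] at h2
  simp [stp, sg] at h2
  rw [h1, sum_XX2]
  simp only [stp, sg]
  simp
  rw [h2, two_mul]
  congr 1
  exact sum_congr rfl fun x _ => by ring

lemma theta_low (L : ℝ) (hL : 2 ≤ L) (k : ℕ) (hk : (k:ℝ) ≤ 8 * L) : Real.exp (-16) ≤ (1 - 1 / L) ^ k := by
  have hL0 : 0 < L := by linarith
  have h1 : Real.exp (-(2 / L)) ≤ 1 - 1 / L := by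
    rw [Real.exp_neg, inv_le_comm₀ (Real.exp_pos _)]
    · have h2 := Real.add_one_le_exp (2 / L)
      refine le_trans ?_ h2
      rw [inv_le_iff_one_le_mul₀]
      · have : 1 / L ≤ 1 / 2 := by
          apply one_div_le_one_div_of_le <;> linarith
        have h3 : 0 < 1 / L := by positivity
        have h4 : 2 / L = 2 * (1 / L) := by ring
        rw [h4]; nlinarith
      · have : 1 / L ≤ 1 / 2 := by
          apply one_div_le_one_div_of_le <;> linarith
        linarith
    · have : 1 / L ≤ 1 / 2 := by
          apply one_div_le_one_div_of_le <;> linarith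
      linarith
  calc Real.exp (-16) ≤ Real.exp (k * (-(2 / L))) := by
        apply Real.exp_le_exp.2
        have : k * (2 / L) ≤ 8 * L * (2 / L) := by gcongr
        have h3 : 8 * L * (2 / L) = 16 := by field_simp; norm_num
        linarith
    _ = Real.exp (-(2 / L)) ^ k := by rw [← Real.exp_nat_mul]
    _ ≤ _ := by gcongr

variable {y lg q v L : ℝ}

theorem main_part (p : Par y lg q v L) (P : Finset ℕ) (θ c : ℝ) (hP : ∀ r ∈ P, r.Prime) (hodd : ∀ r ∈ P, Odd r)
    (hθ : θ = 1 - 1 / L) (hc : c = θ ^ 2) (hℓ : ∑ r ∈ P, (1 : ℝ) / r ≤ L) (hPv : ∀ r ∈ P, Real.exp v ≤ (r : ℝ))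
    (hPy : ∀ r ∈ P, (r : ℝ) ≤ Real.exp y)
    (a : ℤ) (K : ℕ) (hK : Real.exp (L * y ^ 2 / 2) ≤ K) (J : Finset ℤ) (hJ : J = Finset.Ico a (a + K))
    (w₁ w₂ : ℤ → ℝ) (hw₁ : ∀ n, |w₁ n| ≤ 1) (hw₂ : ∀ n, |w₂ n| ≤ 1)
    (hs₁ : ∀ n, n ∉ J → w₁ n = 0) (hs₂ : ∀ n, n ∉ J → w₂ n = 0)
    (ho₁ : ∀ n, 8 * L < om P n → w₁ n = 0) (ho₂ : ∀ n, 8 * L < om P n → w₂ n = 0)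
    (M : ℝ) (hM : 0 < M) :
    |∑ r ∈ P, ∑ n ∈ J, dv c r n * (w₁ n * w₂ (n + r))| ≤
      8 * Real.exp 25 * Real.sqrt (2 * L) *
        (M * ∑ n ∈ J, w₁ n ^ 2 + M⁻¹ * ∑ n ∈ J, w₂ n ^ 2 + 4 * K * (M + M⁻¹) * Real.exp (-(y / q))) := by
  have hL0 := p.hL0
  have hθp : 0 < θ := by
    have : 1 / L ≤ 1 / 2 := by apply one_div_le_one_div_of_le <;> linarith
    rw [hθ]; linarith
  have hg : ∀ n, 0 < gw P θ n := fun n => Real.sqrt_pos.2 (pow_pos hθp _)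
  have hg2 : ∀ n, gw P θ n ^ 2 = θ ^ om P n := fun n => Real.sq_sqrt (pow_pos hθp _).le
  set h : ℤ × Bool → ℝ := fun x =>
    if x.2 then (Real.sqrt M)⁻¹ * (w₂ x.1 / gw P θ x.1) else Real.sqrt M * (w₁ x.1 / gw P θ x.1) with hh
  have hMs : 0 < Real.sqrt M := Real.sqrt_pos.2 hM
  have hM2 : Real.sqrt M ^ 2 = M := Real.sq_sqrt hM.le
  have hsq : ∀ (w : ℤ → ℝ), (∀ n, 8 * L < om P n → w n = 0) → ∀ n, (w n / gw P θ n) ^ 2 ≤ Real.exp 16 * w n ^ 2 := by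
    intro w hw n
    by_cases hn : 8 * L < om P n
    · rw [hw n hn]; simp
    · push Not at hn
      rw [div_pow, hg2, div_le_iff₀ (pow_pos hθp _)]
      have h1 := theta_low L (by linarith) _ hn
      rw [← hθ] at h1
      have h2 : 1 ≤ Real.exp 16 * θ ^ om P n := by
        calc (1:ℝ) = Real.exp 16 * Real.exp (-16) := by rw [← Real.exp_add]; simp
          _ ≤ _ := by gcongr
      nlinarith [sq_nonneg (w n)]
  have hf : ∀ n, h (n, false) ^ 2 ≤ Real.exp 16 * (M * w₁ n ^ 2) := by
    intro n
    have := hsq w₁ ho₁ n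
    simp only [hh, Bool.false_eq_true, if_false]
    rw [mul_pow, hM2]
    nlinarith
  have ht : ∀ n, h (n, true) ^ 2 ≤ Real.exp 16 * (M⁻¹ * w₂ n ^ 2) := by
    intro n
    have := hsq w₂ ho₂ n
    simp only [hh, if_true]
    rw [mul_pow, inv_pow, hM2]
    have h2 : 0 < M⁻¹ := inv_pos.2 hM
    nlinarith
  have hMi : 0 < M⁻¹ := inv_pos.2 hM
  have hb : ∀ x, |h x| ≤ Real.sqrt (Real.exp 16 * (M + M⁻¹)) := by
    rintro ⟨n, b⟩
    apply Real.abs_le_sqrt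
    cases b
    · have h1 : w₁ n ^ 2 ≤ 1 := by rw [sq_le_one_iff_abs_le_one]; exact hw₁ n
      refine (hf n).trans ?_
      gcongr
      nlinarith
    · have h1 : w₂ n ^ 2 ≤ 1 := by rw [sq_le_one_iff_abs_le_one]; exact hw₂ n
      refine (ht n).trans ?_
      gcongr
      nlinarith
  have hs : ∀ x, x ∉ XX J → h x = 0 := by
    rintro ⟨n, b⟩ hx
    rw [mem_XX] at hx
    cases b
    · simp [hh, hs₁ n hx]
    · simp [hh, hs₂ n hx]
  have core := core_par p P θ c hP hodd hθ hc hℓ hPv hPy a K hK h (by rw [← hJ]; exact hs) _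
    (Real.sqrt_nonneg _) hb
  rw [← hJ, Real.sq_sqrt (by positivity)] at core
  have e1 : ip (XX J) h (∑ r ∈ P, Bp P θ c J r h) = 2 * ∑ r ∈ P, ∑ n ∈ J, dv c r n * (w₁ n * w₂ (n + r)) := by
    have : ip (XX J) h (∑ r ∈ P, Bp P θ c J r h) = ∑ r ∈ P, ip (XX J) h (Bp P θ c J r h) := by
      unfold ip
      rw [sum_comm]
      refine sum_congr rfl fun x _ => ?_
      rw [Finset.sum_apply, mul_sum]
    rw [this, mul_sum]
    refine sum_congr rfl fun r _ => ?_
    rw [form_eq]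
    congr 1
    refine sum_congr rfl fun n hn => ?_
    have e2 : stp r (n, false) = (n + r, true) := by simp [stp, sg]
    rw [e2]
    simp only [hh, Bool.false_eq_true, if_false, if_true]
    unfold kap
    rw [e2]
    by_cases hnr : n + (r:ℤ) ∈ J
    · rw [if_pos ⟨hn, hnr⟩]
      have g1 := (hg n).ne'
      have g2 := (hg (n + r)).ne'
      have g3 := hMs.ne'
      field_simp
    · rw [hs₂ _ hnr]; simp
  have e2 : ip (XX J) h h ≤ Real.exp 16 * (M * ∑ n ∈ J, w₁ n ^ 2 + M⁻¹ * ∑ n ∈ J, w₂ n ^ 2) := by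
    unfold ip
    rw [sum_XX2, mul_add, mul_sum, mul_sum, mul_sum, mul_sum]
    refine add_le_add (sum_le_sum fun n _ => ?_) (sum_le_sum fun n _ => ?_)
    · rw [← sq]; exact hf n
    · rw [← sq]; exact ht n
  rw [e1, abs_mul, abs_two] at core
  have e3 : Real.exp 25 = Real.exp 9 * Real.exp 16 := by rw [← Real.exp_add]; norm_num
  have e4 : 16 * Real.exp 9 * Real.sqrt (2 * L) * (ip (XX J) h h + 4 * K * (Real.exp 16 * (M + M⁻¹)) * Real.exp (-(y / q)))
      ≤ 16 * Real.exp 9 * Real.sqrt (2 * L) * (Real.exp 16 * (M * ∑ n ∈ J, w₁ n ^ 2 + M⁻¹ * ∑ n ∈ J, w₂ n ^ 2)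
        + 4 * K * (Real.exp 16 * (M + M⁻¹)) * Real.exp (-(y / q))) := by gcongr
  rw [e3]
  have e5 := core.trans e4
  linarith

end mainpart

end HR


namespace HR

open Finset

section excep

lemma four_om_expand (P : Finset ℕ) (hP : ∀ r ∈ P, r.Prime) (n : ℕ) :
    (4:ℝ) ^ om P (n:ℤ) = ∑ A ∈ P.powerset, (3:ℝ) ^ A.card * (if (∏ r ∈ A, r) ∣ n then 1 else 0) := by
  have h1 : (4:ℝ) ^ om P (n:ℤ) = ∏ r ∈ P, (1 + (if r ∣ n then (3:ℝ) else 0)) := by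
    unfold om
    rw [← prod_const, prod_filter]
    refine prod_congr rfl fun r _ => ?_
    simp only [Int.natCast_dvd_natCast]
    split_ifs <;> norm_num
  rw [h1, prod_one_add]
  refine sum_congr rfl fun A hA => ?_
  rw [mem_powerset] at hA
  by_cases h : ∀ r ∈ A, r ∣ n
  · have h2 : (∏ r ∈ A, r) ∣ n :=
      Finset.prod_primes_dvd n (fun r hr => (hP r (hA hr)).prime) h
    rw [if_pos h2, mul_one, ← prod_const]
    exact prod_congr rfl fun r hr => if_pos (h r hr)
  · have h2 : ¬ (∏ r ∈ A, r) ∣ n := fun h3 => h fun r hr => (dvd_prod_of_mem _ hr).trans h3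
    rw [if_neg h2, mul_zero]
    push Not at h
    obtain ⟨r, hr, hrn⟩ := h
    exact prod_eq_zero hr (if_neg hrn)

lemma four_om (P : Finset ℕ) (hP : ∀ r ∈ P, r.Prime) (X : ℕ) :
    ∑ n ∈ Ioc 0 X, (4:ℝ) ^ om P (n:ℤ) ≤ X * Real.exp (3 * ∑ r ∈ P, (1:ℝ) / r) := by
  calc ∑ n ∈ Ioc 0 X, (4:ℝ) ^ om P (n:ℤ)
      = ∑ A ∈ P.powerset, (3:ℝ) ^ A.card * ((X / ∏ r ∈ A, r : ℕ) : ℝ) := by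
        rw [sum_congr rfl fun n _ => four_om_expand P hP n, sum_comm]
        refine sum_congr rfl fun A _ => ?_
        rw [← mul_sum, ← Nat.Ioc_filter_dvd_card_eq_div]
        congr 1
        rw [← sum_filter]; simp
    _ ≤ ∑ A ∈ P.powerset, X * ∏ r ∈ A, (3 / (r:ℝ)) := by
        refine sum_le_sum fun A _ => ?_
        have h1 : ((X / ∏ r ∈ A, r : ℕ) : ℝ) ≤ (X:ℝ) / ∏ r ∈ A, (r:ℝ) := by
          have := @Nat.cast_div_le ℝ _ _ _ X (∏ r ∈ A, r)
          rwa [Nat.cast_prod] at this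
        rw [prod_div_distrib, prod_const]
        calc (3:ℝ) ^ A.card * ((X / ∏ r ∈ A, r : ℕ) : ℝ) ≤ 3 ^ A.card * ((X:ℝ) / ∏ r ∈ A, (r:ℝ)) := by gcongr
          _ = _ := by ring
    _ = X * ∏ r ∈ P, (1 + 3 / (r:ℝ)) := by rw [← mul_sum, prod_one_add]
    _ ≤ X * ∏ r ∈ P, Real.exp (3 / (r:ℝ)) := by
        gcongr with r hr
        rw [add_comm]; exact Real.add_one_le_exp _
    _ = _ := by
        rw [← Real.exp_sum, mul_sum]
        congr 3
        funext r; ring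

lemma four_om_J (P : Finset ℕ) (hP : ∀ r ∈ P, r.Prime) (N : ℕ) (J : Finset ℤ)
    (hJ : J = Finset.Ico ((N:ℤ) + 1) ((N:ℤ) + 1 + ((2 * N : ℕ) : ℤ))) (L : ℝ) (hℓ : ∑ r ∈ P, (1 : ℝ) / r ≤ L) :
    ∑ n ∈ J, (4:ℝ) ^ om P n ≤ 3 * N * Real.exp (3 * L) := by
  have h1 : J ⊆ (Ioc 0 (3 * N)).image (fun n : ℕ => (n : ℤ)) := by
    intro n hn
    rw [hJ, mem_Ico] at hn
    rw [mem_image]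
    refine ⟨n.toNat, mem_Ioc.2 ⟨by omega, by omega⟩, by omega⟩
  calc ∑ n ∈ J, (4:ℝ) ^ om P n ≤ ∑ n ∈ (Ioc 0 (3 * N)).image (fun n : ℕ => (n : ℤ)), (4:ℝ) ^ om P n :=
        sum_le_sum_of_subset_of_nonneg h1 fun _ _ _ => by positivity
    _ = ∑ n ∈ Ioc 0 (3 * N), (4:ℝ) ^ om P (n:ℤ) := sum_image fun a _ b _ h => by exact_mod_cast h
    _ ≤ ((3 * N : ℕ) : ℝ) * Real.exp (3 * ∑ r ∈ P, (1:ℝ) / r) := four_om P hP _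
    _ ≤ 3 * N * Real.exp (3 * L) := by push_cast; gcongr

lemma om_exc (L : ℝ) (k : ℕ) (hL : 0 ≤ L) (hk : 8 * L < k) : (k:ℝ) ≤ 4 ^ k * Real.exp (-(5 * L)) := by
  have h1 : (k:ℝ) ≤ 2 ^ k := by exact_mod_cast Nat.lt_two_pow_self.le
  have h2 : Real.exp (5 * L) ≤ 2 ^ k := by
    have h3 : (2:ℝ) ^ k = Real.exp (k * Real.log 2) := by
      rw [mul_comm, Real.exp_mul, Real.exp_log (by norm_num), Real.rpow_natCast]
    rw [h3]
    apply Real.exp_le_exp.2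
    have := Real.log_two_gt_d9
    nlinarith
  rw [Real.exp_neg, ← div_eq_mul_inv, le_div_iff₀ (Real.exp_pos _)]
  calc (k:ℝ) * Real.exp (5 * L) ≤ 2 ^ k * 2 ^ k := by gcongr
    _ = 4 ^ k := by rw [← mul_pow]; norm_num

/-- Sum over the exceptional set. -/
lemma exc_sum (P : Finset ℕ) (hP : ∀ r ∈ P, r.Prime) (N : ℕ) (J : Finset ℤ)
    (hJ : J = Finset.Ico ((N:ℤ) + 1) ((N:ℤ) + 1 + ((2 * N : ℕ) : ℤ))) (L : ℝ) (hL : 1 ≤ L) (hℓ : ∑ r ∈ P, (1 : ℝ) / r ≤ L)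
    (E : ℤ → ℝ) (hE : ∀ n, E n = if n ∈ J ∧ 8 * L < om P n then 1 else 0) :
    ∑ r ∈ P, ∑ n ∈ J, ((if (r:ℤ) ∣ n then 1 else 0) + 1 / (r:ℝ)) * E n ≤ 6 * N * Real.exp (-(2 * L)) := by
  rw [sum_comm]
  have h1 : ∀ n ∈ J, ∑ r ∈ P, ((if (r:ℤ) ∣ n then 1 else 0) + 1 / (r:ℝ)) * E n ≤
      2 * Real.exp (-(5 * L)) * 4 ^ om P n := by
    intro n hn
    rw [← sum_mul, sum_add_distrib]
    have h2 : ∑ r ∈ P, (if (r:ℤ) ∣ n then (1:ℝ) else 0) = om P n := by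
      rw [← sum_filter]; simp [om]
    rw [h2, hE]
    split_ifs with h
    · have := om_exc L _ (by linarith) h.2
      linarith [h.2]
    · rw [mul_zero]; positivity
  refine (sum_le_sum h1).trans ?_
  rw [← mul_sum]
  have h3 := four_om_J P hP N J hJ L hℓ
  calc 2 * Real.exp (-(5 * L)) * ∑ n ∈ J, (4:ℝ) ^ om P n
      ≤ 2 * Real.exp (-(5 * L)) * (3 * N * Real.exp (3 * L)) := by gcongr
    _ = 6 * N * (Real.exp (-(5 * L)) * Real.exp (3 * L)) := by ring
    _ = _ := by rw [← Real.exp_add]; ring_nf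

end excep

section block

variable {y lg q v L : ℝ}

lemma cs_shift (J : Finset ℤ) (u₁ u₂ : ℤ → ℝ) (r : ℤ) (hs₂ : ∀ n, n ∉ J → u₂ n = 0) (A₁ A₂ : ℝ)
    (h₁ : ∑ n ∈ J, u₁ n ^ 2 ≤ A₁) (h₂ : ∑ n ∈ J, u₂ n ^ 2 ≤ A₂) :
    ∑ n ∈ J, |u₁ n * u₂ (n + r)| ≤ Real.sqrt (A₁ * A₂) := by
  have h3 : ∑ n ∈ J, u₂ (n + r) ^ 2 ≤ A₂ := by
    refine le_trans ?_ h₂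
    calc ∑ n ∈ J, u₂ (n + r) ^ 2 = ∑ n ∈ J.image (fun n => n + r), u₂ n ^ 2 := by
          rw [sum_image fun a _ b _ h => by simpa using h]
      _ = ∑ n ∈ (J.image (fun n => n + r)).filter (fun n => n ∈ J), u₂ n ^ 2 := by
          rw [sum_filter]
          refine sum_congr rfl fun n _ => ?_
          split_ifs with h
          · rfl
          · rw [hs₂ n h]; simp
      _ ≤ _ := sum_le_sum_of_subset_of_nonneg (fun n hn => (mem_filter.1 hn).2) fun _ _ _ => by positivity
  apply Real.le_sqrt_of_sq_le
  have h4 := sum_mul_sq_le_sq_mul_sq J (fun n => |u₁ n|) (fun n => |u₂ (n + r)|)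
  simp only [sq_abs] at h4
  have h5 : ∑ n ∈ J, |u₁ n * u₂ (n + r)| = ∑ n ∈ J, |u₁ n| * |u₂ (n + r)| := by simp only [abs_mul]
  rw [h5]
  refine h4.trans ?_
  have h0 : 0 ≤ ∑ n ∈ J, u₁ n ^ 2 := sum_nonneg fun _ _ => by positivity
  have h0' : 0 ≤ ∑ n ∈ J, u₂ (n + r) ^ 2 := sum_nonneg fun _ _ => by positivity
  gcongr
  linarith

set_option maxHeartbeats 1000000 in
theorem block (p : Par y lg q v L) (P : Finset ℕ) (hP : ∀ r ∈ P, r.Prime) (hodd : ∀ r ∈ P, Odd r)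
    (hℓ : ∑ r ∈ P, (1 : ℝ) / r ≤ L) (hPv : ∀ r ∈ P, Real.exp v ≤ (r : ℝ))
    (hPy : ∀ r ∈ P, (r : ℝ) ≤ Real.exp y)
    (N : ℕ) (hK : Real.exp (L * y ^ 2 / 2) ≤ ((2 * N : ℕ) : ℝ)) (J : Finset ℤ)
    (hJ : J = Finset.Ico ((N:ℤ) + 1) ((N:ℤ) + 1 + ((2 * N : ℕ) : ℤ)))
    (u₁ u₂ : ℤ → ℝ) (hu₁ : ∀ n, |u₁ n| ≤ 1) (hu₂ : ∀ n, |u₂ n| ≤ 1)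
    (hs₁ : ∀ n, n ∉ J → u₁ n = 0) (hs₂ : ∀ n, n ∉ J → u₂ n = 0)
    (D t₁ t₂ : ℝ) (hD : 1 ≤ D) (ht₁ : 0 < t₁) (ht₂ : 0 < t₂) (ht₁' : t₁ ≤ 1) (ht₂' : t₂ ≤ 1)
    (hA₁ : ∑ n ∈ J, u₁ n ^ 2 ≤ D * N * t₁) (hA₂ : ∑ n ∈ J, u₂ n ^ 2 ≤ D * N * t₂)
    (he : Real.exp (-(y / q)) ≤ t₁ * t₂) (he2 : Real.exp (-(2 * L)) ≤ t₁ * t₂) :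
    |∑ r ∈ P, ∑ n ∈ J, ((if (r:ℤ) ∣ n then 1 else 0) - 1 / (r:ℝ)) * (u₁ n * u₂ (n + r))| ≤
      (288 * Real.exp 25 + 14) * D * N * Real.sqrt L * Real.sqrt (t₁ * t₂) := by
  classical
  have hL0 := p.hL0
  set θ := 1 - 1 / L with hθ
  set c := θ ^ 2 with hc
  set E : ℤ → ℝ := fun n => if n ∈ J ∧ 8 * L < om P n then 1 else 0 with hE
  set w₁ : ℤ → ℝ := fun n => if 8 * L < om P n then 0 else u₁ n with hw₁
  set w₂ : ℤ → ℝ := fun n => if 8 * L < om P n then 0 else u₂ n with hw₂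
  set S := Real.sqrt (t₁ * t₂) with hS
  have htt : 0 < t₁ * t₂ := by positivity
  have hSp : 0 < S := Real.sqrt_pos.2 htt
  have hS2 : S ^ 2 = t₁ * t₂ := Real.sq_sqrt htt.le
  have htt1 : t₁ * t₂ ≤ 1 := mul_le_one₀ ht₁' ht₂.le ht₂'
  have hS1 : S ≤ 1 := Real.sqrt_le_one.2 htt1
  have hS3 : t₁ * t₂ ≤ S := by rw [← hS2]; nlinarith
  have hsL : 1 ≤ Real.sqrt L := Real.one_le_sqrt.2 (by linarith)
  have hNr : (0:ℝ) ≤ N := Nat.cast_nonneg N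
  -- main part
  have wle : ∀ (u : ℤ → ℝ) n, (if 8 * L < om P n then 0 else u n) ^ 2 ≤ u n ^ 2 := by
    intro u n; split_ifs <;> simp [sq_nonneg]
  have hmain := main_part p P θ c hP hodd rfl rfl hℓ hPv hPy ((N:ℤ)+1) (2 * N) hK J hJ w₁ w₂
    (fun n => by simp only [hw₁]; split_ifs <;> simp [hu₁ n])
    (fun n => by simp only [hw₂]; split_ifs <;> simp [hu₂ n])
    (fun n hn => by simp [hw₁, hs₁ n hn]) (fun n hn => by simp [hw₂, hs₂ n hn])
    (fun n hn => by simp [hw₁, hn]) (fun n hn => by simp [hw₂, hn]) (S / t₁) (by positivity)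
  have hW₁ : ∑ n ∈ J, w₁ n ^ 2 ≤ D * N * t₁ := (sum_le_sum fun n _ => wle u₁ n).trans hA₁
  have hW₂ : ∑ n ∈ J, w₂ n ^ 2 ≤ D * N * t₂ := (sum_le_sum fun n _ => wle u₂ n).trans hA₂
  have hinv : (S / t₁)⁻¹ = S / t₂ := by
    rw [inv_div, div_eq_div_iff hSp.ne' ht₂.ne', ← sq, hS2]
  rw [hinv] at hmain
  have hm1 : S / t₁ * ∑ n ∈ J, w₁ n ^ 2 ≤ D * N * S := by
    calc S / t₁ * ∑ n ∈ J, w₁ n ^ 2 ≤ S / t₁ * (D * N * t₁) := by gcongr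
      _ = D * N * S := by field_simp
  have hm2 : S / t₂ * ∑ n ∈ J, w₂ n ^ 2 ≤ D * N * S := by
    calc S / t₂ * ∑ n ∈ J, w₂ n ^ 2 ≤ S / t₂ * (D * N * t₂) := by gcongr
      _ = D * N * S := by field_simp
  have hm3 : 4 * ((2 * N : ℕ) : ℝ) * (S / t₁ + S / t₂) * Real.exp (-(y / q)) ≤ 16 * D * N * S := by
    calc 4 * ((2 * N : ℕ) : ℝ) * (S / t₁ + S / t₂) * Real.exp (-(y / q))
        ≤ 4 * ((2 * N : ℕ) : ℝ) * (S / t₁ + S / t₂) * (t₁ * t₂) := by gcongr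
      _ = 8 * N * S * (t₁ + t₂) := by push_cast; field_simp; ring
      _ ≤ 8 * N * S * (1 + 1) := by gcongr
      _ = 16 * 1 * N * S := by ring
      _ ≤ 16 * D * N * S := by gcongr
  have hs2L : Real.sqrt (2 * L) ≤ 2 * Real.sqrt L := by
    rw [Real.sqrt_le_left (by positivity), mul_pow, Real.sq_sqrt (by linarith)]; linarith
  have hM : |∑ r ∈ P, ∑ n ∈ J, dv c r n * (w₁ n * w₂ (n + r))| ≤ 288 * Real.exp 25 * D * N * Real.sqrt L * S := by
    refine hmain.trans ?_
    calc _ ≤ 8 * Real.exp 25 * (2 * Real.sqrt L) * (D * N * S + D * N * S + 16 * D * N * S) := by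
          gcongr
      _ = _ := by ring
  -- bounds for c
  have hiL : 0 < 1 / L := by positivity
  have hiL1 : 1 / L ≤ 1 := by rw [div_le_one (by linarith)]; linarith
  have hc0 : 0 ≤ c := by positivity
  have hc1 : 1 - c ≤ 2 / L := by
    have : 2 / L = 2 * (1 / L) := by ring
    rw [hc, hθ, this]; nlinarith
  have hcle : c ≤ 1 := by
    rw [hc, hθ]; nlinarith
  -- decomposition
  have hdec : ∑ r ∈ P, ∑ n ∈ J, ((if (r:ℤ) ∣ n then 1 else 0) - 1 / (r:ℝ)) * (u₁ n * u₂ (n + r)) =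
      ∑ r ∈ P, ∑ n ∈ J, dv c r n * (w₁ n * w₂ (n + r)) +
      ∑ r ∈ P, ∑ n ∈ J, dv c r n * (u₁ n * u₂ (n + r) - w₁ n * w₂ (n + r)) -
      ∑ r ∈ P, ∑ n ∈ J, (1 - c) / r * (u₁ n * u₂ (n + r)) := by
    rw [← sum_add_distrib, ← sum_sub_distrib]
    refine sum_congr rfl fun r _ => ?_
    rw [← sum_add_distrib, ← sum_sub_distrib]
    refine sum_congr rfl fun n _ => ?_
    unfold dv
    ring
  have h3 : |∑ r ∈ P, ∑ n ∈ J, (1 - c) / r * (u₁ n * u₂ (n + r))| ≤ 2 * (D * N * S) := by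
    have hq : Real.sqrt (D * N * t₁ * (D * N * t₂)) = D * N * S := by
      rw [hS, show D * N * t₁ * (D * N * t₂) = (D * N) ^ 2 * (t₁ * t₂) by ring,
        Real.sqrt_mul (by positivity), Real.sqrt_sq (by positivity)]
    calc |∑ r ∈ P, ∑ n ∈ J, (1 - c) / r * (u₁ n * u₂ (n + r))|
        ≤ ∑ r ∈ P, (1 - c) / r * ∑ n ∈ J, |u₁ n * u₂ (n + r)| := by
          refine (abs_sum_le_sum_abs _ _).trans (sum_le_sum fun r _ => ?_)
          rw [← mul_sum, abs_mul, abs_of_nonneg (div_nonneg (by linarith) (Nat.cast_nonneg r))]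
          have := abs_sum_le_sum_abs (fun n => u₁ n * u₂ (n + r)) J
          have h0 : 0 ≤ (1 - c) / (r:ℝ) := div_nonneg (by linarith) (Nat.cast_nonneg r)
          gcongr
      _ ≤ ∑ r ∈ P, (1 - c) / r * (D * N * S) := by
          refine sum_le_sum fun r _ => ?_
          have h0 : 0 ≤ (1 - c) / (r:ℝ) := div_nonneg (by linarith) (Nat.cast_nonneg r)
          have := cs_shift J u₁ u₂ r hs₂ _ _ hA₁ hA₂
          rw [hq] at this
          gcongr
      _ = (1 - c) * (∑ r ∈ P, 1 / (r:ℝ)) * (D * N * S) := by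
          rw [← sum_mul, mul_sum]
          congr 1
          exact sum_congr rfl fun r _ => by ring
      _ ≤ (2 / L) * L * (D * N * S) := by
          have : 0 ≤ 1 - c := by linarith
          gcongr
      _ = 2 * (D * N * S) := by field_simp
  have h2 : |∑ r ∈ P, ∑ n ∈ J, dv c r n * (u₁ n * u₂ (n + r) - w₁ n * w₂ (n + r))| ≤ 12 * (D * N * S) := by
    have hdv : ∀ (r : ℕ) (n : ℤ), |dv c r n| ≤ (if (r:ℤ) ∣ n then 1 else 0) + 1 / (r:ℝ) := by
      intro r n
      unfold dv
      have h1 : c / r ≤ 1 / (r:ℝ) := by gcongr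
      have h1' : 0 ≤ c / (r:ℝ) := by positivity
      rw [abs_le]
      constructor <;> split_ifs <;> linarith
    have hdif : ∀ n ∈ J, ∀ r : ℕ, |u₁ n * u₂ (n + r) - w₁ n * w₂ (n + r)| ≤ E n + E (n + r) := by
      intro n hn r
      have hE0 : ∀ m, 0 ≤ E m := fun m => by simp only [hE]; split_ifs <;> norm_num
      by_cases hr : n + (r:ℤ) ∈ J
      · have hb : |u₁ n * u₂ (n + r)| ≤ 1 := by
          rw [abs_mul]; exact mul_le_one₀ (hu₁ n) (abs_nonneg _) (hu₂ _)
        by_cases ha : 8 * L < om P n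
        · have e1 : E n = 1 := if_pos ⟨hn, ha⟩
          have e2 : w₁ n = 0 := if_pos ha
          rw [e1, e2, zero_mul, sub_zero]
          linarith [hE0 (n + r)]
        · by_cases ha2 : 8 * L < om P (n + r)
          · have e1 : E (n + r) = 1 := if_pos ⟨hr, ha2⟩
            have e2 : w₂ (n + r) = 0 := if_pos ha2
            rw [e1, e2, mul_zero, sub_zero]
            linarith [hE0 n]
          · have e1 : w₁ n = u₁ n := if_neg ha
            have e2 : w₂ (n + r) = u₂ (n + r) := if_neg ha2
            rw [e1, e2, sub_self, abs_zero]
            linarith [hE0 n, hE0 (n + r)]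
      · have e1 : u₂ (n + r) = 0 := hs₂ _ hr
        have e2 : w₂ (n + r) = 0 := by simp [hw₂, e1]
        rw [e1, e2]
        simp only [mul_zero, sub_self, abs_zero]
        linarith [hE0 n, hE0 (n + r)]
    have hex := exc_sum P hP N J hJ L (by linarith) hℓ E (fun n => rfl)
    have hex2 : ∀ r ∈ P, ∑ n ∈ J, ((if (r:ℤ) ∣ n then 1 else 0) + 1 / (r:ℝ)) * E (n + r) ≤
        ∑ n ∈ J, ((if (r:ℤ) ∣ n then 1 else 0) + 1 / (r:ℝ)) * E n := by
      intro r _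
      set G : ℤ → ℝ := fun n => ((if (r:ℤ) ∣ n then 1 else 0) + 1 / (r:ℝ)) * E n with hG
      have hG0 : ∀ n, 0 ≤ G n := by
        intro n; simp only [hG, hE]; split_ifs <;> positivity
      have hGs : ∀ n, n ∉ J → G n = 0 := by
        intro n hn; simp [hG, hE, hn]
      calc ∑ n ∈ J, ((if (r:ℤ) ∣ n then 1 else 0) + 1 / (r:ℝ)) * E (n + r) = ∑ n ∈ J, G (n + r) := by
            refine sum_congr rfl fun n _ => ?_
            simp only [hG, dvd_add_self_right]
        _ = ∑ n ∈ J.image (fun n => n + (r:ℤ)), G n := by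
            rw [sum_image fun a _ b _ h => by simpa using h]
        _ = ∑ n ∈ (J.image (fun n => n + (r:ℤ))).filter (fun n => n ∈ J), G n := by
            rw [sum_filter]
            refine sum_congr rfl fun n _ => ?_
            split_ifs with h
            · rfl
            · rw [hGs n h]
        _ ≤ ∑ n ∈ J, G n :=
            sum_le_sum_of_subset_of_nonneg (fun n hn => (mem_filter.1 hn).2) fun n _ _ => hG0 n
    calc |∑ r ∈ P, ∑ n ∈ J, dv c r n * (u₁ n * u₂ (n + r) - w₁ n * w₂ (n + r))|
        ≤ ∑ r ∈ P, ∑ n ∈ J, ((if (r:ℤ) ∣ n then 1 else 0) + 1 / (r:ℝ)) * (E n + E (n + r)) := by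
          refine (abs_sum_le_sum_abs _ _).trans (sum_le_sum fun r _ => ?_)
          refine (abs_sum_le_sum_abs _ _).trans (sum_le_sum fun n hn => ?_)
          rw [abs_mul]
          exact mul_le_mul (hdv r n) (hdif n hn r) (abs_nonneg _) ((abs_nonneg _).trans (hdv r n))
      _ ≤ ∑ r ∈ P, 2 * ∑ n ∈ J, ((if (r:ℤ) ∣ n then 1 else 0) + 1 / (r:ℝ)) * E n := by
          refine sum_le_sum fun r hr => ?_
          simp only [mul_add]
          rw [sum_add_distrib]
          have := hex2 r hr
          linarith
      _ ≤ 2 * (6 * N * Real.exp (-(2 * L))) := by rw [← mul_sum]; gcongr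
      _ ≤ 2 * (6 * N * S) := by
          have := he2.trans hS3
          gcongr
      _ = 12 * (1 * N * S) := by ring
      _ ≤ 12 * (D * N * S) := by gcongr
  rw [hdec]
  have hfin : D * N * S ≤ D * N * Real.sqrt L * S := by
    have : D * N * 1 * S ≤ D * N * Real.sqrt L * S := by gcongr
    linarith
  have ha := abs_sub (∑ r ∈ P, ∑ n ∈ J, dv c r n * (w₁ n * w₂ (n + r)) +
      ∑ r ∈ P, ∑ n ∈ J, dv c r n * (u₁ n * u₂ (n + r) - w₁ n * w₂ (n + r)))
      (∑ r ∈ P, ∑ n ∈ J, (1 - c) / r * (u₁ n * u₂ (n + r)))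
  have hb := abs_add_le (∑ r ∈ P, ∑ n ∈ J, dv c r n * (w₁ n * w₂ (n + r)))
      (∑ r ∈ P, ∑ n ∈ J, dv c r n * (u₁ n * u₂ (n + r) - w₁ n * w₂ (n + r)))
  have hgoal : (288 * Real.exp 25 + 14) * D * N * Real.sqrt L * S =
    288 * Real.exp 25 * D * N * Real.sqrt L * S + 14 * (D * N * Real.sqrt L * S) := by ring
  linarith

end block

end HR


namespace HR

open Finset

section twoblock

lemma par_exists : ∃ Y0 : ℝ, 100 ≤ Y0 ∧ ∀ y : ℝ, Y0 ≤ y → ∀ L : ℝ, 2000000 ≤ L → 2 * L ≤ y →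
    Par y (Real.log y) (y ^ (0.22:ℝ)) (y ^ (0.8:ℝ)) L := by
  have h1 := (isLittleO_log_rpow_atTop (r := (0.02:ℝ)) (by norm_num)).bound (c := 1 / 240) (by norm_num)
  obtain ⟨Y, hY⟩ := Filter.eventually_atTop.1 h1
  refine ⟨max Y 100, le_max_right _ _, fun y hy L hL hLy => ?_⟩
  have hy1 : 100 ≤ y := (le_max_right _ _).trans hy
  have hy0 : 0 < y := by linarith
  have hl1 : 1 ≤ Real.log y := by
    rw [Real.le_log_iff_exp_le hy0]
    have := Real.exp_one_lt_d9; linarith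
  have h2 := hY y ((le_max_left _ _).trans hy)
  rw [Real.norm_of_nonneg (by linarith), Real.norm_of_nonneg (Real.rpow_nonneg hy0.le _)] at h2
  have h3 : 240 * Real.log y ≤ y ^ (0.02:ℝ) := by linarith
  have ad : ∀ a b : ℝ, y ^ a * y ^ b = y ^ (a + b) := fun a b => (Real.rpow_add hy0 a b).symm
  have mono : ∀ a b : ℝ, a ≤ b → y ^ a ≤ y ^ b := fun a b h => Real.rpow_le_rpow_of_exponent_le (by linarith) h
  have one : y ^ (1:ℝ) = y := Real.rpow_one y
  have pos : ∀ a : ℝ, 0 < y ^ a := fun a => Real.rpow_pos_of_pos hy0 a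
  refine ⟨hy1, Real.exp_log hy0, hl1, ?_, ?_, ?_, ?_, ?_, hLy, hL⟩
  · have := mono 0.02 0.22 (by norm_num); linarith
  · have := mono 0.22 1 (by norm_num); rwa [one] at this
  · have e : (y ^ (0.22:ℝ)) ^ 4 = y ^ (0.88:ℝ) := by
      rw [← Real.rpow_natCast, ← Real.rpow_mul hy0.le]; norm_num
    rw [e]
    calc 240 * y ^ (0.88:ℝ) * Real.log y = y ^ (0.88:ℝ) * (240 * Real.log y) := by ring
      _ ≤ y ^ (0.88:ℝ) * y ^ (0.02:ℝ) := by have := pos 0.88; gcongr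
      _ = y ^ (0.9:ℝ) := by rw [ad]; norm_num
      _ ≤ y ^ (1:ℝ) := mono _ _ (by norm_num)
      _ = y := one
  · calc 40 * y * Real.log y ≤ y * (240 * Real.log y) := by nlinarith
      _ ≤ y ^ (1:ℝ) * y ^ (0.02:ℝ) := by rw [one]; gcongr
      _ = y ^ (0.22:ℝ) * y ^ (0.8:ℝ) := by rw [ad, ad]; norm_num
  · have e : y / y ^ (0.22:ℝ) = y ^ (0.78:ℝ) := by
      rw [div_eq_iff (pos _).ne', ad]; norm_num
    rw [e]
    calc 60 * y ^ (0.78:ℝ) * Real.log y ≤ y ^ (0.78:ℝ) * (240 * Real.log y) := by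
          have := pos 0.78
          have h5 : 0 < y ^ (0.78:ℝ) * Real.log y := by positivity
          linarith
      _ ≤ y ^ (0.78:ℝ) * y ^ (0.02:ℝ) := by have := pos 0.78; gcongr
      _ = y ^ (0.8:ℝ) := by rw [ad]; norm_num

lemma two_block_aux : ∃ Y1 : ℝ, 100 ≤ Y1 ∧ ∀ y : ℝ, Y1 ≤ y → ∀ L : ℝ, 2000000 ≤ L → L ≤ Real.log y + 4 →
    Par y (Real.log y) (y ^ (0.22:ℝ)) (y ^ (0.8:ℝ)) L ∧
    Par (y ^ (0.8:ℝ)) (Real.log (y ^ (0.8:ℝ))) ((y ^ (0.8:ℝ)) ^ (0.22:ℝ)) ((y ^ (0.8:ℝ)) ^ (0.8:ℝ)) L ∧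
    Real.exp 4 * y ≤ Real.exp (y ^ (0.624:ℝ)) := by
  obtain ⟨Y0, hY0, hpar⟩ := par_exists
  have h1 := (isLittleO_log_rpow_atTop (r := (0.624:ℝ)) (by norm_num)).bound (c := 1 / 8) (by norm_num)
  have h2 := (tendsto_rpow_atTop (y := (0.8:ℝ)) (by norm_num)).eventually_ge_atTop Y0
  obtain ⟨Y, hY⟩ := Filter.eventually_atTop.1 (h1.and h2)
  refine ⟨max Y 100, le_max_right _ _, fun y hy L hL hLy => ?_⟩
  have hy1 : 100 ≤ y := (le_max_right _ _).trans hy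
  have hy0 : 0 < y := by linarith
  obtain ⟨h3, h4⟩ := hY y ((le_max_left _ _).trans hy)
  have hl : 10 ≤ Real.log y := by linarith
  rw [Real.norm_of_nonneg (by linarith), Real.norm_of_nonneg (Real.rpow_nonneg hy0.le _)] at h3
  have mono : ∀ a b : ℝ, a ≤ b → y ^ a ≤ y ^ b := fun a b h => Real.rpow_le_rpow_of_exponent_le (by linarith) h
  have m1 := mono 0.624 0.8 (by norm_num)
  have m2 := mono 0.8 1 (by norm_num)
  rw [Real.rpow_one] at m2
  have hL2 : 2 * L ≤ y ^ (0.8:ℝ) := by linarith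
  refine ⟨hpar y (by linarith) L hL (by linarith), hpar _ h4 L hL hL2, ?_⟩
  calc Real.exp 4 * y = Real.exp (4 + Real.log y) := by rw [Real.exp_add, Real.exp_log hy0]
    _ ≤ _ := Real.exp_le_exp.2 (by linarith)

/-- Both blocks together. -/
theorem two_block : ∃ Y1 CB : ℝ, 100 ≤ Y1 ∧ 0 < CB ∧ ∀ (y L : ℝ) (P : Finset ℕ) (N : ℕ), Y1 ≤ y → 2000000 ≤ L →
    L ≤ Real.log y + 4 → (∀ r ∈ P, r.Prime) →
    (∀ r ∈ P, y ^ ((2:ℝ)/3) * Real.log y ^ 2 ≤ Real.log r) → (∀ r ∈ P, (r:ℝ) ≤ Real.exp y) →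
    (∑ r ∈ P, (1 : ℝ) / r ≤ L) → (Real.exp (L * y ^ 2) ≤ N) →
    ∀ (J : Finset ℤ), J = Finset.Ico ((N:ℤ) + 1) ((N:ℤ) + 1 + ((2 * N : ℕ) : ℤ)) →
    ∀ (u₁ u₂ : ℤ → ℝ), (∀ n, |u₁ n| ≤ 1) → (∀ n, |u₂ n| ≤ 1) →
    (∀ n, n ∉ J → u₁ n = 0) → (∀ n, n ∉ J → u₂ n = 0) →
    ∀ (D t₁ t₂ : ℝ), 1 ≤ D → 0 < t₁ → 0 < t₂ → t₁ ≤ 1 → t₂ ≤ 1 →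
    (∑ n ∈ J, u₁ n ^ 2 ≤ D * N * t₁) → (∑ n ∈ J, u₂ n ^ 2 ≤ D * N * t₂) →
    (1 / (Real.exp 4 * y) ≤ t₁ * t₂) → (Real.exp (-(2 * L)) ≤ t₁ * t₂) →
    |∑ r ∈ P, ∑ n ∈ J, ((if (r:ℤ) ∣ n then 1 else 0) - 1 / (r:ℝ)) * (u₁ n * u₂ (n + r))| ≤
      CB * D * N * Real.sqrt L * Real.sqrt (t₁ * t₂) := by
  obtain ⟨Y1, hY1, haux⟩ := two_block_aux
  refine ⟨Y1, 2 * (288 * Real.exp 25 + 14), hY1, by positivity, ?_⟩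
  intro y L P N hy hL hLy hP hPl hPy hℓ hN J hJ u₁ u₂ hu₁ hu₂ hs₁ hs₂ D t₁ t₂ hD ht₁ ht₂ ht₁' ht₂' hA₁ hA₂ he he2
  obtain ⟨p1, p2, hexp⟩ := haux y hy L hL hLy
  have hy1 : 100 ≤ y := by linarith
  have hy0 : 0 < y := by linarith
  have mono : ∀ a b : ℝ, a ≤ b → y ^ a ≤ y ^ b := fun a b h => Real.rpow_le_rpow_of_exponent_le (by linarith) h
  have pos : ∀ a : ℝ, 0 < y ^ a := fun a => Real.rpow_pos_of_pos hy0 a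
  have e64 : (y ^ (0.8:ℝ)) ^ (0.8:ℝ) = y ^ (0.64:ℝ) := by
    rw [← Real.rpow_mul hy0.le]; norm_num
  have hl1 : 1 ≤ Real.log y := p1.hlg1
  have hPv2 : ∀ r ∈ P, Real.exp (y ^ (0.64:ℝ)) ≤ r := by
    intro r hr
    have hr0 : (0:ℝ) < r := by exact_mod_cast (hP r hr).pos
    rw [← Real.le_log_iff_exp_le hr0]
    have h1 := mono 0.64 (2/3) (by norm_num)
    have h2 : y ^ ((2:ℝ)/3) * 1 ≤ y ^ ((2:ℝ)/3) * Real.log y ^ 2 := by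
      have := pos (2/3)
      gcongr
      nlinarith
    have h3 := hPl r hr
    linarith
  have hodd : ∀ r ∈ P, Odd r := by
    intro r hr
    apply (hP r hr).odd_of_ne_two
    rintro rfl
    have h1 := hPv2 2 hr
    have h2 := Real.add_one_le_exp (y ^ (0.64:ℝ))
    have h3 := mono 0 0.64 (by norm_num)
    rw [Real.rpow_zero] at h3
    have h4 : (2:ℝ) ≤ y ^ (0.64:ℝ) := by
      have h5 : (100:ℝ) ^ (0.5:ℝ) ≤ y ^ (0.5:ℝ) := Real.rpow_le_rpow (by norm_num) hy1 (by norm_num)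
      have h6 : (100:ℝ) ^ (0.5:ℝ) = 10 := by
        rw [show (100:ℝ) = 10 ^ (2:ℝ) by norm_num, ← Real.rpow_mul (by norm_num)]; norm_num
      have h7 := mono 0.5 0.64 (by norm_num)
      linarith
    push_cast at h1
    linarith
  have hNK : ∀ y' : ℝ, 0 ≤ y' → y' ≤ y → Real.exp (L * y' ^ 2 / 2) ≤ ((2 * N : ℕ) : ℝ) := by
    intro y' h0 h1
    have h2 : Real.exp (L * y' ^ 2 / 2) ≤ Real.exp (L * y ^ 2) := by
      apply Real.exp_le_exp.2
      have h3 : L * y' ^ 2 ≤ L * y ^ 2 := by gcongr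
      have h4 : 0 ≤ L * y' ^ 2 := by positivity
      linarith
    push_cast
    have h5 : (0:ℝ) ≤ N := Nat.cast_nonneg N
    linarith
  have m2 := mono 0.8 1 (by norm_num)
  rw [Real.rpow_one] at m2
  have hexp2 : Real.exp (-(y ^ (0.624:ℝ))) ≤ t₁ * t₂ := by
    refine le_trans ?_ he
    rw [Real.exp_neg, inv_eq_one_div]
    apply one_div_le_one_div_of_le (by positivity) hexp
  have hsub : ∀ Q : Finset ℕ, Q ⊆ P → ∑ r ∈ Q, (1:ℝ) / r ≤ L := fun Q hQ =>
    (sum_le_sum_of_subset_of_nonneg hQ fun _ _ _ => by positivity).trans hℓ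
  have hyq : ∀ z : ℝ, 0 < z → z / z ^ (0.22:ℝ) = z ^ (0.78:ℝ) := by
    intro z hz
    rw [div_eq_iff (Real.rpow_pos_of_pos hz _).ne', ← Real.rpow_add hz]; norm_num
  have b1 := block p1 (P.filter fun r => y ^ (0.8:ℝ) ≤ Real.log r) (fun r hr => hP r (mem_filter.1 hr).1)
    (fun r hr => hodd r (mem_filter.1 hr).1) (hsub _ (filter_subset _ _))
    (fun r hr => by
      have h1 := mem_filter.1 hr
      have hr0 : (0:ℝ) < r := by exact_mod_cast (hP r h1.1).pos
      rw [← Real.le_log_iff_exp_le hr0]; exact h1.2)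
    (fun r hr => hPy r (mem_filter.1 hr).1) N (hNK y hy0.le le_rfl) J hJ u₁ u₂ hu₁ hu₂ hs₁ hs₂ D t₁ t₂ hD ht₁ ht₂
    ht₁' ht₂' hA₁ hA₂
    (by
      rw [hyq y hy0]
      refine le_trans (Real.exp_le_exp.2 ?_) hexp2
      have := mono 0.624 0.78 (by norm_num); linarith) he2
  have b2 := block p2 (P.filter fun r => ¬ y ^ (0.8:ℝ) ≤ Real.log r) (fun r hr => hP r (mem_filter.1 hr).1)
    (fun r hr => hodd r (mem_filter.1 hr).1) (hsub _ (filter_subset _ _))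
    (fun r hr => by
      rw [e64]; exact hPv2 r (mem_filter.1 hr).1)
    (fun r hr => by
      have h1 := mem_filter.1 hr
      have hr0 : (0:ℝ) < r := by exact_mod_cast (hP r h1.1).pos
      rw [← Real.log_le_iff_le_exp hr0]; linarith [h1.2]) N (hNK _ (pos _).le m2) J hJ u₁ u₂ hu₁ hu₂ hs₁ hs₂ D t₁ t₂ hD ht₁ ht₂
    ht₁' ht₂' hA₁ hA₂
    (by
      rw [hyq _ (pos _), ← Real.rpow_mul hy0.le]
      refine le_trans (Real.exp_le_exp.2 ?_) hexp2
      norm_num) he2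
  rw [← sum_filter_add_sum_filter_not P (fun r : ℕ => y ^ (0.8:ℝ) ≤ Real.log r)]
  refine (abs_add_le _ _).trans ?_
  linarith

end twoblock

end HR


namespace HR

open Finset

section reduce

lemma sum_J (N : ℕ) (J : Finset ℤ) (hJ : J = Finset.Ico ((N:ℤ) + 1) ((N:ℤ) + 1 + ((2 * N : ℕ) : ℤ))) (f : ℤ → ℝ) :
    ∑ n ∈ J, f n = ∑ m ∈ Ioc N (3 * N), f (m : ℤ) := by
  symm
  rw [hJ]
  refine sum_nbij' (fun m : ℕ => (m:ℤ)) (fun z : ℤ => z.toNat) ?_ ?_ ?_ ?_ ?_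
  · intro m hm; rw [mem_Ioc] at hm; rw [mem_Ico]; push_cast; omega
  · intro m hm; rw [mem_Ico] at hm; rw [mem_Ioc]; push_cast at hm; omega
  · intro m _; simp
  · intro m hm; rw [mem_Ico] at hm; simp; omega
  · intro m _; rfl

/-- the real bilinear bound for functions on `ℕ` -/
theorem nat_block : ∃ Y1 CB : ℝ, 100 ≤ Y1 ∧ 0 < CB ∧ ∀ (y L : ℝ) (P : Finset ℕ) (N : ℕ), Y1 ≤ y → 2000000 ≤ L →
    L ≤ Real.log y + 4 → (∀ r ∈ P, r.Prime) →
    (∀ r ∈ P, y ^ ((2:ℝ)/3) * Real.log y ^ 2 ≤ Real.log r) → (∀ r ∈ P, (r:ℝ) ≤ Real.exp y) →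
    (∑ r ∈ P, (1 : ℝ) / r ≤ L) → (Real.exp (L * y ^ 2) ≤ N) → (∀ r ∈ P, r ≤ N) →
    ∀ (a b : ℕ → ℝ), (∀ n, |a n| ≤ 1) → (∀ n, |b n| ≤ 1) →
    ∀ (D t₁ t₂ : ℝ), 1 ≤ D → 0 < t₁ → 0 < t₂ → t₁ ≤ 1 → t₂ ≤ 1 →
    (∑ n ∈ Ioc N (3 * N), a n ^ 2 ≤ D * N * t₁) → (∑ n ∈ Ioc N (3 * N), b n ^ 2 ≤ D * N * t₂) →
    (1 / (Real.exp 4 * y) ≤ t₁ * t₂) → (Real.exp (-(2 * L)) ≤ t₁ * t₂) →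
    |∑ r ∈ P, ∑ n ∈ Ioc N (2 * N), ((if r ∣ n then 1 else 0) - 1 / (r:ℝ)) * (a n * b (n + r))| ≤
      CB * D * N * Real.sqrt L * Real.sqrt (t₁ * t₂) := by
  obtain ⟨Y1, CB, hY1, hCB, hmain⟩ := two_block
  refine ⟨Y1, CB, hY1, hCB, ?_⟩
  intro y L P N hy hL hLy hP hPl hPy hℓ hN hPN a b ha hb D t₁ t₂ hD ht₁ ht₂ ht₁' ht₂' hA₁ hA₂ he he2
  set J := Finset.Ico ((N:ℤ) + 1) ((N:ℤ) + 1 + ((2 * N : ℕ) : ℤ)) with hJ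
  set u₁ : ℤ → ℝ := fun z => if (N:ℤ) < z ∧ z ≤ 2 * N then a z.toNat else 0 with hu₁
  set u₂ : ℤ → ℝ := fun z => if z ∈ J then b z.toNat else 0 with hu₂
  have key := hmain y L P N hy hL hLy hP hPl hPy hℓ hN J hJ u₁ u₂
    (fun n => by simp only [hu₁]; split_ifs <;> simp [ha])
    (fun n => by simp only [hu₂]; split_ifs <;> simp [hb])
    (fun n hn => by
      simp only [hu₁]; rw [if_neg]; rw [hJ, mem_Ico] at hn; push_cast at hn; omega)
    (fun n hn => by simp only [hu₂]; rw [if_neg hn])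
    D t₁ t₂ hD ht₁ ht₂ ht₁' ht₂'
    (by
      rw [sum_J N J hJ]
      refine le_trans (sum_le_sum fun n _ => ?_) hA₁
      simp only [hu₁, Int.toNat_natCast]
      split_ifs
      · exact le_rfl
      · simp [sq_nonneg])
    (by
      rw [sum_J N J hJ]
      refine le_trans (sum_le_sum fun n _ => ?_) hA₂
      simp only [hu₂, Int.toNat_natCast]
      split_ifs
      · exact le_rfl
      · simp [sq_nonneg]) he he2
  refine le_trans (le_of_eq ?_) key
  congr 1
  refine sum_congr rfl fun r hr => ?_
  rw [sum_J N J hJ]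
  have hsub : Ioc N (2 * N) ⊆ Ioc N (3 * N) := Ioc_subset_Ioc le_rfl (by omega)
  rw [← sum_subset hsub]
  · refine sum_congr rfl fun n hn => ?_
    rw [mem_Ioc] at hn
    have hrN := hPN r hr
    have e1 : u₁ (n:ℤ) = a n := by
      simp only [hu₁, Int.toNat_natCast]; rw [if_pos]; omega
    have e2 : u₂ ((n:ℤ) + r) = b (n + r) := by
      simp only [hu₂]; rw [if_pos]
      · rw [← Nat.cast_add, Int.toNat_natCast]
      · rw [hJ, mem_Ico]; push_cast; omega
    rw [e1, e2]
    simp only [Int.natCast_dvd_natCast]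
  · intro n _ hn2
    have e1 : u₁ (n:ℤ) = 0 := by
      simp only [hu₁]; rw [if_neg]; rw [mem_Ioc] at hn2; omega
    rw [e1]; simp

/-- complex version -/
theorem cplx_block : ∃ Y1 CB : ℝ, 100 ≤ Y1 ∧ 0 < CB ∧ ∀ (y L : ℝ) (P : Finset ℕ) (N : ℕ), Y1 ≤ y → 2000000 ≤ L →
    L ≤ Real.log y + 4 → (∀ r ∈ P, r.Prime) →
    (∀ r ∈ P, y ^ ((2:ℝ)/3) * Real.log y ^ 2 ≤ Real.log r) → (∀ r ∈ P, (r:ℝ) ≤ Real.exp y) →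
    (∑ r ∈ P, (1 : ℝ) / r ≤ L) → (Real.exp (L * y ^ 2) ≤ N) → (∀ r ∈ P, r ≤ N) →
    ∀ (g₁ g₂ : ℕ → ℂ), (∀ n, ‖g₁ n‖ ≤ 1) → (∀ n, ‖g₂ n‖ ≤ 1) →
    ∀ (D t₁ t₂ : ℝ), 1 ≤ D → 0 < t₁ → 0 < t₂ → t₁ ≤ 1 → t₂ ≤ 1 →
    (∑ n ∈ Ioc N (3 * N), ‖g₁ n‖ ^ 2 ≤ D * N * t₁) → (∑ n ∈ Ioc N (3 * N), ‖g₂ n‖ ^ 2 ≤ D * N * t₂) →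
    (1 / (Real.exp 4 * y) ≤ t₁ * t₂) → (Real.exp (-(2 * L)) ≤ t₁ * t₂) →
    ‖∑ r ∈ P, ∑ n ∈ Ioc N (2 * N), (((if r ∣ n then 1 else 0) - 1 / (r:ℝ) : ℝ) : ℂ) * (g₁ n * g₂ (n + r))‖ ≤
      CB * D * N * Real.sqrt L * Real.sqrt (t₁ * t₂) := by
  obtain ⟨Y1, CB, hY1, hCB, hmain⟩ := nat_block
  refine ⟨Y1, 4 * CB, hY1, by positivity, ?_⟩
  intro y L P N hy hL hLy hP hPl hPy hℓ hN hPN g₁ g₂ hg₁ hg₂ D t₁ t₂ hD ht₁ ht₂ ht₁' ht₂' hA₁ hA₂ he he2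
  have B : ∀ (a b : ℕ → ℝ), (∀ n, |a n| ≤ ‖g₁ n‖) → (∀ n, |b n| ≤ ‖g₂ n‖) →
      |∑ r ∈ P, ∑ n ∈ Ioc N (2 * N), ((if r ∣ n then 1 else 0) - 1 / (r:ℝ)) * (a n * b (n + r))| ≤
      CB * D * N * Real.sqrt L * Real.sqrt (t₁ * t₂) := by
    intro a b ha hb
    refine hmain y L P N hy hL hLy hP hPl hPy hℓ hN hPN a b (fun n => (ha n).trans (hg₁ n))
      (fun n => (hb n).trans (hg₂ n)) D t₁ t₂ hD ht₁ ht₂ ht₁' ht₂' ?_ ?_ he he2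
    · refine le_trans (sum_le_sum fun n _ => ?_) hA₁
      rw [← sq_abs]; have := ha n; gcongr
    · refine le_trans (sum_le_sum fun n _ => ?_) hA₂
      rw [← sq_abs]; have := hb n; gcongr
  have b1 := B (fun n => (g₁ n).re) (fun n => (g₂ n).re) (fun n => Complex.abs_re_le_norm _) (fun n => Complex.abs_re_le_norm _)
  have b2 := B (fun n => (g₁ n).im) (fun n => (g₂ n).im) (fun n => Complex.abs_im_le_norm _) (fun n => Complex.abs_im_le_norm _)
  have b3 := B (fun n => (g₁ n).re) (fun n => (g₂ n).im) (fun n => Complex.abs_re_le_norm _) (fun n => Complex.abs_im_le_norm _)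
  have b4 := B (fun n => (g₁ n).im) (fun n => (g₂ n).re) (fun n => Complex.abs_im_le_norm _) (fun n => Complex.abs_re_le_norm _)
  refine (Complex.norm_le_abs_re_add_abs_im _).trans ?_
  have hre : (∑ r ∈ P, ∑ n ∈ Ioc N (2 * N), (((if r ∣ n then 1 else 0) - 1 / (r:ℝ) : ℝ) : ℂ) * (g₁ n * g₂ (n + r))).re =
      ∑ r ∈ P, ∑ n ∈ Ioc N (2 * N), ((if r ∣ n then 1 else 0) - 1 / (r:ℝ)) * ((g₁ n).re * (g₂ (n + r)).re) -
      ∑ r ∈ P, ∑ n ∈ Ioc N (2 * N), ((if r ∣ n then 1 else 0) - 1 / (r:ℝ)) * ((g₁ n).im * (g₂ (n + r)).im) := by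
    simp only [Complex.re_sum, ← sum_sub_distrib]
    refine sum_congr rfl fun r _ => sum_congr rfl fun n _ => ?_
    rw [Complex.re_ofReal_mul, Complex.mul_re]; ring
  have him : (∑ r ∈ P, ∑ n ∈ Ioc N (2 * N), (((if r ∣ n then 1 else 0) - 1 / (r:ℝ) : ℝ) : ℂ) * (g₁ n * g₂ (n + r))).im =
      ∑ r ∈ P, ∑ n ∈ Ioc N (2 * N), ((if r ∣ n then 1 else 0) - 1 / (r:ℝ)) * ((g₁ n).re * (g₂ (n + r)).im) +
      ∑ r ∈ P, ∑ n ∈ Ioc N (2 * N), ((if r ∣ n then 1 else 0) - 1 / (r:ℝ)) * ((g₁ n).im * (g₂ (n + r)).re) := by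
    simp only [Complex.im_sum, ← sum_add_distrib]
    refine sum_congr rfl fun r _ => sum_congr rfl fun n _ => ?_
    rw [Complex.im_ofReal_mul, Complex.mul_im]; ring
  rw [hre, him]
  have c1 := abs_sub (∑ r ∈ P, ∑ n ∈ Ioc N (2 * N), ((if r ∣ n then 1 else 0) - 1 / (r:ℝ)) * ((g₁ n).re * (g₂ (n + r)).re))
    (∑ r ∈ P, ∑ n ∈ Ioc N (2 * N), ((if r ∣ n then 1 else 0) - 1 / (r:ℝ)) * ((g₁ n).im * (g₂ (n + r)).im))
  have c2 := abs_add_le (∑ r ∈ P, ∑ n ∈ Ioc N (2 * N), ((if r ∣ n then 1 else 0) - 1 / (r:ℝ)) * ((g₁ n).re * (g₂ (n + r)).im))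
    (∑ r ∈ P, ∑ n ∈ Ioc N (2 * N), ((if r ∣ n then 1 else 0) - 1 / (r:ℝ)) * ((g₁ n).im * (g₂ (n + r)).re))
  linarith

lemma reind (N p : ℕ) (hp : 0 < p) (f : ℕ → ℂ) :
    ∑ n ∈ Ioc (N / p) (2 * N / p), f (p * n) = ∑ m ∈ Ioc N (2 * N), (if p ∣ m then 1 else 0) * f m := by
  have h1 : ∑ m ∈ Ioc N (2 * N), (if p ∣ m then 1 else 0) * f m = ∑ m ∈ (Ioc N (2 * N)).filter (fun m => p ∣ m), f m := by
    rw [sum_filter]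
    exact sum_congr rfl fun m _ => by split_ifs <;> simp
  rw [h1]
  refine sum_nbij' (fun n => p * n) (fun m => m / p) ?_ ?_ ?_ ?_ ?_
  · intro n hn
    rw [mem_Ioc, Nat.div_lt_iff_lt_mul hp, Nat.le_div_iff_mul_le hp] at hn
    rw [mem_filter, mem_Ioc]
    exact ⟨⟨by linarith [mul_comm n p], by linarith [mul_comm n p]⟩, dvd_mul_right _ _⟩
  · intro m hm
    rw [mem_filter, mem_Ioc] at hm
    obtain ⟨⟨h1, h2⟩, k, rfl⟩ := hm
    rw [Nat.mul_div_cancel_left _ hp, mem_Ioc, Nat.div_lt_iff_lt_mul hp, Nat.le_div_iff_mul_le hp]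
    exact ⟨by linarith [mul_comm k p], by linarith [mul_comm k p]⟩
  · intro n _; exact Nat.mul_div_cancel_left _ hp
  · intro m hm
    exact Nat.mul_div_cancel' (mem_filter.1 hm).2
  · intro n _; rfl

end reduce

end HR


namespace HR

open Finset

section gen

noncomputable def TF (N : ℕ) (L : ℝ) (P : Finset ℕ) (G₁ G₂ g₁ g₂ : ℕ → ℂ) : ℂ :=
  ((1 / ((N : ℝ) * L) : ℝ) : ℂ) * ∑ p ∈ P, ∑ n ∈ Finset.Ioc (N / p) (2 * N / p), G₁ n * G₂ (n + 1) -
  ((1 / ((N : ℝ) * L) : ℝ) : ℂ) * ∑ n ∈ Finset.Ioc N (2 * N), g₁ n * ∑ p ∈ P, g₂ (n + p) / (p : ℂ)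

lemma TT_eq (N : ℕ) (L : ℝ) (P : Finset ℕ) (G₁ G₂ g₁ g₂ : ℕ → ℂ) (hP : ∀ r ∈ P, r.Prime)
    (h₁ : ∀ r ∈ P, ∀ n, 0 < n → g₁ (r * n) = G₁ n) (h₂ : ∀ r ∈ P, ∀ n, 0 < n → g₂ (r * n) = G₂ n) :
    TF N L P G₁ G₂ g₁ g₂ = ((1 / ((N : ℝ) * L) : ℝ) : ℂ) *
      ∑ r ∈ P, ∑ n ∈ Ioc N (2 * N), (((if r ∣ n then 1 else 0) - 1 / (r:ℝ) : ℝ) : ℂ) * (g₁ n * g₂ (n + r)) := by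
  unfold TF
  rw [← mul_sub]
  congr 1
  have e2 : ∑ n ∈ Finset.Ioc N (2 * N), g₁ n * ∑ p ∈ P, g₂ (n + p) / (p : ℂ) =
      ∑ p ∈ P, ∑ n ∈ Finset.Ioc N (2 * N), 1 / (p:ℂ) * (g₁ n * g₂ (n + p)) := by
    rw [sum_comm]
    refine sum_congr rfl fun n _ => ?_
    rw [mul_sum]
    exact sum_congr rfl fun p _ => by ring
  rw [e2, ← sum_sub_distrib]
  refine sum_congr rfl fun r hr => ?_
  have e1 : ∑ n ∈ Finset.Ioc (N / r) (2 * N / r), G₁ n * G₂ (n + 1) =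
      ∑ n ∈ Finset.Ioc (N / r) (2 * N / r), (fun m => g₁ m * g₂ (m + r)) (r * n) := by
    refine sum_congr rfl fun n hn => ?_
    rw [mem_Ioc] at hn
    have : r * n + r = r * (n + 1) := by ring
    simp only [this]
    rw [h₁ r hr n (lt_of_le_of_lt (Nat.zero_le _) hn.1), h₂ r hr (n+1) (Nat.succ_pos n)]
  rw [e1, reind N r (hP r hr).pos (fun m => g₁ m * g₂ (m + r)), ← sum_sub_distrib]
  refine sum_congr rfl fun n _ => ?_
  split_ifs <;> push_cast <;> ring

lemma cs_norm {ι : Type*} (S : Finset ι) (a b : ι → ℂ) (A B : ℝ) (hA : ∑ n ∈ S, ‖a n‖ ^ 2 ≤ A) (hB : ∑ n ∈ S, ‖b n‖ ^ 2 ≤ B) :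
    ‖∑ n ∈ S, a n * b n‖ ≤ Real.sqrt (A * B) := by
  apply Real.le_sqrt_of_sq_le
  have h1 : ‖∑ n ∈ S, a n * b n‖ ≤ ∑ n ∈ S, ‖a n‖ * ‖b n‖ :=
    (norm_sum_le _ _).trans (sum_le_sum fun n _ => (norm_mul _ _).le)
  have h2 := sum_mul_sq_le_sq_mul_sq S (fun n => ‖a n‖) (fun n => ‖b n‖)
  have h0 : 0 ≤ ∑ n ∈ S, ‖a n‖ ^ 2 := sum_nonneg fun _ _ => by positivity
  have h0' : 0 ≤ ∑ n ∈ S, ‖b n‖ ^ 2 := sum_nonneg fun _ _ => by positivity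
  calc ‖∑ n ∈ S, a n * b n‖ ^ 2 ≤ (∑ n ∈ S, ‖a n‖ * ‖b n‖) ^ 2 := by gcongr
    _ ≤ _ := h2
    _ ≤ A * B := by
        gcongr
        linarith

lemma shift_le (S : Finset ℕ) (T : Finset ℕ) (r : ℕ) (b : ℕ → ℂ) (h : ∀ n ∈ S, n + r ∈ T) :
    ∑ n ∈ S, ‖b (n + r)‖ ^ 2 ≤ ∑ n ∈ T, ‖b n‖ ^ 2 := by
  calc ∑ n ∈ S, ‖b (n + r)‖ ^ 2 = ∑ n ∈ S.image (fun n => n + r), ‖b n‖ ^ 2 := by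
        rw [sum_image fun a _ b _ h => by simpa using h]
    _ ≤ _ := sum_le_sum_of_subset_of_nonneg (fun n hn => by
        obtain ⟨m, hm, rfl⟩ := mem_image.1 hn
        exact h m hm) fun _ _ _ => by positivity

theorem TT_cs (N : ℕ) (L : ℝ) (P : Finset ℕ) (G₁ G₂ g₁ g₂ : ℕ → ℂ) (hN : 0 < N) (hP : ∀ r ∈ P, r.Prime)
    (hL : L = ∑ p ∈ P, (1:ℝ) / p) (hL0 : 0 < L) (hPN : ∀ r ∈ P, r * r ≤ N)
    (D t₁ t₂ : ℝ) (hD : 1 ≤ D) (ht₁ : 0 < t₁) (ht₂ : 0 < t₂)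
    (hG₁ : ∀ x : ℕ, N ≤ x ^ 2 → x ≤ 3 * N → ∑ n ∈ Ioc 0 x, ‖G₁ n‖ ^ 2 ≤ D * x * t₁)
    (hG₂ : ∀ x : ℕ, N ≤ x ^ 2 → x ≤ 3 * N → ∑ n ∈ Ioc 0 x, ‖G₂ n‖ ^ 2 ≤ D * x * t₂)
    (hg₁ : ∑ n ∈ Ioc N (3 * N), ‖g₁ n‖ ^ 2 ≤ D * N * t₁) (hg₂ : ∑ n ∈ Ioc N (3 * N), ‖g₂ n‖ ^ 2 ≤ D * N * t₂) :
    ‖TF N L P G₁ G₂ g₁ g₂‖ ≤ 4 * D * Real.sqrt (t₁ * t₂) := by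
  have hNr : (0:ℝ) < N := by exact_mod_cast hN
  set S := Real.sqrt (t₁ * t₂) with hS
  have hS0 : 0 ≤ S := Real.sqrt_nonneg _
  have hq : ∀ x : ℝ, 0 ≤ x → Real.sqrt (D * x * t₁ * (D * x * t₂)) = D * x * S := by
    intro x hx
    rw [hS, show D * x * t₁ * (D * x * t₂) = (D * x) ^ 2 * (t₁ * t₂) by ring,
        Real.sqrt_mul (by positivity), Real.sqrt_sq (by positivity)]
  have a1 : ‖∑ p ∈ P, ∑ n ∈ Finset.Ioc (N / p) (2 * N / p), G₁ n * G₂ (n + 1)‖ ≤ 3 * D * N * L * S := by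
    have : ∀ p ∈ P, ‖∑ n ∈ Finset.Ioc (N / p) (2 * N / p), G₁ n * G₂ (n + 1)‖ ≤ 3 * D * N * S * (1 / (p:ℝ)) := by
      intro p hp
      have hp0 := (hP p hp).pos
      have hpp := hPN p hp
      have hpN : p ≤ N := le_trans (Nat.le_mul_of_pos_left p hp0) hpp
      have hpr : (0:ℝ) < p := by exact_mod_cast hp0
      set x := 2 * N / p + 1 with hx
      have hxp : 2 * N < x * p := by
        rw [hx, mul_comm _ p]; exact Nat.lt_mul_div_succ (2 * N) hp0
      have hx2 : N ≤ x ^ 2 := by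
        by_contra h
        push Not at h
        have h3 : x ^ 2 * (p * p) ≤ N * N := Nat.mul_le_mul h.le hpp
        have h4 : N * N < (x * p) * (x * p) := by
          have : N < x * p := by omega
          exact Nat.mul_lt_mul'' this this
        have h5 : (x * p) * (x * p) = x ^ 2 * (p * p) := by ring
        omega
      have hx3 : x ≤ 3 * N := by
        have : 2 * N / p ≤ 2 * N := Nat.div_le_self _ _
        omega
      have hxr : (x:ℝ) ≤ 3 * N / p := by
        have h6 : ((2 * N / p : ℕ) : ℝ) ≤ ((2 * N : ℕ) : ℝ) / p := Nat.cast_div_le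
        have h7 : (1:ℝ) ≤ N / p := by rw [le_div_iff₀ hpr, one_mul]; exact_mod_cast hpN
        rw [hx]; push_cast at h6 ⊢
        have h8 : 3 * (N:ℝ) / p = 2 * N / p + N / p := by ring
        linarith
      have c1 : ∑ n ∈ Finset.Ioc (N / p) (2 * N / p), ‖G₁ n‖ ^ 2 ≤ D * x * t₁ := by
        refine le_trans (sum_le_sum_of_subset_of_nonneg ?_ fun _ _ _ => by positivity) (hG₁ x hx2 hx3)
        apply Ioc_subset_Ioc (Nat.zero_le _); omega
      have c2 : ∑ n ∈ Finset.Ioc (N / p) (2 * N / p), ‖G₂ (n + 1)‖ ^ 2 ≤ D * x * t₂ := by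
        refine (shift_le _ (Ioc 0 x) 1 G₂ fun n hn => ?_).trans (hG₂ x hx2 hx3)
        rw [mem_Ioc] at hn ⊢; omega
      have c3 := cs_norm _ G₁ (fun n => G₂ (n + 1)) _ _ c1 c2
      rw [hq _ (Nat.cast_nonneg _)] at c3
      calc _ ≤ D * x * S := c3
        _ ≤ D * (3 * N / p) * S := by gcongr
        _ = _ := by ring
    refine (norm_sum_le _ _).trans ((sum_le_sum this).trans ?_)
    rw [← mul_sum, ← hL]; linarith
  have a2 : ‖∑ n ∈ Finset.Ioc N (2 * N), g₁ n * ∑ p ∈ P, g₂ (n + p) / (p : ℂ)‖ ≤ D * N * L * S := by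
    have e2 : ∑ n ∈ Finset.Ioc N (2 * N), g₁ n * ∑ p ∈ P, g₂ (n + p) / (p : ℂ) =
        ∑ p ∈ P, 1 / (p:ℂ) * ∑ n ∈ Finset.Ioc N (2 * N), (g₁ n * g₂ (n + p)) := by
      simp only [mul_sum]
      rw [sum_comm]
      refine sum_congr rfl fun p _ => ?_
      exact sum_congr rfl fun n _ => by ring
    rw [e2]
    have : ∀ p ∈ P, ‖1 / (p:ℂ) * ∑ n ∈ Finset.Ioc N (2 * N), (g₁ n * g₂ (n + p))‖ ≤ D * N * S * (1 / (p:ℝ)) := by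
      intro p hp
      have hp0 := (hP p hp).pos
      have hpp := hPN p hp
      have hpN : p ≤ N := le_trans (Nat.le_mul_of_pos_left p hp0) hpp
      have c1 : ∑ n ∈ Finset.Ioc N (2 * N), ‖g₁ n‖ ^ 2 ≤ D * N * t₁ := by
        refine le_trans (sum_le_sum_of_subset_of_nonneg ?_ fun _ _ _ => by positivity) hg₁
        apply Ioc_subset_Ioc le_rfl; omega
      have c2 : ∑ n ∈ Finset.Ioc N (2 * N), ‖g₂ (n + p)‖ ^ 2 ≤ D * N * t₂ := by
        refine (shift_le _ (Ioc N (3 * N)) p g₂ fun n hn => ?_).trans hg₂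
        rw [mem_Ioc] at hn ⊢; omega
      have c3 := cs_norm _ g₁ (fun n => g₂ (n + p)) _ _ c1 c2
      rw [hq _ (Nat.cast_nonneg _)] at c3
      rw [norm_mul, norm_div, norm_one, Complex.norm_natCast, mul_comm]
      gcongr
    refine (norm_sum_le _ _).trans ((sum_le_sum this).trans ?_)
    rw [← mul_sum, ← hL]; linarith
  unfold TF
  refine (norm_sub_le _ _).trans ?_
  rw [norm_mul, norm_mul, Complex.norm_real, Real.norm_of_nonneg (by positivity)]
  calc _ ≤ 1 / (N * L) * (3 * D * N * L * S) + 1 / (N * L) * (D * N * L * S) := by gcongr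
    _ = _ := by field_simp; ring

/-- The main general bound. -/
theorem TT_main : ∃ Y1 CB : ℝ, 100 ≤ Y1 ∧ 0 < CB ∧ ∀ (y L : ℝ) (P : Finset ℕ) (N : ℕ), Y1 ≤ y → 2000000 ≤ L →
    L ≤ Real.log y + 4 → (∀ r ∈ P, r.Prime) →
    (∀ r ∈ P, y ^ ((2:ℝ)/3) * Real.log y ^ 2 ≤ Real.log r) → (∀ r ∈ P, (r:ℝ) ≤ Real.exp y) →
    (∑ r ∈ P, (1 : ℝ) / r ≤ L) → (Real.exp (L * y ^ 2) ≤ N) → (∀ r ∈ P, r ≤ N) →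
    ∀ (G₁ G₂ g₁ g₂ : ℕ → ℂ), (∀ n, ‖g₁ n‖ ≤ 1) → (∀ n, ‖g₂ n‖ ≤ 1) →
    (∀ r ∈ P, ∀ n, 0 < n → g₁ (r * n) = G₁ n) → (∀ r ∈ P, ∀ n, 0 < n → g₂ (r * n) = G₂ n) →
    ∀ (D t₁ t₂ : ℝ), 1 ≤ D → 0 < t₁ → 0 < t₂ → t₁ ≤ 1 → t₂ ≤ 1 →
    (∑ n ∈ Ioc N (3 * N), ‖g₁ n‖ ^ 2 ≤ D * N * t₁) → (∑ n ∈ Ioc N (3 * N), ‖g₂ n‖ ^ 2 ≤ D * N * t₂) →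
    (1 / (Real.exp 4 * y) ≤ t₁ * t₂) → (Real.exp (-(2 * L)) ≤ t₁ * t₂) →
    ‖TF N L P G₁ G₂ g₁ g₂‖ ≤ CB * D * Real.sqrt (t₁ * t₂) * (1 / Real.sqrt L) := by
  obtain ⟨Y1, CB, hY1, hCB, hmain⟩ := cplx_block
  refine ⟨Y1, CB, hY1, hCB, ?_⟩
  intro y L P N hy hL hLy hP hPl hPy hℓ hN hPN G₁ G₂ g₁ g₂ hg₁ hg₂ h₁ h₂ D t₁ t₂ hD ht₁ ht₂ ht₁' ht₂' hA₁ hA₂ he he2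
  have key := hmain y L P N hy hL hLy hP hPl hPy hℓ hN hPN g₁ g₂ hg₁ hg₂ D t₁ t₂ hD ht₁ ht₂ ht₁' ht₂' hA₁ hA₂ he he2
  have hNr : (0:ℝ) < N := (Real.exp_pos _).trans_le hN
  have hL0 : 0 < L := by linarith
  have hsL : 0 < Real.sqrt L := Real.sqrt_pos.2 hL0
  rw [TT_eq N L P G₁ G₂ g₁ g₂ hP h₁ h₂, norm_mul, Complex.norm_real, Real.norm_of_nonneg (by positivity)]
  calc _ ≤ 1 / (N * L) * (CB * D * N * Real.sqrt L * Real.sqrt (t₁ * t₂)) := by gcongr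
    _ = CB * D * Real.sqrt (t₁ * t₂) * (Real.sqrt L / L) := by field_simp
    _ = _ := by rw [Real.sqrt_div_self']

end gen

end HR


namespace HR

open Finset

section counting

/-- number of prime factors with multiplicity -/
def Omg (n : ℕ) : ℕ := n.primeFactorsList.length

lemma Omg_mul_prime (r n : ℕ) (hr : r.Prime) (hn : 0 < n) : Omg (r * n) - 1 = Omg n := by
  have h1 : ArithmeticFunction.cardFactors (r * n) = Omg (r * n) := rfl
  have h2 : ArithmeticFunction.cardFactors n = Omg n := rfl
  rw [← h1, ← h2, ArithmeticFunction.cardFactors_mul hr.ne_zero hn.ne', ArithmeticFunction.cardFactors_apply_prime hr]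
  omega

lemma Omg_pos (n : ℕ) (hn : 2 ≤ n) : 1 ≤ Omg n := by
  unfold Omg
  rw [Nat.one_le_iff_ne_zero, Ne, List.length_eq_zero_iff, Nat.primeFactorsList_eq_nil]
  omega

lemma count_le : ∃ D : ℝ, 1 ≤ D ∧ ∀ (N : ℕ) (S : Finset ℕ), 2 ≤ Real.log (Real.log N) →
    ∀ x : ℕ, N ≤ x ^ 2 →
    (((Ioc 0 x).filter fun n => Omg n ∈ S).card : ℝ) ≤
      D * x * (min (S.card : ℝ) (Real.sqrt (Real.log (Real.log N))) / Real.sqrt (Real.log (Real.log N))) := by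
  obtain ⟨C, hC, hhr⟩ := hr
  refine ⟨2 * C + 1, by linarith, fun N S hN x hx => ?_⟩
  set l := Real.log (Real.log N) with hl
  have hlpos : 0 < Real.sqrt l := Real.sqrt_pos.2 (by linarith)
  have hN1 : 1 < Real.log N := by
    by_contra h
    push Not at h
    have h0 : 0 ≤ Real.log (N:ℝ) := Real.log_natCast_nonneg N
    have := Real.log_nonpos h0 h
    linarith
  have hN0 : (0:ℝ) < N := by
    rcases Nat.eq_zero_or_pos N with h | h
    · subst h; simp at hN1; linarith
    · exact_mod_cast h
  have hlx : Real.log N / 2 ≤ Real.log x := by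
    have h1 : Real.log N ≤ Real.log ((x:ℝ) ^ 2) := Real.log_le_log hN0 (by exact_mod_cast hx)
    rw [Real.log_pow] at h1
    push_cast at h1; linarith
  have hllx : l / 2 ≤ Real.log (Real.log x) := by
    have h1 : Real.log (Real.log N / 2) ≤ Real.log (Real.log x) := Real.log_le_log (by linarith) hlx
    rw [Real.log_div (by linarith) (by norm_num)] at h1
    have := Real.log_two_lt_d9
    linarith
  have hsq : Real.sqrt l / 2 ≤ Real.sqrt (Real.log (Real.log x)) := by
    apply Real.le_sqrt_of_sq_le
    rw [div_pow, Real.sq_sqrt (by linarith)]; linarith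
  have b1 : (((Ioc 0 x).filter fun n => Omg n ∈ S).card : ℝ) ≤ x := by
    have := card_filter_le (Ioc 0 x) (fun n => Omg n ∈ S)
    rw [Nat.card_Ioc] at this
    exact_mod_cast this
  have b2 : (((Ioc 0 x).filter fun n => Omg n ∈ S).card : ℝ) ≤ S.card * (2 * C * x / Real.sqrt l) := by
    have hsub : ((Ioc 0 x).filter fun n => Omg n ∈ S) ⊆ S.biUnion fun k => Om x k := by
      intro n hn
      rw [mem_filter] at hn
      rw [mem_biUnion]
      exact ⟨Omg n, hn.2, by unfold Om; rw [mem_filter]; exact ⟨hn.1, rfl⟩⟩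
    have h1 := (card_le_card hsub).trans card_biUnion_le
    have h2 : (((Ioc 0 x).filter fun n => Omg n ∈ S).card : ℝ) ≤ ∑ k ∈ S, ((Om x k).card : ℝ) := by exact_mod_cast h1
    refine h2.trans ?_
    rw [← nsmul_eq_mul, ← sum_const]
    refine sum_le_sum fun k _ => ?_
    refine (hhr x (by linarith) k).trans ?_
    calc C * x / Real.sqrt (Real.log (Real.log x)) ≤ C * x / (Real.sqrt l / 2) := by gcongr
      _ = _ := by field_simp
  rcases min_choice (S.card : ℝ) (Real.sqrt l) with h | h
  · rw [h]
    refine b2.trans ?_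
    have : (0:ℝ) ≤ x * (S.card / Real.sqrt l) := by positivity
    calc (S.card:ℝ) * (2 * C * x / Real.sqrt l) = 2 * C * (x * (S.card / Real.sqrt l)) := by ring
      _ ≤ (2 * C + 1) * (x * (S.card / Real.sqrt l)) := by gcongr; linarith
      _ = _ := by ring
  · rw [h, div_self hlpos.ne', mul_one]
    refine b1.trans ?_
    have : (0:ℝ) ≤ x := Nat.cast_nonneg x
    nlinarith

lemma norm_count (F : ℕ → ℂ) (S : Finset ℕ) (hF : ∀ m, ‖F m‖ ≤ 1) (hS : ∀ m, m ∉ S → F m = 0) (A : Finset ℕ)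
    (φ : ℕ → ℕ) : ∑ n ∈ A, ‖F (φ n)‖ ^ 2 ≤ ((A.filter fun n => φ n ∈ S).card : ℝ) := by
  rw [card_filter]
  push_cast
  refine sum_le_sum fun n _ => ?_
  split_ifs with h
  · exact pow_le_one₀ (norm_nonneg _) (hF _)
  · rw [hS _ h]; simp

/-- The two counting inputs needed. -/
lemma counts : ∃ D : ℝ, 1 ≤ D ∧ ∀ (N : ℕ) (F : ℕ → ℂ) (S : Finset ℕ) (t : ℝ), 2 ≤ Real.log (Real.log N) → 2 ≤ N →
    (∀ m, ‖F m‖ ≤ 1) → (∀ m, m ∉ S → F m = 0) →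
    t = min (S.card : ℝ) (Real.sqrt (Real.log (Real.log N))) / Real.sqrt (Real.log (Real.log N)) →
    (∀ x : ℕ, N ≤ x ^ 2 → ∑ n ∈ Ioc 0 x, ‖F (Omg n)‖ ^ 2 ≤ D * x * t) ∧
    ∑ n ∈ Ioc N (3 * N), ‖F (Omg n - 1)‖ ^ 2 ≤ D * N * t := by
  obtain ⟨D, hD, hc⟩ := count_le
  refine ⟨3 * D, by linarith, fun N F S t hN hN2 hF hS ht => ⟨fun x hx => ?_, ?_⟩⟩
  · have h1 := (norm_count F S hF hS (Ioc 0 x) Omg).trans (hc N S hN x hx)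
    rw [← ht] at h1
    have ht0 : 0 ≤ t := by rw [ht]; positivity
    have h2 : 0 ≤ D * x * t := by positivity
    linarith
  · have hsub : ((Ioc N (3 * N)).filter fun n => Omg n - 1 ∈ S) ⊆
        ((Ioc 0 (3 * N)).filter fun n => Omg n ∈ S.image (fun k => k + 1)) := by
      intro n hn
      rw [mem_filter, mem_Ioc] at hn ⊢
      have := Omg_pos n (by omega)
      exact ⟨⟨by omega, hn.1.2⟩, mem_image.2 ⟨_, hn.2, by omega⟩⟩
    have h1 := norm_count F S hF hS (Ioc N (3 * N)) (fun n => Omg n - 1)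
    have h2 : (((Ioc N (3 * N)).filter fun n => Omg n - 1 ∈ S).card : ℝ) ≤
      (((Ioc 0 (3 * N)).filter fun n => Omg n ∈ S.image (fun k => k + 1)).card : ℝ) := by
      exact_mod_cast card_le_card hsub
    have h3 := hc N (S.image (fun k => k + 1)) hN (3 * N) (by nlinarith)
    rw [card_image_of_injective _ (fun a b h => by simpa using h), ← ht] at h3
    push_cast at h3
    linarith

end counting

end HR


namespace HR

open Finset

section final

lemma sum_prs7 : ∑ p ∈ prs 7, (1:ℝ) / p ≤ 2 := by
  have : prs 7 = {2, 3, 5, 7} := by decide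
  rw [this]
  norm_num

lemma y_ge_two (H L : ℝ) (P : Finset ℕ) (hH : 1 ≤ H) (hP : ∀ p ∈ P, Nat.Prime p ∧ (p : ℝ) ≤ H)
    (hL : L = ∑ p ∈ P, (1 : ℝ) / (p : ℝ)) (hLe : Real.exp 1 ≤ L) : 2 ≤ Real.log H := by
  by_contra h
  push Not at h
  have h1 : H < Real.exp 2 := by rwa [← Real.log_lt_iff_lt_exp (by linarith)]
  have h2 : Real.exp 2 < 8 := by
    have e : Real.exp 2 = Real.exp 1 * Real.exp 1 := by rw [← Real.exp_add]; norm_num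
    have := Real.exp_one_lt_d9
    have := Real.exp_pos 1
    rw [e]; nlinarith
  have hsub : P ⊆ prs 7 := by
    intro p hp
    obtain ⟨hp1, hp2⟩ := hP p hp
    rw [mem_prs]
    refine ⟨?_, hp1⟩
    have : (p:ℝ) < (8:ℕ) := by push_cast; linarith
    have h3 : p < 8 := by exact_mod_cast this
    omega
  have h4 : L ≤ 2 := by
    rw [hL]
    exact (sum_le_sum_of_subset_of_nonneg hsub fun _ _ _ => by positivity).trans sum_prs7
  have := Real.exp_one_gt_d9
  linarith

lemma L_le (H L : ℝ) (P : Finset ℕ) (hH : 2 ≤ Real.log H) (hP : ∀ p ∈ P, Nat.Prime p ∧ (p : ℝ) ≤ H)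
    (hL : L = ∑ p ∈ P, (1 : ℝ) / (p : ℝ)) (hH1 : 1 ≤ H) : L ≤ Real.log (Real.log H) + 4 := by
  have hH2 : 2 ≤ H := by
    have := Real.log_le_sub_one_of_pos (show 0 < H by linarith); linarith
  have hf : 2 ≤ ⌊H⌋₊ := Nat.le_floor (by exact_mod_cast hH2)
  have hsub : P ⊆ prs ⌊H⌋₊ := by
    intro p hp
    obtain ⟨hp1, hp2⟩ := hP p hp
    rw [mem_prs]
    exact ⟨Nat.le_floor hp2, hp1⟩
  have h1 : L ≤ ∑ p ∈ prs ⌊H⌋₊, (1:ℝ) / p := by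
    rw [hL]
    exact sum_le_sum_of_subset_of_nonneg hsub fun _ _ _ => by positivity
  have h2 := mertens _ hf
  have hf' : (2:ℝ) ≤ ⌊H⌋₊ := by exact_mod_cast hf
  have h3 : Real.log ⌊H⌋₊ ≤ Real.log H := Real.log_le_log (by linarith) (Nat.floor_le (by linarith))
  have h4 : Real.log (Real.log ⌊H⌋₊) ≤ Real.log (Real.log H) :=
    Real.log_le_log (Real.log_pos (by linarith)) h3
  linarith

set_option maxHeartbeats 1000000 in
theorem final :
    ∃ C : ℝ, 0 < C ∧
      ∀ (N : ℕ) (H₀ H : ℝ) (P : Finset ℕ) (L : ℝ) (F₁ F₂ : ℕ → ℂ) (S₁ S₂ : Finset ℕ)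
        (s₁ s₂ : ℝ),
        0 < N →
        1 ≤ H₀ → H₀ ≤ H →
        Real.log H ^ ((2 : ℝ) / 3) * Real.log (Real.log H) ^ 2 ≤ Real.log H₀ →
        (∀ p ∈ P, Nat.Prime p ∧ H₀ ≤ (p : ℝ) ∧ (p : ℝ) ≤ H) →
        L = ∑ p ∈ P, (1 : ℝ) / (p : ℝ) →
        Real.exp 1 ≤ L →
        Real.log H ≤ Real.sqrt (Real.log (N : ℝ) / L) →
        (∀ m : ℕ, ‖F₁ m‖ ≤ 1) → (∀ m : ℕ, ‖F₂ m‖ ≤ 1) →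
        (∀ m : ℕ, m ∉ S₁ → F₁ m = 0) → (∀ m : ℕ, m ∉ S₂ → F₂ m = 0) →
        s₁ = min (S₁.card : ℝ) (Real.sqrt (Real.log (Real.log (N : ℝ)))) →
        s₂ = min (S₂.card : ℝ) (Real.sqrt (Real.log (Real.log (N : ℝ)))) →
        ‖((1 / ((N : ℝ) * L) : ℝ) : ℂ) * ∑ p ∈ P, ∑ n ∈ Finset.Ioc (N / p) (2 * N / p),
              F₁ (Omg n) * (starRingEnd ℂ) (F₂ (Omg (n + 1))) -
            ((1 / ((N : ℝ) * L) : ℝ) : ℂ) * ∑ n ∈ Finset.Ioc N (2 * N),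
              F₁ (Omg n - 1) *
                ∑ p ∈ P, (starRingEnd ℂ) (F₂ (Omg (n + p) - 1)) / (p : ℂ)‖ ≤
          C * min (1 / Real.sqrt L)
              (Real.sqrt (s₁ * s₂) / Real.sqrt (Real.log (Real.log (N : ℝ))) *
                (1 / Real.sqrt L + Real.log (Real.log (Real.log (N : ℝ))) / L)) := by
  obtain ⟨Y1, CB, hY1, hCB, hmain⟩ := TT_main
  obtain ⟨D, hD, hcount⟩ := counts
  set L0 : ℝ := max 2000000 (Real.log Y1 + 4) with hL0def
  have hL0big : 2000000 ≤ L0 := le_max_left _ _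
  have hsL0 : 0 < Real.sqrt L0 := Real.sqrt_pos.2 (by linarith)
  refine ⟨3 * CB + 12 * Real.sqrt L0 + D * (CB + 4 * Real.sqrt L0 + 4), by positivity, ?_⟩
  intro N H₀ H P L F₁ F₂ S₁ S₂ s₁ s₂ hN hH0 hHH hlogH hP hL hLe hHN hF₁ hF₂ hS₁ hS₂ hs₁ hs₂
  have hH1 : 1 ≤ H := hH0.trans hHH
  have hHpos : 0 < H := by linarith
  have hP' : ∀ p ∈ P, Nat.Prime p ∧ (p : ℝ) ≤ H := fun p hp => ⟨(hP p hp).1, (hP p hp).2.2⟩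
  have hPp : ∀ p ∈ P, Nat.Prime p := fun p hp => (hP p hp).1
  have hy2 := y_ge_two H L P hH1 hP' hL hLe
  have hLle := L_le H L P hy2 hP' hL hH1
  have he1 := Real.exp_one_gt_d9
  have hLpos : 0 < L := by linarith
  have hL2 : 2 ≤ L := by linarith
  have hsL : 0 < Real.sqrt L := Real.sqrt_pos.2 hLpos
  set y := Real.log H with hy
  have hy0 : 0 < y := by linarith
  have hNr : (0:ℝ) < N := by exact_mod_cast hN
  have hLy : L * y ^ 2 ≤ Real.log N := by
    rw [Real.le_sqrt' hy0, le_div_iff₀ hLpos] at hHN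
    linarith
  have hexpN : Real.exp (L * y ^ 2) ≤ N := by
    rwa [← Real.le_log_iff_exp_le hNr]
  have hlogN : Real.exp 2 ≤ Real.log N := by
    have e : Real.exp 2 = Real.exp 1 * Real.exp 1 := by rw [← Real.exp_add]; norm_num
    have h3 := Real.exp_one_lt_d9
    have h4 : Real.exp 1 * Real.exp 1 ≤ L * y ^ 2 := by
      apply mul_le_mul hLe _ (Real.exp_pos 1).le hLpos.le
      nlinarith
    rw [e]; linarith
  have hlNpos : 0 < Real.log N := (Real.exp_pos 2).trans_le hlogN
  have hLLN : 2 ≤ Real.log (Real.log N) := by rwa [Real.le_log_iff_exp_le hlNpos]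
  set l := Real.log (Real.log (N:ℝ)) with hl
  have hlpos : 0 < l := by linarith
  have hsl : 0 < Real.sqrt l := Real.sqrt_pos.2 hlpos
  have hll0 : 0 ≤ Real.log l := Real.log_nonneg (by linarith)
  have hN2 : 2 ≤ N := by
    by_contra h
    have h1 : N = 1 := by omega
    rw [h1] at hlNpos; simp at hlNpos
  have hPexp : ∀ r ∈ P, (r:ℝ) ≤ Real.exp y := fun r hr => by
    rw [hy, Real.exp_log hHpos]; exact (hP' r hr).2
  have hPP : ∀ r ∈ P, r * r ≤ N := by
    intro r hr
    have h1 : (r:ℝ) * r ≤ Real.exp y * Real.exp y :=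
      mul_le_mul (hPexp r hr) (hPexp r hr) (Nat.cast_nonneg r) (Real.exp_pos y).le
    rw [← Real.exp_add] at h1
    have h2 : Real.exp (y + y) ≤ Real.exp (L * y ^ 2) := by
      apply Real.exp_le_exp.2
      have h3 : 2 * y ^ 2 ≤ L * y ^ 2 := by gcongr
      have h4 : 2 * y ≤ y ^ 2 := by rw [sq]; gcongr
      linarith [sq_nonneg y]
    have h5 : ((r * r : ℕ) : ℝ) ≤ N := by push_cast; linarith
    exact_mod_cast h5
  have hPN : ∀ r ∈ P, r ≤ N := fun r hr => (Nat.le_mul_of_pos_left r (hPp r hr).pos).trans (hPP r hr)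
  have hPl : ∀ r ∈ P, y ^ ((2:ℝ)/3) * Real.log y ^ 2 ≤ Real.log r := fun r hr =>
    hlogH.trans (Real.log_le_log (by linarith) (hP r hr).2.1)
  set G₁ : ℕ → ℂ := fun n => F₁ (Omg n) with hG₁
  set G₂ : ℕ → ℂ := fun n => (starRingEnd ℂ) (F₂ (Omg n)) with hG₂
  set g₁ : ℕ → ℂ := fun n => F₁ (Omg n - 1) with hg₁
  set g₂ : ℕ → ℂ := fun n => (starRingEnd ℂ) (F₂ (Omg n - 1)) with hg₂
  have hconv : ∀ n, ‖(starRingEnd ℂ) (F₂ n)‖ = ‖F₂ n‖ := fun n => RCLike.norm_conj _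
  have hg₁n : ∀ n, ‖g₁ n‖ ≤ 1 := fun n => hF₁ _
  have hg₂n : ∀ n, ‖g₂ n‖ ≤ 1 := fun n => by simp only [hg₂]; rw [hconv]; exact hF₂ _
  have hr₁ : ∀ r ∈ P, ∀ n, 0 < n → g₁ (r * n) = G₁ n := fun r hr n hn => by
    simp only [hg₁, hG₁]; rw [Omg_mul_prime r n (hPp r hr) hn]
  have hr₂ : ∀ r ∈ P, ∀ n, 0 < n → g₂ (r * n) = G₂ n := fun r hr n hn => by
    simp only [hg₂, hG₂]; rw [Omg_mul_prime r n (hPp r hr) hn]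
  have hTF : ((1 / ((N : ℝ) * L) : ℝ) : ℂ) * ∑ p ∈ P, ∑ n ∈ Finset.Ioc (N / p) (2 * N / p),
              F₁ (Omg n) * (starRingEnd ℂ) (F₂ (Omg (n + 1))) -
            ((1 / ((N : ℝ) * L) : ℝ) : ℂ) * ∑ n ∈ Finset.Ioc N (2 * N),
              F₁ (Omg n - 1) *
                ∑ p ∈ P, (starRingEnd ℂ) (F₂ (Omg (n + p) - 1)) / (p : ℂ) = TF N L P G₁ G₂ g₁ g₂ := rfl
  rw [hTF]
  have hYy : L0 ≤ L → Y1 ≤ y := by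
    intro h
    have h1 : Real.log Y1 + 4 ≤ L := (le_max_right _ _).trans h
    have h2 : Real.log Y1 ≤ Real.log y := by linarith
    exact (Real.log_le_log_iff (by linarith) hy0).1 h2
  -- the first bound
  have B1 : ‖TF N L P G₁ G₂ g₁ g₂‖ ≤ (3 * CB + 12 * Real.sqrt L0) * (1 / Real.sqrt L) := by
    have triv : ∀ (g : ℕ → ℂ), (∀ n, ‖g n‖ ≤ 1) → ∀ A : Finset ℕ, ∑ n ∈ A, ‖g n‖ ^ 2 ≤ A.card := by
      intro g hg A
      have : ∀ n ∈ A, ‖g n‖ ^ 2 ≤ 1 := fun n _ => pow_le_one₀ (norm_nonneg _) (hg n)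
      simpa using sum_le_sum this
    have triv2 : ∀ (g : ℕ → ℂ), (∀ n, ‖g n‖ ≤ 1) → ∑ n ∈ Ioc N (3 * N), ‖g n‖ ^ 2 ≤ 3 * N * 1 := by
      intro g hg
      refine (triv g hg _).trans ?_
      rw [Nat.card_Ioc]
      have : 3 * N - N ≤ 3 * N := Nat.sub_le _ _
      have h2 : ((3 * N - N : ℕ) : ℝ) ≤ ((3 * N : ℕ) : ℝ) := by exact_mod_cast this
      push_cast at h2; linarith
    have triv3 : ∀ (g : ℕ → ℂ), (∀ n, ‖g n‖ ≤ 1) → ∀ x : ℕ, ∑ n ∈ Ioc 0 x, ‖g n‖ ^ 2 ≤ 3 * x * 1 := by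
      intro g hg x
      refine (triv g hg _).trans ?_
      rw [Nat.card_Ioc]
      have h2 : (0:ℝ) ≤ x := Nat.cast_nonneg x
      simp only [Nat.sub_zero]
      linarith
    rcases le_total L0 L with hc | hc
    · have h1 := hmain y L P N (hYy hc) (hL0big.trans hc) hLle hPp hPl hPexp hL.ge hexpN hPN G₁ G₂ g₁ g₂
        hg₁n hg₂n hr₁ hr₂ 3 1 1 (by norm_num) one_pos one_pos le_rfl le_rfl (triv2 _ hg₁n) (triv2 _ hg₂n)
        (by
          rw [mul_one, div_le_one (by positivity)]
          have h5 : 1 ≤ Real.exp 4 := Real.one_le_exp (by norm_num)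
          nlinarith)
        (by rw [mul_one, Real.exp_le_one_iff]; linarith)
      rw [mul_one, Real.sqrt_one, mul_one] at h1
      refine h1.trans ?_
      gcongr
      linarith
    · have h1 := TT_cs N L P G₁ G₂ g₁ g₂ hN hPp hL hLpos hPP 3 1 1 (by norm_num) one_pos one_pos
        (fun x _ _ => triv3 G₁ (fun n => hF₁ _) x)
        (fun x _ _ => triv3 G₂ (fun n => by simp only [hG₂]; rw [hconv]; exact hF₂ _) x) (triv2 _ hg₁n) (triv2 _ hg₂n)
      rw [mul_one, Real.sqrt_one, mul_one] at h1
      have h2 : Real.sqrt L ≤ Real.sqrt L0 := Real.sqrt_le_sqrt hc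
      have h3 : 1 ≤ Real.sqrt L0 * (1 / Real.sqrt L) := by
        rw [mul_one_div, le_div_iff₀ hsL]; linarith
      have h4 : 0 ≤ 3 * CB * (1 / Real.sqrt L) := by positivity
      linarith
  -- the second bound
  have B2 : ‖TF N L P G₁ G₂ g₁ g₂‖ ≤ (D * (CB + 4 * Real.sqrt L0 + 4)) *
      (Real.sqrt (s₁ * s₂) / Real.sqrt l * (1 / Real.sqrt L + Real.log l / L)) := by
    have hR : 0 ≤ (D * (CB + 4 * Real.sqrt L0 + 4)) *
      (Real.sqrt (s₁ * s₂) / Real.sqrt l * (1 / Real.sqrt L + Real.log l / L)) := by positivity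
    by_cases hempty : S₁ = ∅ ∨ S₂ = ∅
    · have hz : TF N L P G₁ G₂ g₁ g₂ = 0 := by
        rcases hempty with h | h
        · have hz : ∀ m, F₁ m = 0 := fun m => hS₁ m (by simp [h])
          simp [TF, hG₁, hg₁, hz]
        · have hz : ∀ m, F₂ m = 0 := fun m => hS₂ m (by simp [h])
          simp [TF, hG₂, hg₂, hz]
      rw [hz, norm_zero]; exact hR
    · push Not at hempty
      obtain ⟨hne₁, hne₂⟩ := hempty
      have hc₁ : (1:ℝ) ≤ S₁.card := by exact_mod_cast card_pos.2 hne₁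
      have hc₂ : (1:ℝ) ≤ S₂.card := by exact_mod_cast card_pos.2 hne₂
      have hsl1 : 1 ≤ Real.sqrt l := Real.one_le_sqrt.2 (by linarith)
      have hs₁1 : 1 ≤ s₁ := by rw [hs₁]; exact le_min hc₁ hsl1
      have hs₂1 : 1 ≤ s₂ := by rw [hs₂]; exact le_min hc₂ hsl1
      have hs₁l : s₁ ≤ Real.sqrt l := by rw [hs₁]; exact min_le_right _ _
      have hs₂l : s₂ ≤ Real.sqrt l := by rw [hs₂]; exact min_le_right _ _
      obtain ⟨k1, k2⟩ := hcount N F₁ S₁ (s₁ / Real.sqrt l) hLLN hN2 hF₁ hS₁ (by rw [hs₁])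
      obtain ⟨k3, k4⟩ := hcount N F₂ S₂ (s₂ / Real.sqrt l) hLLN hN2 hF₂ hS₂ (by rw [hs₂])
      have k3' : ∀ x : ℕ, N ≤ x ^ 2 → ∑ n ∈ Ioc 0 x, ‖G₂ n‖ ^ 2 ≤ D * x * (s₂ / Real.sqrt l) := by
        intro x hx
        refine le_trans (le_of_eq (sum_congr rfl fun n _ => ?_)) (k3 x hx)
        simp only [hG₂]; rw [hconv]
      have k4' : ∑ n ∈ Ioc N (3 * N), ‖g₂ n‖ ^ 2 ≤ D * N * (s₂ / Real.sqrt l) := by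
        refine le_trans (le_of_eq (sum_congr rfl fun n _ => ?_)) k4
        simp only [hg₂]; rw [hconv]
      have ht₁ : 0 < s₁ / Real.sqrt l := by positivity
      have ht₂ : 0 < s₂ / Real.sqrt l := by positivity
      have ett : s₁ / Real.sqrt l * (s₂ / Real.sqrt l) = s₁ * s₂ / l := by
        rw [div_mul_div_comm, Real.mul_self_sqrt hlpos.le]
      have esq : Real.sqrt (s₁ / Real.sqrt l * (s₂ / Real.sqrt l)) = Real.sqrt (s₁ * s₂) / Real.sqrt l := by
        rw [ett, Real.sqrt_div' _ hlpos.le]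
      have hcs := TT_cs N L P G₁ G₂ g₁ g₂ hN hPp hL hLpos hPP D _ _ hD ht₁ ht₂
        (fun x hx _ => k1 x hx) (fun x hx _ => k3' x hx) k2 k4'
      rw [esq] at hcs
      set Q := Real.sqrt (s₁ * s₂) / Real.sqrt l with hQ
      have hQ0 : 0 ≤ Q := by positivity
      have hDQ : 0 ≤ D * Q := by positivity
      have hlL : 0 ≤ Real.log l / L := by positivity
      have hiL : 0 < 1 / Real.sqrt L := by positivity
      have expand : D * (CB + 4 * Real.sqrt L0 + 4) * (Q * (1 / Real.sqrt L + Real.log l / L)) =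
          (D * Q) * CB * (1 / Real.sqrt L) + (D * Q) * 4 * (Real.sqrt L0 * (1 / Real.sqrt L)) + (D * Q) * 4 * (1 / Real.sqrt L)
          + (D * Q) * CB * (Real.log l / L) + (D * Q) * 4 * Real.sqrt L0 * (Real.log l / L)
          + (D * Q) * 4 * (Real.log l / L) := by ring
      have p1 : 0 ≤ (D * Q) * CB * (1 / Real.sqrt L) := by positivity
      have p2 : 0 ≤ (D * Q) * 4 * (Real.sqrt L0 * (1 / Real.sqrt L)) := by positivity
      have p3 : 0 ≤ (D * Q) * 4 * (1 / Real.sqrt L) := by positivity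
      have p4 : 0 ≤ (D * Q) * CB * (Real.log l / L) := by positivity
      have p5 : 0 ≤ (D * Q) * 4 * Real.sqrt L0 * (Real.log l / L) := by positivity
      have p6 : 0 ≤ (D * Q) * 4 * (Real.log l / L) := by positivity
      rw [expand]
      rcases le_total L L0 with hc | hc
      · have h2 : Real.sqrt L ≤ Real.sqrt L0 := Real.sqrt_le_sqrt hc
        have h3 : 1 ≤ Real.sqrt L0 * (1 / Real.sqrt L) := by
          rw [mul_one_div, le_div_iff₀ hsL]; linarith
        have h4 : (D * Q) * 4 * 1 ≤ (D * Q) * 4 * (Real.sqrt L0 * (1 / Real.sqrt L)) := by gcongr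
        linarith
      · rcases le_total L (Real.log l) with hc2 | hc2
        · have h3 : 1 ≤ Real.log l / L := by rw [le_div_iff₀ hLpos]; linarith
          have h4 : (D * Q) * 4 * 1 ≤ (D * Q) * 4 * (Real.log l / L) := by gcongr
          linarith
        · have hle : l ≤ Real.exp L := by rwa [← Real.log_le_iff_le_exp hlpos]
          have hss : 1 / l ≤ s₁ / Real.sqrt l * (s₂ / Real.sqrt l) := by
            rw [ett]
            gcongr
            nlinarith
          have h1 := hmain y L P N (hYy hc) (hL0big.trans hc) hLle hPp hPl hPexp hL.ge hexpN hPN G₁ G₂ g₁ g₂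
            hg₁n hg₂n hr₁ hr₂ D _ _ hD ht₁ ht₂ (by rw [div_le_one hsl]; exact hs₁l) (by rw [div_le_one hsl]; exact hs₂l)
            k2 k4'
            (by
              refine le_trans (one_div_le_one_div_of_le hlpos ?_) hss
              refine hle.trans ?_
              calc Real.exp L ≤ Real.exp (Real.log y + 4) := Real.exp_le_exp.2 hLle
                _ = Real.exp 4 * y := by rw [Real.exp_add, Real.exp_log hy0, mul_comm])
            (by
              refine le_trans ?_ hss
              rw [Real.exp_neg, inv_eq_one_div]
              refine one_div_le_one_div_of_le hlpos (hle.trans (Real.exp_le_exp.2 ?_))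
              linarith)
          rw [esq] at h1
          have h5 : CB * D * Q * (1 / Real.sqrt L) = (D * Q) * CB * (1 / Real.sqrt L) := by ring
          linarith
  rw [mul_min_of_nonneg _ _ (by positivity)]
  refine le_min ?_ ?_
  · refine B1.trans ?_
    refine mul_le_mul_of_nonneg_right ?_ (by positivity)
    have : 0 ≤ D * (CB + 4 * Real.sqrt L0 + 4) := by positivity
    linarith
  · refine B2.trans ?_
    refine mul_le_mul_of_nonneg_right ?_ (by positivity)
    have : 0 ≤ 3 * CB + 12 * Real.sqrt L0 := by positivity
    linarith

end final

end HR

theorem cor_cruxio :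
    ∃ C : ℝ, 0 < C ∧
      ∀ (N : ℕ) (H₀ H : ℝ) (P : Finset ℕ) (L : ℝ) (F₁ F₂ : ℕ → ℂ) (S₁ S₂ : Finset ℕ)
        (s₁ s₂ : ℝ),
        0 < N →
        1 ≤ H₀ → H₀ ≤ H →
        Real.log H ^ ((2 : ℝ) / 3) * Real.log (Real.log H) ^ 2 ≤ Real.log H₀ →
        (∀ p ∈ P, Nat.Prime p ∧ H₀ ≤ (p : ℝ) ∧ (p : ℝ) ≤ H) →
        L = ∑ p ∈ P, (1 : ℝ) / (p : ℝ) →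
        Real.exp 1 ≤ L →
        Real.log H ≤ Real.sqrt (Real.log (N : ℝ) / L) →
        (∀ m : ℕ, ‖F₁ m‖ ≤ 1) → (∀ m : ℕ, ‖F₂ m‖ ≤ 1) →
        (∀ m : ℕ, m ∉ S₁ → F₁ m = 0) → (∀ m : ℕ, m ∉ S₂ → F₂ m = 0) →
        s₁ = min (S₁.card : ℝ) (Real.sqrt (Real.log (Real.log (N : ℝ)))) →
        s₂ = min (S₂.card : ℝ) (Real.sqrt (Real.log (Real.log (N : ℝ)))) →
        ‖((1 / ((N : ℝ) * L) : ℝ) : ℂ) * ∑ p ∈ P, ∑ n ∈ Finset.Ioc (N / p) (2 * N / p),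
              F₁ (bigOmega n) * (starRingEnd ℂ) (F₂ (bigOmega (n + 1))) -
            ((1 / ((N : ℝ) * L) : ℝ) : ℂ) * ∑ n ∈ Finset.Ioc N (2 * N),
              F₁ (bigOmega n - 1) *
                ∑ p ∈ P, (starRingEnd ℂ) (F₂ (bigOmega (n + p) - 1)) / (p : ℂ)‖ ≤
          C * min (1 / Real.sqrt L)
              (Real.sqrt (s₁ * s₂) / Real.sqrt (Real.log (Real.log (N : ℝ))) *
                (1 / Real.sqrt L + Real.log (Real.log (Real.log (N : ℝ))) / L)) := by
  exact HR.final
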